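/- Global regularity for the loglog energy-supercritical wave equation: for any smooth, compactly supported initial data (u₀, u₁) on ℝ³ there exists a global smooth solution u : ℝ × ℝ³ → ℝ of ∂ₜₜu − Δu = −f(u) with u(0,·) = u₀ and ∂ₜu(0,·) = u₁. Moreover there exists a constant M₀ ≥ 0, depending only on ‖u₀‖_{H̃²(ℝ³)} and ‖u₁‖_{H¹(ℝ³)}, such that sup_{t∈ℝ} ( ‖u(t,·)‖_{H̃²(ℝ³)} + ‖∂ₜu(t,·)‖_{H¹(ℝ³)} ) ≤ M₀. -/

import Mathlib

open MeasureTheory Set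

noncomputable section

abbrev Space : Type := EuclideanSpace ℝ (Fin 3)

/-- The loglog weight `g(u) = (log log (10 + u²))^c`. -/
def g (c u : ℝ) : ℝ := Real.log (Real.log (10 + u ^ 2)) ^ c

/-- The nonlinearity `f(u) = u⁵ g(u)`. -/
def f (c u : ℝ) : ℝ := u ^ 5 * g c u

/-- The potential `F(u) = ∫₀ᵘ f(v) dv`. -/
def Fpot (c u : ℝ) : ℝ := ∫ v in (0:ℝ)..u, f c v

/-- First time derivative `∂ₜ u`. -/
def dt1 (u : ℝ → Space → ℝ) (t : ℝ) (x : Space) : ℝ := deriv (fun s => u s x) t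

/-- Second time derivative `∂ₜₜ u`. -/
def dt2 (u : ℝ → Space → ℝ) (t : ℝ) (x : Space) : ℝ := deriv (fun s => dt1 u s x) t

/-- The spatial Laplacian. -/
def lap (h : Space → ℝ) (x : Space) : ℝ :=
  ∑ i : Fin 3, fderiv ℝ (fun y => fderiv ℝ h y (EuclideanSpace.single i 1)) x
    (EuclideanSpace.single i 1)

/-- A classical solution of `∂ₜₜ u - Δ u = -f(u)` on the time interval `J`:
infinitely differentiable, compactly supported in space for each fixed time,
and satisfying the equation. -/
structure IsClassicalSol (c : ℝ) (J : Set ℝ) (u : ℝ → Space → ℝ) : Prop where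
  smooth : ContDiffOn ℝ (⊤ : ℕ∞) (fun p : ℝ × Space => u p.1 p.2) (J ×ˢ (Set.univ : Set Space))
  compactSpt : ∀ t ∈ J, HasCompactSupport (u t)
  eqn : ∀ t ∈ J, ∀ x : Space, dt2 u t x - lap (u t) x = - f c (u t x)

/-- The conserved energy. -/
def energy (c : ℝ) (u : ℝ → Space → ℝ) (t : ℝ) : ℝ :=
  (1/2) * (∫ x : Space, (dt1 u t x) ^ 2)
    + (1/2) * (∫ x : Space, ‖gradient (u t) x‖ ^ 2)
    + ∫ x : Space, Fpot c (u t x)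

/-- Spatial `L^r` norm. -/
def LxNorm (r : ℝ) (h : Space → ℝ) : ℝ := (∫ x : Space, |h x| ^ r) ^ (1 / r)

/-- Mixed norm `L^q_t L^r_x (J × ℝ³)`. -/
def LtLxNorm (q r : ℝ) (J : Set ℝ) (u : ℝ → Space → ℝ) : ℝ :=
  (∫ t in J, (LxNorm r (u t)) ^ q) ^ (1 / q)

/-- The homogeneous `H̃² = Ḣ² ∩ Ḣ¹` norm. -/
def H2tildeNorm (h : Space → ℝ) : ℝ :=
  (∫ x : Space, ‖iteratedFDeriv ℝ 2 h x‖ ^ 2) ^ ((1:ℝ)/2)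
    + (∫ x : Space, ‖gradient h x‖ ^ 2) ^ ((1:ℝ)/2)

/-- The inhomogeneous `H¹` norm. -/
def H1Norm (h : Space → ℝ) : ℝ :=
  (∫ x : Space, (h x) ^ 2) ^ ((1:ℝ)/2)
    + (∫ x : Space, ‖gradient h x‖ ^ 2) ^ ((1:ℝ)/2)

/-- Spatial `L^r` norm restricted to the interior of the light cone at time `t`,
i.e. the norm of `h · 1_{|x| < t}`. -/
def LxConeNorm (r t : ℝ) (h : Space → ℝ) : ℝ :=
  (∫ x in Metric.ball (0:Space) t, |h x| ^ r) ^ (1 / r)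

/-- Mixed norm `L^q_t L^r_x (Γ₊(J))` on the truncated forward light cone. -/
def LtLxConeNorm (q r : ℝ) (J : Set ℝ) (u : ℝ → Space → ℝ) : ℝ :=
  (∫ t in J, (LxConeNorm r t (u t)) ^ q) ^ (1 / q)

/-- The local energy `e(t)` (integral over the ball `|x| ≤ t`). -/
def locEnergy (c : ℝ) (u : ℝ → Space → ℝ) (t : ℝ) : ℝ :=
  (1/2) * (∫ x in Metric.closedBall (0:Space) t, (dt1 u t x) ^ 2)
    + (1/2) * (∫ x in Metric.closedBall (0:Space) t, ‖gradient (u t) x‖ ^ 2)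
    + ∫ x in Metric.closedBall (0:Space) t, Fpot c (u t x)

open scoped Pointwise ENNReal RealInnerProductSpace
open ENNReal (ofReal ofReal_mul ofReal_ne_top ofReal_le_ofReal ofReal_rpow_of_nonneg ofReal_pow mul_rpow_of_nonneg ofReal_le_ofReal_iff ofReal_add toReal_nonneg ofReal_toReal pow_ne_top rpow_add_of_nonneg rpow_ne_top_of_nonneg ofReal_natCast rpow_mul rpow_natCast rpow_le_rpow)
open Real (exp cos sin log norm_eq_abs norm_of_nonneg exp_pos sq_sqrt sinc enorm_eq_ofReal_abs exp_le_exp sqrt_pos sqrt_nonneg sqrt_eq_rpow)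
open intervalIntegral (integral_of_le integral_mono_on integral_eq_sub_of_hasDerivAt integral_comp_sub_left integral_same integral_interval_sub_left integral_hasDerivAt_right integral_add_adjacent_intervals)
open Metric (closedBall ball isClosed_closedBall)
open Finset (sum_nonneg sum_le_sum mul_sum sum_congr)
open Filter.Eventually (of_forall)

notation "Smooth" => ContDiff ℝ (⊤ : ℕ∞)

notation "ℝ⁴" => ℝ × Space

/-! ### Directional derivatives and parametric integrals -/

section Calculus

variable {E : Type*} [NormedAddCommGroup E] [NormedSpace ℝ E]
  {F : Type*} [NormedAddCommGroup F] [NormedSpace ℝ F]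

/-- Directional derivative of `U` in the direction `v`. -/
def dd (v : E) (U : E → F) : E → F := fun p => fderiv ℝ U p v

theorem ContDiff.dd_top {U : E → F} (hU : Smooth U) (v : E) :
    Smooth (dd v U) :=
  (hU.fderiv_right (m := (⊤ : ℕ∞)) (by norm_cast)).clm_apply contDiff_const

theorem ContDiff.dble {U : E → F} (hU : Smooth U) : Differentiable ℝ U :=
  hU.differentiable (by simp)

theorem dd_comm {U : E → F} (hU : Smooth U) (v w : E) :
    dd v (dd w U) = dd w (dd v U) := by
  funext p
  have h1 : ∀ a b : E, dd a (dd b U) p = fderiv ℝ (fderiv ℝ U) p a b := by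
    intro a b
    have hd : DifferentiableAt ℝ (fderiv ℝ U) p :=
      ((hU.fderiv_right (m := (⊤ : ℕ∞)) (by norm_cast)).dble) p
    have : HasFDerivAt (fun q => fderiv ℝ U q b)
        ((ContinuousLinearMap.apply ℝ F b).comp (fderiv ℝ (fderiv ℝ U) p)) p :=
      (ContinuousLinearMap.apply ℝ F b).hasFDerivAt.comp p hd.hasFDerivAt
    have h2 : HasFDerivAt (dd b U) _ p := this
    rw [dd, h2.fderiv]; rfl
  rw [h1, h1]
  have hs : IsSymmSndFDerivAt ℝ U p := hU.contDiffAt.isSymmSndFDerivAt (by simp; exact WithTop.coe_le_coe.2 le_top)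
  exact hs v w

theorem dd_mul {U V : E → ℝ} (hU : Differentiable ℝ U) (hV : Differentiable ℝ V) (v p : E) :
    dd v (fun q => U q * V q) p = U p * dd v V p + V p * dd v U p := by
  simp only [dd]
  rw [fderiv_fun_mul (hU p) (hV p)]
  simp

theorem dd_add {U V : E → ℝ} (hU : Differentiable ℝ U) (hV : Differentiable ℝ V) (v p : E) :
    dd v (fun q => U q + V q) p = dd v U p + dd v V p := by
  simp only [dd]
  rw [fderiv_fun_add (hU p) (hV p)]
  simp

theorem dd_const_mul {U : E → ℝ} (hU : Differentiable ℝ U) (a : ℝ) (v p : E) :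
    dd v (fun q => a * U q) p = a * dd v U p := by
  simp only [dd]
  rw [fderiv_const_mul (hU p)]
  simp

theorem dd_comp_real {U : E → ℝ} (hU : Differentiable ℝ U) {φ φ' : ℝ → ℝ}
    (hφ : ∀ s, HasDerivAt φ (φ' s) s) (v p : E) :
    dd v (fun q => φ (U q)) p = φ' (U p) * dd v U p := by
  have h : HasFDerivAt (fun q => φ (U q)) _ p :=
    (hφ (U p)).comp_hasFDerivAt p (hU p).hasFDerivAt
  rw [dd, h.fderiv]
  simp [dd]

theorem dd_pow_two {U : E → ℝ} (hU : Differentiable ℝ U) (v p : E) :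
    dd v (fun q => U q ^ 2) p = 2 * U p * dd v U p := by
  rw [dd_comp_real hU (φ := fun s => s ^ 2) (φ' := fun s => 2 * s)]
  intro s; simpa using hasDerivAt_pow 2 s

/-- Restriction of a function to an affine line. -/
theorem hasDerivAt_comp_line {U : E → F} (hU : Differentiable ℝ U) {γ : ℝ → E} {γ' : E} {s : ℝ}
    (hγ : HasDerivAt γ γ' s) : HasDerivAt (fun s => U (γ s)) (dd γ' U (γ s)) s :=
  (hU (γ s)).hasFDerivAt.comp_hasDerivAt s hγ

theorem dd_add_dir (U : E → F) (v w p : E) : dd (v + w) U p = dd v U p + dd w U p := by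
  simp [dd]

theorem dd_smul_dir (U : E → F) (a : ℝ) (v p : E) : dd (a • v) U p = a • dd v U p := by
  simp [dd]

theorem dd_sub_dir (U : E → F) (v w p : E) : dd (v - w) U p = dd v U p - dd w U p := by
  simp [dd]

theorem dd_sum_dir {ι : Type*} (s : Finset ι) (U : E → F) (v : ι → E) (p : E) :
    dd (∑ i ∈ s, v i) U p = ∑ i ∈ s, dd (v i) U p := by
  simp [dd]

end Calculus

section Param

variable {P : Type} [NormedAddCommGroup P] [NormedSpace ℝ P] [FiniteDimensional ℝ P]
  {Q : Type} [NormedAddCommGroup Q] [NormedSpace ℝ Q] [FiniteDimensional ℝ Q]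
  [MeasurableSpace Q] [BorelSpace Q]

theorem integrable_of_continuous_of_ae_mem {F : Type} [NormedAddCommGroup F]
    {μ : Measure Q} [IsFiniteMeasure μ] {K : Set Q} (hK : IsCompact K) (hμ : ∀ᵐ q ∂μ, q ∈ K)
    {h : Q → F} (hh : Continuous h) : Integrable h μ := by
  have : SecondCountableTopology Q := have := FiniteDimensional.proper ℝ Q; inferInstance
  obtain ⟨C, hC⟩ := hK.exists_bound_of_continuousOn hh.continuousOn
  exact Integrable.of_bound hh.aestronglyMeasurable C (hμ.mono fun q hq => hC q hq)

theorem hasFDerivAt_integral_param {F : Type} [NormedAddCommGroup F] [NormedSpace ℝ F]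
    {μ : Measure Q} [IsFiniteMeasure μ] {K : Set Q} (hK : IsCompact K) (hμ : ∀ᵐ q ∂μ, q ∈ K)
    {f : P × Q → F} (hf : Smooth f) (p₀ : P) :
    HasFDerivAt (fun p => ∫ q, f (p, q) ∂μ)
      (∫ q, (fderiv ℝ f (p₀, q)).comp (ContinuousLinearMap.inl ℝ P Q) ∂μ) p₀ := by
  have : SecondCountableTopology Q := have := FiniteDimensional.proper ℝ Q; inferInstance
  have : ProperSpace P := FiniteDimensional.proper ℝ P
  have hcf : Continuous (fun z : P × Q => (fderiv ℝ f z).comp (ContinuousLinearMap.inl ℝ P Q)) :=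
    (hf.continuous_fderiv (by simp)).clm_comp continuous_const
  obtain ⟨C, hC⟩ := ((isCompact_closedBall p₀ 1).prod hK).exists_bound_of_continuousOn
    hcf.continuousOn
  refine hasFDerivAt_integral_of_dominated_of_fderiv_le (μ := μ) (bound := fun _ => C)
    (F' := fun p q => (fderiv ℝ f (p, q)).comp (ContinuousLinearMap.inl ℝ P Q))
    (Metric.ball_mem_nhds p₀ one_pos) ?_ ?_ ?_ ?_ (integrable_const C) ?_
  · exact of_forall fun p =>
      (hf.continuous.comp (by fun_prop : Continuous fun q : Q => (p, q))).aestronglyMeasurable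
  · exact integrable_of_continuous_of_ae_mem hK hμ
      (hf.continuous.comp (by fun_prop : Continuous fun q : Q => (p₀, q)))
  · exact (hcf.comp (by fun_prop : Continuous fun q : Q => (p₀, q))).aestronglyMeasurable
  · filter_upwards [hμ] with q hq p hp
    exact hC (p, q) ⟨Metric.ball_subset_closedBall hp, hq⟩
  · refine of_forall fun q p _ => ?_
    have h1 : HasFDerivAt (fun p : P => (p, q)) (ContinuousLinearMap.inl ℝ P Q) p :=
      hasFDerivAt_prodMk_left p q
    exact (hf.dble (p, q)).hasFDerivAt.comp p h1

theorem contDiff_integral_param {F : Type} [NormedAddCommGroup F] [NormedSpace ℝ F]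
    {μ : Measure Q} [IsFiniteMeasure μ] {K : Set Q} (hK : IsCompact K) (hμ : ∀ᵐ q ∂μ, q ∈ K)
    {f : P × Q → F} (hf : Smooth f) :
    Smooth (fun p => ∫ q, f (p, q) ∂μ) := by
  have main : ∀ n : ℕ, ∀ (F' : Type) [NormedAddCommGroup F'] [NormedSpace ℝ F']
      (f : P × Q → F'), Smooth f → ContDiff ℝ n (fun p => ∫ q, f (p, q) ∂μ) := by
    intro n
    induction n with
    | zero =>
      intro F' _ _ f hf
      refine contDiff_zero.2 (continuous_iff_continuousAt.2 fun p =>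
        (hasFDerivAt_integral_param hK hμ hf p).continuousAt)
    | succ n ih =>
      intro F' _ _ f hf
      have hd := fun p => hasFDerivAt_integral_param hK hμ hf p
      have h1 : ContDiff ℝ ((n : WithTop ℕ∞) + 1) (fun p => ∫ q, f (p, q) ∂μ) := by
        refine contDiff_succ_iff_fderiv.2 ⟨fun p => (hd p).differentiableAt, by simp, ?_⟩
        have : fderiv ℝ (fun p => ∫ q, f (p, q) ∂μ) =
            fun p => ∫ q, (fderiv ℝ f (p, q)).comp (ContinuousLinearMap.inl ℝ P Q) ∂μ :=
          funext fun p => (hd p).fderiv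
        rw [this]
        exact ih (P →L[ℝ] F') (fun z => (fderiv ℝ f z).comp (ContinuousLinearMap.inl ℝ P Q))
          ((hf.fderiv_right (m := (⊤ : ℕ∞)) (by norm_cast)).clm_comp contDiff_const)
      exact_mod_cast h1
  exact contDiff_infty.2 fun n => main n F f hf

end Param

/-! ### The uniform probability measure on the unit sphere -/


/-- The area of the unit sphere of `ℝ³`. -/
def sphArea : ℝ := (volume : Measure Space).toSphere.real univ

theorem sphArea_pos : 0 < sphArea := by
  rw [sphArea, measureReal_def]
  exact ENNReal.toReal_pos (by simp [Real.pi_pos]) (measure_ne_top _ _)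

theorem ofReal_sphArea : ofReal sphArea = (volume : Measure Space).toSphere univ := by
  rw [sphArea, measureReal_def, ofReal_toReal (measure_ne_top _ _)]

/-- The uniform probability measure on the unit sphere, as a measure on `ℝ³`. -/
def sph : Measure Space :=
  (ofReal sphArea)⁻¹ • ((volume : Measure Space).toSphere.map Subtype.val)

instance : IsProbabilityMeasure sph := by
  refine ⟨?_⟩
  rw [sph, Measure.smul_apply, Measure.map_apply measurable_subtype_coe MeasurableSet.univ,
    preimage_univ, ← ofReal_sphArea, smul_eq_mul]
  exact ENNReal.inv_mul_cancel (by simpa using sphArea_pos) ofReal_ne_top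

theorem ae_sph_norm : ∀ᵐ ω ∂sph, ‖ω‖ = 1 := by
  have hm : MeasurableSet {ω : Space | ‖ω‖ = 1} := (isClosed_eq continuous_norm continuous_const).measurableSet
  refine Measure.ae_smul_measure ?_ _
  rw [ae_map_iff measurable_subtype_coe.aemeasurable hm]
  exact of_forall fun ω => by simp

theorem ae_sph_norm_smul {r : ℝ} (hr : 0 ≤ r) : ∀ᵐ ω ∂sph, ‖r • ω‖ = r :=
  ae_sph_norm.mono fun ω hω => by rw [norm_smul, hω, mul_one, norm_of_nonneg hr]

theorem ae_sph_mem : ∀ᵐ ω ∂sph, ω ∈ closedBall (0 : Space) 1 :=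
  ae_sph_norm.mono fun ω hω => by simp [hω]

theorem integrable_sph {F : Type} [NormedAddCommGroup F] {h : Space → F} (hh : Continuous h) :
    Integrable h sph :=
  integrable_of_continuous_of_ae_mem (isCompact_closedBall 0 1) ae_sph_mem hh

theorem lintegral_polar {k : Space → ℝ≥0∞} (hk : Measurable k) :
    ∫⁻ y, k y = ofReal sphArea *
      ∫⁻ r in Ioi (0 : ℝ), ofReal (r ^ 2) * ∫⁻ ω, k (r • ω) ∂sph := by
  have hsph : ∀ h : Space → ℝ≥0∞, Measurable h → ofReal sphArea * ∫⁻ ω, h ω ∂sph =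
      ∫⁻ ω, h ω.1 ∂(volume : Measure Space).toSphere := by
    intro h hh
    rw [sph, lintegral_smul_measure, lintegral_map hh measurable_subtype_coe, smul_eq_mul,
      ← mul_assoc, ENNReal.mul_inv_cancel (by simpa using sphArea_pos) ofReal_ne_top,
      one_mul]
  have hfr : Module.finrank ℝ Space - 1 = 2 := by simp [Space]
  have mp := Measure.measurePreserving_homeomorphUnitSphereProd (volume : Measure Space)
  rw [hfr] at mp
  have e1 : ∫⁻ y, k y = ∫⁻ y : ({0}ᶜ : Set Space), k y ∂(Measure.comap Subtype.val volume) := by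
    rw [lintegral_subtype_comap (measurableSet_singleton _).compl]
    rw [restrict_compl_singleton]
  have e2 : ∫⁻ y : ({0}ᶜ : Set Space), k y ∂(Measure.comap Subtype.val volume) =
      ∫⁻ z : Metric.sphere (0 : Space) 1 × Ioi (0 : ℝ), k (z.2.1 • z.1.1)
        ∂((volume : Measure Space).toSphere.prod (Measure.volumeIoiPow 2)) := by
    rw [← mp.lintegral_comp_emb (Homeomorph.measurableEmbedding _)]
    refine lintegral_congr fun y => ?_
    have : ((homeomorphUnitSphereProd Space y).2.1 • (homeomorphUnitSphereProd Space y).1.1 : Space)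
        = y := by
      have hy : ‖(y : Space)‖ ≠ 0 := norm_ne_zero_iff.2 y.2
      simp [smul_smul, hy]
    rw [this]
  have hmeas : Measurable fun z : Metric.sphere (0 : Space) 1 × Ioi (0 : ℝ) =>
      k (z.2.1 • z.1.1) := hk.comp (by fun_prop)
  rw [e1, e2, lintegral_prod_symm' _ hmeas]
  rw [Measure.volumeIoiPow, lintegral_withDensity_eq_lintegral_mul]
  · rw [← lintegral_const_mul' _ _ ofReal_ne_top]
    rw [← lintegral_subtype_comap (measurableSet_Ioi)]
    refine lintegral_congr fun r => ?_
    simp only [Pi.mul_apply]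
    rw [mul_left_comm, hsph (fun ω => k (r.1 • ω)) (hk.comp (by fun_prop))]
  · fun_prop
  · exact hmeas.lintegral_prod_left'

theorem setLIntegral_polar {s : Set ℝ} (hs : MeasurableSet s) {F : ℝ⁴ → ℝ≥0∞} (hF : Measurable F) :
    ∫⁻ y in {y : Space | ‖y‖ ∈ s}, F (‖y‖, y) = ofReal sphArea *
      ∫⁻ r in s ∩ Ioi 0, ofReal (r ^ 2) * ∫⁻ ω, F (r, r • ω) ∂sph := by
  have hset : MeasurableSet {y : Space | ‖y‖ ∈ s} := measurable_norm hs
  rw [← lintegral_indicator hset, lintegral_polar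
    ((show Measurable fun y => F (‖y‖, y) from hF.comp (by fun_prop)).indicator hset), ← Measure.restrict_restrict hs, ← lintegral_indicator hs]
  congr 1
  refine setLIntegral_congr_fun measurableSet_Ioi fun r hr => ?_
  have e := ae_sph_norm_smul (le_of_lt hr)
  by_cases h : r ∈ s
  · rw [indicator_of_mem h, lintegral_congr_ae (e.mono fun ω hω => ?_)]
    simp [indicator, hω, h]
  · rw [indicator_of_notMem h, lintegral_eq_zero_of_ae_eq_zero (e.mono fun ω hω => ?_), mul_zero]
    simp [indicator, hω, h]

theorem inv_sphArea_mul (a : ℝ≥0∞) : (ofReal sphArea)⁻¹ * (ofReal sphArea * a) = a := by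
  rw [← mul_assoc, ENNReal.inv_mul_cancel (by simpa using sphArea_pos) ofReal_ne_top, one_mul]

theorem map_sph_isometry (L : Space ≃ₗᵢ[ℝ] Space) : sph.map L = sph := by
  ext B hB
  have hL : Measurable L := L.continuous.measurable
  rw [Measure.map_apply hL hB, sph, Measure.smul_apply, Measure.smul_apply,
    Measure.map_apply measurable_subtype_coe hB,
    Measure.map_apply measurable_subtype_coe (hL hB)]
  congr 1
  rw [Measure.toSphere_apply' _ (measurable_subtype_coe hB),
    Measure.toSphere_apply' _ (measurable_subtype_coe (hL hB))]
  congr 1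
  have hset : Ioo (0 : ℝ) 1 • ((↑) '' ((↑) ⁻¹' (L ⁻¹' B) : Set (Metric.sphere (0 : Space) 1))) =
      L ⁻¹' (Ioo (0 : ℝ) 1 • ((↑) '' ((↑) ⁻¹' B : Set (Metric.sphere (0 : Space) 1))) : Set Space) := by
    ext y
    constructor
    · rintro ⟨r, hr, _, ⟨ω, hω, rfl⟩, rfl⟩
      refine ⟨r, hr, L ω, ⟨⟨L ω, by simp⟩, hω, rfl⟩, by simp⟩
    · rintro ⟨r, hr, _, ⟨ω, hω, rfl⟩, h⟩
      refine ⟨r, hr, L.symm ω, ⟨⟨L.symm ω, by simp⟩, by simpa using hω, rfl⟩, ?_⟩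
      have : L.symm (L y) = L.symm (r • (ω : Space)) := by rw [← h]
      simpa using this.symm
  rw [hset]
  exact L.measurePreserving.measure_preimage_equiv (f := L.toHomeomorph.toMeasurableEquiv) _

/-- Rotation by the angle `α` in the plane of two orthonormal vectors. -/
def planeRot (a b : Space) (α : ℝ) (ω : Space) : Space :=
  ω + ((cos α - 1) * ⟪a, ω⟫ - sin α * ⟪b, ω⟫) • a +
    ((cos α - 1) * ⟪b, ω⟫ + sin α * ⟪a, ω⟫) • b

theorem norm_planeRot {a b : Space} (ha : ‖a‖ = 1) (hb : ‖b‖ = 1) (hab : ⟪a, b⟫ = 0) (α : ℝ)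
    (ω : Space) : ‖planeRot a b α ω‖ = ‖ω‖ := by
  have haa : ⟪a, a⟫ = 1 := by rw [real_inner_self_eq_norm_sq, ha]; norm_num
  have hbb : ⟪b, b⟫ = 1 := by rw [real_inner_self_eq_norm_sq, hb]; norm_num
  have hba : ⟪b, a⟫ = 0 := by rw [real_inner_comm]; exact hab
  have hωa : ⟪ω, a⟫ = ⟪a, ω⟫ := real_inner_comm _ _
  have hωb : ⟪ω, b⟫ = ⟪b, ω⟫ := real_inner_comm _ _
  have h : ‖planeRot a b α ω‖ ^ 2 = ‖ω‖ ^ 2 := by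
    rw [← real_inner_self_eq_norm_sq, ← real_inner_self_eq_norm_sq, planeRot]
    simp only [inner_add_left, inner_add_right, real_inner_smul_left, real_inner_smul_right,
      haa, hbb, hab, hba, hωa, hωb]
    linear_combination (⟪a, ω⟫ ^ 2 + ⟪b, ω⟫ ^ 2) * Real.sin_sq_add_cos_sq α
  exact (sq_eq_sq₀ (norm_nonneg _) (norm_nonneg _)).1 h

theorem integral_planeRot {a b : Space} (ha : ‖a‖ = 1) (hb : ‖b‖ = 1) (hab : ⟪a, b⟫ = 0) (α : ℝ)
    {F : Space → ℝ} (hF : Continuous F) :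
    ∫ ω, F (planeRot a b α ω) ∂sph = ∫ ω, F ω ∂sph := by
  let L₀ : Space →ₗᵢ[ℝ] Space :=
    { toFun := planeRot a b α
      map_add' := fun x y => by
        simp only [planeRot, inner_add_right]
        module
      map_smul' := fun r x => by
        simp only [planeRot, real_inner_smul_right, RingHom.id_apply]
        module
      norm_map' := fun x => norm_planeRot ha hb hab α x }
  let L : Space ≃ₗᵢ[ℝ] Space := L₀.toLinearIsometryEquiv rfl
  have : ∫ ω, F ω ∂sph = ∫ ω, F ω ∂(sph.map L) := by rw [map_sph_isometry]
  rw [this, integral_map L.continuous.measurable.aemeasurable hF.aestronglyMeasurable]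
  rfl

theorem integral_sph_rotation {a b : Space} (ha : ‖a‖ = 1) (hb : ‖b‖ = 1) (hab : ⟪a, b⟫ = 0)
    {F : Space → ℝ} (hF : Smooth F) :
    ∫ ω, dd (⟪a, ω⟫ • b - ⟪b, ω⟫ • a) F ω ∂sph = 0 := by
  have hK : Smooth (fun z : ℝ⁴ => F (planeRot a b z.1 z.2)) := by
    refine hF.comp ?_
    unfold planeRot
    have h1 : Smooth fun z : ℝ⁴ => cos z.1 := Real.contDiff_cos.comp contDiff_fst
    have h2 : Smooth fun z : ℝ⁴ => sin z.1 := Real.contDiff_sin.comp contDiff_fst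
    have h3 : ∀ c : Space, Smooth fun z : ℝ⁴ => ⟪c, z.2⟫ := fun c =>
      contDiff_const.inner ℝ contDiff_snd
    exact (contDiff_snd.add ((((h1.sub contDiff_const).mul (h3 a)).sub (h2.mul (h3 b))).smul
      contDiff_const)).add ((((h1.sub contDiff_const).mul (h3 b)).add (h2.mul (h3 a))).smul
      contDiff_const)
  have hd := hasFDerivAt_integral_param (isCompact_closedBall (0 : Space) 1) ae_sph_mem hK 0
  have hconst : (fun p : ℝ => ∫ ω, F (planeRot a b p ω) ∂sph) = fun _ => ∫ ω, F ω ∂sph :=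
    funext fun p => integral_planeRot ha hb hab p hF.continuous
  have h0 := hd.unique (by simpa only [hconst] using hasFDerivAt_const (𝕜 := ℝ) (∫ ω, F ω ∂sph) (0 : ℝ))
  have h1 := congrArg (fun T : ℝ →L[ℝ] ℝ => T 1) h0
  rw [ContinuousLinearMap.integral_apply] at h1
  · rw [zero_apply] at h1
    rw [← h1]
    refine integral_congr_ae (of_forall fun ω => ?_)
    have hz : HasDerivAt (fun α => planeRot a b α ω) (⟪a, ω⟫ • b - ⟪b, ω⟫ • a) 0 := by
      unfold planeRot
      have hc := (Real.hasDerivAt_cos 0).sub_const 1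
      have hs := Real.hasDerivAt_sin 0
      have := ((((hc.mul_const ⟪a, ω⟫).sub (hs.mul_const ⟪b, ω⟫)).smul_const a).const_add ω).add
        (((hc.mul_const ⟪b, ω⟫).add (hs.mul_const ⟪a, ω⟫)).smul_const b)
      refine this.congr_deriv ?_
      simp [sub_eq_add_neg, add_comm]
    have h3 := hasDerivAt_comp_line hF.dble hz
    have h4 : HasDerivAt (fun α : ℝ => (fun z : ℝ⁴ => F (planeRot a b z.1 z.2)) (α, ω))
        (fderiv ℝ (fun z : ℝ⁴ => F (planeRot a b z.1 z.2)) (0, ω) (1, 0)) 0 :=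
      hasDerivAt_comp_line hK.dble ((hasDerivAt_id (0 : ℝ)).prodMk (hasDerivAt_const (0 : ℝ) ω))
    have h5 := h3.unique h4
    have h6 : planeRot a b 0 ω = ω := by simp [planeRot]
    rw [h6] at h5
    simpa using h5
  · exact integrable_sph (((hK.continuous_fderiv (by simp)).clm_comp continuous_const).comp
      (by fun_prop : Continuous fun q : Space => ((0 : ℝ), q)))

/-- Standard basis vector. -/
def ex (i : Fin 3) : Space := EuclideanSpace.single i 1

theorem inner_ex (i : Fin 3) (ω : Space) : ⟪ex i, ω⟫ = ω i := by
  simp [ex, EuclideanSpace.inner_single_left]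

theorem norm_ex (i : Fin 3) : ‖ex i‖ = 1 := by simp [ex]

theorem ex_apply (i j : Fin 3) : ex i j = if j = i then 1 else 0 := by
  simp [ex]

theorem sum_ex (ω : Space) : ω = ∑ i, ω i • ex i := by
  ext j
  fin_cases j <;> simp [Fin.sum_univ_three, ex_apply]

theorem contDiff_coord (j : Fin 3) : Smooth fun ω : Space => ω j :=
  (EuclideanSpace.proj (𝕜 := ℝ) j).contDiff

theorem dd_coord (j : Fin 3) (v p : Space) : dd v (fun ω : Space => ω j) p = v j := by
  have : HasFDerivAt (fun ω : Space => ω j) (EuclideanSpace.proj (𝕜 := ℝ) j) p :=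
    (EuclideanSpace.proj (𝕜 := ℝ) j).hasFDerivAt
  rw [dd, this.fderiv]; rfl

theorem sum_sq_coord {ω : Space} (h : ‖ω‖ = 1) : ∑ j, ω j ^ 2 = 1 := by
  have := EuclideanSpace.norm_sq_eq ω
  rw [h] at this
  simpa using this.symm

/-- The divergence theorem on the sphere, for the coordinate directions. -/
theorem integral_sph_tangential {F : Space → ℝ} (hF : Smooth F) (i : Fin 3) :
    ∫ ω, (dd (ex i) F ω - ω i * dd ω F ω - 2 * (F ω * ω i)) ∂sph = 0 := by
  have hz : ∀ j, ∫ ω, dd (ω j • ex i - ω i • ex j) (fun ω => ω j * F ω) ω ∂sph = 0 := by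
    intro j
    by_cases hij : j = i
    · subst hij; simp [dd]
    · have hab : ⟪ex j, ex i⟫ = 0 := by rw [inner_ex, ex_apply, if_neg hij]
      have := integral_sph_rotation (norm_ex j) (norm_ex i) hab ((contDiff_coord j).mul hF)
      simpa only [inner_ex] using this
  have hi : ∀ j, Integrable (fun ω => dd (ω j • ex i - ω i • ex j) (fun ω => ω j * F ω) ω) sph := by
    intro j
    have hc := (((contDiff_coord j).mul hF).continuous_fderiv (by simp))
    exact integrable_sph (hc.clm_apply (by fun_prop))
  have hs : ∫ ω, ∑ j, dd (ω j • ex i - ω i • ex j) (fun ω => ω j * F ω) ω ∂sph = 0 := by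
    rw [integral_finsetSum _ fun j _ => hi j]
    exact Finset.sum_eq_zero fun j _ => hz j
  rw [← hs]
  refine integral_congr_ae (ae_sph_norm.mono fun ω hω => ?_)
  have hsq := sum_sq_coord hω
  have hω' : dd ω F ω = ∑ j, ω j * dd (ex j) F ω := by
    conv_lhs => rw [show dd ω F ω = dd (∑ j, ω j • ex j) F ω by rw [← sum_ex]]
    rw [dd_sum_dir]; simp [dd_smul_dir]
  simp only [dd_mul (contDiff_coord _).dble hF.dble, dd_sub_dir, dd_smul_dir, dd_coord, hω',
    Fin.sum_univ_three, smul_eq_mul, ex_apply] at hsq ⊢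
  fin_cases i <;> simp <;> linear_combination (-(dd _ F ω)) * hsq

/-- The Darboux identity behind Kirchhoff's formula. -/
theorem integral_sph_darboux {ψ : Space → ℝ} (hψ : Smooth ψ) (x : Space) (r : ℝ) :
    ∫ ω, (2 * dd ω ψ (x + r • ω) - r * (∑ i, dd (ex i) (dd (ex i) ψ) (x + r • ω)
      - ∑ i, ω i * dd ω (dd (ex i) ψ) (x + r • ω))) ∂sph = 0 := by
  have hsm : ∀ i, Smooth fun ω => dd (ex i) ψ (x + r • ω) := fun i =>
    (hψ.dd_top (ex i)).comp (contDiff_const.add (contDiff_id.const_smul r))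
  have hd : ∀ i (v ω : Space), dd v (fun ω => dd (ex i) ψ (x + r • ω)) ω
      = r * dd v (dd (ex i) ψ) (x + r • ω) := by
    intro i v ω
    have h1 : HasFDerivAt (fun ω : Space => x + r • ω) (r • ContinuousLinearMap.id ℝ Space) ω :=
      ((hasFDerivAt_id ω).const_smul r).const_add x
    have h2 := HasFDerivAt.comp (f := fun ω : Space => x + r • ω) ω
      ((hψ.dd_top (ex i)).dble (x + r • ω)).hasFDerivAt h1
    have h3 : HasFDerivAt (fun ω => dd (ex i) ψ (x + r • ω)) _ ω := h2
    rw [dd, h3.fderiv]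
    simp [dd]
  have hig : ∀ i, Integrable (fun ω => dd (ex i) (fun ω => dd (ex i) ψ (x + r • ω)) ω -
      ω i * dd ω (fun ω => dd (ex i) ψ (x + r • ω)) ω - 2 * (dd (ex i) ψ (x + r • ω) * ω i)) sph := by
    intro i
    have c1 := (hsm i).continuous_fderiv (by simp)
    have c2 := (hsm i).continuous
    refine integrable_sph ?_
    unfold dd at c1 c2 ⊢
    exact (((c1.clm_apply continuous_const).sub ((contDiff_coord i).continuous.mul
      (c1.clm_apply continuous_id))).sub (continuous_const.mul (c2.mul (contDiff_coord i).continuous)))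
  have hsum : ∫ ω, ∑ i, (dd (ex i) (fun ω => dd (ex i) ψ (x + r • ω)) ω -
      ω i * dd ω (fun ω => dd (ex i) ψ (x + r • ω)) ω - 2 * (dd (ex i) ψ (x + r • ω) * ω i)) ∂sph = 0 := by
    rw [integral_finsetSum _ fun i _ => hig i]
    exact Finset.sum_eq_zero fun i _ => integral_sph_tangential (hsm i) i
  rw [← neg_eq_zero, ← integral_neg, ← hsum]
  refine integral_congr_ae (of_forall fun ω => ?_)
  have hω' : dd ω ψ (x + r • ω) = ∑ j, ω j * dd (ex j) ψ (x + r • ω) := by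
    conv_lhs => rw [show dd ω ψ (x + r • ω) = dd (∑ j, ω j • ex j) ψ (x + r • ω) by rw [← sum_ex]]
    rw [dd_sum_dir]; simp [dd_smul_dir]
  simp only [hd, hω', Fin.sum_univ_three]
  ring

/-! ### Kirchhoff's formula -/

section ParamDir

variable {P : Type} [NormedAddCommGroup P] [NormedSpace ℝ P] [FiniteDimensional ℝ P]
  {Q : Type} [NormedAddCommGroup Q] [NormedSpace ℝ Q] [FiniteDimensional ℝ Q]
  [MeasurableSpace Q] [BorelSpace Q]

theorem dd_slice {E F : Type} [NormedAddCommGroup E] [NormedSpace ℝ E] [NormedAddCommGroup F]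
    [NormedSpace ℝ F] {U : E × F → ℝ} (hU : Differentiable ℝ U) (v : F) (a : E) (y : F) :
    dd v (fun y => U (a, y)) y = dd ((0 : E), v) U (a, y) := by
  have h := HasFDerivAt.comp (f := fun y : F => (a, y)) y (hU (a, y)).hasFDerivAt
    (hasFDerivAt_prodMk_right a y)
  have h' : HasFDerivAt (fun y => U (a, y)) _ y := h
  rw [dd, h'.fderiv]; simp [dd]

theorem dd_slice_left {E F : Type} [NormedAddCommGroup E] [NormedSpace ℝ E] [NormedAddCommGroup F]
    [NormedSpace ℝ F] {U : E × F → ℝ} (hU : Differentiable ℝ U) (v : E) (a : E) (y : F) :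
    dd v (fun a => U (a, y)) a = dd (v, (0 : F)) U (a, y) := by
  have h := HasFDerivAt.comp (f := fun a : E => (a, y)) a (hU (a, y)).hasFDerivAt
    (hasFDerivAt_prodMk_left a y)
  have h' : HasFDerivAt (fun a => U (a, y)) _ a := h
  rw [dd, h'.fderiv]; simp [dd]

theorem dd_integral_param {μ : Measure Q} [IsFiniteMeasure μ] {K : Set Q} (hK : IsCompact K)
    (hμ : ∀ᵐ q ∂μ, q ∈ K) {f : P × Q → ℝ} (hf : Smooth f) (v p : P) :
    dd v (fun p => ∫ q, f (p, q) ∂μ) p = ∫ q, dd v (fun p => f (p, q)) p ∂μ := by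
  rw [dd, (hasFDerivAt_integral_param hK hμ hf p).fderiv, ContinuousLinearMap.integral_apply]
  · refine integral_congr_ae (of_forall fun q => ?_)
    simp only [dd_slice_left hf.dble]
    simp [dd]
  · exact integrable_of_continuous_of_ae_mem hK hμ
      (((hf.continuous_fderiv (by simp)).clm_comp continuous_const).comp
        (by fun_prop : Continuous fun q : Q => (p, q)))

end ParamDir

/-- The unit time vector of space-time. -/
def vt : ℝ⁴ := (1, 0)

/-- The unit space vectors of space-time. -/
def vx (i : Fin 3) : ℝ⁴ := (0, ex i)

/-- The d'Alembert operator. -/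
def box (U : ℝ⁴ → ℝ) (p : ℝ⁴) : ℝ :=
  dd vt (dd vt U) p - ∑ i, dd (vx i) (dd (vx i) U) p

theorem dd_comp_shear {ψ : Space → ℝ} (hψ : Differentiable ℝ ψ) (ω : Space) (v p : ℝ⁴) :
    dd v (fun p : ℝ⁴ => ψ (p.2 + p.1 • ω)) p = dd (v.2 + v.1 • ω) ψ (p.2 + p.1 • ω) := by
  have h1 : HasFDerivAt (fun p : ℝ⁴ => p.2 + p.1 • ω)
      (ContinuousLinearMap.snd ℝ ℝ Space + (ContinuousLinearMap.fst ℝ ℝ Space).smulRight ω) p :=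
    hasFDerivAt_snd.add (hasFDerivAt_fst.smul_const ω)
  have h2 : HasFDerivAt (fun p : ℝ⁴ => ψ (p.2 + p.1 • ω)) _ p :=
    HasFDerivAt.comp (f := fun p : ℝ⁴ => p.2 + p.1 • ω) p (hψ _).hasFDerivAt h1
  rw [dd, h2.fderiv]; simp [dd]

theorem dd_fst (v p : ℝ⁴) : dd v (fun p : ℝ⁴ => p.1) p = v.1 := by
  rw [dd, hasFDerivAt_fst.fderiv]; rfl

theorem dd_sum_coord {ψ : Space → ℝ} (ω y : Space) :
    dd ω ψ y = ∑ j, ω j * dd (ex j) ψ y := by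
  conv_lhs => rw [show dd ω ψ y = dd (∑ j, ω j • ex j) ψ y by rw [← sum_ex]]
  rw [dd_sum_dir]; simp [dd_smul_dir]

/-- `t` times the spherical mean of `ψ` over the sphere of radius `t` around `x`. -/
def smean (ψ : Space → ℝ) (p : ℝ⁴) : ℝ := ∫ ω, p.1 * ψ (p.2 + p.1 • ω) ∂sph

theorem contDiff_shear :
    Smooth (fun z : ℝ⁴ × Space => z.1.2 + z.1.1 • z.2) := by fun_prop

theorem contDiff_smean {ψ : Space → ℝ} (hψ : Smooth ψ) :
    Smooth (smean ψ) := by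
  refine contDiff_integral_param (isCompact_closedBall (0 : Space) 1) ae_sph_mem
    (f := fun z : ℝ⁴ × Space => z.1.1 * ψ (z.1.2 + z.1.1 • z.2)) ?_
  exact (contDiff_fst.comp contDiff_fst).mul (hψ.comp contDiff_shear)

theorem dd_smean_vt {ψ : Space → ℝ} (hψ : Smooth ψ) (p : ℝ⁴) : dd vt (smean ψ) p =
    ∫ ω, (ψ (p.2 + p.1 • ω) + p.1 * dd ω ψ (p.2 + p.1 • ω)) ∂sph := by
  have hs : Smooth fun z : ℝ⁴ × Space => z.1.1 * ψ (z.1.2 + z.1.1 • z.2) :=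
    (contDiff_fst.comp contDiff_fst).mul (hψ.comp contDiff_shear)
  have h := dd_integral_param (isCompact_closedBall (0 : Space) 1) ae_sph_mem hs vt p
  refine h.trans (integral_congr_ae (of_forall fun ω => ?_))
  have hd : Differentiable ℝ fun p : ℝ⁴ => ψ (p.2 + p.1 • ω) := hψ.dble.comp (by fun_prop)
  simp only
  rw [dd_mul (by fun_prop) hd, dd_comp_shear hψ.dble, dd_fst]
  simp [vt]; ring

theorem dd_smean_vx {ψ : Space → ℝ} (hψ : Smooth ψ) (i : Fin 3) : dd (vx i) (smean ψ) = smean (dd (ex i) ψ) := by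
  funext p
  have hs : Smooth fun z : ℝ⁴ × Space => z.1.1 * ψ (z.1.2 + z.1.1 • z.2) :=
    (contDiff_fst.comp contDiff_fst).mul (hψ.comp contDiff_shear)
  have h := dd_integral_param (isCompact_closedBall (0 : Space) 1) ae_sph_mem hs (vx i) p
  refine h.trans (integral_congr_ae (of_forall fun ω => ?_))
  have hd : Differentiable ℝ fun p : ℝ⁴ => ψ (p.2 + p.1 • ω) := hψ.dble.comp (by fun_prop)
  simp only
  rw [dd_mul (by fun_prop) hd, dd_comp_shear hψ.dble, dd_fst]
  simp [vx]

theorem dd_dd_smean_vt {ψ : Space → ℝ} (hψ : Smooth ψ) (p : ℝ⁴) : dd vt (dd vt (smean ψ)) p =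
    ∫ ω, (2 * dd ω ψ (p.2 + p.1 • ω)
      + p.1 * ∑ i, ω i * dd ω (dd (ex i) ψ) (p.2 + p.1 • ω)) ∂sph := by
  have hψ' : ∀ i, Smooth (dd (ex i) ψ) := fun i => hψ.dd_top _
  have h0 : dd vt (smean ψ) = fun p => ∫ ω, (ψ (p.2 + p.1 • ω)
      + p.1 * ∑ i, ω i * dd (ex i) ψ (p.2 + p.1 • ω)) ∂sph := by
    funext p
    rw [dd_smean_vt hψ]
    simp only [← dd_sum_coord]
  have hs : Smooth fun z : ℝ⁴ × Space => ψ (z.1.2 + z.1.1 • z.2)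
      + z.1.1 * ∑ i, z.2 i * dd (ex i) ψ (z.1.2 + z.1.1 • z.2) :=
    (hψ.comp contDiff_shear).add ((contDiff_fst.comp contDiff_fst).mul
      (ContDiff.sum fun i _ => ((contDiff_coord i).comp contDiff_snd).mul
        ((hψ' i).comp contDiff_shear)))
  rw [h0, dd_integral_param (isCompact_closedBall (0 : Space) 1) ae_sph_mem hs vt p]
  refine integral_congr_ae (of_forall fun ω => ?_)
  have hd : ∀ {φ : Space → ℝ}, Smooth φ →
      Differentiable ℝ fun p : ℝ⁴ => φ (p.2 + p.1 • ω) := fun h => h.dble.comp (by fun_prop)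
  have h1 := hd (hψ' 0)
  have h2 := hd (hψ' 1)
  have h3 := hd (hψ' 2)
  simp only [Fin.sum_univ_three]
  rw [dd_add (hd hψ) (by fun_prop), dd_mul (by fun_prop) (by fun_prop),
    dd_add (by fun_prop) (by fun_prop), dd_add (by fun_prop) (by fun_prop),
    dd_const_mul h1, dd_const_mul h2, dd_const_mul h3, dd_comp_shear hψ.dble,
    dd_comp_shear (hψ' 0).dble, dd_comp_shear (hψ' 1).dble, dd_comp_shear (hψ' 2).dble, dd_fst]
  have := dd_sum_coord (ψ := ψ) ω (p.2 + p.1 • ω)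
  rw [Fin.sum_univ_three] at this
  simp only [vt, zero_add, one_smul, mul_one]
  linear_combination (-1 : ℝ) * this

theorem box_smean {ψ : Space → ℝ} (hψ : Smooth ψ) (p : ℝ⁴) : box (smean ψ) p = 0 := by
  rw [box, dd_dd_smean_vt hψ]
  simp only [dd_smean_vx hψ, fun i => dd_smean_vx (hψ.dd_top (ex i)) i]
  have hψ' : ∀ i, Smooth (dd (ex i) ψ) := fun i => hψ.dd_top _
  have hc : ∀ {φ : Space → ℝ}, Smooth φ → Continuous fun ω => φ (p.2 + p.1 • ω) :=
    fun h => h.continuous.comp (by fun_prop)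
  have hcf : ∀ {φ : Space → ℝ}, Smooth φ →
      Continuous fun ω => dd ω φ (p.2 + p.1 • ω) := fun h =>
    ((h.continuous_fderiv (by simp)).comp (by fun_prop)).clm_apply continuous_id
  unfold smean
  have hi : ∀ i ∈ Finset.univ, Integrable
      (fun ω => p.1 * dd (ex i) (dd (ex i) ψ) (p.2 + p.1 • ω)) sph := fun i _ =>
    integrable_sph (continuous_const.mul (hc ((hψ' i).dd_top (ex i))))
  rw [← integral_finsetSum _ hi, ← integral_sub]
  · rw [← integral_sph_darboux hψ p.2 p.1]
    refine integral_congr_ae (of_forall fun ω => ?_)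
    simp only [← mul_sum]
    ring
  · exact integrable_sph ((continuous_const.mul (hcf hψ)).add (continuous_const.mul
      (continuous_finsetSum _ fun i _ => (contDiff_coord i).continuous.mul (hcf (hψ' i)))))
  · exact integrable_sph (continuous_finsetSum _ fun i _ =>
      continuous_const.mul (hc ((hψ' i).dd_top (ex i))))

/-- Kirchhoff's solution of the free wave equation with data `(u₀, u₁)` at time `0`. -/
def freeWave (u₀ u₁ : Space → ℝ) (p : ℝ⁴) : ℝ := dd vt (smean u₀) p + smean u₁ p

theorem box_add {U V : ℝ⁴ → ℝ} (hU : Smooth U) (hV : Smooth V)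
    (p : ℝ⁴) : box (fun p => U p + V p) p = box U p + box V p := by
  have h : ∀ v, dd v (fun p => U p + V p) = fun p => dd v U p + dd v V p := fun v =>
    funext fun p => dd_add hU.dble hV.dble v p
  simp only [box, h]
  have h2 : ∀ v, dd v (fun p => dd v U p + dd v V p) p = dd v (dd v U) p + dd v (dd v V) p :=
    fun v => dd_add (hU.dd_top v).dble (hV.dd_top v).dble v p
  simp only [h2, Finset.sum_add_distrib]
  ring

theorem box_sub {U V : ℝ⁴ → ℝ} (hU : Smooth U) (hV : Smooth V)
    (p : ℝ⁴) : box (fun p => U p - V p) p = box U p - box V p := by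
  have hn : ∀ {W : ℝ⁴ → ℝ}, Smooth W → ∀ v p,
      dd v (fun p => -1 * W p) p = -1 * dd v W p := fun h v p => dd_const_mul h.dble (-1) v p
  have e : (fun p => U p - V p) = fun p => U p + -1 * V p := by funext p; ring
  rw [e, box_add hU (contDiff_const.mul hV), box, box]
  have h : ∀ v, dd v (fun p => -1 * V p) = fun p => -1 * dd v V p := fun v => funext fun p => hn hV v p
  simp only [box, h, hn (hV.dd_top _), ← mul_sum]
  ring

theorem contDiff_freeWave {u₀ u₁ : Space → ℝ} (h₀ : Smooth u₀)
    (h₁ : Smooth u₁) : Smooth (freeWave u₀ u₁) :=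
  ((contDiff_smean h₀).dd_top vt).add (contDiff_smean h₁)

theorem box_freeWave {u₀ u₁ : Space → ℝ} (h₀ : Smooth u₀)
    (h₁ : Smooth u₁) (p : ℝ⁴) : box (freeWave u₀ u₁) p = 0 := by
  have hs := contDiff_smean h₀
  unfold freeWave
  rw [box_add (hs.dd_top vt) (contDiff_smean h₁), box_smean h₁, add_zero]
  have hz : (fun p => dd vt (dd vt (smean u₀)) p) =
      fun p => ∑ i, dd (vx i) (dd (vx i) (smean u₀)) p := by
    funext p; have := box_smean h₀ p; rw [box] at this; linarith
  have hz' : dd vt (dd vt (smean u₀)) = fun p => ∑ i, dd (vx i) (dd (vx i) (smean u₀)) p := hz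
  have h3 : ∀ i, dd (vx i) (dd (vx i) (dd vt (smean u₀))) = dd vt (dd (vx i) (dd (vx i) (smean u₀))) := by
    intro i
    rw [dd_comm hs (vx i) vt, dd_comm (hs.dd_top (vx i)) (vx i) vt]
  rw [box, hz']
  simp only [h3, Fin.sum_univ_three]
  have d : ∀ i, Differentiable ℝ (dd (vx i) (dd (vx i) (smean u₀))) := fun i =>
    ((hs.dd_top _).dd_top _).dble
  have d0 := d 0
  have d1 := d 1
  rw [dd_add (by fun_prop) (d 2), dd_add d0 d1]
  ring

theorem freeWave_eq {u₀ u₁ : Space → ℝ} (h₀ : Smooth u₀)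
    (h₁ : Continuous u₁) (p : ℝ⁴) : freeWave u₀ u₁ p =
    ∫ ω, (u₀ (p.2 + p.1 • ω) + p.1 * (dd ω u₀ (p.2 + p.1 • ω) + u₁ (p.2 + p.1 • ω))) ∂sph := by
  rw [freeWave, dd_smean_vt h₀, smean, ← integral_add]
  · refine integral_congr_ae (of_forall fun ω => ?_)
    simp only; ring
  · have : Continuous fun ω => dd ω u₀ (p.2 + p.1 • ω) :=
      ((h₀.continuous_fderiv (by simp)).comp (by fun_prop)).clm_apply continuous_id
    exact integrable_sph ((h₀.continuous.comp (by fun_prop)).add (continuous_const.mul this))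
  · exact integrable_sph (continuous_const.mul (h₁.comp (by fun_prop)))

theorem freeWave_zero {u₀ u₁ : Space → ℝ} (h₀ : Smooth u₀)
    (h₁ : Continuous u₁) (x : Space) : freeWave u₀ u₁ (0, x) = u₀ x := by
  rw [freeWave_eq h₀ h₁]; simp

theorem integral_sph_dir {ψ : Space → ℝ} (hψ : Smooth ψ) (x : Space) :
    ∫ ω, dd ω ψ x ∂sph = 0 := by
  have := integral_sph_darboux hψ x 0
  simp only [zero_smul, add_zero, zero_mul, sub_zero] at this
  rw [integral_const_mul] at this
  linarith

theorem dd_freeWave_zero {u₀ u₁ : Space → ℝ} (h₀ : Smooth u₀)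
    (h₁ : Smooth u₁) (x : Space) : dd vt (freeWave u₀ u₁) (0, x) = u₁ x := by
  unfold freeWave
  rw [dd_add ((contDiff_smean h₀).dd_top vt).dble (contDiff_smean h₁).dble, dd_dd_smean_vt h₀,
    dd_smean_vt h₁]
  simp only [zero_smul, add_zero, zero_mul]
  rw [integral_const_mul, integral_sph_dir h₀]
  simp

theorem HasDerivAt.dd_one {φ : ℝ → ℝ} {d s : ℝ} (h : HasDerivAt φ d s) : dd (1 : ℝ) φ s = d := by
  rw [dd, h.hasFDerivAt.fderiv]; simp

theorem Differentiable.hasDerivAt_dd {φ : ℝ → ℝ} (h : Differentiable ℝ φ) (s : ℝ) :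
    HasDerivAt φ (dd (1 : ℝ) φ s) s := by
  have := (h s).hasDerivAt
  rwa [← this.dd_one] at this

theorem dd_time_space {V : ℝ⁴ → ℝ} (ω : Space) (p : ℝ⁴) :
    dd ((1 : ℝ), -ω) V p = dd vt V p - ∑ i, ω i * dd (vx i) V p := by
  have h : ((1 : ℝ), -ω) = vt - ∑ i, ω i • vx i := by
    ext1
    · simp [vt, vx, Prod.fst_sum]
    · conv_lhs => rw [sum_ex ω]
      simp [vt, vx, Prod.snd_sum]
  rw [h, dd_sub_dir, dd_sum_dir]
  simp [dd_smul_dir]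

theorem dd_space {V : ℝ⁴ → ℝ} (ω : Space) (p : ℝ⁴) :
    dd ((0 : ℝ), ω) V p = ∑ i, ω i * dd (vx i) V p := by
  have h : ((0 : ℝ), ω) = ∑ i, ω i • vx i := by
    ext1
    · simp [vx, Prod.fst_sum]
    · conv_lhs => rw [sum_ex ω]
      simp [vx, Prod.snd_sum]
  rw [h, dd_sum_dir]
  simp [dd_smul_dir]

theorem contDiff_slice {U : ℝ⁴ → ℝ} (hU : Smooth U) (s : ℝ) :
    Smooth fun y => U (s, y) := hU.comp (by fun_prop)

theorem dd_slice_fun {U : ℝ⁴ → ℝ} (hU : Smooth U) (s : ℝ) (v : Space) :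
    dd v (fun y => U (s, y)) = fun y => dd ((0 : ℝ), v) U (s, y) :=
  funext fun y => dd_slice hU.dble v s y

theorem contDiff_box {U : ℝ⁴ → ℝ} (hU : Smooth U) :
    Smooth (box U) :=
  ((hU.dd_top _).dd_top _).sub (ContDiff.sum fun _ _ => (hU.dd_top _).dd_top _)

/-- **Kirchhoff's formula** for an arbitrary smooth function. -/
theorem kirchhoff {U : ℝ⁴ → ℝ} (hU : Smooth U) (a t : ℝ) (x : Space) :
    U (t, x) = freeWave (fun y => U (a, y)) (fun y => dd vt U (a, y)) (t - a, x)
      + ∫ s in a..t, smean (fun y => box U (s, y)) (t - s, x) := by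
  have hUt := hU.dd_top vt
  have hUx := fun i => hU.dd_top (vx i)
  let γ : ℝ⁴ → ℝ⁴ := fun z => (z.1, x + (t - z.1) • z.2)
  have hγ : Smooth γ := by fun_prop
  let K : ℝ⁴ → ℝ := fun z =>
    U (γ z) + (t - z.1) * (∑ i, z.2 i * dd (vx i) U (γ z) + dd vt U (γ z))
  have hK : Smooth K :=
    (hU.comp hγ).add ((contDiff_const.sub contDiff_fst).mul ((ContDiff.sum fun i _ =>
      ((contDiff_coord i).comp contDiff_snd).mul ((hUx i).comp hγ)).add (hUt.comp hγ)))
  have hΦ : ∀ s, freeWave (fun y => U (s, y)) (fun y => dd vt U (s, y)) (t - s, x)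
      = ∫ ω, K (s, ω) ∂sph := by
    intro s
    rw [freeWave_eq (contDiff_slice hU s) (contDiff_slice hUt s).continuous]
    refine integral_congr_ae (of_forall fun ω => ?_)
    simp only [dd_slice_fun hU, dd_space]
    rfl
  have hsm : Smooth fun s => ∫ ω, K (s, ω) ∂sph :=
    contDiff_integral_param (isCompact_closedBall (0 : Space) 1) ae_sph_mem hK
  have hder : ∀ s, HasDerivAt (fun s => ∫ ω, K (s, ω) ∂sph)
      (smean (fun y => box U (s, y)) (t - s, x)) s := by
    intro s
    refine (hsm.dble.hasDerivAt_dd s).congr_deriv ?_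
    rw [dd_integral_param (isCompact_closedBall (0 : Space) 1) ae_sph_mem hK]
    have hpt : ∀ ω, dd (1 : ℝ) (fun s => K (s, ω)) s =
        (t - s) * (dd vt (dd vt U) (γ (s, ω))) - (2 * ∑ i, ω i * dd (vx i) U (γ (s, ω))
          + (t - s) * ∑ i, ω i * ∑ j, ω j * dd (vx j) (dd (vx i) U) (γ (s, ω))) := by
      intro ω
      have hl : HasDerivAt (fun s : ℝ => γ (s, ω)) ((1 : ℝ), -ω) s := by
        refine (hasDerivAt_id s).prodMk ?_
        have := (((hasDerivAt_id s).const_sub t).smul_const ω).const_add x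
        simpa using this
      have e0 := hasDerivAt_comp_line hU.dble hl
      have e1 := hasDerivAt_comp_line hUt.dble hl
      have e2 : HasDerivAt (fun s => ∑ i, ω i * dd (vx i) U (γ (s, ω)))
          (∑ i, ω i * dd ((1 : ℝ), -ω) (dd (vx i) U) (γ (s, ω))) s :=
        HasDerivAt.fun_sum fun i _ => (hasDerivAt_comp_line (hUx i).dble hl).const_mul (ω i)
      have e3 := e0.add ((((hasDerivAt_id s).const_sub t).mul (e2.add e1)))
      have e4 : HasDerivAt (fun s => K (s, ω)) _ s := e3
      rw [e4.dd_one]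
      simp only [dd_time_space, fun i => dd_comm hU vt (vx i), id, Fin.sum_univ_three]
      simp
      ring
    simp only [hpt]
    have hψ := contDiff_slice hU s
    have hD := integral_sph_darboux hψ x (t - s)
    have hsub : ∀ i, dd (ex i) (fun y => U (s, y)) = fun y => dd (vx i) U (s, y) := fun i =>
      dd_slice_fun hU s (ex i)
    have hcont : ∀ {V : ℝ⁴ → ℝ}, Smooth V →
        Continuous fun ω => V (γ (s, ω)) := fun h =>
      h.continuous.comp (hγ.continuous.comp (by fun_prop))
    rw [smean, ← sub_eq_zero, ← integral_sub]
    · rw [← neg_eq_zero, ← integral_neg, ← hD]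
      refine integral_congr_ae (of_forall fun ω => ?_)
      have e5 : ∀ i v, dd v (dd (ex i) fun y => U (s, y)) = fun y => dd ((0:ℝ), v) (dd (vx i) U) (s, y) := by
        intro i v
        rw [hsub, dd_slice_fun (hUx i)]
      simp only [e5, box]
      simp only [dd_slice_fun hU, dd_space, Fin.sum_univ_three, ex_apply]
      simp [γ]
      ring
    · refine integrable_sph ?_
      have c1 := hcont (hUt.dd_top vt)
      have c2 := fun i => hcont (hUx i)
      have c3 := fun i j => hcont ((hUx i).dd_top (vx j))
      have c4 := fun i : Fin 3 => (contDiff_coord i).continuous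
      exact (continuous_const.mul c1).sub ((continuous_const.mul (continuous_finsetSum _ fun i _ =>
        (c4 i).mul (c2 i))).add (continuous_const.mul (continuous_finsetSum _ fun i _ =>
        (c4 i).mul (continuous_finsetSum _ fun j _ => (c4 j).mul (c3 i j)))))
    · exact integrable_sph (continuous_const.mul (hcont (contDiff_box hU)))
  have hcontd : Continuous fun s => smean (fun y => box U (s, y)) (t - s, x) := by
    have : (fun s => smean (fun y => box U (s, y)) (t - s, x)) =
        dd (1 : ℝ) (fun s => ∫ ω, K (s, ω) ∂sph) := funext fun s => (hder s).dd_one.symm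
    rw [this]
    exact (hsm.dd_top 1).continuous
  rw [integral_eq_sub_of_hasDerivAt (fun s _ => hder s)
    (hcontd.intervalIntegrable a t), ← hΦ, ← hΦ, sub_self,
    freeWave_zero (contDiff_slice hU t) (contDiff_slice hUt t).continuous]
  ring

/-! ### Duhamel's formula -/

/-- Integral over a time interval with moving end point. -/
def volterra (Q : ℝ × ℝ⁴ → ℝ) (p : ℝ⁴) : ℝ := ∫ s in (0 : ℝ)..p.1, Q (s, p)

/-- The two-variable primitive, as an integral over a fixed interval. -/
def primFix (Q : ℝ × ℝ⁴ → ℝ) (z : ℝ × ℝ⁴) : ℝ :=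
  ∫ τ in Icc (0 : ℝ) 1, z.1 * Q (z.1 * τ, z.2)

theorem primFix_eq (Q : ℝ × ℝ⁴ → ℝ) (z : ℝ × ℝ⁴) :
    primFix Q z = ∫ s in (0 : ℝ)..z.1, Q (s, z.2) := by
  have := intervalIntegral.smul_integral_comp_mul_left (a := (0 : ℝ)) (b := 1)
    (fun s => Q (s, z.2)) z.1
  simp only [mul_zero, mul_one, smul_eq_mul] at this
  rw [← this, primFix, integral_Icc_eq_integral_Ioc, integral_of_le zero_le_one,
    integral_const_mul]

theorem ae_Icc_mem : ∀ᵐ τ ∂(volume.restrict (Icc (0 : ℝ) 1)), τ ∈ Icc (0 : ℝ) 1 :=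
  ae_restrict_mem measurableSet_Icc

theorem contDiff_primFix {Q : ℝ × ℝ⁴ → ℝ} (hQ : Smooth Q) :
    Smooth (primFix Q) := by
  refine contDiff_integral_param (isCompact_Icc (a := (0 : ℝ)) (b := 1)) ae_Icc_mem
    (f := fun w : (ℝ × ℝ⁴) × ℝ => w.1.1 * Q (w.1.1 * w.2, w.1.2)) ?_
  exact (by fun_prop : Smooth fun w : (ℝ × ℝ⁴) × ℝ => w.1.1).mul
    (hQ.comp (by fun_prop))

theorem volterra_eq (Q : ℝ × ℝ⁴ → ℝ) : volterra Q = fun p => primFix Q (p.1, p) :=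
  funext fun p => (primFix_eq Q (p.1, p)).symm

theorem contDiff_volterra {Q : ℝ × ℝ⁴ → ℝ} (hQ : Smooth Q) :
    Smooth (volterra Q) := by
  rw [volterra_eq]
  exact (contDiff_primFix hQ).comp (by fun_prop)

theorem dd_volterra {Q : ℝ × ℝ⁴ → ℝ} (hQ : Smooth Q) (v : ℝ⁴) :
    dd v (volterra Q) = fun p => v.1 * Q (p.1, p) + volterra (dd ((0 : ℝ), v) Q) p := by
  funext p
  have hP := contDiff_primFix hQ
  have e1 : dd v (volterra Q) p = dd (v.1, v) (primFix Q) (p.1, p) := by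
    have h1 : HasFDerivAt (fun p : ℝ⁴ => (p.1, p))
        ((ContinuousLinearMap.fst ℝ ℝ Space).prod (ContinuousLinearMap.id ℝ ℝ⁴)) p :=
      HasFDerivAt.prodMk (𝕜 := ℝ) hasFDerivAt_fst (hasFDerivAt_id p)
    have h2 := HasFDerivAt.comp (f := fun p : ℝ⁴ => (p.1, p)) p (hP.dble _).hasFDerivAt h1
    have h2 : HasFDerivAt (fun p : ℝ⁴ => primFix Q (p.1, p)) _ p := h2
    rw [← volterra_eq] at h2
    rw [dd, h2.fderiv]; simp [dd]
  have e2 : dd (v.1, v) (primFix Q) (p.1, p) = v.1 * dd ((1 : ℝ), (0 : ℝ⁴)) (primFix Q) (p.1, p)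
      + dd ((0 : ℝ), v) (primFix Q) (p.1, p) := by
    have : (v.1, v) = v.1 • ((1 : ℝ), (0 : ℝ⁴)) + ((0 : ℝ), v) := by simp
    conv_lhs => rw [this]
    rw [dd_add_dir, dd_smul_dir, smul_eq_mul]
  have e3 : dd ((1 : ℝ), (0 : ℝ⁴)) (primFix Q) (p.1, p) = Q (p.1, p) := by
    rw [← dd_slice_left hP.dble]
    refine HasDerivAt.dd_one ?_
    simp only [primFix_eq]
    have hc : Continuous fun s => Q (s, p) := hQ.continuous.comp (by fun_prop)
    exact integral_hasDerivAt_right (hc.intervalIntegrable _ _)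
      hc.stronglyMeasurable.stronglyMeasurableAtFilter hc.continuousAt
  have e4 : dd ((0 : ℝ), v) (primFix Q) (p.1, p) = volterra (dd ((0 : ℝ), v) Q) p := by
    rw [volterra_eq, ← dd_slice hP.dble]
    have hs : Smooth fun w : ℝ⁴ × ℝ => p.1 * Q (p.1 * w.2, w.1) :=
      contDiff_const.mul (hQ.comp (by fun_prop))
    refine (dd_integral_param (isCompact_Icc (a := (0 : ℝ)) (b := 1)) ae_Icc_mem hs v p).trans ?_
    refine integral_congr_ae (of_forall fun τ => ?_)
    have hd : Differentiable ℝ fun q : ℝ⁴ => Q (p.1 * τ, q) := hQ.dble.comp (by fun_prop)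
    simp only
    rw [dd_const_mul hd, dd_slice hQ.dble]
  rw [e1, e2, e3, e4]

/-- The solution of `□ W = h` with zero data at time `0`. -/
def duhamel (h : ℝ⁴ → ℝ) (p : ℝ⁴) : ℝ :=
  ∫ s in (0 : ℝ)..p.1, smean (fun y => h (s, y)) (p.1 - s, p.2)

/-- The integrand of `duhamel`. -/
def duhKer (h : ℝ⁴ → ℝ) (z : ℝ × ℝ⁴) : ℝ :=
  smean (fun y => h (z.1, y)) (z.2.1 - z.1, z.2.2)

theorem contDiff_duhKer {h : ℝ⁴ → ℝ} (hh : Smooth h) :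
    Smooth (duhKer h) := by
  refine contDiff_integral_param (isCompact_closedBall (0 : Space) 1) ae_sph_mem
    (f := fun w : (ℝ × ℝ⁴) × Space => (w.1.2.1 - w.1.1) *
      h (w.1.1, w.1.2.2 + (w.1.2.1 - w.1.1) • w.2)) ?_
  exact (by fun_prop : Smooth fun w : (ℝ × ℝ⁴) × Space =>
    (w.1.2.1 - w.1.1)).mul (hh.comp (by fun_prop))

theorem dd_translate {V : ℝ⁴ → ℝ} (s : ℝ) (v p : ℝ⁴) :
    dd v (fun q : ℝ⁴ => V (q.1 - s, q.2)) p = dd v V (p.1 - s, p.2) := by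
  have : (fun q : ℝ⁴ => V (q.1 - s, q.2)) = fun q => V (q - (s, 0)) := by
    funext q; congr 1; ext1 <;> simp
  rw [this]
  simp only [dd]
  rw [fderiv_comp_sub]
  congr 2
  ext1 <;> simp

theorem dd_duhKer {h : ℝ⁴ → ℝ} (hh : Smooth h) (v w : ℝ⁴)
    (z : ℝ × ℝ⁴) : dd ((0 : ℝ), v) (dd ((0 : ℝ), w) (duhKer h)) z =
      dd v (dd w (smean fun y => h (z.1, y))) (z.2.1 - z.1, z.2.2) := by
  have hk := contDiff_duhKer hh
  have e1 : ∀ s q, dd ((0 : ℝ), w) (duhKer h) (s, q) =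
      dd w (smean fun y => h (s, y)) (q.1 - s, q.2) := fun s q => by
    rw [← dd_slice hk.dble, ← dd_translate s w q]; rfl
  have e2 : dd ((0 : ℝ), v) (dd ((0 : ℝ), w) (duhKer h)) z =
      dd v (fun q => dd ((0 : ℝ), w) (duhKer h) (z.1, q)) z.2 :=
    (dd_slice (hk.dd_top _).dble v z.1 z.2).symm
  rw [e2]
  simp only [e1]
  exact dd_translate z.1 v z.2

theorem contDiff_duhamel {h : ℝ⁴ → ℝ} (hh : Smooth h) :
    Smooth (duhamel h) := contDiff_volterra (contDiff_duhKer hh)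

theorem smean_zero (ψ : Space → ℝ) (x : Space) : smean ψ (0, x) = 0 := by simp [smean]

theorem dd_vt_duhamel {h : ℝ⁴ → ℝ} (hh : Smooth h) :
    dd vt (duhamel h) = volterra (dd ((0 : ℝ), vt) (duhKer h)) := by
  have h1 := dd_volterra (contDiff_duhKer hh) vt
  have h2 : duhamel h = volterra (duhKer h) := rfl
  rw [h2, h1]
  funext p
  simp [duhKer, smean_zero]

theorem box_duhamel {h : ℝ⁴ → ℝ} (hh : Smooth h) (p : ℝ⁴) :
    box (duhamel h) p = h p := by
  have hk := contDiff_duhKer hh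
  have e1 : dd vt (dd vt (duhamel h)) p = h p +
      volterra (dd ((0 : ℝ), vt) (dd ((0 : ℝ), vt) (duhKer h))) p := by
    rw [dd_vt_duhamel hh, dd_volterra (hk.dd_top _)]
    have : dd ((0 : ℝ), vt) (duhKer h) (p.1, p) = h p := by
      rw [← dd_slice hk.dble]
      have e : dd vt (fun q => duhKer h (p.1, q)) p =
        dd vt (smean fun y => h (p.1, y)) (p.1 - p.1, p.2) :=
        dd_translate (V := smean fun y => h (p.1, y)) p.1 vt p
      rw [e, dd_smean_vt (contDiff_slice hh _)]
      simp
    simp only [this]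
    simp [vt]
  have e2 : ∀ i, dd (vx i) (dd (vx i) (duhamel h)) p =
      volterra (dd ((0 : ℝ), vx i) (dd ((0 : ℝ), vx i) (duhKer h))) p := by
    intro i
    have a1 : dd (vx i) (duhamel h) = volterra (dd ((0 : ℝ), vx i) (duhKer h)) := by
      have h1 := dd_volterra hk (vx i)
      have h2 : duhamel h = volterra (duhKer h) := rfl
      rw [h2, h1]; funext p; simp [vx]
    rw [a1, dd_volterra (hk.dd_top _)]
    simp [vx]
  have hc : ∀ v, Continuous fun s => dd ((0 : ℝ), v) (dd ((0 : ℝ), v) (duhKer h)) (s, p) := fun v =>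
    ((hk.dd_top _).dd_top _).continuous.comp (by fun_prop)
  rw [box, e1]
  simp only [e2, volterra]
  rw [← intervalIntegral.integral_finsetSum fun i _ => (hc (vx i)).intervalIntegrable _ _,
    add_sub_assoc, ← intervalIntegral.integral_sub ((hc vt).intervalIntegrable _ _)
    ((continuous_finsetSum _ fun i _ => hc (vx i)).intervalIntegrable _ _)]
  simp only [dd_duhKer hh]
  have := fun s => box_smean (contDiff_slice hh s) (p.1 - s, p.2)
  simp only [box] at this
  simp [this]

theorem duhamel_zero (h : ℝ⁴ → ℝ) (x : Space) : duhamel h (0, x) = 0 := by simp [duhamel]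

theorem dd_duhamel_zero {h : ℝ⁴ → ℝ} (hh : Smooth h) (x : Space) :
    dd vt (duhamel h) (0, x) = 0 := by
  rw [dd_vt_duhamel hh]; simp [volterra]

/-! ### Superposition operators and smooth dependence of fixed points -/

section Nemytskii

variable {K : Type} [TopologicalSpace K] [CompactSpace K]

/-- Pointwise application of a family of linear maps, as a bilinear map of continuous functions. -/
def pointwiseApply (E F : Type) [NormedAddCommGroup E] [NormedSpace ℝ E] [NormedAddCommGroup F]
    [NormedSpace ℝ F] : C(K, E →L[ℝ] F) →L[ℝ] C(K, E) →L[ℝ] C(K, F) :=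
  LinearMap.mkContinuous₂
    (LinearMap.mk₂ ℝ (fun (A : C(K, E →L[ℝ] F)) (V : C(K, E)) => (⟨fun z => A z (V z), A.continuous.clm_apply V.continuous⟩ : C(K, F)))
      (fun A B V => by ext z; simp) (fun c A V => by ext z; simp)
      (fun A V W => by ext z; simp) (fun c A V => by ext z; simp)) 1 (by
    intro A V
    refine (ContinuousMap.norm_le _ (by positivity)).2 fun z => ?_
    simp only [LinearMap.mk₂_apply, ContinuousMap.coe_mk, one_mul]
    exact (A z).le_opNorm_of_le (V.norm_coe_le_norm z) |>.trans
      (mul_le_mul_of_nonneg_right (A.norm_coe_le_norm z) (norm_nonneg _)))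

theorem pointwiseApply_apply {E F : Type} [NormedAddCommGroup E] [NormedSpace ℝ E]
    [NormedAddCommGroup F] [NormedSpace ℝ F] (A : C(K, E →L[ℝ] F)) (V : C(K, E)) (z : K) :
    pointwiseApply E F A V z = A z (V z) := rfl

theorem hasFDerivAt_nemytskii {E F : Type} [NormedAddCommGroup E] [NormedSpace ℝ E]
    [FiniteDimensional ℝ E] [NormedAddCommGroup F] [NormedSpace ℝ F] {H : E → F}
    (hH : Smooth H) (U : C(K, E)) :
    HasFDerivAt (fun U : C(K, E) => (⟨H, hH.continuous⟩ : C(E, F)).comp U)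
      (pointwiseApply E F ((⟨fderiv ℝ H, hH.continuous_fderiv (by simp)⟩ : C(E, E →L[ℝ] F)).comp U))
      U := by
  have : ProperSpace E := FiniteDimensional.proper ℝ E
  have huc : UniformContinuousOn (fderiv ℝ H) (closedBall 0 (‖U‖ + 1)) :=
    (isCompact_closedBall _ _).uniformContinuousOn_of_continuous
      (hH.continuous_fderiv (by simp)).continuousOn
  rw [hasFDerivAt_iff_isLittleO_nhds_zero, Asymptotics.isLittleO_iff]
  intro ε hε
  obtain ⟨δ, hδ, h⟩ := Metric.uniformContinuousOn_iff.1 huc ε hε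
  filter_upwards [Metric.ball_mem_nhds (0 : C(K, E)) (lt_min hδ one_pos)] with V hV
  rw [mem_ball_zero_iff, lt_min_iff] at hV
  refine (ContinuousMap.norm_le _ (by positivity)).2 fun z => ?_
  simp only [ContinuousMap.sub_apply, ContinuousMap.comp_apply, ContinuousMap.coe_mk,
    ContinuousMap.add_apply, pointwiseApply_apply]
  have hVz := V.norm_coe_le_norm z
  have hUz := U.norm_coe_le_norm z
  have hs : ∀ w ∈ segment ℝ (U z) (U z + V z), ‖fderiv ℝ H w - fderiv ℝ H (U z)‖ ≤ ε := by
    intro w hw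
    have hw1 : ‖w - U z‖ ≤ ‖V z‖ := by
      have := norm_sub_le_of_mem_segment hw
      simpa using this
    have hw2 : ‖w‖ ≤ ‖U‖ + 1 := by
      calc ‖w‖ = ‖(w - U z) + U z‖ := by simp
        _ ≤ ‖w - U z‖ + ‖U z‖ := norm_add_le _ _
        _ ≤ ‖U‖ + 1 := by linarith
    have := h w (by simpa using hw2) (U z) (by simpa using by linarith)
      (by rw [dist_eq_norm]; linarith)
    rw [dist_eq_norm] at this
    exact this.le
  have := (convex_segment (U z) (U z + V z)).norm_image_sub_le_of_norm_hasFDerivWithin_le'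
    (fun w _ => (hH.dble w).hasFDerivAt.hasFDerivWithinAt) hs (left_mem_segment _ _ _)
    (right_mem_segment _ _ _)
  rw [add_sub_cancel_left] at this
  exact this.trans (mul_le_mul_of_nonneg_left hVz hε.le)

theorem contDiff_nemytskii {E F : Type} [NormedAddCommGroup E] [NormedSpace ℝ E]
    [FiniteDimensional ℝ E] [NormedAddCommGroup F] [NormedSpace ℝ F] {H : E → F}
    (hH : Smooth H) :
    Smooth (fun U : C(K, E) => (⟨H, hH.continuous⟩ : C(E, F)).comp U) := by
  have main : ∀ n : ℕ, ∀ (F : Type) [NormedAddCommGroup F] [NormedSpace ℝ F] (H : E → F)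
      (hH : Smooth H),
      ContDiff ℝ n (fun U : C(K, E) => (⟨H, hH.continuous⟩ : C(E, F)).comp U) := by
    intro n
    induction n with
    | zero => intro F _ _ H hH; exact contDiff_zero.2 (ContinuousMap.continuous_postcomp _)
    | succ n ih =>
      intro F _ _ H hH
      have h1 : ContDiff ℝ ((n : WithTop ℕ∞) + 1)
          (fun U : C(K, E) => (⟨H, hH.continuous⟩ : C(E, F)).comp U) := by
        refine contDiff_succ_iff_fderiv.2
          ⟨fun U => (hasFDerivAt_nemytskii hH U).differentiableAt, by simp, ?_⟩
        rw [show fderiv ℝ (fun U : C(K, E) => (⟨H, hH.continuous⟩ : C(E, F)).comp U) = _ from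
          funext fun U => (hasFDerivAt_nemytskii hH U).fderiv]
        exact (pointwiseApply E F).contDiff.comp
          (ih (E →L[ℝ] F) (fderiv ℝ H) (hH.fderiv_right (m := (⊤ : ℕ∞)) (by norm_cast)))
      exact_mod_cast h1
  exact contDiff_infty.2 fun n => main n F H hH

end Nemytskii

theorem contDiffAt_fixedPoint {P X : Type} [NormedAddCommGroup P] [NormedSpace ℝ P]
    [CompleteSpace P] [NormedAddCommGroup X] [NormedSpace ℝ X] [CompleteSpace X] {Ψ : P × X → X}
    (hΨ : Smooth Ψ) {O : Set P} (hO : IsOpen O)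
    (hc : ∀ p ∈ O, ∀ V W, ‖Ψ (p, V) - Ψ (p, W)‖ ≤ 1 / 2 * ‖V - W‖) {V : P → X}
    (hV : ∀ p ∈ O, Ψ (p, V p) = V p) {p : P} (hp : p ∈ O) : ContDiffAt ℝ (⊤ : ℕ∞) V p := by
  let G : P × X → X := fun z => z.2 - Ψ z
  have hG : Smooth G := contDiff_snd.sub hΨ
  let A : X →L[ℝ] X := (fderiv ℝ Ψ (p, V p)).comp (ContinuousLinearMap.inr ℝ P X)
  have hA : HasFDerivAt (fun W => Ψ (p, W)) A (V p) :=
    HasFDerivAt.comp (f := fun W : X => (p, W)) (V p) (hΨ.dble _).hasFDerivAt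
      (hasFDerivAt_prodMk_right p (V p))
  have hAn : ‖A‖ ≤ 1 / 2 := by
    have hl : LipschitzWith (1 / 2 : NNReal) fun W => Ψ (p, W) :=
      LipschitzWith.of_dist_le_mul fun W W' => by
        rw [dist_eq_norm, dist_eq_norm]; simpa using hc p hp W W'
    have := hA.le_of_lipschitz hl
    simpa using this
  have hinv : (fderiv ℝ G (p, V p) ∘L ContinuousLinearMap.inr ℝ P X).IsInvertible := by
    have e : fderiv ℝ G (p, V p) ∘L ContinuousLinearMap.inr ℝ P X = 1 - A := by
      have : HasFDerivAt G (ContinuousLinearMap.snd ℝ P X - fderiv ℝ Ψ (p, V p)) (p, V p) :=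
        hasFDerivAt_snd.sub (hΨ.dble _).hasFDerivAt
      rw [this.fderiv]
      ext W
      simp [A]
    rw [e]
    have hu : IsUnit (1 - A) := isUnit_one_sub_of_norm_lt_one (by linarith)
    obtain ⟨w, hw⟩ := hu
    exact ⟨ContinuousLinearEquiv.ofUnit w, hw⟩
  have hcd := hG.contDiffAt (x := (p, V p))
  have hn : ((⊤ : ℕ∞) : WithTop ℕ∞) ≠ 0 := by simp
  have h1 := ContDiffAt.contDiffAt_implicitFunction hcd hn hinv
  refine h1.congr_of_eventuallyEq ?_
  have h2 := ContDiffAt.eventually_apply_implicitFunction hcd hn hinv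
  filter_upwards [h2, hO.mem_nhds hp] with q hq hqO
  have e0 : G (p, V p) = 0 := by simp [G, hV p hp]
  rw [e0] at hq
  set W := hcd.implicitFunction hn hinv q
  have hW : Ψ (q, W) = W := (sub_eq_zero.1 hq).symm
  have h3 := hc q hqO (V q) W
  rw [hV q hqO, hW] at h3
  have : ‖V q - W‖ = 0 := le_antisymm (by linarith) (norm_nonneg _)
  exact sub_eq_zero.1 (norm_eq_zero.1 this)

/-! ### The reference cone -/

/-- The reference backward cone. -/
def refCone : Set ℝ⁴ := {z | 0 ≤ z.1 ∧ z.1 ≤ 1 ∧ ‖z.2‖ ≤ 2 - z.1}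

theorem isCompact_refCone : IsCompact refCone := by
  refine Metric.isCompact_of_isClosed_isBounded ?_ ?_
  · have h1 : IsClosed {z : ℝ⁴ | 0 ≤ z.1} := isClosed_le (by fun_prop) (by fun_prop)
    have h2 : IsClosed {z : ℝ⁴ | z.1 ≤ 1} := isClosed_le (by fun_prop) (by fun_prop)
    have h3 : IsClosed {z : ℝ⁴ | ‖z.2‖ ≤ 2 - z.1} := isClosed_le (by fun_prop) (by fun_prop)
    exact h1.inter (h2.inter h3)
  · refine (Metric.isBounded_closedBall (x := (0 : ℝ⁴)) (r := 2)).subset ?_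
    rintro z ⟨h0, h1, h2⟩
    rw [mem_closedBall_zero_iff, Prod.norm_def]
    exact max_le (by rw [norm_eq_abs, abs_of_nonneg h0]; linarith) (by linarith)

instance : CompactSpace refCone := isCompact_iff_compactSpace.1 isCompact_refCone

/-- A continuous retraction of space-time onto the reference cone. -/
def coneRet (z : ℝ⁴) : refCone :=
  ⟨(max 0 (min 1 z.1), ((2 - max 0 (min 1 z.1)) / max (2 - max 0 (min 1 z.1)) ‖z.2‖) • z.2), by
    have h0 : 0 ≤ max 0 (min 1 z.1) := le_max_left _ _
    have h1 : max 0 (min 1 z.1) ≤ 1 := max_le zero_le_one (min_le_left _ _)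
    refine ⟨h0, h1, ?_⟩
    set ρ := 2 - max 0 (min 1 z.1)
    have hρ : 0 < ρ := by simp only [ρ]; linarith
    have hm : 0 < max ρ ‖z.2‖ := lt_max_of_lt_left hρ
    rw [norm_smul, norm_eq_abs, abs_of_nonneg (by positivity), div_mul_eq_mul_div,
      div_le_iff₀ hm]
    exact mul_le_mul_of_nonneg_left (le_max_right _ _) hρ.le⟩

theorem continuous_coneRet : Continuous coneRet := by
  refine Continuous.subtype_mk ?_ _
  have hc : Continuous fun z : ℝ⁴ => 2 - max 0 (min 1 z.1) := by fun_prop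
  refine Continuous.prodMk (by fun_prop) ?_
  refine (hc.div (hc.max (by fun_prop)) fun z => ?_).smul continuous_snd
  have h1 : max 0 (min 1 z.1) ≤ 1 := max_le zero_le_one (min_le_left _ _)
  exact (lt_max_of_lt_left (by linarith)).ne'

theorem coneRet_of_mem {z : ℝ⁴} (hz : z ∈ refCone) : coneRet z = ⟨z, hz⟩ := by
  obtain ⟨h0, h1, h2⟩ := hz
  have e : max 0 (min 1 z.1) = z.1 := by rw [min_eq_right h1, max_eq_right h0]
  apply Subtype.ext
  simp only [coneRet, e]
  rw [max_eq_left h2, div_self (by linarith), one_smul]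

/-- The measure of averaging in the Duhamel formula. -/
def avgMeas : Measure ℝ⁴ := (volume.restrict (Icc (0 : ℝ) 1)).prod sph

instance : IsProbabilityMeasure avgMeas := by
  have : IsProbabilityMeasure (volume.restrict (Icc (0 : ℝ) 1)) := ⟨by simp⟩
  unfold avgMeas; infer_instance

theorem ae_avgMeas : ∀ᵐ q ∂avgMeas, (0 ≤ q.1 ∧ q.1 ≤ 1) ∧ ‖q.2‖ = 1 := by
  have h1 : ∀ᵐ q ∂avgMeas, q.1 ∈ Icc (0 : ℝ) 1 :=
    Measure.quasiMeasurePreserving_fst.ae ae_Icc_mem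
  have h2 : ∀ᵐ q ∂avgMeas, ‖q.2‖ = 1 := Measure.quasiMeasurePreserving_snd.ae ae_sph_norm
  filter_upwards [h1, h2] with q a b using ⟨⟨a.1, a.2⟩, b⟩

/-- The point of the cone where the source is evaluated. -/
def srcPt (z q : ℝ⁴) : ℝ⁴ := (z.1 * q.1, z.2 + (z.1 * (1 - q.1)) • q.2)

theorem srcPt_mem {z q : ℝ⁴} (hz : z ∈ refCone) (hq : (0 ≤ q.1 ∧ q.1 ≤ 1) ∧ ‖q.2‖ = 1) :
    srcPt z q ∈ refCone := by
  obtain ⟨h0, h1, h2⟩ := hz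
  obtain ⟨⟨a, b⟩, c⟩ := hq
  refine ⟨mul_nonneg h0 a, mul_le_one₀ h1 a b, ?_⟩
  calc ‖(srcPt z q).2‖ ≤ ‖z.2‖ + ‖(z.1 * (1 - q.1)) • q.2‖ := norm_add_le _ _
    _ = ‖z.2‖ + z.1 * (1 - q.1) := by
      rw [norm_smul, c, norm_eq_abs, abs_of_nonneg (mul_nonneg h0 (by linarith)), mul_one]
    _ ≤ 2 - (srcPt z q).1 := by simp only [srcPt]; linarith

/-- The Duhamel operator on the reference cone, with an exponential weight. -/
def coneOp (lam : ℝ) (V : C(refCone, ℝ)) : C(refCone, ℝ) where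
  toFun z := ∫ q, z.1.1 ^ 2 * (max 0 (1 - q.1)) * exp (-lam * (z.1.1 * max 0 (1 - q.1)))
    * V (coneRet (srcPt z.1 q)) ∂avgMeas
  continuous_toFun := by
    have hK : IsCompact (Icc (0:ℝ) 1 ×ˢ closedBall (0 : Space) 1) :=
      isCompact_Icc.prod (isCompact_closedBall 0 1)
    let F : refCone → ℝ⁴ → ℝ := fun z q => z.1.1 ^ 2 * (max 0 (1 - q.1))
      * exp (-lam * (z.1.1 * max 0 (1 - q.1))) * V (coneRet (srcPt z.1 q))
    have hF : Continuous (Function.uncurry F) := by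
      have h1 : Continuous fun w : refCone × ℝ⁴ => V (coneRet (srcPt w.1.1 w.2)) :=
        V.continuous.comp (continuous_coneRet.comp (by unfold srcPt; fun_prop))
      exact (by fun_prop : Continuous fun w : refCone × ℝ⁴ => w.1.1.1 ^ 2 * (max 0 (1 - w.2.1))
        * exp (-lam * (w.1.1.1 * max 0 (1 - w.2.1)))).mul h1
    obtain ⟨C, hC⟩ := (isCompact_univ.prod hK).exists_bound_of_continuousOn hF.continuousOn
    refine continuous_of_dominated (F := F) (bound := fun _ => C) (fun z =>
      (hF.comp (by fun_prop : Continuous fun q => (z, q))).aestronglyMeasurable) (fun z => ?_)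
      (integrable_const C) ?_
    · filter_upwards [ae_avgMeas] with q hq
      exact hC (z, q) ⟨mem_univ _, ⟨hq.1.1, hq.1.2⟩, by simp [hq.2]⟩
    · exact of_forall fun q => hF.comp (by fun_prop : Continuous fun z => (z, q))

/-! ### Global smooth solutions for a Lipschitz nonlinearity -/

theorem integrable_avgMeas {h : ℝ⁴ → ℝ} (hh : Continuous h) : Integrable h avgMeas := by
  refine integrable_of_continuous_of_ae_mem (K := Icc (0:ℝ) 1 ×ˢ closedBall (0 : Space) 1)
    (isCompact_Icc.prod (isCompact_closedBall 0 1)) ?_ hh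
  filter_upwards [ae_avgMeas] with q hq
  exact ⟨⟨hq.1.1, hq.1.2⟩, by simp [hq.2]⟩

theorem continuous_coneKer (lam : ℝ) (V : C(refCone, ℝ)) (z : refCone) :
    Continuous fun q : ℝ⁴ => z.1.1 ^ 2 * (max 0 (1 - q.1))
      * exp (-lam * (z.1.1 * max 0 (1 - q.1))) * V (coneRet (srcPt z.1 q)) := by
  have h1 : Continuous fun q : ℝ⁴ => V (coneRet (srcPt z.1 q)) :=
    V.continuous.comp (continuous_coneRet.comp (by unfold srcPt; fun_prop))
  exact (by fun_prop : Continuous fun q : ℝ⁴ => z.1.1 ^ 2 * (max 0 (1 - q.1))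
      * exp (-lam * (z.1.1 * max 0 (1 - q.1)))).mul h1

theorem coneKer_bound {lam : ℝ} (hlam : 0 < lam) {τ s : ℝ} (h0 : 0 ≤ τ) (h1 : τ ≤ 1) (hs : 0 ≤ s) :
    τ ^ 2 * s * exp (-lam * (τ * s)) ≤ 1 / lam := by
  have hx : lam * (τ * s) * exp (-(lam * (τ * s))) ≤ 1 := by
    have h := Real.add_one_le_exp (lam * (τ * s))
    rw [Real.exp_neg, ← div_eq_mul_inv, div_le_one (exp_pos _)]
    linarith
  have hE := (exp_pos (-lam * (τ * s))).le
  rw [le_div_iff₀ hlam]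
  calc τ ^ 2 * s * exp (-lam * (τ * s)) * lam
      = τ * (lam * (τ * s) * exp (-lam * (τ * s))) := by ring
    _ ≤ 1 * (lam * (τ * s) * exp (-lam * (τ * s))) := by gcongr
    _ ≤ 1 := by rw [one_mul, neg_mul]; exact hx

theorem coneOp_sub_le {lam : ℝ} (hlam : 0 < lam) (V W : C(refCone, ℝ)) :
    ‖coneOp lam V - coneOp lam W‖ ≤ 1 / lam * ‖V - W‖ := by
  refine (ContinuousMap.norm_le _ (by positivity)).2 fun z => ?_
  have hiV := integrable_avgMeas (continuous_coneKer lam V z)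
  have hiW := integrable_avgMeas (continuous_coneKer lam W z)
  have e : (coneOp lam V - coneOp lam W) z = ∫ q, (z.1.1 ^ 2 * (max 0 (1 - q.1))
      * exp (-lam * (z.1.1 * max 0 (1 - q.1)))) * ((V - W) (coneRet (srcPt z.1 q))) ∂avgMeas := by
    rw [ContinuousMap.sub_apply]
    refine (integral_sub hiV hiW).symm.trans (integral_congr_ae (of_forall fun q => ?_))
    simp only [ContinuousMap.sub_apply]; ring
  rw [e]
  refine (norm_integral_le_of_norm_le_const (C := 1 / lam * ‖V - W‖) ?_).trans (by simp)
  refine of_forall fun q => ?_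
  rw [norm_mul]
  refine mul_le_mul ?_ ((V - W).norm_coe_le_norm _) (norm_nonneg _) (by positivity)
  rw [norm_eq_abs, abs_of_nonneg (by have := le_max_left 0 (1 - q.1); positivity)]
  exact coneKer_bound hlam z.2.1 z.2.2.1 (le_max_left _ _)

theorem coneOp_add (lam : ℝ) (V W : C(refCone, ℝ)) :
    coneOp lam (V + W) = coneOp lam V + coneOp lam W := by
  ext z
  rw [ContinuousMap.add_apply]
  refine Eq.trans ?_ (integral_add (integrable_avgMeas (continuous_coneKer lam V z))
    (integrable_avgMeas (continuous_coneKer lam W z)))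
  refine integral_congr_ae (of_forall fun q => ?_)
  simp only [ContinuousMap.add_apply]; ring

theorem coneOp_smul (lam c : ℝ) (V : C(refCone, ℝ)) : coneOp lam (c • V) = c • coneOp lam V := by
  ext z
  rw [ContinuousMap.smul_apply, smul_eq_mul]
  refine Eq.trans ?_ (integral_const_mul c _)
  refine integral_congr_ae (of_forall fun q => ?_)
  simp only [ContinuousMap.smul_apply, smul_eq_mul]; ring

/-- `coneOp` as a bounded operator. -/
def coneOpL {lam : ℝ} (hlam : 0 < lam) : C(refCone, ℝ) →L[ℝ] C(refCone, ℝ) :=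
  LinearMap.mkContinuous
    { toFun := coneOp lam, map_add' := coneOp_add lam, map_smul' := coneOp_smul lam } (1 / lam) (by
      intro V
      have h0 : coneOp lam 0 = 0 := by simpa using coneOp_smul lam 0 0
      have := coneOp_sub_le hlam V 0
      rw [h0] at this
      simpa using this)

/-- The weight `e^{aτ}` on the cone. -/
def coneExp (a : ℝ) : C(refCone, ℝ) := ⟨fun z => exp (a * z.1.1), by fun_prop⟩

/-- The point of space-time corresponding to a point of the reference cone with apex `p`. -/
def conePt (p z : ℝ⁴) : ℝ⁴ := (p.1 * z.1, p.2 + p.1 • z.2)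

/-- The restriction of a smooth function to the cone with apex `p`. -/
def coneRestr (W : ℝ⁴ → ℝ) (hW : Smooth W) (p : ℝ⁴) : C(refCone, ℝ) :=
  ⟨fun z => W (conePt p z), hW.continuous.comp (by unfold conePt; fun_prop)⟩

theorem contDiff_coneRestr {W : ℝ⁴ → ℝ} (hW : Smooth W) :
    Smooth (coneRestr W hW) := by
  let H : ℝ⁴ × ℝ⁴ → ℝ := fun w => W (conePt w.1 w.2)
  have hH : Smooth H := hW.comp (by unfold conePt; fun_prop)
  let ι : C(refCone, ℝ⁴ × ℝ⁴) := ⟨fun z => (0, z.1), by fun_prop⟩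
  let J : ℝ⁴ →L[ℝ] C(refCone, ℝ⁴ × ℝ⁴) :=
    LinearMap.mkContinuous
      { toFun := fun p => ⟨fun _ => (p, 0), continuous_const⟩
        map_add' := fun p q => by ext z <;> simp
        map_smul' := fun c p => by ext z <;> simp } 1 (fun p => by
          refine (ContinuousMap.norm_le _ (by positivity)).2 fun z => ?_
          simp [Prod.norm_def])
  have e : coneRestr W hW = fun p => (⟨H, hH.continuous⟩ : C(_, ℝ)).comp (J p + ι) := by
    funext p; ext z
    simp [coneRestr, H, J, ι]
  rw [e]
  exact (contDiff_nemytskii hH).comp (J.contDiff.add contDiff_const)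

section Solve

variable {h : ℝ → ℝ} (hh : Smooth h) {L : ℝ} (hL : ∀ a b, |h a - h b| ≤ L * |a - b|)
  {W : ℝ⁴ → ℝ} (hW : Smooth W)

/-- The integral equation on the cone with apex `p`. -/
def ConeSol (h : ℝ → ℝ) (W : ℝ⁴ → ℝ) (p : ℝ⁴) (U : C(refCone, ℝ)) : Prop :=
  ∀ z : refCone, U z = W (conePt p z) -
    p.1 ^ 2 * ∫ q, z.1.1 ^ 2 * (1 - q.1) * h (U (coneRet (srcPt z.1 q))) ∂avgMeas

/-- The weighted fixed point map. -/
def coneMap (hh : Smooth h) (hW : Smooth W) {lam : ℝ} (hlam : 0 < lam)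
    (w : ℝ⁴ × C(refCone, ℝ)) : C(refCone, ℝ) :=
  coneExp (-lam) * coneRestr W hW w.1 - w.1.1 ^ 2 •
    coneOpL hlam (coneExp (-lam) * (⟨h, hh.continuous⟩ : C(ℝ, ℝ)).comp (coneExp lam * w.2))

theorem contDiff_coneMap {lam : ℝ} (hlam : 0 < lam) :
    Smooth (coneMap hh hW hlam) := by
  have h1 : Smooth fun w : ℝ⁴ × C(refCone, ℝ) => coneRestr W hW w.1 :=
    (contDiff_coneRestr hW).comp contDiff_fst
  have h2 : Smooth fun w : ℝ⁴ × C(refCone, ℝ) =>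
      (⟨h, hh.continuous⟩ : C(ℝ, ℝ)).comp (coneExp lam * w.2) :=
    (contDiff_nemytskii hh).comp (contDiff_const.mul contDiff_snd)
  have h3 : Smooth fun w : ℝ⁴ × C(refCone, ℝ) => w.1.1 ^ 2 := by fun_prop
  exact (contDiff_const.mul h1).sub (h3.smul ((coneOpL hlam).contDiff.comp (contDiff_const.mul h2)))

theorem coneMap_apply {lam : ℝ} (hlam : 0 < lam) (p : ℝ⁴) (V : C(refCone, ℝ)) (z : refCone) :
    coneMap hh hW hlam (p, V) z = exp (-lam * z.1.1) * (W (conePt p z) - p.1 ^ 2 *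
      ∫ q, z.1.1 ^ 2 * (1 - q.1) * h ((coneExp lam * V) (coneRet (srcPt z.1 q))) ∂avgMeas) := by
  have e : coneOp lam (coneExp (-lam) * (⟨h, hh.continuous⟩ : C(ℝ, ℝ)).comp (coneExp lam * V)) z =
      exp (-lam * z.1.1) *
      ∫ q, z.1.1 ^ 2 * (1 - q.1) * h ((coneExp lam * V) (coneRet (srcPt z.1 q))) ∂avgMeas := by
    rw [← integral_const_mul]
    refine integral_congr_ae ?_
    filter_upwards [ae_avgMeas] with q hq
    have hm := srcPt_mem z.2 hq
    rw [coneRet_of_mem hm, max_eq_right (by linarith [hq.1.2])]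
    simp only [ContinuousMap.mul_apply, ContinuousMap.comp_apply, ContinuousMap.coe_mk, coneExp]
    have : exp (-lam * z.1.1) = exp (-lam * (z.1.1 * (1 - q.1))) *
        exp (-lam * (srcPt z.1 q).1) := by
      rw [← Real.exp_add]; congr 1; simp only [srcPt]; ring
    rw [this]; ring
  have e2 : coneMap hh hW hlam (p, V) z = exp (-lam * z.1.1) * W (conePt p z) - p.1 ^ 2 *
      coneOp lam (coneExp (-lam) * (⟨h, hh.continuous⟩ : C(ℝ, ℝ)).comp (coneExp lam * V)) z := rfl
  rw [e2, e]; ring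

theorem coneSol_iff {lam : ℝ} (hlam : 0 < lam) (p : ℝ⁴) (V : C(refCone, ℝ)) :
    coneMap hh hW hlam (p, V) = V ↔ ConeSol h W p (coneExp lam * V) := by
  have hexp : ∀ z : refCone, exp (lam * z.1.1) * exp (-lam * z.1.1) = 1 := fun z => by
    rw [← Real.exp_add]; simp
  constructor
  · intro hV z
    have := congrArg (fun X : C(refCone, ℝ) => X z) hV
    simp only [coneMap_apply] at this
    have e : (coneExp lam * V) z = exp (lam * z.1.1) * V z := rfl
    rw [e, ← this, ← mul_assoc, hexp, one_mul]
  · intro hV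
    ext z
    rw [coneMap_apply, ← hV z]
    have e : (coneExp lam * V) z = exp (lam * z.1.1) * V z := rfl
    rw [e, ← mul_assoc, mul_comm (exp _) (exp _), hexp, one_mul]

theorem coneExp_mul_cancel (a : ℝ) (U : C(refCone, ℝ)) : coneExp a * (coneExp (-a) * U) = U := by
  ext z
  simp only [ContinuousMap.mul_apply, coneExp, ContinuousMap.coe_mk]
  rw [← mul_assoc, ← Real.exp_add]; simp

theorem coneMap_contract (hL : ∀ a b, |h a - h b| ≤ L * |a - b|) (hL0 : 0 ≤ L) {lam : ℝ}
    (hlam : 0 < lam) {p : ℝ⁴}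
    (hp : 2 * (p.1 ^ 2 * L) ≤ lam) (V V' : C(refCone, ℝ)) :
    ‖coneMap hh hW hlam (p, V) - coneMap hh hW hlam (p, V')‖ ≤ 1 / 2 * ‖V - V'‖ := by
  set N : C(refCone, ℝ) → C(refCone, ℝ) := fun V =>
    coneExp (-lam) * (⟨h, hh.continuous⟩ : C(ℝ, ℝ)).comp (coneExp lam * V) with hN
  have hNl : ‖N V - N V'‖ ≤ L * ‖V - V'‖ := by
    refine (ContinuousMap.norm_le _ (by positivity)).2 fun z => ?_
    have e : (N V - N V') z = exp (-lam * z.1.1) * (h (exp (lam * z.1.1) * V z) -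
        h (exp (lam * z.1.1) * V' z)) := by
      simp only [hN, ContinuousMap.sub_apply, ContinuousMap.mul_apply, ContinuousMap.comp_apply,
        ContinuousMap.coe_mk, coneExp]; ring
    rw [e, norm_mul, norm_eq_abs, norm_eq_abs, abs_of_pos (exp_pos _)]
    calc exp (-lam * z.1.1) * |h (exp (lam * z.1.1) * V z) - h (exp (lam * z.1.1) * V' z)|
        ≤ exp (-lam * z.1.1) * (L * |exp (lam * z.1.1) * V z - exp (lam * z.1.1) * V' z|) := by
          gcongr; exact hL _ _
      _ = (exp (-lam * z.1.1) * exp (lam * z.1.1)) * (L * |(V - V') z|) := by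
          rw [← mul_sub, abs_mul, abs_of_pos (exp_pos _), ContinuousMap.sub_apply]; ring
      _ = L * |(V - V') z| := by rw [← Real.exp_add]; simp
      _ ≤ L * ‖V - V'‖ := by gcongr; exact (V - V').norm_coe_le_norm z
  have e : coneMap hh hW hlam (p, V) - coneMap hh hW hlam (p, V') =
      -(p.1 ^ 2 • (coneOp lam (N V) - coneOp lam (N V'))) := by
    have : ∀ V, coneMap hh hW hlam (p, V) = coneExp (-lam) * coneRestr W hW p - p.1 ^ 2 •
      coneOp lam (N V) := fun V => rfl
    rw [this, this, smul_sub]; abel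
  rw [e, norm_neg, norm_smul, norm_eq_abs, abs_of_nonneg (sq_nonneg _)]
  calc p.1 ^ 2 * ‖coneOp lam (N V) - coneOp lam (N V')‖ ≤ p.1 ^ 2 * (1 / lam * (L * ‖V - V'‖)) := by
        gcongr; exact (coneOp_sub_le hlam _ _).trans (by gcongr)
    _ = (p.1 ^ 2 * L) / lam * ‖V - V'‖ := by ring
    _ ≤ 1 / 2 * ‖V - V'‖ := by
        have : p.1 ^ 2 * L / lam ≤ 1 / 2 := by rw [div_le_div_iff₀ hlam two_pos]; linarith
        exact mul_le_mul_of_nonneg_right this (norm_nonneg _)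

theorem existsUnique_coneSol (hh : Smooth h) (hL : ∀ a b, |h a - h b| ≤ L * |a - b|)
    (hL0 : 0 ≤ L) (hW : Smooth W)
    (p : ℝ⁴) : ∃! U, ConeSol h W p U := by
  have hlam : 0 < 2 * (p.1 ^ 2 * L) + 1 := by positivity
  set lam := 2 * (p.1 ^ 2 * L) + 1
  have hc := coneMap_contract hh hW hL hL0 hlam (p := p) (by simp [lam])
  have hcon : ContractingWith (1 / 2 : NNReal) fun V => coneMap hh hW hlam (p, V) :=
    ⟨by rw [← NNReal.coe_lt_coe]; norm_num, LipschitzWith.of_dist_le_mul fun V V' => by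
      rw [dist_eq_norm, dist_eq_norm]; simpa using hc V V'⟩
  refine ⟨coneExp lam * hcon.fixedPoint _, ?_, ?_⟩
  · exact (coneSol_iff hh hW hlam p _).1 hcon.fixedPoint_isFixedPt
  · intro U hU
    rw [← coneExp_mul_cancel lam U] at hU ⊢
    rw [hcon.fixedPoint_unique ((coneSol_iff hh hW hlam p _).2 hU)]

end Solve

/-- Existence, uniqueness and smoothness for the integral equation. -/
theorem exists_smooth_integral_solution {h : ℝ → ℝ} (hh : Smooth h) {L : ℝ}
    (hL : ∀ a b, |h a - h b| ≤ L * |a - b|) (hL0 : 0 ≤ L) {W : ℝ⁴ → ℝ}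
    (hW : Smooth W) :
    ∃ u : ℝ⁴ → ℝ, Smooth u ∧
      (∀ p, u p = W p - p.1 ^ 2 * ∫ q, (1 - q.1) * h (u (conePt p (srcPt (1, 0) q))) ∂avgMeas) ∧
      (∀ p, h 0 = 0 → (∀ z ∈ refCone, W (conePt p z) = 0) → u p = 0) := by
  choose U hU hUu using fun p => existsUnique_coneSol hh hL hL0 hW p
  have hapex : ((1 : ℝ), (0 : Space)) ∈ refCone := ⟨zero_le_one, le_rfl, by norm_num⟩
  let u : ℝ⁴ → ℝ := fun p => U p ⟨(1, 0), hapex⟩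
  have hconsist : ∀ p (z : refCone), ‖z.1.2‖ ≤ 2 - 2 * z.1.1 → U p z = u (conePt p z) := by
    intro p z hz
    let m : ℝ⁴ → ℝ⁴ := fun w => (z.1.1 * w.1, z.1.2 + z.1.1 • w.2)
    have hm : Continuous m := by fun_prop
    have hmem : ∀ w : refCone, m w ∈ refCone := by
      rintro ⟨w, w0, w1, w2⟩
      refine ⟨mul_nonneg z.2.1 w0, mul_le_one₀ z.2.2.1 w0 w1, ?_⟩
      calc ‖z.1.2 + z.1.1 • w.2‖ ≤ ‖z.1.2‖ + ‖z.1.1 • w.2‖ := norm_add_le _ _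
        _ = ‖z.1.2‖ + z.1.1 * ‖w.2‖ := by
            rw [norm_smul, norm_eq_abs, abs_of_nonneg z.2.1]
        _ ≤ (2 - 2 * z.1.1) + z.1.1 * (2 - w.1) := by gcongr; exact z.2.1
        _ = 2 - z.1.1 * w.1 := by ring
    let V : C(refCone, ℝ) := ⟨fun w => U p (coneRet (m w)),
      (U p).continuous.comp (continuous_coneRet.comp (hm.comp continuous_subtype_val))⟩
    have hV : ConeSol h W (conePt p z) V := by
      intro w
      have e1 : V w = U p ⟨m w, hmem w⟩ := by
        change U p (coneRet (m w)) = _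
        rw [coneRet_of_mem (hmem w)]
      rw [e1, hU p ⟨m w, hmem w⟩]
      congr 1
      · congr 1
        simp only [conePt, m, Prod.mk.injEq]
        refine ⟨by ring, ?_⟩
        module
      · rw [← integral_const_mul, ← integral_const_mul]
        refine integral_congr_ae ?_
        filter_upwards [ae_avgMeas] with q hq
        have e2 : V (coneRet (srcPt w q)) = U p (coneRet (srcPt (m w) q)) := by
          change U p (coneRet (m (coneRet (srcPt w q)))) = _
          rw [coneRet_of_mem (srcPt_mem w.2 hq)]
          congr 2
          simp only [srcPt, m, Prod.mk.injEq]
          exact ⟨by ring, by module⟩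
        rw [e2]
        simp only [conePt, m]
        ring
    have e3 := hUu (conePt p z) V hV
    change U p z = U (conePt p z) ⟨(1, 0), hapex⟩
    rw [← e3]
    change _ = U p (coneRet (m (1, 0)))
    rw [show m (1, 0) = z by simp [m], coneRet_of_mem z.2]
  refine ⟨u, ?_, ?_, ?_⟩
  · refine contDiff_iff_contDiffAt.2 fun p₀ => ?_
    set lam := 2 * ((|p₀.1| + 1) ^ 2 * L) + 1
    have hlam : 0 < lam := by positivity
    have hO : IsOpen {p : ℝ⁴ | |p.1| < |p₀.1| + 1} :=
      isOpen_lt (by fun_prop) (by fun_prop)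
    have hfix := contDiffAt_fixedPoint (contDiff_coneMap hh hW hlam) hO
      (fun p hp => coneMap_contract hh hW hL hL0 hlam (p := p) (by
        have hp' : |p.1| ≤ |p₀.1| + 1 := le_of_lt hp
        have : p.1 ^ 2 ≤ (|p₀.1| + 1) ^ 2 := by
          rw [← sq_abs]; gcongr
        have : p.1 ^ 2 * L ≤ (|p₀.1| + 1) ^ 2 * L := by gcongr
        simp only [lam]; linarith)) (V := fun p => coneExp (-lam) * U p)
      (fun p _ => (coneSol_iff hh hW hlam p _).2 (by rw [coneExp_mul_cancel]; exact hU p))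
      (p := p₀) (by simp)
    have e : u = fun p => exp lam *
        ContinuousMap.evalCLM ℝ (⟨(1, 0), hapex⟩ : refCone) (coneExp (-lam) * U p) := by
      funext p
      have : (coneExp (-lam) * U p) ⟨(1, 0), hapex⟩ = exp (-lam * 1) * u p := rfl
      change _ = _ * ((coneExp (-lam) * U p) ⟨(1, 0), hapex⟩)
      rw [this, ← mul_assoc, ← Real.exp_add]; simp
    rw [e]
    exact contDiffAt_const.mul ((ContinuousLinearMap.contDiff _).contDiffAt.comp p₀ hfix)
  · intro p
    refine (hU p ⟨(1, 0), hapex⟩).trans ?_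
    congr 1
    · simp [conePt]
    · congr 1
      refine integral_congr_ae ?_
      filter_upwards [ae_avgMeas] with q hq
      rw [coneRet_of_mem (srcPt_mem hapex hq), hconsist]
      · simp
      · have : ‖(srcPt ((1 : ℝ), (0 : Space)) q).2‖ = 1 - q.1 := by
          simp [srcPt, norm_smul, hq.2, abs_of_nonneg (sub_nonneg.2 hq.1.2)]
        rw [this]
        simp only [srcPt]; linarith [hq.1.2]
  · intro p h0 hz
    have : ConeSol h W p 0 := fun z => by simp [hz z z.2, h0]
    change U p _ = 0
    rw [← hUu p 0 this]; rfl

theorem duhamel_eq_avg {k : ℝ⁴ → ℝ} (hk : Continuous k) (p : ℝ⁴) :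
    duhamel k p = p.1 ^ 2 * ∫ q, (1 - q.1) * k (conePt p (srcPt (1, 0) q)) ∂avgMeas := by
  have hig : Integrable (fun q : ℝ⁴ => (1 - q.1) * k (conePt p (srcPt (1, 0) q))) avgMeas :=
    integrable_avgMeas (by unfold conePt srcPt; fun_prop)
  unfold avgMeas at hig ⊢
  rw [integral_prod _ hig, integral_Icc_eq_integral_Ioc,
    ← integral_of_le zero_le_one, duhamel]
  have h := intervalIntegral.mul_integral_comp_mul_left (a := 0) (b := 1)
    (f := fun s => smean (fun y => k (s, y)) (p.1 - s, p.2)) p.1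
  rw [mul_zero, mul_one] at h
  rw [← h, pow_two, mul_assoc]
  congr 1
  rw [← intervalIntegral.integral_const_mul]
  refine intervalIntegral.integral_congr fun σ _ => ?_
  simp only [smean]
  rw [← integral_const_mul]
  refine integral_congr_ae (of_forall fun ω => ?_)
  simp only [conePt, srcPt, zero_add, one_mul, smul_smul]
  ring_nf

theorem freeWave_eq_zero {u₀ u₁ : Space → ℝ} (h₀ : Smooth u₀)
    (h₁ : Continuous u₁) {R : ℝ} (hR₀ : ∀ x, R ≤ ‖x‖ → u₀ x = 0) (hR₁ : ∀ x, R ≤ ‖x‖ → u₁ x = 0)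
    {p : ℝ⁴} (hp : R + |p.1| < ‖p.2‖) : freeWave u₀ u₁ p = 0 := by
  rw [freeWave_eq h₀ h₁]
  refine integral_eq_zero_of_ae ?_
  filter_upwards [ae_sph_norm] with ω hω
  have hlt : R < ‖p.2 + p.1 • ω‖ := by
    have := norm_sub_norm_le p.2 (-(p.1 • ω))
    rw [sub_neg_eq_add, norm_neg, norm_smul, hω, mul_one, norm_eq_abs] at this
    linarith
  have hd : dd ω u₀ (p.2 + p.1 • ω) = 0 := by
    have he : u₀ =ᶠ[nhds (p.2 + p.1 • ω)] fun _ => 0 := by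
      filter_upwards [(isOpen_lt continuous_const continuous_norm).mem_nhds hlt] with y hy
      exact hR₀ y (le_of_lt hy)
    rw [dd, he.fderiv_eq]; simp
  simp [hR₀ _ hlt.le, hR₁ _ hlt.le, hd]

/-- Global smooth solutions of `□U = -h(U)` for a Lipschitz nonlinearity. -/
theorem exists_solution {h : ℝ → ℝ} (hh : Smooth h) {L : ℝ}
    (hL : ∀ a b, |h a - h b| ≤ L * |a - b|) (hL0 : 0 ≤ L) (h0 : h 0 = 0) {u₀ u₁ : Space → ℝ}
    (h₀ : Smooth u₀) (h₁ : Smooth u₁) {R : ℝ}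
    (hR₀ : ∀ x, R ≤ ‖x‖ → u₀ x = 0) (hR₁ : ∀ x, R ≤ ‖x‖ → u₁ x = 0) :
    ∃ U : ℝ⁴ → ℝ, Smooth U ∧ (∀ p, box U p = -h (U p)) ∧
      (∀ x, U (0, x) = u₀ x) ∧ (∀ x, dd vt U (0, x) = u₁ x) ∧
      ∀ p : ℝ⁴, R + 2 * |p.1| < ‖p.2‖ → U p = 0 := by
  have hW := contDiff_freeWave h₀ h₁
  obtain ⟨u, hu, hue, hus⟩ := exists_smooth_integral_solution hh hL hL0 hW
  have hk : Smooth fun p => h (u p) := hh.comp hu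
  have e : u = fun p => freeWave u₀ u₁ p - duhamel (fun p => h (u p)) p := by
    funext p
    rw [duhamel_eq_avg hk.continuous]; exact hue p
  have hd := contDiff_duhamel hk
  refine ⟨u, hu, fun p => ?_, fun x => ?_, fun x => ?_, fun p hp => ?_⟩
  · have : box u p = box (fun p => freeWave u₀ u₁ p - duhamel (fun p => h (u p)) p) p := by rw [← e]
    rw [this, box_sub hW hd, box_freeWave h₀ h₁, box_duhamel hk, zero_sub]
  · rw [e]
    simp only [duhamel_zero, freeWave_zero h₀ h₁.continuous, sub_zero]
  · have : dd vt u (0, x) = dd vt (fun p => freeWave u₀ u₁ p + -1 * duhamel (fun p => h (u p)) p) (0, x) := by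
      congr 1; funext p; refine (congrFun e p).trans ?_; ring
    rw [this, dd_add hW.dble (contDiff_const.mul hd).dble, dd_const_mul hd.dble, dd_duhamel_zero hk,
      dd_freeWave_zero h₀ h₁]
    simp
  · refine hus p h0 fun z hz => freeWave_eq_zero h₀ h₁.continuous hR₀ hR₁ ?_
    have h1 := norm_sub_norm_le p.2 (-(p.1 • z.2))
    rw [sub_neg_eq_add, norm_neg, norm_smul, norm_eq_abs] at h1
    have h2 : |p.1| * ‖z.2‖ ≤ |p.1| * (2 - z.1) := mul_le_mul_of_nonneg_left hz.2.2 (abs_nonneg _)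
    have h3 : |(conePt p z).1| = |p.1| * z.1 := by
      simp only [conePt]; rw [abs_mul, abs_of_nonneg hz.1]
    rw [h3]
    change _ < ‖p.2 + p.1 • z.2‖
    linarith

/-! ### Functions with spatially compact support -/

/-- `K` vanishes outside a cone, hence has compact support in space at each time. -/
def SpaceCpt (K : ℝ⁴ → ℝ) : Prop :=
  ∃ R L : ℝ, ∀ p : ℝ⁴, R + L * |p.1| < ‖p.2‖ → K p = 0

theorem eventually_zero_dd {U : ℝ⁴ → ℝ} {p : ℝ⁴} (h : ∀ᶠ q in nhds p, U q = 0)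
    (v : ℝ⁴) : ∀ᶠ q in nhds p, dd v U q = 0 := by
  filter_upwards [h.eventually_nhds] with q hq
  have : U =ᶠ[nhds q] fun _ => 0 := hq
  rw [dd, this.fderiv_eq]; simp

theorem SpaceCpt.of_local {U K : ℝ⁴ → ℝ} (hU : SpaceCpt U)
    (h : ∀ p, (∀ᶠ q in nhds p, U q = 0) → K p = 0) : SpaceCpt K := by
  obtain ⟨R, L, hR⟩ := hU
  refine ⟨R, L, fun p hp => h p ?_⟩
  have ho : IsOpen {p : ℝ⁴ | R + L * |p.1| < ‖p.2‖} := isOpen_lt (by fun_prop) (by fun_prop)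
  filter_upwards [ho.mem_nhds hp] with q hq using hR q hq

theorem SpaceCpt.dd {U : ℝ⁴ → ℝ} (hU : SpaceCpt U) (v : ℝ⁴) : SpaceCpt (dd v U) :=
  hU.of_local fun _ hp => (eventually_zero_dd hp v).self_of_nhds

theorem SpaceCpt.mul_left {U : ℝ⁴ → ℝ} (hU : SpaceCpt U) (V : ℝ⁴ → ℝ) :
    SpaceCpt (fun p => V p * U p) :=
  hU.of_local fun p hp => by simp [hp.self_of_nhds]

theorem SpaceCpt.slice {K : ℝ⁴ → ℝ} (hK : SpaceCpt K) (t : ℝ) :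
    HasCompactSupport fun x => K (t, x) := by
  obtain ⟨R, L, hR⟩ := hK
  refine HasCompactSupport.intro (isCompact_closedBall (0 : Space) (R + L * |t|)) fun x hx => ?_
  exact hR (t, x) (by simpa using hx)

theorem SpaceCpt.integrable {K : ℝ⁴ → ℝ} (hK : SpaceCpt K) (hc : Continuous K) (t : ℝ) :
    Integrable fun x => K (t, x) :=
  (hc.comp (by fun_prop : Continuous fun x : Space => (t, x))).integrable_of_hasCompactSupport
    (hK.slice t)

theorem SpaceCpt.hasDerivAt_integral {K : ℝ⁴ → ℝ} (hK : SpaceCpt K)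
    (hc : Smooth K) (t : ℝ) :
    HasDerivAt (fun t => ∫ x, K (t, x)) (∫ x, _root_.dd vt K (t, x)) t := by
  obtain ⟨R, L, hR⟩ := hK
  set B : Set Space := closedBall 0 (|R| + |L| * (|t| + 1))
  have hout : ∀ s, |s| < |t| + 1 → ∀ x ∉ B, K (s, x) = 0 := fun s hs x hx => hR (s, x) (by
    have hx' : |R| + |L| * (|t| + 1) < ‖x‖ := by simpa [B] using hx
    have : L * |s| ≤ |L| * (|t| + 1) :=
      (mul_le_mul_of_nonneg_right (le_abs_self L) (abs_nonneg s)).trans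
        (mul_le_mul_of_nonneg_left hs.le (abs_nonneg L))
    linarith [le_abs_self R])
  have hs : IsOpen {s : ℝ | |s| < |t| + 1} := isOpen_lt (by fun_prop) (by fun_prop)
  have hts : |t| < |t| + 1 := by linarith
  have hev : (fun t => ∫ x, K (t, x)) =ᶠ[nhds t] fun t => ∫ x in B, K (t, x) := by
    filter_upwards [hs.mem_nhds hts] with s hs
    exact (setIntegral_eq_integral_of_forall_compl_eq_zero fun x hx => hout s hs x hx).symm
  have hae : ∀ᵐ x ∂(volume.restrict B), x ∈ B := ae_restrict_mem measurableSet_closedBall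
  have : IsFiniteMeasure (volume.restrict B) :=
    ⟨by rw [Measure.restrict_apply_univ]; exact measure_closedBall_lt_top⟩
  have h1 := hasFDerivAt_integral_param (isCompact_closedBall _ _) hae hc t
  have h2 := dd_integral_param (isCompact_closedBall _ _) hae hc (1 : ℝ) t
  have h3 := h1.hasDerivAt
  rw [← h1.fderiv] at h3
  refine HasDerivAt.congr_of_eventuallyEq ?_ hev
  convert h3 using 1
  rw [← _root_.dd, h2, ← setIntegral_eq_integral_of_forall_compl_eq_zero (s := B)]
  · refine integral_congr_ae (of_forall fun x => ?_)
    simp only [dd_slice_left hc.dble]; rfl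
  · intro x hx
    have he : ∀ᶠ s in nhds t, K (s, x) = 0 := by
      filter_upwards [hs.mem_nhds hts] with s hs using hout s hs x hx
    have := dd_slice_left hc.dble (1 : ℝ) t x
    change _root_.dd ((1 : ℝ), (0 : Space)) K (t, x) = 0
    rw [← this, _root_.dd, Filter.EventuallyEq.fderiv_eq (f := fun _ => (0 : ℝ)) he]; simp

theorem integral_dd_eq_zero {k : Space → ℝ} (hk : HasCompactSupport k)
    (hc : Smooth k) (v : Space) : ∫ x, dd v k x = 0 := by
  have hi : Integrable (dd v k) := by
    refine (hc.dd_top v).continuous.integrable_of_hasCompactSupport ?_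
    exact (hk.fderiv (𝕜 := ℝ)).comp_left (g := fun A : Space →L[ℝ] ℝ => A v) (by simp)
  have := integral_mul_fderiv_eq_neg_fderiv_mul_of_integrable (μ := (volume : Measure Space))
    (f := fun _ : Space => (1 : ℝ)) (g := k) (v := v) (by simp) (by simp only [one_mul]; exact hi)
    (by simpa using hc.continuous.integrable_of_hasCompactSupport hk)
    (fun x _ => differentiableAt_const _) (fun x _ => hc.dble x)
  simpa [dd] using this

theorem SpaceCpt.integral_dd_vx {K : ℝ⁴ → ℝ} (hK : SpaceCpt K)
    (hc : Smooth K) (t : ℝ) (i : Fin 3) : ∫ x, _root_.dd (vx i) K (t, x) = 0 := by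
  have := integral_dd_eq_zero (hK.slice t) (contDiff_slice hc t) (ex i)
  simp only [dd_slice hc.dble] at this
  exact this

/-! ### The energy identity on space-like graphs -/

/-- Energy density, with potential `H`. -/
def edens (H : ℝ → ℝ) (U : ℝ⁴ → ℝ) (p : ℝ⁴) : ℝ :=
  1 / 2 * (dd vt U p ^ 2 + ∑ i, dd (vx i) U p ^ 2) + H (U p)

notation "edens₀" => edens fun _ => 0

/-- Energy flux. -/
def eflux (U : ℝ⁴ → ℝ) (i : Fin 3) (p : ℝ⁴) : ℝ := dd vt U p * dd (vx i) U p

theorem contDiff_edens {H : ℝ → ℝ} (hH : Smooth H) {U : ℝ⁴ → ℝ}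
    (hU : Smooth U) : Smooth (edens H U) := by
  have := hU.dd_top vt
  have := fun i => hU.dd_top (vx i)
  unfold edens
  exact (contDiff_const.mul (((hU.dd_top vt).pow 2).add
    (ContDiff.sum fun i _ => (hU.dd_top (vx i)).pow 2))).add (hH.comp hU)

theorem contDiff_eflux {U : ℝ⁴ → ℝ} (hU : Smooth U) (i : Fin 3) :
    Smooth (eflux U i) := (hU.dd_top vt).mul (hU.dd_top (vx i))

theorem dd_finset_sum {E ι : Type*} [NormedAddCommGroup E] [NormedSpace ℝ E] (s : Finset ι)
    {U : ι → E → ℝ} (hU : ∀ i, Differentiable ℝ (U i)) (v p : E) :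
    dd v (fun q => ∑ i ∈ s, U i q) p = ∑ i ∈ s, dd v (U i) p := by
  simp only [dd]
  rw [fderiv_fun_sum fun i _ => hU i p]
  simp

theorem dd_vt_edens {H h : ℝ → ℝ} (hH : Smooth H) (hHh : ∀ s, HasDerivAt H (h s) s)
    {U : ℝ⁴ → ℝ} (hU : Smooth U) (p : ℝ⁴) :
    dd vt (edens H U) p = ∑ i, dd (vx i) (eflux U i) p + dd vt U p * (box U p + h (U p)) := by
  have ht := hU.dd_top vt
  have hx := fun i => hU.dd_top (vx i)
  have hcomm : ∀ i, dd vt (dd (vx i) U) = dd (vx i) (dd vt U) := fun i => dd_comm hU _ _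
  have e1 : ∀ i, dd (vx i) (eflux U i) p =
      dd vt U p * dd (vx i) (dd (vx i) U) p + dd (vx i) U p * dd (vx i) (dd vt U) p := fun i =>
    dd_mul ht.dble (hx i).dble _ p
  have hHU : Smooth fun p => H (U p) := hH.comp hU
  have hs : Smooth fun p => ∑ i, dd (vx i) U p ^ 2 :=
    ContDiff.sum fun i _ => (hx i).pow 2
  have e2 : dd vt (edens H U) p = 1 / 2 * (2 * dd vt U p * dd vt (dd vt U) p +
      ∑ i, 2 * dd (vx i) U p * dd (vx i) (dd vt U) p) + h (U p) * dd vt U p := by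
    unfold edens
    rw [dd_add (contDiff_const.mul ((ht.pow 2).add hs)).dble hHU.dble,
      dd_comp_real hU.dble hHh, dd_const_mul ((ht.pow 2).add hs).dble,
      dd_add (ht.pow 2).dble hs.dble, dd_pow_two ht.dble, dd_finset_sum _ fun i => ((hx i).pow 2).dble]
    simp only [dd_pow_two (hx _).dble, hcomm]
  rw [e2]
  simp only [e1, box, Fin.sum_univ_three]
  ring

theorem dd_comp_snd {φ : Space → ℝ} (hφ : Differentiable ℝ φ) (v p : ℝ⁴) :
    dd v (fun p : ℝ⁴ => φ p.2) p = dd v.2 φ p.2 := by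
  have h2 : HasFDerivAt (fun p : ℝ⁴ => φ p.2)
      ((fderiv ℝ φ p.2).comp (ContinuousLinearMap.snd ℝ ℝ Space)) p :=
    HasFDerivAt.comp (f := fun p : ℝ⁴ => p.2) p (hφ p.2).hasFDerivAt hasFDerivAt_snd
  rw [dd, h2.fderiv]; rfl

theorem dd_comp_graph {φ : Space → ℝ} (hφ : Smooth φ) {K : ℝ⁴ → ℝ}
    (hK : Differentiable ℝ K) (v p : ℝ⁴) :
    dd v (fun p : ℝ⁴ => K (p.1 * φ p.2, p.2)) p =
      (v.1 * φ p.2 + p.1 * dd v.2 φ p.2) * dd vt K (p.1 * φ p.2, p.2) +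
        dd ((0 : ℝ), v.2) K (p.1 * φ p.2, p.2) := by
  have h2 : HasFDerivAt (fun p : ℝ⁴ => φ p.2)
      ((fderiv ℝ φ p.2).comp (ContinuousLinearMap.snd ℝ ℝ Space)) p :=
    HasFDerivAt.comp (f := fun p : ℝ⁴ => p.2) p (hφ.dble p.2).hasFDerivAt hasFDerivAt_snd
  have h1 := (((hasFDerivAt_fst (𝕜 := ℝ) (p := p)).mul h2).prodMk (hasFDerivAt_snd (𝕜 := ℝ) (p := p)))
  have h3 : HasFDerivAt (fun p : ℝ⁴ => K (p.1 * φ p.2, p.2)) _ p :=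
    HasFDerivAt.comp (f := fun p : ℝ⁴ => (p.1 * φ p.2, p.2)) p (hK _).hasFDerivAt h1
  have e : ((v.1 * φ p.2 + p.1 * dd v.2 φ p.2) • vt + ((0 : ℝ), v.2)) =
      ((v.1 * φ p.2 + p.1 * dd v.2 φ p.2), v.2) := by
    simp [vt]
  rw [← smul_eq_mul (_ + _), ← dd_smul_dir, ← dd_add_dir, e, dd, h3.fderiv]
  simp only [dd, ContinuousLinearMap.comp_apply, ContinuousLinearMap.prod_apply,
    add_apply, smul_apply, ContinuousLinearMap.coe_fst',
    ContinuousLinearMap.coe_snd', smul_eq_mul]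
  congr 2
  ring

theorem SpaceCpt.comp_graph {K : ℝ⁴ → ℝ} (hK : SpaceCpt K) {φ : Space → ℝ} {T : ℝ}
    (hφ : ∀ x, |φ x| ≤ T) : SpaceCpt fun p : ℝ⁴ => K (p.1 * φ p.2, p.2) := by
  obtain ⟨R, L, hR⟩ := hK
  refine ⟨R, |L| * T, fun p hp => hR _ (lt_of_le_of_lt ?_ hp)⟩
  have hT : 0 ≤ T := (abs_nonneg _).trans (hφ 0)
  simp only [abs_mul]
  have : L * (|p.1| * |φ p.2|) ≤ |L| * (|p.1| * T) := by
    gcongr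
    · exact le_abs_self L
    · exact hφ _
  nlinarith

/-- Conservation of energy on smooth graphs. -/
theorem integral_graph_energy {H h : ℝ → ℝ} (hH : Smooth H)
    (hHh : ∀ s, HasDerivAt H (h s) s) (hH0 : H 0 = 0) {U : ℝ⁴ → ℝ}
    (hU : Smooth U) (hUc : SpaceCpt U) {T : ℝ}
    (heq : ∀ p : ℝ⁴, 0 ≤ p.1 → p.1 ≤ T → box U p = -h (U p)) {φ : Space → ℝ}
    (hφ : Smooth φ) (hφ0 : ∀ x, 0 ≤ φ x) (hφT : ∀ x, φ x ≤ T) :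
    ∫ x, (edens H U (φ x, x) + ∑ i, eflux U i (φ x, x) * dd (ex i) φ x) =
      ∫ x, edens H U (0, x) := by
  have hφa : ∀ x, |φ x| ≤ T := fun x => by rw [abs_of_nonneg (hφ0 x)]; exact hφT x
  have he := contDiff_edens hH hU
  have hq := contDiff_eflux hU
  have hgr : Smooth fun p : ℝ⁴ => (p.1 * φ p.2, p.2) :=
    (contDiff_fst.mul (hφ.comp contDiff_snd)).prodMk contDiff_snd
  have hec : SpaceCpt (edens H U) := hUc.of_local fun p hp => by
    simp [edens, hp.self_of_nhds, (eventually_zero_dd hp _).self_of_nhds, hH0]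
  have hqc : ∀ i, SpaceCpt (eflux U i) := fun i => hUc.of_local fun p hp => by
    simp [eflux, (eventually_zero_dd hp _).self_of_nhds]
  let A : ℝ⁴ → ℝ := fun p => edens H U (p.1 * φ p.2, p.2)
  let Bq : Fin 3 → ℝ⁴ → ℝ := fun i p => eflux U i (p.1 * φ p.2, p.2)
  let D : Fin 3 → ℝ⁴ → ℝ := fun i p => p.1 * dd (ex i) φ p.2
  let K : ℝ⁴ → ℝ := fun p => A p + ∑ i, D i p * Bq i p
  have hA : Smooth A := he.comp hgr
  have hB : ∀ i, Smooth (Bq i) := fun i => (hq i).comp hgr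
  have hD : ∀ i, Smooth (D i) := fun i =>
    contDiff_fst.mul ((hφ.dd_top _).comp contDiff_snd)
  have hDB : ∀ i, Smooth fun p => D i p * Bq i p := fun i => (hD i).mul (hB i)
  have hK : Smooth K := hA.add (ContDiff.sum fun i _ => hDB i)
  have hKc : SpaceCpt K := by
    obtain ⟨R, L, hR⟩ := hUc
    refine ⟨|R| , |L| * T, fun p hp => ?_⟩
    have hmem : R + L * |p.1 * φ p.2| < ‖p.2‖ := by
      have hT : 0 ≤ T := (abs_nonneg _).trans (hφa 0)
      have : L * |p.1 * φ p.2| ≤ |L| * (|p.1| * T) := by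
        rw [abs_mul]
        gcongr
        · exact le_abs_self L
        · exact hφa _
      nlinarith [le_abs_self R]
    have ho : IsOpen {p : ℝ⁴ | R + L * |p.1| < ‖p.2‖} := isOpen_lt (by fun_prop) (by fun_prop)
    have hz : ∀ᶠ q in nhds (p.1 * φ p.2, p.2), U q = 0 := by
      filter_upwards [ho.mem_nhds hmem] with q hq using hR q hq
    simp [K, A, Bq, edens, eflux, hz.self_of_nhds, (eventually_zero_dd hz _).self_of_nhds, hH0]
  let P : Fin 3 → ℝ⁴ → ℝ := fun i p => φ p.2 * Bq i p
  have hP : ∀ i, Smooth (P i) := fun i => (hφ.comp contDiff_snd).mul (hB i)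
  have hPc : ∀ i, SpaceCpt (P i) := fun i => ((hqc i).comp_graph hφa).mul_left _
  have hkey : ∀ p : ℝ⁴, 0 ≤ p.1 → p.1 ≤ 1 → dd vt K p = ∑ i, dd (vx i) (P i) p := by
    intro p hp0 hp1
    have hb : box U (p.1 * φ p.2, p.2) + h (U (p.1 * φ p.2, p.2)) = 0 := by
      rw [heq _ (mul_nonneg hp0 (hφ0 _))
        ((mul_le_of_le_one_left (hφ0 _) hp1).trans (hφT _))]; ring
    have hDt : ∀ i, dd vt (D i) p = dd (ex i) φ p.2 := by
      intro i
      have := dd_mul (U := fun p : ℝ⁴ => p.1) (V := fun p : ℝ⁴ => dd (ex i) φ p.2)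
        differentiable_fst (((hφ.dd_top (ex i)).comp contDiff_snd).dble) vt p
      rw [this, dd_fst]
      rw [dd_comp_snd (hφ.dd_top (ex i)).dble]; simp [vt, dd]
    have e1 : dd vt K p = dd vt A p + ∑ i, (D i p * dd vt (Bq i) p + Bq i p * dd vt (D i) p) := by
      rw [dd_add hA.dble (ContDiff.sum fun i _ => hDB i).dble, dd_finset_sum _ fun i => (hDB i).dble]
      simp only [dd_mul (hD _).dble (hB _).dble]
    have e2 : ∀ i, dd (vx i) (P i) p = φ p.2 * dd (vx i) (Bq i) p + Bq i p * dd (ex i) φ p.2 := by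
      intro i
      have := dd_mul (U := fun p : ℝ⁴ => φ p.2) (hφ.comp contDiff_snd).dble (hB i).dble (vx i) p
      rw [dd_comp_snd hφ.dble] at this
      exact this
    have e3 : ∀ {K : ℝ⁴ → ℝ}, Differentiable ℝ K →
        dd vt (fun p : ℝ⁴ => K (p.1 * φ p.2, p.2)) p =
        φ p.2 * dd vt K (p.1 * φ p.2, p.2) := by
      intro K hK
      rw [dd_comp_graph hφ hK]
      have : dd ((0:ℝ), vt.2) K (p.1 * φ p.2, p.2) = 0 := by simp [dd, vt, ← Prod.zero_eq_mk]
      rw [this]; simp [vt, dd]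
    have e4 : ∀ i, dd (vx i) (Bq i) p = p.1 * dd (ex i) φ p.2 * dd vt (eflux U i) (p.1 * φ p.2, p.2) +
        dd (vx i) (eflux U i) (p.1 * φ p.2, p.2) := by
      intro i
      simp only [Bq]
      rw [dd_comp_graph hφ (hq i).dble]; simp [vx]
    rw [e1]
    simp only [e2, e4, hDt]
    have e5 : dd vt A p = φ p.2 * ∑ i, dd (vx i) (eflux U i) (p.1 * φ p.2, p.2) := by
      simp only [A]
      rw [e3 he.dble, dd_vt_edens hH hHh hU, hb]; ring
    have e6 : ∀ i, dd vt (Bq i) p = φ p.2 * dd vt (eflux U i) (p.1 * φ p.2, p.2) := fun i =>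
      e3 (hq i).dble
    rw [e5]
    simp only [e6, D, Fin.sum_univ_three]
    ring
  have hder : ∀ s ∈ Icc (0 : ℝ) 1, HasDerivAt (fun t => ∫ x, K (t, x)) 0 s := by
    intro s hs
    have := hKc.hasDerivAt_integral hK s
    convert this using 1
    have e : ∀ x, dd vt K (s, x) = ∑ i, dd (vx i) (P i) (s, x) := fun x => hkey (s, x) hs.1 hs.2
    simp only [e]
    rw [integral_finsetSum]
    · simp [(hPc _).integral_dd_vx (hP _)]
    · intro i _
      exact ((hPc i).dd _).integrable ((hP i).dd_top _).continuous s
  have hconst := constant_of_has_deriv_right_zero (a := (0:ℝ)) (b := 1)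
    (fun s hs => (hder s hs).continuousAt.continuousWithinAt)
    (fun s hs => (hder s ⟨hs.1, hs.2.le⟩).hasDerivWithinAt) 1 ⟨zero_le_one, le_rfl⟩
  simp only [K, A, Bq, D, one_mul, zero_mul, Finset.sum_const_zero, add_zero] at hconst
  rw [← hconst]
  refine integral_congr_ae (of_forall fun x => ?_)
  simp only [mul_comm]

theorem exists_smooth_lipschitz_approx {φ : Space → ℝ} (hφ : LipschitzWith 1 φ) {T : ℝ}
    (hφ0 : ∀ x, 0 ≤ φ x) (hφT : ∀ x, φ x ≤ T) {ε : ℝ} (hε : 0 < ε) :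
    ∃ ψ : Space → ℝ, Smooth ψ ∧ LipschitzWith 1 ψ ∧ (∀ x, 0 ≤ ψ x) ∧
      (∀ x, ψ x ≤ T) ∧ ∀ x, |ψ x - φ x| ≤ ε := by
  let ρ : ContDiffBump (0 : Space) := ⟨ε / 2, ε, by positivity, by linarith⟩
  let r : Space → ℝ := ρ.normed volume
  have hr0 : ∀ x, 0 ≤ r x := fun x => ρ.nonneg_normed x
  have hr1 : ∫ x, r x = 1 := ρ.integral_normed
  have hrc : HasCompactSupport r := ρ.hasCompactSupport_normed
  have hrs : Smooth r := ρ.contDiff_normed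
  have hri : Integrable r := hrs.continuous.integrable_of_hasCompactSupport hrc
  have hig : ∀ x, Integrable fun t => r t * φ (x - t) := fun x =>
    (hrs.continuous.mul (hφ.continuous.comp (by fun_prop))).integrable_of_hasCompactSupport
      hrc.mul_right
  let ψ : Space → ℝ := fun x => ∫ t, r t * φ (x - t)
  have hψ : ψ = MeasureTheory.convolution r φ (ContinuousLinearMap.lsmul ℝ ℝ) volume := by
    funext x; rfl
  refine ⟨ψ, ?_, ?_, fun x => ?_, fun x => ?_, fun x => ?_⟩
  · rw [hψ]
    exact hrc.contDiff_convolution_left _ hrs hφ.continuous.locallyIntegrable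
  · refine LipschitzWith.of_dist_le_mul fun x y => ?_
    rw [Real.dist_eq, NNReal.coe_one, one_mul]
    change |(∫ t, r t * φ (x - t)) - ∫ t, r t * φ (y - t)| ≤ _
    rw [← integral_sub (hig x) (hig y), ← norm_eq_abs]
    calc ‖∫ t, (r t * φ (x - t) - r t * φ (y - t))‖ ≤ ∫ t, r t * dist x y := by
          refine norm_integral_le_of_norm_le (hri.mul_const _)
            (of_forall fun t => ?_)
          rw [← mul_sub, norm_mul, norm_of_nonneg (hr0 t)]
          have := hφ.dist_le_mul (x - t) (y - t)
          rw [NNReal.coe_one, one_mul, dist_sub_right] at this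
          exact mul_le_mul_of_nonneg_left this (hr0 t)
      _ = dist x y := by rw [integral_mul_const, hr1, one_mul]
  · exact integral_nonneg fun t => mul_nonneg (hr0 t) (hφ0 _)
  · calc ψ x ≤ ∫ t, r t * T := integral_mono (hig x) (hri.mul_const _) fun t =>
          mul_le_mul_of_nonneg_left (hφT _) (hr0 t)
      _ = T := by rw [integral_mul_const, hr1, one_mul]
  · have e : ψ x - φ x = ∫ t, r t * (φ (x - t) - φ x) := by
      have : ∫ t, r t * φ x = φ x := by rw [integral_mul_const, hr1, one_mul]
      simp only [mul_sub]
      rw [integral_sub (hig x) (hri.mul_const _), this]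
    rw [e, ← norm_eq_abs]
    calc ‖∫ t, r t * (φ (x - t) - φ x)‖ ≤ ∫ t, r t * ε := by
          refine norm_integral_le_of_norm_le (hri.mul_const _)
            (of_forall fun t => ?_)
          rw [norm_mul, norm_of_nonneg (hr0 t)]
          by_cases ht : t ∈ ball (0 : Space) ε
          · refine mul_le_mul_of_nonneg_left ?_ (hr0 t)
            have := hφ.dist_le_mul (x - t) x
            rw [NNReal.coe_one, one_mul, dist_eq_norm, dist_eq_norm (x - t)] at this
            have ht' : ‖t‖ < ε := by simpa using ht
            have h2 : ‖x - t - x‖ = ‖t‖ := by rw [sub_sub_cancel_left, norm_neg]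
            rw [h2] at this
            exact this.trans ht'.le
          · have : r t = 0 := by
              have hs : Function.support r = ball 0 ε := ρ.support_normed_eq
              by_contra hne
              exact ht (hs ▸ hne)
            simp [this]
      _ = ε := by rw [integral_mul_const, hr1, one_mul]

theorem sum_dd_mul_le {φ : Space → ℝ} (hφ : LipschitzWith 1 φ) (x : Space) (a : Fin 3 → ℝ) :
    |∑ i, a i * dd (ex i) φ x| ≤ √(∑ i, a i ^ 2) := by
  have e : ∑ i, a i * dd (ex i) φ x = fderiv ℝ φ x (∑ i, a i • ex i) := by simp [dd]
  rw [e]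
  have h1 := (fderiv ℝ φ x).le_opNorm (∑ i, a i • ex i)
  have h2 := norm_fderiv_le_of_lipschitz ℝ hφ (x₀ := x)
  have h3 : ‖∑ i, a i • ex i‖ = √(∑ i, a i ^ 2) := by
    rw [EuclideanSpace.norm_eq]
    congr 1
    refine sum_congr rfl fun j _ => ?_
    simp [ex, norm_eq_abs, sq_abs, Finset.sum_apply, Pi.single_apply]
  rw [h3] at h1
  refine h1.trans ?_
  calc _ ≤ 1 * √(∑ i, a i ^ 2) := mul_le_mul_of_nonneg_right (by simpa using h2) (sqrt_nonneg _)
    _ = _ := one_mul _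

/-- The potential energy on a Lipschitz graph is bounded by the energy. -/
theorem integral_graph_potential_le {H h : ℝ → ℝ} (hH : Smooth H)
    (hHh : ∀ s, HasDerivAt H (h s) s) (hH0 : H 0 = 0) {U : ℝ⁴ → ℝ}
    (hU : Smooth U) (hUc : SpaceCpt U) {T : ℝ}
    (heq : ∀ p : ℝ⁴, 0 ≤ p.1 → p.1 ≤ T → box U p = -h (U p)) {φ : Space → ℝ}
    (hφ : LipschitzWith 1 φ) (hφ0 : ∀ x, 0 ≤ φ x) (hφT : ∀ x, φ x ≤ T) :
    ∫ x, H (U (φ x, x)) ≤ ∫ x, edens H U (0, x) := by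
  obtain ⟨R, L, hR⟩ := hUc
  have hUc : SpaceCpt U := ⟨R, L, hR⟩
  have hT : 0 ≤ T := (hφ0 0).trans (hφT 0)
  have ho : IsOpen {p : ℝ⁴ | R + L * |p.1| < ‖p.2‖} := isOpen_lt (by fun_prop) (by fun_prop)
  have hz : ∀ t : ℝ, 0 ≤ t → t ≤ T → ∀ x : Space, R + |L| * T < ‖x‖ →
      ∀ᶠ q in nhds (t, x), U q = 0 := fun t h0 h1 x hx => by
    have hm : (t, x) ∈ {p : ℝ⁴ | R + L * |p.1| < ‖p.2‖} := by
      have : L * |t| ≤ |L| * T := by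
        rw [abs_of_nonneg h0]; gcongr; exact le_abs_self L
      change R + L * |t| < ‖x‖
      linarith
    filter_upwards [ho.mem_nhds hm] with q hq using hR q hq
  have hcs : ∀ {k : Space → ℝ}, (∀ x, R + |L| * T < ‖x‖ → k x = 0) → HasCompactSupport k := by
    intro k hk
    refine HasCompactSupport.intro (isCompact_closedBall (0 : Space) (R + |L| * T)) fun x hx => ?_
    exact hk x (by simpa using hx)
  have hHU : Continuous fun p => H (U p) := hH.continuous.comp hU.continuous
  have smooth : ∀ ψ : Space → ℝ, Smooth ψ → LipschitzWith 1 ψ → (∀ x, 0 ≤ ψ x) →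
      (∀ x, ψ x ≤ T) → ∫ x, H (U (ψ x, x)) ≤ ∫ x, edens H U (0, x) := by
    intro ψ hψ hψl h0 h1
    rw [← integral_graph_energy hH hHh hH0 hU hUc heq hψ h0 h1]
    have hgr : Continuous fun x => (ψ x, x) := hψ.continuous.prodMk continuous_id
    refine integral_mono ?_ ?_ fun x => ?_
    · refine (hHU.comp hgr).integrable_of_hasCompactSupport (hcs fun x hx => ?_)
      simp [(hz _ (h0 x) (h1 x) x hx).self_of_nhds, hH0]
    · refine Continuous.integrable_of_hasCompactSupport ?_ (hcs fun x hx => ?_)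
      · exact ((contDiff_edens hH hU).continuous.comp hgr).add (continuous_finsetSum _ fun i _ =>
          ((contDiff_eflux hU i).continuous.comp hgr).mul (hψ.dd_top _).continuous)
      · have := hz _ (h0 x) (h1 x) x hx
        simp [edens, eflux, this.self_of_nhds, (eventually_zero_dd this _).self_of_nhds, hH0]
    · have h2 := sum_dd_mul_le hψl x fun i => dd (vx i) U (ψ x, x)
      simp only [edens, eflux]
      set S := ∑ i, dd (vx i) U (ψ x, x) ^ 2
      have hS : 0 ≤ S := sum_nonneg fun i _ => sq_nonneg _
      have e : ∑ i, dd vt U (ψ x, x) * dd (vx i) U (ψ x, x) * dd (ex i) ψ x =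
          dd vt U (ψ x, x) * ∑ i, dd (vx i) U (ψ x, x) * dd (ex i) ψ x := by
        rw [mul_sum]; exact sum_congr rfl fun i _ => by ring
      rw [e]
      set b := ∑ i, dd (vx i) U (ψ x, x) * dd (ex i) ψ x
      have hb : b ^ 2 ≤ S := by
        rw [← sq_abs, ← sq_sqrt hS]
        gcongr
      nlinarith [sq_nonneg (dd vt U (ψ x, x) + b)]
  choose ψ hψ hψl hψ0 hψT hψe using fun n : ℕ =>
    exists_smooth_lipschitz_approx hφ hφ0 hφT (ε := 1 / ((n : ℝ) + 1)) (by positivity)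
  set B := closedBall (0 : Space) (R + |L| * T)
  obtain ⟨C, hC⟩ := ((isCompact_Icc (a := (0:ℝ)) (b := T)).prod
    (isCompact_closedBall (0 : Space) (R + |L| * T))).exists_bound_of_continuousOn hHU.continuousOn
  have hlim : Filter.Tendsto (fun n => ∫ x, H (U (ψ n x, x))) Filter.atTop
      (nhds (∫ x, H (U (φ x, x)))) := by
    refine tendsto_integral_of_dominated_convergence (B.indicator fun _ => C) (fun n => ?_) ?_
      (fun n => ?_) (of_forall fun x => ?_)
    · exact (hHU.comp ((hψ n).continuous.prodMk continuous_id)).aestronglyMeasurable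
    · exact (integrableOn_const (by exact measure_closedBall_lt_top.ne)).integrable_indicator
        measurableSet_closedBall
    · refine of_forall fun x => ?_
      by_cases hx : x ∈ B
      · rw [indicator_of_mem hx]
        exact hC (ψ n x, x) ⟨⟨hψ0 n x, hψT n x⟩, hx⟩
      · have := (hz _ (hψ0 n x) (hψT n x) x (by simpa [B] using hx)).self_of_nhds
        simp [this, hH0, hx]
    · have h1 : Filter.Tendsto (fun n => ψ n x) Filter.atTop (nhds (φ x)) := by
        rw [tendsto_iff_dist_tendsto_zero]
        exact squeeze_zero (fun n => dist_nonneg) (fun n => hψe n x)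
          tendsto_one_div_add_atTop_nhds_zero_nat
      exact (hHU.tendsto _).comp (h1.prodMk_nhds tendsto_const_nhds)
  exact le_of_tendsto' hlim fun n => smooth _ (hψ n) (hψl n) (hψ0 n) (hψT n)

/-- Conservation of energy. -/
theorem integral_edens_eq {H h : ℝ → ℝ} (hH : Smooth H)
    (hHh : ∀ s, HasDerivAt H (h s) s) (hH0 : H 0 = 0) {U : ℝ⁴ → ℝ}
    (hU : Smooth U) (hUc : SpaceCpt U) {T : ℝ}
    (heq : ∀ p : ℝ⁴, 0 ≤ p.1 → p.1 ≤ T → box U p = -h (U p)) {t : ℝ} (h0 : 0 ≤ t)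
    (hT : t ≤ T) : ∫ x, edens H U (t, x) = ∫ x, edens H U (0, x) := by
  have := integral_graph_energy hH hHh hH0 hU hUc heq (φ := fun _ => t) contDiff_const
    (fun _ => h0) (fun _ => hT)
  simpa [dd] using this

/-! ### The Morawetz estimate -/

theorem dd_sub {E : Type*} [NormedAddCommGroup E] [NormedSpace ℝ E] {U V : E → ℝ}
    (hU : Differentiable ℝ U) (hV : Differentiable ℝ V) (v p : E) :
    dd v (fun q => U q - V q) p = dd v U p - dd v V p := by
  simp only [dd]
  rw [fderiv_fun_sub (hU p) (hV p)]
  simp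

theorem dd_pow {E : Type*} [NormedAddCommGroup E] [NormedSpace ℝ E] {U : E → ℝ}
    (hU : Differentiable ℝ U) (n : ℕ) (v p : E) :
    dd v (fun q => U q ^ n) p = n * U p ^ (n - 1) * dd v U p := by
  rw [dd_comp_real hU (φ := fun s => s ^ n) (φ' := fun s => n * s ^ (n - 1))]
  intro s; simpa using hasDerivAt_pow n s

/-- The regularised inverse distance to `X`. -/
def invDist (X : Space) (δ : ℝ) (x : Space) : ℝ := (√(‖x - X‖ ^ 2 + δ ^ 2))⁻¹

section invDist

variable (X : Space) {δ : ℝ}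

theorem invDist_pos (hδ : 0 < δ) (x : Space) : 0 < invDist X δ x := by
  unfold invDist; positivity

theorem invDist_sq (hδ : 0 < δ) (x : Space) :
    invDist X δ x ^ 2 * (‖x - X‖ ^ 2 + δ ^ 2) = 1 := by
  unfold invDist
  rw [inv_pow, sq_sqrt (by positivity), inv_mul_cancel₀ (by positivity)]

theorem contDiff_invDist (hδ : 0 < δ) : Smooth (invDist X δ) := by
  unfold invDist
  have h : Smooth fun x : Space => ‖x - X‖ ^ 2 + δ ^ 2 :=
    ((contDiff_id.sub contDiff_const).norm_sq ℝ).add contDiff_const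
  refine ContDiff.inv (h.sqrt fun x => ?_) fun x => ?_ <;> positivity

theorem dd_invDist (hδ : 0 < δ) (v x : Space) :
    dd v (invDist X δ) x = -⟪x - X, v⟫ * invDist X δ x ^ 3 := by
  have hd := (contDiff_invDist X hδ).dble
  have h1 := dd_mul (U := fun x => invDist X δ x ^ 2) (V := fun x => ‖x - X‖ ^ 2 + δ ^ 2)
    (hd.pow 2) (((contDiff_id.sub contDiff_const).norm_sq ℝ).add contDiff_const).dble v x
  rw [show (fun q => invDist X δ q ^ 2 * (‖q - X‖ ^ 2 + δ ^ 2)) = fun _ => (1 : ℝ) from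
    funext fun q => invDist_sq X hδ q, dd_pow_two hd] at h1
  have h2 : dd v (fun x : Space => ‖x - X‖ ^ 2 + δ ^ 2) x = 2 * ⟪x - X, v⟫ := by
    have : HasFDerivAt (fun x : Space => ‖x - X‖ ^ 2 + δ ^ 2) _ x :=
      (((hasFDerivAt_id x).sub_const X).norm_sq).add_const (δ ^ 2)
    rw [dd, this.fderiv]
    simp [inner_sub_left]
  rw [h2] at h1
  have h3 : dd v (fun _ : Space => (1 : ℝ)) x = 0 := by simp [dd]
  rw [h3] at h1
  have hp := invDist_pos X hδ x
  have hq := invDist_sq X hδ x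
  set w := invDist X δ x
  set z := dd v (invDist X δ) x
  have : w * (w * ⟪x - X, v⟫ + (‖x - X‖ ^ 2 + δ ^ 2) * z) = 0 := by linarith
  have h4 : w * ⟪x - X, v⟫ + (‖x - X‖ ^ 2 + δ ^ 2) * z = 0 :=
    (mul_eq_zero.1 this).resolve_left hp.ne'
  linear_combination w ^ 2 * h4 - z * hq

end invDist

theorem norm_sq_coord (y : Space) : ‖y‖ ^ 2 = y 0 ^ 2 + y 1 ^ 2 + y 2 ^ 2 := by
  rw [EuclideanSpace.norm_sq_eq, Fin.sum_univ_three]; simp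

theorem invDist_sq_mul_le (X : Space) {δ : ℝ} (hδ : 0 < δ) (x : Space) (a b c : ℝ) :
    invDist X δ x ^ 2 * ((x - X) 0 * a + (x - X) 1 * b + (x - X) 2 * c) ^ 2 ≤ a ^ 2 + b ^ 2 + c ^ 2 := by
  have hq := invDist_sq X hδ x
  rw [norm_sq_coord] at hq
  set w := invDist X δ x
  set y := (x - X) 0
  set z := (x - X) 1
  set t := (x - X) 2
  have h2 : w ^ 2 * (y ^ 2 + z ^ 2 + t ^ 2) ≤ 1 := by nlinarith [sq_nonneg (w * δ)]
  have hcs : (y * a + z * b + t * c) ^ 2 ≤ (y ^ 2 + z ^ 2 + t ^ 2) * (a ^ 2 + b ^ 2 + c ^ 2) := by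
    nlinarith [sq_nonneg (y * b - z * a), sq_nonneg (y * c - t * a), sq_nonneg (z * c - t * b)]
  have hS : 0 ≤ a ^ 2 + b ^ 2 + c ^ 2 := by positivity
  nlinarith [mul_le_mul_of_nonneg_left hcs (sq_nonneg w), mul_le_mul_of_nonneg_right h2 hS]

/-- The Morawetz multiplier. -/
def moraMult (X : Space) (δ : ℝ) (U : ℝ⁴ → ℝ) (p : ℝ⁴) : ℝ :=
  invDist X δ p.2 * ((p.2 - X) 0 * dd (vx 0) U p + (p.2 - X) 1 * dd (vx 1) U p +
    (p.2 - X) 2 * dd (vx 2) U p) + (invDist X δ p.2 + δ ^ 2 / 2 * invDist X δ p.2 ^ 3) * U p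

/-- Multiplier density in the Morawetz identity. -/
def moraDens (X : Space) (δ : ℝ) (U : ℝ⁴ → ℝ) (p : ℝ⁴) : ℝ :=
  dd vt U p * moraMult X δ U p

/-- Flux in the Morawetz identity. -/
def moraFlux (X : Space) (δ : ℝ) (H : ℝ → ℝ) (U : ℝ⁴ → ℝ) (i : Fin 3) (p : ℝ⁴) : ℝ :=
  dd (vx i) U p * moraMult X δ U p
  + (p.2 - X) i * invDist X δ p.2 * (1 / 2 * dd vt U p ^ 2 - 1 / 2 * (dd (vx 0) U p ^ 2 +
    dd (vx 1) U p ^ 2 + dd (vx 2) U p ^ 2) - H (U p))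
  + (p.2 - X) i * (1 / 2 * invDist X δ p.2 ^ 3 + 3 / 4 * δ ^ 2 * invDist X δ p.2 ^ 5) * U p ^ 2

theorem dd_const_fun {E : Type*} [NormedAddCommGroup E] [NormedSpace ℝ E] (v p : E) (a : ℝ) :
    dd v (fun _ => a) p = 0 := by simp [dd]

set_option maxHeartbeats 1000000 in
theorem morawetz_identity (X : Space) {δ : ℝ} (hδ : 0 < δ) {H h : ℝ → ℝ}
    (hH : Smooth H) (hHh : ∀ s, HasDerivAt H (h s) s) {U : ℝ⁴ → ℝ}
    (hU : Smooth U) {p : ℝ⁴} (hp : box U p = -h (U p)) :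
    dd vt (moraDens X δ U) p = ∑ i, dd (vx i) (moraFlux X δ H U i) p
      - (invDist X δ p.2 * (dd (vx 0) U p ^ 2 + dd (vx 1) U p ^ 2 + dd (vx 2) U p ^ 2)
        - invDist X δ p.2 ^ 3 * ((p.2 - X) 0 * dd (vx 0) U p + (p.2 - X) 1 * dd (vx 1) U p +
          (p.2 - X) 2 * dd (vx 2) U p) ^ 2)
      - 15 / 4 * δ ^ 4 * invDist X δ p.2 ^ 7 * U p ^ 2
      - (2 * invDist X δ p.2 + δ ^ 2 * invDist X δ p.2 ^ 3) * (1 / 2 * (U p * h (U p)) - H (U p)) := by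
  set W : ℝ⁴ → ℝ := fun p => invDist X δ p.2 with hWdef
  set Y : Fin 3 → ℝ⁴ → ℝ := fun i p => (p.2 - X) i with hYdef
  set T : ℝ⁴ → ℝ := dd vt U with hTdef
  set V : Fin 3 → ℝ⁴ → ℝ := fun i => dd (vx i) U with hVdef
  have hUd : Differentiable ℝ U := hU.dble
  have hWc : Smooth W := (contDiff_invDist X hδ).comp contDiff_snd
  have hWd : Differentiable ℝ W := hWc.dble
  have hYc : ∀ i, Smooth (Y i) := fun i =>
    (contDiff_coord i).comp (contDiff_snd.sub contDiff_const)
  have hYd : ∀ i, Differentiable ℝ (Y i) := fun i => (hYc i).dble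
  have hTd : Differentiable ℝ T := (hU.dd_top vt).dble
  have hVd : ∀ i, Differentiable ℝ (V i) := fun i => (hU.dd_top (vx i)).dble
  obtain ⟨Z, hZ⟩ : ∃ Z : ℝ⁴ → ℝ, Z = fun p => H (U p) := ⟨_, rfl⟩
  have hZd : Differentiable ℝ Z := by rw [hZ]; exact (hH.comp hU).dble
  have hdW : ∀ v, dd v W p = -⟪p.2 - X, v.2⟫ * W p ^ 3 := fun v => by
    rw [hWdef, dd_comp_snd (contDiff_invDist X hδ).dble, dd_invDist X hδ]
  have hdWt : dd vt W p = 0 := by rw [hdW]; simp [vt]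
  have hdWx : ∀ i, dd (vx i) W p = -Y i p * W p ^ 3 := fun i => by
    rw [hdW]
    simp only [vx, Y]
    rw [real_inner_comm, inner_ex]
  have hdY : ∀ i v, dd v (Y i) p = v.2 i := fun i v => by
    have e : Y i = fun p => (fun x : Space => x i - X i) p.2 := by funext q; simp [Y]
    rw [e, dd_comp_snd ((contDiff_coord i).sub contDiff_const).dble,
      dd_sub (contDiff_coord i).dble (differentiable_const _), dd_coord, dd_const_fun, sub_zero]
  have hdYt : ∀ i, dd vt (Y i) p = 0 := fun i => by rw [hdY]; simp [vt]
  have hdYx : ∀ i j, dd (vx j) (Y i) p = if i = j then 1 else 0 := fun i j => by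
    rw [hdY]; exact ex_apply j i
  have hcm : ∀ i, dd vt (V i) p = dd (vx i) T p := fun i => congrFun (dd_comm hU _ _) p
  have hcx : ∀ i j, dd (vx i) (V j) p = dd (vx j) (V i) p := fun i j => congrFun (dd_comm hU _ _) p
  have hHx : ∀ v, dd v Z p = h (U p) * dd v U p := fun v => by
    rw [hZ]; exact dd_comp_real hUd hHh v p
  have hW1 : W p ^ 2 * (Y 0 p ^ 2 + Y 1 p ^ 2 + Y 2 p ^ 2 + δ ^ 2) = 1 := by
    have := invDist_sq X hδ p.2
    rw [norm_sq_coord] at this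
    exact this
  have hb : dd vt T p = dd (vx 0) (V 0) p + dd (vx 1) (V 1) p + dd (vx 2) (V 2) p - h (U p) := by
    have : dd vt T p - ∑ i, dd (vx i) (V i) p = -h (U p) := hp
    rw [Fin.sum_univ_three] at this
    linarith
  have e1 : moraDens X δ U = fun p => T p * (W p * (Y 0 p * V 0 p + Y 1 p * V 1 p + Y 2 p * V 2 p)
      + (W p + δ ^ 2 / 2 * W p ^ 3) * U p) := rfl
  have e2 : ∀ i, moraFlux X δ H U i = fun p =>
      V i p * (W p * (Y 0 p * V 0 p + Y 1 p * V 1 p + Y 2 p * V 2 p)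
      + (W p + δ ^ 2 / 2 * W p ^ 3) * U p) + Y i p * W p * (1 / 2 * T p ^ 2 - 1 / 2 *
      (V 0 p ^ 2 + V 1 p ^ 2 + V 2 p ^ 2) - Z p) +
      Y i p * (1 / 2 * W p ^ 3 + 3 / 4 * δ ^ 2 * W p ^ 5) * U p ^ 2 := fun i => by rw [hZ]; rfl
  have hUx : ∀ i, dd (vx i) U p = V i p := fun i => rfl
  have hUt : dd vt U p = T p := rfl
  have hWp : invDist X δ p.2 = W p := rfl
  have hYp : ∀ i, (p.2 - X) i = Y i p := fun i => rfl
  have hZp : H (U p) = Z p := by rw [hZ]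
  rw [e1, Fin.sum_univ_three, hWp, hZp]
  simp only [e2]
  simp (disch := fun_prop) only [dd_add, dd_sub, dd_mul, dd_pow, dd_const_fun, hHx]
  simp only [hYp, hdWt, hdWx, hdYt, hdYx, hcm, hUx, hUt, hb]
  rw [hcx 1 0, hcx 2 0, hcx 2 1]
  simp only [Fin.isValue, one_ne_zero, zero_ne_one, if_true, if_false, Fin.reduceEq]
  push_cast
  linear_combination (W p * (1 / 2 * T p ^ 2 - 1 / 2 * (V 0 p ^ 2 + V 1 p ^ 2 + V 2 p ^ 2) - Z p)
    + (3 / 2 * W p ^ 3 + 15 / 4 * δ ^ 2 * W p ^ 5) * U p ^ 2) * hW1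

theorem hardy (X : Space) {δ : ℝ} (hδ : 0 < δ) {u : Space → ℝ} (hu : Smooth u)
    (hc : HasCompactSupport u) :
    ∫ x, (invDist X δ x * u x) ^ 2 ≤ 4 * ∫ x, ∑ i, dd (ex i) u x ^ 2 := by
  let W : Space → ℝ := invDist X δ
  let Y : Fin 3 → Space → ℝ := fun i x => (x - X) i
  let V : Fin 3 → Space → ℝ := fun i => dd (ex i) u
  have hW : Smooth W := contDiff_invDist X hδ
  have hY : ∀ i, Smooth (Y i) := fun i =>
    (contDiff_coord i).comp (contDiff_id.sub contDiff_const)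
  have hV : ∀ i, Smooth (V i) := fun i => hu.dd_top _
  have hVc : ∀ i, HasCompactSupport (V i) := fun i =>
    (hc.fderiv (𝕜 := ℝ)).comp_left (g := fun A : Space →L[ℝ] ℝ => A (ex i)) (by simp)
  let P : Fin 3 → Space → ℝ := fun i x => Y i x * W x ^ 2 * u x ^ 2
  have hP : ∀ i, Smooth (P i) := fun i => ((hY i).mul (hW.pow 2)).mul (hu.pow 2)
  have hu2 : HasCompactSupport fun x => u x ^ 2 := hc.comp_left (g := fun s : ℝ => s ^ 2) (by simp)
  have hPc : ∀ i, HasCompactSupport (P i) := fun i => hu2.mul_left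
  have hz : ∫ x, ∑ i, dd (ex i) (P i) x = 0 := by
    rw [integral_finsetSum]
    · simp [integral_dd_eq_zero (hPc _) (hP _)]
    · intro i _
      exact ((hP i).dd_top _).continuous.integrable_of_hasCompactSupport
        (((hPc i).fderiv (𝕜 := ℝ)).comp_left (g := fun A : Space →L[ℝ] ℝ => A (ex i)) (by simp))
  have hi1 : Integrable fun x => (W x * u x) ^ 2 := by
    refine ((hW.mul hu).pow 2).continuous.integrable_of_hasCompactSupport ?_
    exact (hc.mul_left (f := W)).comp_left (g := fun s : ℝ => s ^ 2) (by simp)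
  have hi2 : Integrable fun x => ∑ i, V i x ^ 2 := integrable_finsetSum _ fun i _ =>
    ((hV i).pow 2).continuous.integrable_of_hasCompactSupport
      ((hVc i).comp_left (g := fun s : ℝ => s ^ 2) (by simp))
  have hpt : ∀ x, 1 / 2 * (W x * u x) ^ 2 - 2 * ∑ i, V i x ^ 2 ≤ ∑ i, dd (ex i) (P i) x := by
    intro x
    have hYd := fun i => (hY i).dble
    have hWd := hW.dble
    have hud := hu.dble
    have hdW : ∀ i, dd (ex i) W x = -Y i x * W x ^ 3 := fun i => by
      simp only [W, Y]
      rw [dd_invDist X hδ, real_inner_comm, inner_ex]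
    have hdY : ∀ i, dd (ex i) (Y i) x = 1 := fun i => by
      have e : Y i = fun x => x i - X i := by funext q; simp [Y]
      rw [e, dd_sub (contDiff_coord i).dble (differentiable_const _), dd_coord, dd_const_fun,
        sub_zero, ex_apply]; simp
    have hdu : ∀ i, dd (ex i) u x = V i x := fun i => rfl
    have hW1 : W x ^ 2 * (Y 0 x ^ 2 + Y 1 x ^ 2 + Y 2 x ^ 2 + δ ^ 2) = 1 := by
      have := invDist_sq X hδ x
      rw [norm_sq_coord] at this
      exact this
    have hP' : ∀ i, dd (ex i) (P i) x = W x ^ 2 * u x ^ 2 - 2 * Y i x ^ 2 * W x ^ 4 * u x ^ 2 +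
        2 * W x ^ 2 * u x * (Y i x * V i x) := by
      intro i
      simp (disch := fun_prop) only [P, dd_mul, dd_pow]
      simp only [hdW, hdY, hdu]
      push_cast
      ring
    simp only [hP', Fin.sum_univ_three]
    have h1 := invDist_sq_mul_le X hδ x (V 0 x) (V 1 x) (V 2 x)
    change W x ^ 2 * (Y 0 x * V 0 x + Y 1 x * V 1 x + Y 2 x * V 2 x) ^ 2 ≤ _ at h1
    set a := Y 0 x * V 0 x + Y 1 x * V 1 x + Y 2 x * V 2 x with ha
    set ρ := Y 0 x ^ 2 + Y 1 x ^ 2 + Y 2 x ^ 2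
    have h3 : W x ^ 4 * ρ * u x ^ 2 = W x ^ 2 * u x ^ 2 - δ ^ 2 * W x ^ 4 * u x ^ 2 := by
      linear_combination W x ^ 2 * u x ^ 2 * hW1
    have h4 : 0 ≤ δ ^ 2 * W x ^ 4 * u x ^ 2 := by positivity
    have h5 : W x ^ 2 * u x ^ 2 - 2 * Y 0 x ^ 2 * W x ^ 4 * u x ^ 2 + 2 * W x ^ 2 * u x * (Y 0 x * V 0 x)
      + (W x ^ 2 * u x ^ 2 - 2 * Y 1 x ^ 2 * W x ^ 4 * u x ^ 2 + 2 * W x ^ 2 * u x * (Y 1 x * V 1 x))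
      + (W x ^ 2 * u x ^ 2 - 2 * Y 2 x ^ 2 * W x ^ 4 * u x ^ 2 + 2 * W x ^ 2 * u x * (Y 2 x * V 2 x))
      = 3 * (W x ^ 2 * u x ^ 2) - 2 * (W x ^ 4 * ρ * u x ^ 2) + 2 * W x ^ 2 * u x * a := by
      simp only [ρ, ha]; ring
    rw [h5]
    nlinarith [sq_nonneg (W x * u x + 2 * (W x * a))]
  have hm := integral_mono (((hi1.const_mul (1 / 2)).sub (hi2.const_mul 2))) (g := fun x =>
      ∑ i, dd (ex i) (P i) x) ?_ hpt
  · simp only [Pi.sub_apply] at hm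
    rw [hz, integral_sub (hi1.const_mul _) (hi2.const_mul _), integral_const_mul,
      integral_const_mul] at hm
    change ∫ x, (W x * u x) ^ 2 ≤ 4 * ∫ x, ∑ i, V i x ^ 2
    linarith
  · exact integrable_finsetSum _ fun i _ =>
      ((hP i).dd_top _).continuous.integrable_of_hasCompactSupport
        (((hPc i).fderiv (𝕜 := ℝ)).comp_left (g := fun A : Space →L[ℝ] ℝ => A (ex i)) (by simp))

theorem SpaceCpt.continuous_integral {K : ℝ⁴ → ℝ} (hK : SpaceCpt K)
    (hc : Smooth K) : Continuous fun t => ∫ x, K (t, x) :=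
  continuous_iff_continuousAt.2 fun t => (hK.hasDerivAt_integral hc t).continuousAt

theorem abs_mul_le_half (a b : ℝ) : |a * b| ≤ 1 / 2 * a ^ 2 + 1 / 2 * b ^ 2 := by
  rw [abs_le]
  constructor <;> nlinarith [sq_nonneg (a + b), sq_nonneg (a - b)]

set_option maxHeartbeats 800000 in
theorem morawetz {H h : ℝ → ℝ}
    (hH : Smooth H) (hHh : ∀ s, HasDerivAt H (h s) s) (hH0 : H 0 = 0)
    (hHp : ∀ s, 0 ≤ H s) {κ : ℝ} (hκ0 : 0 ≤ κ) (hκ : ∀ s, κ * s ^ 6 ≤ 1 / 2 * (s * h s) - H s)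
    {U : ℝ⁴ → ℝ} (hU : Smooth U) (hUc : SpaceCpt U) {T : ℝ} (hT : 0 ≤ T)
    (heq : ∀ p : ℝ⁴, 0 ≤ p.1 → p.1 ≤ T → box U p = -h (U p)) (X : Space) {δ : ℝ}
    (hδ : 0 < δ) :
    κ * ∫ t in (0 : ℝ)..T, ∫ x, invDist X δ x * U (t, x) ^ 6 ≤ 12 * ∫ x, edens H U (0, x) := by
  have hW : Smooth fun p : ℝ⁴ => invDist X δ p.2 :=
    (contDiff_invDist X hδ).comp contDiff_snd
  have hY : ∀ i : Fin 3, Smooth fun p : ℝ⁴ => (p.2 - X) i := fun i =>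
    (contDiff_coord i).comp (contDiff_snd.sub contDiff_const)
  have hUt := hU.dd_top vt
  have hUx := fun i => hU.dd_top (vx i)
  have hmm : Smooth (moraMult X δ U) := (hW.mul ((((hY 0).mul (hUx 0)).add ((hY 1).mul (hUx 1))).add
    ((hY 2).mul (hUx 2)))).add ((hW.add (contDiff_const.mul (hW.pow 3))).mul hU)
  have hM : Smooth (moraDens X δ U) := hUt.mul hmm
  have hF : ∀ i, Smooth (moraFlux X δ H U i) := fun i => (((hUx i).mul hmm).add
    (((hY i).mul hW).mul (((contDiff_const.mul (hUt.pow 2)).sub (contDiff_const.mul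
      ((((hUx 0).pow 2).add ((hUx 1).pow 2)).add ((hUx 2).pow 2)))).sub (hH.comp hU)))).add
    (((hY i).mul ((contDiff_const.mul (hW.pow 3)).add (contDiff_const.mul (hW.pow 5)))).mul (hU.pow 2))
  have hMc : SpaceCpt (moraDens X δ U) := hUc.of_local fun p hp => by
    simp [moraDens, moraMult, hp.self_of_nhds, (eventually_zero_dd hp _).self_of_nhds]
  have hFc : ∀ i, SpaceCpt (moraFlux X δ H U i) := fun i => hUc.of_local fun p hp => by
    simp [moraFlux, moraMult, hp.self_of_nhds, (eventually_zero_dd hp _).self_of_nhds, hH0]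
  let K : ℝ⁴ → ℝ := fun p => invDist X δ p.2 * U p ^ 6
  have hK : Smooth K := hW.mul (hU.pow 6)
  have hKc : SpaceCpt K := hUc.of_local fun p hp => by simp [K, hp.self_of_nhds]
  have hec : SpaceCpt (edens H U) := hUc.of_local fun p hp => by
    simp [edens, hp.self_of_nhds, (eventually_zero_dd hp _).self_of_nhds, hH0]
  set E := ∫ x, edens H U (0, x)
  have hder := fun t => hMc.hasDerivAt_integral hM t
  have hdc : Continuous fun t => ∫ x, dd vt (moraDens X δ U) (t, x) :=
    (hMc.dd vt).continuous_integral (hM.dd_top vt)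
  have hftc := integral_eq_sub_of_hasDerivAt (a := 0) (b := T)
    (fun t _ => hder t) (hdc.intervalIntegrable _ _)
  have hle : ∀ t ∈ Icc (0:ℝ) T, ∫ x, dd vt (moraDens X δ U) (t, x) ≤ -(2 * κ) * ∫ x, K (t, x) := by
    intro t ht
    have h1 : ∫ x, ∑ i, dd (vx i) (moraFlux X δ H U i) (t, x) = 0 := by
      rw [integral_finsetSum]
      · simp [(hFc _).integral_dd_vx (hF _)]
      · intro i _
        exact ((hFc i).dd _).integrable ((hF i).dd_top _).continuous t
    have hi1 : Integrable fun x => ∑ i, dd (vx i) (moraFlux X δ H U i) (t, x) :=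
      integrable_finsetSum _ fun i _ => ((hFc i).dd _).integrable ((hF i).dd_top _).continuous t
    have hi2 := (hKc.integrable hK.continuous t).const_mul (-(2 * κ))
    rw [← integral_const_mul]
    calc ∫ x, dd vt (moraDens X δ U) (t, x)
        ≤ ∫ x, (∑ i, dd (vx i) (moraFlux X δ H U i) (t, x) + -(2 * κ) * K (t, x)) := by
          refine integral_mono ((hMc.dd vt).integrable (hM.dd_top vt).continuous t) (hi1.add hi2)
            fun x => ?_
          have hb := heq (t, x) ht.1 ht.2
          have hid := morawetz_identity X hδ hH hHh hU hb
          simp only at hid ⊢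
          rw [hid]
          have hw := invDist_pos X hδ x
          have hκx := hκ (U (t, x))
          have h3 := mul_le_mul_of_nonneg_left (invDist_sq_mul_le X hδ x (dd (vx 0) U (t, x))
            (dd (vx 1) U (t, x)) (dd (vx 2) U (t, x))) hw.le
          simp only [K]
          set w := invDist X δ x
          have h4 : 0 ≤ 15 / 4 * δ ^ 4 * w ^ 7 * U (t, x) ^ 2 := by positivity
          have h5 : 0 ≤ 1 / 2 * (U (t, x) * h (U (t, x))) - H (U (t, x)) :=
            le_trans (by positivity) hκx
          have h6 : 2 * w * (κ * U (t, x) ^ 6) ≤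
              (2 * w + δ ^ 2 * w ^ 3) * (1 / 2 * (U (t, x) * h (U (t, x))) - H (U (t, x))) := by
            have : 0 ≤ δ ^ 2 * w ^ 3 := by positivity
            calc _ ≤ 2 * w * (1 / 2 * (U (t, x) * h (U (t, x))) - H (U (t, x))) := by gcongr
              _ ≤ _ := by gcongr; linarith
          linarith
      _ = ∫ x, -(2 * κ) * K (t, x) := by rw [integral_add hi1 hi2, h1, zero_add]
  have hbd : ∀ t ∈ Icc (0:ℝ) T, |∫ x, moraDens X δ U (t, x)| ≤ 12 * E := by
    intro t ht
    have hE := integral_edens_eq hH hHh hH0 hU hUc heq ht.1 ht.2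
    have hut := contDiff_slice hU t
    have hhar := hardy X hδ hut (hUc.slice t)
    have hgr : ∀ x i, dd (ex i) (fun y => U (t, y)) x = dd (vx i) U (t, x) := fun x i =>
      dd_slice hU.dble (ex i) t x
    simp only [hgr] at hhar
    have hiW : Integrable fun x => (invDist X δ x * U (t, x)) ^ 2 :=
      SpaceCpt.integrable (K := fun p => (invDist X δ p.2 * U p) ^ 2)
        (hUc.of_local fun p hp => by simp [hp.self_of_nhds]) ((hW.mul hU).pow 2).continuous t
    have hiE : Integrable fun x => edens H U (t, x) := hec.integrable (contDiff_edens hH hU).continuous t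
    have hiG : Integrable fun x => ∑ i, dd (vx i) U (t, x) ^ 2 :=
      SpaceCpt.integrable (K := fun p => ∑ i, dd (vx i) U p ^ 2)
        (hUc.of_local fun p hp => by simp [(eventually_zero_dd hp _).self_of_nhds])
        (ContDiff.sum fun i _ => (hUx i).pow 2).continuous t
    have hG : ∫ x, ∑ i, dd (vx i) U (t, x) ^ 2 ≤ 2 * ∫ x, edens H U (t, x) := by
      rw [← integral_const_mul]
      refine integral_mono hiG (hiE.const_mul 2) fun x => ?_
      simp only [edens]
      nlinarith [hHp (U (t, x)), sq_nonneg (dd vt U (t, x))]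
    calc |∫ x, moraDens X δ U (t, x)|
        ≤ ∫ x, (3 * edens H U (t, x) + 9 / 8 * (invDist X δ x * U (t, x)) ^ 2) := by
          rw [← norm_eq_abs]
          refine norm_integral_le_of_norm_le ((hiE.const_mul 3).add (hiW.const_mul (9 / 8)))
            (of_forall fun x => ?_)
          rw [norm_eq_abs]
          have hw := invDist_pos X hδ x
          have hq := invDist_sq X hδ x
          have hHx := hHp (U (t, x))
          simp only [edens, moraDens, moraMult, Fin.sum_univ_three]
          have h3 := invDist_sq_mul_le X hδ x (dd (vx 0) U (t, x)) (dd (vx 1) U (t, x)) (dd (vx 2) U (t, x))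
          rw [← mul_pow] at h3
          set w := invDist X δ x
          set b := dd vt U (t, x)
          set u := U (t, x)
          set m := (w + δ ^ 2 / 2 * w ^ 3) * u
          have h4 : m ^ 2 ≤ 9 / 4 * (w * u) ^ 2 := by
            have h5 : δ ^ 2 * w ^ 2 ≤ 1 := by
              nlinarith [mul_nonneg (sq_nonneg w) (sq_nonneg ‖x - X‖)]
            have h6 : 0 ≤ δ ^ 2 * w ^ 2 := by positivity
            have : m ^ 2 = (1 + δ ^ 2 * w ^ 2 / 2) ^ 2 * (w * u) ^ 2 := by simp only [m]; ring
            rw [this]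
            gcongr
            nlinarith
          have k1 := abs_mul_le_half b (w * ((x - X) 0 * dd (vx 0) U (t, x) + (x - X) 1 * dd (vx 1) U (t, x) +
            (x - X) 2 * dd (vx 2) U (t, x)))
          have hS : 0 ≤ dd (vx 0) U (t, x) ^ 2 + dd (vx 1) U (t, x) ^ 2 + dd (vx 2) U (t, x) ^ 2 := by positivity
          have k2 := abs_mul_le_half b m
          rw [mul_add]
          refine (abs_add_le _ _).trans ?_
          have hb := sq_nonneg b
          linarith
      _ = (3 * ∫ x, edens H U (t, x)) + 9 / 8 * ∫ x, (invDist X δ x * U (t, x)) ^ 2 := by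
          rw [integral_add (hiE.const_mul 3) (hiW.const_mul _), integral_const_mul, integral_const_mul]
      _ ≤ 12 * E := by rw [hE] at *; linarith
  have hig : ∫ t in (0:ℝ)..T, ∫ x, dd vt (moraDens X δ U) (t, x) ≤
      ∫ t in (0:ℝ)..T, -(2 * κ) * ∫ x, K (t, x) :=
    integral_mono_on hT (hdc.intervalIntegrable _ _)
      ((continuous_const.mul (hKc.continuous_integral hK)).intervalIntegrable _ _) hle
  rw [intervalIntegral.integral_const_mul, hftc] at hig
  have b0 := abs_le.1 (hbd 0 ⟨le_rfl, hT⟩)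
  have bT := abs_le.1 (hbd T ⟨hT, le_rfl⟩)
  change κ * ∫ t in (0 : ℝ)..T, ∫ x, K (t, x) ≤ 12 * E
  nlinarith

/-! ### Sobolev inequalities -/

theorem gradient_coord (v : Space → ℝ) (x : Space) (i : Fin 3) : gradient v x i = dd (ex i) v x := by
  rw [← inner_ex, real_inner_comm, gradient, InnerProductSpace.toDual_symm_apply]; rfl

theorem norm_gradient_eq (v : Space → ℝ) (x : Space) : ‖gradient v x‖ = ‖fderiv ℝ v x‖ := by
  rw [gradient, LinearIsometryEquiv.norm_map]

theorem norm_fderiv_sq (v : Space → ℝ) (x : Space) :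
    ‖fderiv ℝ v x‖ ^ 2 = ∑ i, dd (ex i) v x ^ 2 := by
  rw [← norm_gradient_eq, EuclideanSpace.norm_sq_eq]
  simp [gradient_coord]

theorem hasCompactSupport_dd {v : Space → ℝ} (hc : HasCompactSupport v) (y : Space) :
    HasCompactSupport (dd y v) :=
  (hc.fderiv (𝕜 := ℝ)).comp_left (g := fun A : Space →L[ℝ] ℝ => A y) (by simp)

theorem exists_gagliardo_six : ∃ K : NNReal, ∀ v : Space → ℝ, Smooth v →
    HasCompactSupport v → eLpNorm v ((6 : NNReal) : ℝ≥0∞) ≤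
      K * eLpNorm (fderiv ℝ v) ((2 : NNReal) : ℝ≥0∞) := by
  have hfr : Module.finrank ℝ Space = 3 := by simp [Space]
  exact ⟨SNormLESNormFDerivOfEqConst ℝ (volume : Measure Space) 2, fun v hv hc =>
    eLpNorm_le_eLpNorm_fderiv_of_eq (volume : Measure Space) (p := 2) (p' := 6)
    (hv.of_le (by norm_cast)) hc (by norm_num) (by rw [hfr]; norm_num)
    (by rw [hfr]; norm_num)⟩

theorem le_of_ofReal_rpow_le {A B : ℝ} {K : NNReal} (hA : 0 ≤ A) (hB : 0 ≤ B)
    (h : ofReal A ^ (1 / 6 : ℝ) ≤ K * ofReal B ^ (1 / 2 : ℝ)) :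
    A ≤ ((K : ℝ) ^ 6 + 1) * B ^ 3 := by
  rw [ofReal_rpow_of_nonneg hA (by norm_num), ofReal_rpow_of_nonneg hB (by norm_num),
    ← ENNReal.ofReal_coe_nnreal, ← ofReal_mul (by positivity),
    ofReal_le_ofReal_iff (by positivity)] at h
  have h6 := pow_le_pow_left₀ (by positivity) h 6
  rw [mul_pow, ← Real.rpow_natCast (A ^ _), ← Real.rpow_mul hA, ← Real.rpow_natCast (B ^ _),
    ← Real.rpow_mul hB] at h6
  norm_num at h6
  refine h6.trans ?_
  have : 0 ≤ B ^ 3 := by positivity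
  linarith [add_mul ((K : ℝ) ^ 6) 1 (B ^ 3)]

theorem HasCompactSupport.integrable_pow {k : Space → ℝ} (hc : HasCompactSupport k) (hk : Continuous k) {n : ℕ}
    (hn : n ≠ 0) : Integrable fun x => k x ^ n :=
  (hk.pow n).integrable_of_hasCompactSupport (hc.comp_left (g := fun s : ℝ => s ^ n) (by simp [hn]))

theorem lintegral_enorm_pow {E : Type*} [NormedAddCommGroup E] {k : Space → E} {n : ℕ}
    (hi : Integrable fun x => ‖k x‖ ^ n) : ∫⁻ x, ‖k x‖ₑ ^ n = ofReal (∫ x, ‖k x‖ ^ n) := by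
  rw [ofReal_integral_eq_lintegral_ofReal hi (of_forall fun x => by positivity)]
  simp only [← ofReal_norm, ofReal_pow (norm_nonneg _)]

theorem lintegral_enorm_even_pow {k : Space → ℝ} {n : ℕ} (hn : Even n) (hi : Integrable fun x => k x ^ n) :
    ∫⁻ x, ‖k x‖ₑ ^ n = ofReal (∫ x, k x ^ n) := by
  have e : ∀ x, k x ^ n = ‖k x‖ ^ n := fun x => (hn.pow_abs _).symm
  simp only [e] at hi ⊢
  exact lintegral_enorm_pow hi

theorem exists_sobolev_six : ∃ C : ℝ, 0 < C ∧ ∀ v : Space → ℝ, Smooth v →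
    HasCompactSupport v → ∫ x, v x ^ 6 ≤ C * (∫ x, ∑ i, dd (ex i) v x ^ 2) ^ 3 := by
  obtain ⟨K, hK⟩ := exists_gagliardo_six
  refine ⟨(K : ℝ) ^ 6 + 1, by positivity, fun v hv hc => ?_⟩
  have h := hK v hv hc
  have hi2 : Integrable fun x => ‖fderiv ℝ v x‖ ^ 2 := by
    simp only [norm_fderiv_sq]
    exact integrable_finsetSum _ fun i _ =>
      (hasCompactSupport_dd hc _).integrable_pow (hv.dd_top (ex i)).continuous two_ne_zero
  rw [eLpNorm_eq_lintegral_rpow_enorm_toReal (by norm_num) (by simp),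
    eLpNorm_eq_lintegral_rpow_enorm_toReal (by norm_num) (by simp)] at h
  simp only [ENNReal.coe_toReal, NNReal.coe_ofNat, ENNReal.rpow_ofNat] at h
  rw [lintegral_enorm_even_pow (by decide) (hc.integrable_pow hv.continuous (by norm_num)),
    lintegral_enorm_pow hi2] at h
  simp only [norm_fderiv_sq] at h
  exact le_of_ofReal_rpow_le (integral_nonneg fun x => by positivity)
    (integral_nonneg fun x => by positivity) h

theorem three_fn_holder {α : Type*} [MeasurableSpace α] {μ : Measure α} {f₁ f₂ f₃ : α → ℝ≥0∞}
    (h₁ : AEMeasurable f₁ μ) (h₂ : AEMeasurable f₂ μ) (h₃ : AEMeasurable f₃ μ) {a b c : ℝ} (ha : 0 ≤ a)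
    (hb : 0 ≤ b) (hc : 0 ≤ c) (h : a + b + c = 1) :
    ∫⁻ x, f₁ x ^ a * f₂ x ^ b * f₃ x ^ c ∂μ ≤
      (∫⁻ x, f₁ x ∂μ) ^ a * (∫⁻ x, f₂ x ∂μ) ^ b * (∫⁻ x, f₃ x ∂μ) ^ c := by
  have h := ENNReal.lintegral_prod_norm_pow_le (μ := μ) Finset.univ
    (f := ![f₁, f₂, f₃]) (p := ![a, b, c]) (by intro i _; fin_cases i <;> assumption)
    (by simp [Fin.sum_univ_three, h]) (by intro i _; fin_cases i <;> assumption)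
  simpa only [Fin.prod_univ_three, Matrix.cons_val_zero, Matrix.cons_val_one, Matrix.cons_val] using h

theorem ENNReal.pow_rpow {n m : ℕ} {r : ℝ} (h : n * r = m) (x : ℝ≥0∞) : (x ^ n) ^ r = x ^ m := by
  rw [← rpow_natCast, ← rpow_mul, h, rpow_natCast]

/-- Hölder's inequality with exponents `3, 6, 2`. -/
theorem integral_three_holder {a b c : Space → ℝ} (ha : Continuous a) (hac : HasCompactSupport a)
    (hb : Continuous b) (hbc : HasCompactSupport b) (hc : Continuous c) (hcc : HasCompactSupport c) :
    ∫ x, a x ^ 4 * |b x| * |c x| ≤ (∫ x, a x ^ 12) ^ (1 / 3 : ℝ) * (∫ x, b x ^ 6) ^ (1 / 6 : ℝ) *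
      (∫ x, c x ^ 2) ^ (1 / 2 : ℝ) := by
  have h := three_fn_holder (μ := volume) (ha.enorm.measurable.pow_const 12).aemeasurable
    (hb.enorm.measurable.pow_const 6).aemeasurable (hc.enorm.measurable.pow_const 2).aemeasurable
    (a := 1 / 3) (b := 1 / 6) (c := 1 / 2) (by norm_num) (by norm_num) (by norm_num) (by norm_num)
  have e : ∀ x, (‖a x‖ₑ ^ 12) ^ (1 / 3 : ℝ) * (‖b x‖ₑ ^ 6) ^ (1 / 6 : ℝ) * (‖c x‖ₑ ^ 2) ^ (1 / 2 : ℝ) =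
      ofReal (a x ^ 4 * |b x| * |c x|) := fun x => by
    rw [ENNReal.pow_rpow (m := 4) (by norm_num), ENNReal.pow_rpow (m := 1) (by norm_num),
      ENNReal.pow_rpow (m := 1) (by norm_num), pow_one, pow_one, ofReal_mul (by positivity),
      ofReal_mul (by positivity), ← Even.pow_abs (by decide), ofReal_pow (abs_nonneg _)]
    simp only [enorm_eq_ofReal_abs]
  simp only [e] at h
  rwa [lintegral_enorm_even_pow (by decide) (hac.integrable_pow ha (by norm_num)),
    lintegral_enorm_even_pow (by decide) (hbc.integrable_pow hb (by norm_num)),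
    lintegral_enorm_even_pow (by decide) (hcc.integrable_pow hc (by norm_num)),
    ← ofReal_integral_eq_lintegral_ofReal ((show Continuous fun x => a x ^ 4 * |b x| * |c x| by
      fun_prop).integrable_of_hasCompactSupport (HasCompactSupport.mul_left
        (hcc.comp_left (g := fun s : ℝ => |s|) (by simp)))) (of_forall fun x => by positivity), ofReal_rpow_of_nonneg (by positivity) (by norm_num),
    ofReal_rpow_of_nonneg (by positivity) (by norm_num), ofReal_rpow_of_nonneg (by positivity) (by norm_num),
    ← ofReal_mul (by positivity), ← ofReal_mul (by positivity), ofReal_le_ofReal_iff (by positivity)] at h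

theorem lintegral_ball_rpow_lt_top :
    ∫⁻ y in {y : Space | ‖y‖ ∈ Iio 1}, ofReal (‖y‖ ^ (-(12 / 5) : ℝ)) < ⊤ := by
  rw [setLIntegral_polar measurableSet_Iio (F := fun q => ofReal (q.1 ^ (-(12 / 5) : ℝ))) (by fun_prop),
    inter_comm, Ioi_inter_Iio]
  refine ENNReal.mul_lt_top ENNReal.ofReal_lt_top ?_
  have hi := intervalIntegral.intervalIntegrable_rpow' (a := 0) (b := 1) (r := -(2 / 5)) (by norm_num)
  rw [intervalIntegrable_iff_integrableOn_Ioo_of_le zero_le_one] at hi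
  refine (setLIntegral_congr_fun measurableSet_Ioo fun r hr => ?_).trans_lt hi.lintegral_lt_top
  simp only
  rw [lintegral_const, measure_univ, mul_one, ← ofReal_mul (by positivity), ← Real.rpow_natCast,
    ← Real.rpow_add hr.1]
  norm_num

theorem abs_le_line_integral {u : Space → ℝ} (hu : Smooth u) (x ω : Space)
    (hω : ‖ω‖ = 1) : ‖u x‖ₑ ≤ ∫⁻ s in Ioo (0:ℝ) 1, (‖u (x + s • ω)‖ₑ + ‖fderiv ℝ u (x + s • ω)‖ₑ) := by
  have hder : ∀ s : ℝ, HasDerivAt (fun s : ℝ => (1 - s) * u (x + s • ω))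
      ((-1) * u (x + s • ω) + (1 - s) * dd ω u (x + s • ω)) s := fun s => by
    have hγ : HasDerivAt (fun s : ℝ => x + s • ω) ω s := by
      simpa using ((hasDerivAt_id s).smul_const ω).const_add x
    exact ((hasDerivAt_id s).const_sub 1).mul (hasDerivAt_comp_line hu.dble hγ)
  have hcont : Continuous fun s : ℝ => (-1) * u (x + s • ω) + (1 - s) * dd ω u (x + s • ω) := by
    have := hu.continuous
    have := (hu.dd_top ω).continuous
    fun_prop
  have h := integral_eq_sub_of_hasDerivAt (a := 0) (b := 1) (fun s _ => hder s)
    (hcont.intervalIntegrable _ _)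
  simp only [sub_self, zero_mul, sub_zero, one_mul, zero_smul, add_zero, zero_sub] at h
  have h2 : ‖u x‖ₑ = ‖∫ s in Ioo (0:ℝ) 1, ((-1) * u (x + s • ω) + (1 - s) * dd ω u (x + s • ω))‖ₑ := by
    rw [← integral_Ioc_eq_integral_Ioo, ← integral_of_le zero_le_one, h, enorm_neg]
  rw [h2]
  refine (enorm_integral_le_lintegral_enorm _).trans (setLIntegral_mono' measurableSet_Ioo fun s hs => ?_)
  refine (enorm_add_le _ _).trans (add_le_add (by simp) ?_)
  rw [enorm_mul]
  have h3 : ‖1 - s‖ₑ ≤ 1 := by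
    rw [← ofReal_norm, norm_of_nonneg (by linarith [hs.2])]
    exact ENNReal.ofReal_le_one.2 (by linarith [hs.1])
  have h4 : ‖dd ω u (x + s • ω)‖ₑ ≤ ‖fderiv ℝ u (x + s • ω)‖ₑ := by
    rw [← ofReal_norm, ← ofReal_norm]
    refine ofReal_le_ofReal ?_
    have := (fderiv ℝ u (x + s • ω)).le_opNorm ω
    rwa [hω, mul_one] at this
  calc _ ≤ 1 * ‖fderiv ℝ u (x + s • ω)‖ₑ := mul_le_mul' h3 h4
    _ = _ := one_mul _

theorem exists_sobolev_sup : ∃ C : ℝ≥0∞, C ≠ ⊤ ∧ ∀ u : Space → ℝ, Smooth u →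
    ∀ x, ‖u x‖ₑ ≤ C * (∫⁻ y, (‖u y‖ₑ + ‖fderiv ℝ u y‖ₑ) ^ (6 : ℝ)) ^ (1 / 6 : ℝ) := by
  refine ⟨(ofReal sphArea)⁻¹ * (∫⁻ y in {y : Space | ‖y‖ ∈ Iio 1},
      ofReal (‖y‖ ^ (-(12 / 5) : ℝ))) ^ (5 / 6 : ℝ), ENNReal.mul_ne_top (by simpa using sphArea_pos)
      (rpow_ne_top_of_nonneg (by norm_num) lintegral_ball_rpow_lt_top.ne), fun u hu x => ?_⟩
  set k : Space → ℝ≥0∞ := fun y => ‖u y‖ₑ + ‖fderiv ℝ u y‖ₑ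
  have hk : Measurable k :=
    hu.continuous.enorm.measurable.add (hu.continuous_fderiv (by simp)).enorm.measurable
  have h1 : ‖u x‖ₑ ≤ ∫⁻ ω, (∫⁻ s in Ioo (0:ℝ) 1, k (x + s • ω)) ∂sph := by
    calc ‖u x‖ₑ = ∫⁻ _, ‖u x‖ₑ ∂sph := by simp
      _ ≤ _ := lintegral_mono_ae (ae_sph_norm.mono fun ω hω => abs_le_line_integral hu x ω hω)
  have hm : Measurable fun z : Space × ℝ => k (x + z.2 • z.1) := hk.comp (by fun_prop)
  rw [lintegral_lintegral_swap hm.aemeasurable] at h1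
  have h2 : ∫⁻ s in Ioo (0:ℝ) 1, ∫⁻ ω, k (x + s • ω) ∂sph = (ofReal sphArea)⁻¹ *
      ∫⁻ y in {y : Space | ‖y‖ ∈ Iio 1}, ofReal (‖y‖ ^ (-2 : ℝ)) * k (x + y) := by
    rw [setLIntegral_polar measurableSet_Iio (F := fun q => ofReal (q.1 ^ (-2 : ℝ)) * k (x + q.2))
      (Measurable.mul (by fun_prop) (hk.comp (by fun_prop))), inv_sphArea_mul, inter_comm, Ioi_inter_Iio]
    refine setLIntegral_congr_fun measurableSet_Ioo fun s hs => ?_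
    simp only
    rw [lintegral_const_mul' _ _ ofReal_ne_top, ← mul_assoc, ← ofReal_mul (by positivity),
      ← Real.rpow_natCast, ← Real.rpow_add hs.1]
    norm_num
  rw [h2] at h1
  refine h1.trans ?_
  rw [mul_assoc]
  gcongr
  refine (ENNReal.lintegral_mul_le_Lp_mul_Lq _ (p := 6 / 5) (q := 6) (by rw [Real.holderConjugate_iff]; norm_num)
    (by fun_prop) (hk.comp (by fun_prop : Measurable fun y => x + y)).aemeasurable).trans ?_
  rw [show (1 / (6 / 5) : ℝ) = 5 / 6 by norm_num]
  refine mul_le_mul' (le_of_eq ?_) (rpow_le_rpow ((setLIntegral_le_lintegral _ _).trans_eq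
    (lintegral_add_left_eq_self (fun y => k y ^ (6 : ℝ)) x)) (by norm_num))
  congr 1
  refine lintegral_congr fun y => ?_
  rw [ofReal_rpow_of_nonneg (by positivity) (by norm_num), ← Real.rpow_mul (norm_nonneg _)]
  norm_num

/-! ### Second order energy -/

/-- The energy of the spatial derivatives. -/
def hEn (U : ℝ⁴ → ℝ) (t : ℝ) : ℝ := ∑ i, ∫ x, edens₀ (dd (vx i) U) (t, x)

/-- The fourth power of the spatial `L¹²` norm. -/
def nFour (U : ℝ⁴ → ℝ) (t : ℝ) : ℝ := (∫ x, U (t, x) ^ 12) ^ (1 / 3 : ℝ)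

theorem nFour_nonneg (U : ℝ⁴ → ℝ) (t : ℝ) : 0 ≤ nFour U t :=
  Real.rpow_nonneg (integral_nonneg fun x => by positivity) _

theorem edens_zero_nonneg (U : ℝ⁴ → ℝ) (p : ℝ⁴) : 0 ≤ edens₀ U p := by
  unfold edens
  have : 0 ≤ ∑ i, dd (vx i) U p ^ 2 := sum_nonneg fun i _ => sq_nonneg _
  positivity

theorem hEn_nonneg (U : ℝ⁴ → ℝ) (t : ℝ) : 0 ≤ hEn U t :=
  sum_nonneg fun _ _ => integral_nonneg fun _ => edens_zero_nonneg _ _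

theorem continuous_nFour {U : ℝ⁴ → ℝ} (hU : Smooth U) (hUc : SpaceCpt U) :
    Continuous (nFour U) := by
  have : SpaceCpt fun p => U p ^ 12 := hUc.of_local fun p hp => by simp [hp.self_of_nhds]
  exact (this.continuous_integral (hU.pow 12)).rpow_const fun _ => Or.inr (by norm_num)

theorem box_dd {U : ℝ⁴ → ℝ} (hU : Smooth U) (v p : ℝ⁴) :
    box (dd v U) p = dd v (box U) p := by
  have e1 : dd v (box U) p = dd v (dd vt (dd vt U)) p - ∑ i, dd v (dd (vx i) (dd (vx i) U)) p := by
    unfold box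
    rw [dd_sub ((hU.dd_top _).dd_top _).dble
      (ContDiff.sum fun i _ => (hU.dd_top (vx i)).dd_top (vx i)).dble,
      dd_finset_sum _ fun i => ((hU.dd_top (vx i)).dd_top (vx i)).dble]
  have e2 : ∀ w, dd v (dd w (dd w U)) = dd w (dd w (dd v U)) := fun w => by
    rw [dd_comm (hU.dd_top w) v w, dd_comm hU v w]
  rw [e1, box]
  simp only [e2]

theorem integral_edens_zero {V : ℝ⁴ → ℝ} (hV : Smooth V) (hVc : SpaceCpt V) (t : ℝ) :
    ∫ x, edens₀ V (t, x) =
      1 / 2 * ((∫ x, dd vt V (t, x) ^ 2) + ∫ x, ∑ j, dd (vx j) V (t, x) ^ 2) := by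
  have hiD : Integrable fun x => dd vt V (t, x) ^ 2 :=
    SpaceCpt.integrable (K := fun p => dd vt V p ^ 2)
      (hVc.of_local fun p hp => by simp [(eventually_zero_dd hp _).self_of_nhds])
      ((hV.dd_top vt).pow 2).continuous t
  have hiS : Integrable fun x => ∑ j, dd (vx j) V (t, x) ^ 2 :=
    SpaceCpt.integrable (K := fun p => ∑ j, dd (vx j) V p ^ 2)
      (hVc.of_local fun p hp => by simp [(eventually_zero_dd hp _).self_of_nhds])
      (ContDiff.sum fun j _ => (hV.dd_top (vx j)).pow 2).continuous t
  rw [← integral_add hiD hiS, ← integral_const_mul]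
  simp [edens]

theorem integral_sobolev_sqrt {C₀ : ℝ} (hC₀ : 0 < C₀) {v : Space → ℝ} {S : ℝ} (hS0 : 0 ≤ S)
    (h : ∫ x, v x ^ 6 ≤ C₀ * S ^ 3) : (∫ x, v x ^ 6) ^ (1 / 6 : ℝ) ≤ C₀ ^ (1 / 6 : ℝ) * √S := by
  calc (∫ x, v x ^ 6) ^ (1 / 6 : ℝ) ≤ (C₀ * S ^ 3) ^ (1 / 6 : ℝ) :=
        Real.rpow_le_rpow (integral_nonneg fun x => by positivity) h (by norm_num)
    _ = C₀ ^ (1 / 6 : ℝ) * √S := by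
        rw [Real.mul_rpow hC₀.le (by positivity), ← Real.rpow_natCast S 3, ← Real.rpow_mul hS0,
          sqrt_eq_rpow]
        norm_num

theorem integral_dd_edens_le {C₀ : ℝ} (hC₀ : 0 < C₀)
    (hsob : ∀ v : Space → ℝ, Smooth v →
      HasCompactSupport v → ∫ x, v x ^ 6 ≤ C₀ * (∫ x, ∑ i, dd (ex i) v x ^ 2) ^ 3)
    {U V : ℝ⁴ → ℝ} (hU : Smooth U) (hUc : SpaceCpt U)
    (hV : Smooth V) (hVc : SpaceCpt V) {A t : ℝ} (hA : 0 ≤ A) {w : Space → ℝ}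
    (hb : ∀ x, box V (t, x) = -(w x * V (t, x))) (hw : ∀ x, |w x| ≤ A * U (t, x) ^ 4) :
    ∫ x, dd vt (edens₀ V) (t, x) ≤
      C₀ ^ (1 / 6 : ℝ) * A * nFour U t * ∫ x, edens₀ V (t, x) := by
  have hE : Smooth (edens₀ V) := contDiff_edens contDiff_const hV
  have hEc : SpaceCpt (edens₀ V) := hVc.of_local fun p hp => by
    simp [edens, (eventually_zero_dd hp _).self_of_nhds]
  have hfc : ∀ j, SpaceCpt (eflux V j) := fun j => hVc.of_local fun p hp => by
    simp [eflux, (eventually_zero_dd hp _).self_of_nhds]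
  have hflux : ∫ x, ∑ j, dd (vx j) (eflux V j) (t, x) = 0 := by
    rw [integral_finsetSum]
    · simp [(hfc _).integral_dd_vx (contDiff_eflux hV _)]
    · intro j _
      exact ((hfc j).dd _).integrable ((contDiff_eflux hV j).dd_top _).continuous t
  have hifl : Integrable fun x => ∑ j, dd (vx j) (eflux V j) (t, x) :=
    integrable_finsetSum _ fun j _ =>
      ((hfc j).dd _).integrable ((contDiff_eflux hV j).dd_top _).continuous t
  have hcU : Continuous fun x => U (t, x) := (contDiff_slice hU t).continuous
  have hcV : Continuous fun x => V (t, x) := (contDiff_slice hV t).continuous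
  have hcVt : Continuous fun x => dd vt V (t, x) := (contDiff_slice (hV.dd_top vt) t).continuous
  have hsU := hUc.slice t
  have hsV := hVc.slice t
  have hsVt := (hVc.dd vt).slice t
  have hi3 : Integrable fun x => U (t, x) ^ 4 * |V (t, x)| * |dd vt V (t, x)| :=
    SpaceCpt.integrable (K := fun p => U p ^ 4 * |V p| * |dd vt V p|)
      (hVc.of_local fun p hp => by simp [hp.self_of_nhds])
      (((hU.continuous.pow 4).mul hV.continuous.abs).mul (hV.dd_top vt).continuous.abs) t
  have h1 : ∫ x, dd vt (edens₀ V) (t, x) ≤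
      A * ∫ x, U (t, x) ^ 4 * |V (t, x)| * |dd vt V (t, x)| := by
    calc ∫ x, dd vt (edens₀ V) (t, x) ≤ ∫ x, (∑ j, dd (vx j) (eflux V j) (t, x) +
          A * (U (t, x) ^ 4 * |V (t, x)| * |dd vt V (t, x)|)) := by
          refine integral_mono ((hEc.dd vt).integrable (hE.dd_top vt).continuous t)
            (hifl.add (hi3.const_mul A)) fun x => ?_
          have e := dd_vt_edens (H := fun _ => 0) (h := fun _ => 0) contDiff_const
            (fun s => hasDerivAt_const s 0) hV (t, x)
          simp only at e ⊢
          rw [e, hb, add_zero]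
          have : dd vt V (t, x) * -(w x * V (t, x)) ≤
              |w x| * (|V (t, x)| * |dd vt V (t, x)|) := by
            refine (le_abs_self _).trans (le_of_eq ?_)
            rw [abs_mul, abs_neg, abs_mul]; ring
          have h2 : |w x| * (|V (t, x)| * |dd vt V (t, x)|) ≤
              A * U (t, x) ^ 4 * (|V (t, x)| * |dd vt V (t, x)|) :=
            mul_le_mul_of_nonneg_right (hw x) (by positivity)
          linarith
      _ = A * ∫ x, U (t, x) ^ 4 * |V (t, x)| * |dd vt V (t, x)| := by
          rw [integral_add hifl (hi3.const_mul A), hflux, zero_add, integral_const_mul]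
  have h2 := integral_three_holder hcU hsU hcV hsV hcVt hsVt
  have h3 := hsob _ (contDiff_slice hV t) hsV
  simp only [dd_slice hV.dble] at h3
  rw [integral_edens_zero hV hVc]
  have hS0 : 0 ≤ ∫ x, ∑ j, dd (vx j) V (t, x) ^ 2 :=
    integral_nonneg fun x => sum_nonneg fun j _ => sq_nonneg _
  have hD0 : 0 ≤ ∫ x, dd vt V (t, x) ^ 2 := integral_nonneg fun x => sq_nonneg _
  have h6 := integral_sobolev_sqrt hC₀ hS0 h3
  generalize (∫ x, ∑ j, dd (vx j) V (t, x) ^ 2) = S at *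
  generalize (∫ x, dd vt V (t, x) ^ 2) = D at *
  have hn : 0 ≤ nFour U t := nFour_nonneg U t
  change _ ≤ nFour U t * _ * _ at h2
  rw [← sqrt_eq_rpow] at h2
  calc _ ≤ A * (nFour U t * (∫ x, V (t, x) ^ 6) ^ (1 / 6 : ℝ) * √D) :=
        h1.trans (mul_le_mul_of_nonneg_left h2 hA)
    _ ≤ A * (nFour U t * (C₀ ^ (1 / 6 : ℝ) * √S) * √D) := by
        gcongr
    _ = C₀ ^ (1 / 6 : ℝ) * A * nFour U t * (√S * √D) := by ring
    _ ≤ C₀ ^ (1 / 6 : ℝ) * A * nFour U t * (1 / 2 * (D + S)) := by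
        refine mul_le_mul_of_nonneg_left ?_ (by positivity)
        nlinarith [sq_nonneg (√S - √D), sq_sqrt hS0, sq_sqrt hD0]

theorem exists_hEn_growth : ∃ C : ℝ, 0 < C ∧ ∀ (h h' : ℝ → ℝ), (∀ s, HasDerivAt h (h' s) s) →
    ∀ (U : ℝ⁴ → ℝ), Smooth U → SpaceCpt U → ∀ T A : ℝ, 0 ≤ A →
    (∀ p : ℝ⁴, 0 ≤ p.1 → p.1 ≤ T → box U p = -h (U p)) →
    (∀ p : ℝ⁴, 0 ≤ p.1 → p.1 ≤ T → |h' (U p)| ≤ A * U p ^ 4) →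
    ∀ t ∈ Icc (0 : ℝ) T, hEn U t ≤ hEn U 0 * exp (C * A * ∫ s in (0 : ℝ)..t, nFour U s) := by
  obtain ⟨C₀, hC₀, hsob⟩ := exists_sobolev_six
  refine ⟨C₀ ^ (1 / 6 : ℝ), by positivity, fun h h' hh U hU hUc T A hA heq hA' => ?_⟩
  set C := C₀ ^ (1 / 6 : ℝ)
  have hC : 0 < C := by positivity
  have hV := fun i => hU.dd_top (vx i)
  have hVc := fun i => hUc.dd (vx i)
  have hE : ∀ i, Smooth (edens₀ (dd (vx i) U)) := fun i =>
    contDiff_edens contDiff_const (hV i)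
  have hEc : ∀ i, SpaceCpt (edens₀ (dd (vx i) U)) := fun i => (hVc i).of_local fun p hp => by
    simp [edens, (eventually_zero_dd hp _).self_of_nhds]
  have hder : ∀ t, HasDerivAt (hEn U) (∑ i, ∫ x, dd vt (edens₀ (dd (vx i) U)) (t, x)) t := by
    intro t
    unfold hEn
    exact HasDerivAt.fun_sum fun i _ => (hEc i).hasDerivAt_integral (hE i) t
  have hbd : ∀ t ∈ Icc (0:ℝ) T, (∑ i, ∫ x, dd vt (edens₀ (dd (vx i) U)) (t, x)) ≤
      C * A * nFour U t * hEn U t := by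
    intro t ht
    rw [hEn, mul_sum]
    refine sum_le_sum fun i _ => ?_
    have hb : ∀ x, box (dd (vx i) U) (t, x) = -(h' (U (t, x)) * dd (vx i) U (t, x)) := by
      intro x
      rw [box_dd hU]
      have e1 := dd_slice (contDiff_box hU).dble (ex i) t x
      have e2 : (fun y => box U (t, y)) = fun y => (-1) * h (U (t, y)) := by
        funext y; rw [heq (t, y) ht.1 ht.2]; ring
      have hs := contDiff_slice hU t
      have hhd : Differentiable ℝ fun y => h (U (t, y)) := fun y =>
        ((hh _).differentiableAt).comp y (hs.dble y)
      rw [e2, dd_const_mul hhd, dd_comp_real hs.dble hh, dd_slice hU.dble] at e1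
      change dd ((0:ℝ), ex i) (box U) (t, x) = _
      rw [← e1]; simp only [vx]; ring
    exact integral_dd_edens_le hC₀ hsob hU hUc (hV i) (hVc i) hA hb fun x => hA' (t, x) ht.1 ht.2
  have hnc := continuous_nFour hU hUc
  let Ψ : ℝ → ℝ := fun t => C * A * ∫ s in (0 : ℝ)..t, nFour U s
  have hΨ : ∀ t, HasDerivAt Ψ (C * A * nFour U t) t := fun t =>
    ((integral_hasDerivAt_right (hnc.intervalIntegrable _ _)
      (hnc.stronglyMeasurableAtFilter _ _) hnc.continuousAt)).const_mul _
  let Φ : ℝ → ℝ := fun t => hEn U t * exp (-Ψ t)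
  have hΦ : ∀ t, HasDerivAt Φ (((∑ i, ∫ x, dd vt (edens₀ (dd (vx i) U)) (t, x)) -
      C * A * nFour U t * hEn U t) * exp (-Ψ t)) t := fun t => by
    have := (hder t).mul ((hΨ t).neg.exp)
    refine this.congr_deriv ?_
    simp only [Pi.neg_apply]
    ring
  have hanti : AntitoneOn Φ (Icc 0 T) := by
    refine antitoneOn_of_deriv_nonpos (convex_Icc 0 T)
      (fun t _ => (hΦ t).continuousAt.continuousWithinAt)
      (fun t _ => (hΦ t).differentiableAt.differentiableWithinAt) fun t ht => ?_
    rw [(hΦ t).deriv]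
    refine mul_nonpos_of_nonpos_of_nonneg ?_ (exp_pos _).le
    have := hbd t (interior_subset ht)
    linarith
  intro t ht
  have := hanti ⟨le_rfl, ht.1.trans ht.2⟩ ht ht.1
  simp only [Φ, Ψ, integral_same, mul_zero, neg_zero, Real.exp_zero, mul_one] at this
  rw [Real.exp_neg, ← div_eq_mul_inv, div_le_iff₀ (exp_pos _)] at this
  exact this

/-! ### The characteristic function of the sphere -/

theorem dd_clm {E : Type*} [NormedAddCommGroup E] [NormedSpace ℝ E] (A : E →L[ℝ] ℝ) (v p : E) :
    dd v (fun q => A q) p = A v := by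
  rw [dd, A.hasFDerivAt.fderiv]

theorem integral_cos_sph (k : Space) : ∫ ω, cos ⟪k, ω⟫ ∂sph = sinc ‖k‖ := by
  rcases eq_or_ne k 0 with rfl | hk
  · simp
  have hk' : 0 < ‖k‖ := norm_pos_iff.2 hk
  set a := ‖k‖
  let A : ℝ⁴ →L[ℝ] ℝ := a • ContinuousLinearMap.fst ℝ ℝ Space
  let B : ℝ⁴ →L[ℝ] ℝ := (innerSL ℝ k).comp (ContinuousLinearMap.snd ℝ ℝ Space)
  let U : ℝ⁴ → ℝ := fun p => a⁻¹ * (sin (A p) * cos (B p))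
  have hs (L : ℝ⁴ →L[ℝ] ℝ) : Smooth fun p => sin (L p) := Real.contDiff_sin.comp L.contDiff
  have hc (L : ℝ⁴ →L[ℝ] ℝ) : Smooth fun p => cos (L p) := Real.contDiff_cos.comp L.contDiff
  have hU : Smooth U := contDiff_const.mul ((hs A).mul (hc B))
  have ds (L : ℝ⁴ →L[ℝ] ℝ) v p : dd v (fun p => sin (L p)) p = cos (L p) * L v := by
    rw [dd_comp_real L.differentiable Real.hasDerivAt_sin, dd_clm]
  have dc (L : ℝ⁴ →L[ℝ] ℝ) v p : dd v (fun p => cos (L p)) p = -sin (L p) * L v := by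
    rw [dd_comp_real L.differentiable Real.hasDerivAt_cos, dd_clm]
  have hAt : A vt = a := by simp [A, vt]
  have hAx : ∀ i, A (vx i) = 0 := fun i => by simp [A, vx]
  have hBt : B vt = 0 := by simp [B, vt]
  have hBx : ∀ i, B (vx i) = k i := fun i => by
    simp only [B, vx, ContinuousLinearMap.comp_apply, ContinuousLinearMap.coe_snd', innerSL_apply_apply]
    rw [real_inner_comm, inner_ex]
  have dUt : dd vt U = fun p => cos (A p) * cos (B p) := by
    funext p
    simp only [U]
    rw [dd_const_mul ((hs A).mul (hc B)).dble, dd_mul (hs A).dble (hc B).dble, ds, dc, hAt, hBt]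
    field_simp; ring
  have dUtt : ∀ p, dd vt (dd vt U) p = -a ^ 2 * U p := fun p => by
    rw [dUt, dd_mul (hc A).dble (hc B).dble, dc, dc, hAt, hBt]
    simp only [U]
    field_simp; ring
  have dUx : ∀ i, dd (vx i) U = fun p => (-(a⁻¹ * k i)) * (sin (A p) * sin (B p)) := fun i => by
    funext p
    simp only [U]
    rw [dd_const_mul ((hs A).mul (hc B)).dble, dd_mul (hs A).dble (hc B).dble, ds, dc, hAx, hBx]
    ring
  have dUxx : ∀ i p, dd (vx i) (dd (vx i) U) p = -(k i) ^ 2 * U p := fun i p => by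
    rw [dUx, dd_const_mul ((hs A).mul (hs B)).dble, dd_mul (hs A).dble (hs B).dble, ds, ds, hAx, hBx]
    simp only [U]; ring
  have hbox : ∀ p, box U p = 0 := fun p => by
    rw [box, dUtt]
    simp only [dUxx, Fin.sum_univ_three]
    have := norm_sq_coord k
    change a ^ 2 = _ at this
    rw [this]; ring
  have h := kirchhoff hU 0 1 0
  have hz : ∀ y : Space, U (0, y) = 0 := fun y => by simp [U, A]
  have ht : ∀ y : Space, dd vt U (0, y) = cos ⟪k, y⟫ := fun y => by
    rw [dUt]; simp [A, B]
  simp only [hbox, hz, ht] at h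
  rw [freeWave_eq contDiff_const (by fun_prop)] at h
  have hs0 : ∀ p, smean (fun _ : Space => (0:ℝ)) p = 0 := fun p => by simp [smean]
  simp only [hs0, intervalIntegral.integral_zero, add_zero, dd_const_fun, sub_zero, one_smul,
    zero_add, one_mul] at h
  rw [← h, Real.sinc_of_ne_zero hk'.ne']
  simp only [U, A, B]
  simp [div_eq_inv_mul]

theorem integral_sin_sph (k : Space) : ∫ ω, sin ⟪k, ω⟫ ∂sph = 0 := by
  have h := map_sph_isometry (LinearIsometryEquiv.neg ℝ)
  have h2 : ∫ ω, sin ⟪k, ω⟫ ∂sph = ∫ ω, sin ⟪k, -ω⟫ ∂sph := by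
    conv_lhs => rw [← h]
    rw [integral_map (by fun_prop) (by fun_prop)]
    rfl
  simp only [inner_neg_right, Real.sin_neg, integral_neg] at h2
  linarith

theorem charFun_sph (k : Space) : charFun sph k = (sinc ‖k‖ : ℂ) := by
  rw [charFun_apply]
  have e : ∀ ω : Space, Complex.exp (⟪ω, k⟫ * Complex.I) =
      ((cos ⟪k, ω⟫ : ℝ) : ℂ) + ((sin ⟪k, ω⟫ : ℝ) : ℂ) * Complex.I := fun ω => by
    rw [real_inner_comm, Complex.exp_mul_I, Complex.ofReal_cos, Complex.ofReal_sin]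
  simp only [e]
  have hc : Integrable (fun ω : Space => ((cos ⟪k, ω⟫ : ℝ) : ℂ)) sph :=
    integrable_sph (by fun_prop)
  have hs : Integrable (fun ω : Space => ((sin ⟪k, ω⟫ : ℝ) : ℂ)) sph :=
    integrable_sph (by fun_prop)
  rw [integral_add hc (hs.mul_const _), integral_mul_const, integral_complex_ofReal,
    integral_complex_ofReal, integral_cos_sph, integral_sin_sph]
  simp

theorem integral_cexp_sph (ρ : ℝ) (k : Space) :
    ∫ ω, Complex.exp (⟪ρ • ω, k⟫ * Complex.I) ∂sph = (sinc (ρ * ‖k‖) : ℂ) := by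
  have := charFun_sph (ρ • k)
  rw [charFun_apply, norm_smul, norm_eq_abs] at this
  rw [show sinc (ρ * ‖k‖) = sinc (|ρ| * ‖k‖) by rcases abs_choice ρ with h | h <;> simp [h], ← this]
  simp only [inner_smul_left, inner_smul_right, RCLike.conj_to_real]

/-- Archimedes: a coordinate of a uniform point on the sphere is uniform on `[-1, 1]`. -/
theorem map_inner_sph {e : Space} (he : ‖e‖ = 1) :
    sph.map (fun ω => ⟪e, ω⟫) = ofReal (1 / 2) • volume.restrict (Icc (-1 : ℝ) 1) := by
  have hme : Measurable fun ω : Space => ⟪e, ω⟫ := by fun_prop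
  have : IsFiniteMeasure (volume.restrict (Icc (-1 : ℝ) 1)) := ⟨by simp⟩
  have : IsFiniteMeasure (ofReal (1 / 2) • volume.restrict (Icc (-1 : ℝ) 1)) :=
    Measure.smul_finite _ ofReal_ne_top
  have : IsProbabilityMeasure (sph.map fun ω => ⟪e, ω⟫) := Measure.isProbabilityMeasure_map hme.aemeasurable
  refine Measure.ext_of_charFun (funext fun s => ?_)
  have h1 : charFun (sph.map fun ω => ⟪e, ω⟫) s = (sinc s : ℂ) := by
    rw [charFun_apply, integral_map hme.aemeasurable (by fun_prop)]
    have := integral_cexp_sph s e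
    rw [he, mul_one] at this
    rw [← this]
    simp [inner_smul_right, real_inner_comm e]
  rw [h1, charFun_apply, integral_smul_measure, integral_Icc_eq_integral_Ioc,
    ← integral_of_le (by norm_num : (-1:ℝ) ≤ 1)]
  have e1 : ∀ x : ℝ, Complex.exp (⟪x, s⟫ * Complex.I) = Complex.exp ((s * Complex.I) * x) := fun x => by
    congr 1; simp; ring
  simp only [e1]
  rcases eq_or_ne s 0 with rfl | hs
  · simp
    norm_num
  · have hc : (s * Complex.I : ℂ) ≠ 0 := mul_ne_zero (by exact_mod_cast hs) Complex.I_ne_zero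
    rw [integral_exp_mul_complex hc, Real.sinc_of_ne_zero hs]
    have e2 := Complex.two_sin (s : ℂ)
    rw [ENNReal.toReal_ofReal (by norm_num), Complex.real_smul]
    push_cast
    have hs' : (s : ℂ) ≠ 0 := by exact_mod_cast hs
    have e3 : Complex.sin s = (Complex.exp (-s * Complex.I) - Complex.exp (s * Complex.I)) * Complex.I / 2 := rfl
    rw [e3]
    field_simp
    rw [show Complex.I ^ 2 = -1 from Complex.I_sq]
    ring_nf

theorem cap_le (x : Space) {r ρ : ℝ} (hr : 0 < r) (hρ : 0 ≤ ρ) :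
    sph {ω | ‖x + r • ω‖ ≤ ρ} ≤ ofReal (4 * ρ ^ 2 / r ^ 2) := by
  rcases le_or_gt r (2 * ρ) with h | h
  · refine prob_le_one.trans ?_
    rw [ENNReal.one_le_ofReal, le_div_iff₀ (by positivity)]
    nlinarith
  rcases lt_or_ge ‖x‖ (r - ρ) with hx | hx
  · have : sph {ω | ‖x + r • ω‖ ≤ ρ} = 0 := by
      rw [← compl_compl {ω | ‖x + r • ω‖ ≤ ρ}, ← mem_ae_iff]
      filter_upwards [ae_sph_norm_smul hr.le] with ω hω
      change ¬ (‖x + r • ω‖ ≤ ρ)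
      have h1 := norm_sub_norm_le (r • ω) (-x)
      rw [norm_neg, hω, sub_neg_eq_add, add_comm _ x] at h1
      linarith
    simp [this]
  have hxp : 0 < ‖x‖ := by linarith
  set e := ‖x‖⁻¹ • x
  have he : ‖e‖ = 1 := by simp [e, norm_smul, hxp.ne']
  set s := (ρ ^ 2 - ‖x‖ ^ 2 - r ^ 2) / (2 * r * ‖x‖)
  have hsub : ∀ᵐ ω ∂sph, ω ∈ {ω | ‖x + r • ω‖ ≤ ρ} → ω ∈ (fun ω => ⟪e, ω⟫) ⁻¹' (Iic s) := by
    filter_upwards [ae_sph_norm] with ω hω h1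
    replace h1 : ‖x + r • ω‖ ≤ ρ := h1
    simp only [mem_preimage, mem_Iic, e, s, inner_smul_left, RCLike.conj_to_real]
    have h2 : ‖x + r • ω‖ ^ 2 ≤ ρ ^ 2 := by gcongr
    rw [norm_add_sq_real, norm_smul, hω, inner_smul_right, norm_of_nonneg hr.le] at h2
    rw [le_div_iff₀ (by positivity)]
    field_simp
    linarith
  have hm : Measurable fun ω : Space => ⟪e, ω⟫ := by fun_prop
  calc sph {ω | ‖x + r • ω‖ ≤ ρ} ≤ sph ((fun ω => ⟪e, ω⟫) ⁻¹' (Iic s)) := measure_mono_ae hsub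
    _ = ofReal (1 / 2) * volume (Iic s ∩ Icc (-1) 1) := by
        rw [← Measure.map_apply hm measurableSet_Iic, map_inner_sph he, Measure.smul_apply,
          Measure.restrict_apply measurableSet_Iic, smul_eq_mul]
    _ ≤ ofReal (1 / 2) * volume (Icc (-1) s) := by
        gcongr
        exact fun y hy => ⟨hy.2.1, hy.1⟩
    _ ≤ ofReal (4 * ρ ^ 2 / r ^ 2) := by
        rw [Real.volume_Icc, ← ofReal_mul (by norm_num)]
        refine ofReal_le_ofReal ?_
        rw [show s - -1 = (ρ ^ 2 - (‖x‖ - r) ^ 2) / (2 * r * ‖x‖) by simp only [s]; field_simp; ring,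
          show 4 * ρ ^ 2 / r ^ 2 = 1 / 2 * (8 * ρ ^ 2 / (2 * r * (r / 2))) by field_simp; ring]
        have : r / 2 ≤ ‖x‖ := by linarith
        gcongr
        linarith [sq_nonneg (‖x‖ - r), sq_nonneg ρ]

/-- The law of the distance of two independent uniform points on centred spheres of radii `r` and `r'`. -/
def radLaw (r r' : ℝ) : Measure ℝ :=
  (volume.restrict (Ioc |r - r'| (r + r'))).withDensity fun ρ => ofReal (ρ / (2 * r * r'))

theorem integral_sinc {r r' a : ℝ} (hr : 0 < r) (hr' : 0 < r') (ha : 0 ≤ a) :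
    ∫ ρ in |r - r'|..(r + r'), ρ / (2 * r * r') * sinc (ρ * a) =
      sinc (r * a) * sinc (r' * a) := by
  rcases ha.eq_or_lt with rfl | ha
  · simp only [mul_zero, Real.sinc_zero, mul_one]
    rw [intervalIntegral.integral_div, integral_id, sq_abs]
    field_simp; ring
  · have hder : ∀ ρ : ℝ, HasDerivAt (fun ρ => -(1 / (2 * r * r' * a ^ 2)) * cos (ρ * a))
        (ρ / (2 * r * r') * sinc (ρ * a)) ρ := fun ρ => by
      have h1 := ((Real.hasDerivAt_cos (ρ * a)).comp ρ ((hasDerivAt_id ρ).mul_const a)).const_mul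
        (-(1 / (2 * r * r' * a ^ 2)))
      refine h1.congr_deriv ?_
      rcases eq_or_ne ρ 0 with rfl | hρ
      · simp
      · rw [Real.sinc_of_ne_zero (mul_ne_zero hρ ha.ne')]
        field_simp
    rw [integral_eq_sub_of_hasDerivAt (fun ρ _ => hder ρ)]
    · rw [Real.sinc_of_ne_zero (by positivity), Real.sinc_of_ne_zero (by positivity)]
      have e1 : cos (|r - r'| * a) = cos (r * a - r' * a) := by
        rw [← abs_of_pos ha, ← abs_mul, Real.cos_abs, abs_of_pos ha, sub_mul]
      rw [e1, add_mul, Real.cos_add, Real.cos_sub]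
      field_simp; ring
    · exact Continuous.intervalIntegrable (by
        have := Real.continuous_sinc; fun_prop) _ _

theorem radLaw_finite (r r' : ℝ) : IsFiniteMeasure (radLaw r r') := by
  refine isFiniteMeasure_withDensity_ofReal ?_
  have : Continuous fun ρ : ℝ => ρ / (2 * r * r') := by fun_prop
  exact (this.integrableOn_Ioc).2

theorem abs_sub_le_add {r r' : ℝ} (hr : 0 < r) (hr' : 0 < r') : |r - r'| ≤ r + r' :=
  abs_le.2 ⟨by linarith, by linarith⟩

theorem integral_radLaw {r r' : ℝ} (hr : 0 < r) (hr' : 0 < r') (k : ℝ → ℂ) :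
    ∫ ρ, k ρ ∂(radLaw r r') = ∫ ρ in |r - r'|..(r + r'), ((ρ / (2 * r * r') : ℝ) : ℂ) * k ρ := by
  rw [radLaw, integral_of_le (abs_sub_le_add hr hr'),
    integral_withDensity_eq_integral_toReal_smul (by fun_prop)
      (of_forall fun _ => ENNReal.ofReal_lt_top)]
  refine setIntegral_congr_fun measurableSet_Ioc fun ρ hρ => ?_
  have : 0 ≤ ρ := (abs_nonneg _).trans hρ.1.le
  rw [ENNReal.toReal_ofReal (by positivity), Complex.real_smul]

theorem map_pair_sph {r r' : ℝ} (hr : 0 < r) (hr' : 0 < r') :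
    (sph.prod sph).map (fun z : Space × Space => r' • z.2 - r • z.1) =
      ((radLaw r r').prod sph).map (fun z : ℝ⁴ => z.1 • z.2) := by
  have := radLaw_finite r r'
  refine Measure.ext_of_charFun (funext fun k => ?_)
  rw [charFun_apply, charFun_apply, integral_map (by fun_prop) (by fun_prop),
    integral_map (by fun_prop) (by fun_prop)]
  have e1 : ∀ z : Space × Space, Complex.exp (⟪r' • z.2 - r • z.1, k⟫ * Complex.I) =
      Complex.exp (⟪z.1, (-r) • k⟫ * Complex.I) * Complex.exp (⟪z.2, r' • k⟫ * Complex.I) := fun z => by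
    rw [← Complex.exp_add]
    congr 1
    rw [inner_sub_left, inner_smul_left, inner_smul_left, inner_smul_right, inner_smul_right]
    simp
    ring
  simp only [e1]
  rw [integral_prod_mul (fun ω : Space => Complex.exp (⟪ω, (-r) • k⟫ * Complex.I))
    (fun ω : Space => Complex.exp (⟪ω, r' • k⟫ * Complex.I)), ← charFun_apply, ← charFun_apply,
    charFun_sph, charFun_sph, norm_smul, norm_smul, norm_neg, norm_of_nonneg hr.le,
    norm_of_nonneg hr'.le, integral_prod]
  · simp only [integral_cexp_sph]
    rw [integral_radLaw hr hr']
    have := integral_sinc hr hr' (norm_nonneg k)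
    rw [← Complex.ofReal_mul, ← this, ← intervalIntegral.integral_ofReal]
    simp
  · refine Integrable.of_bound (C := 1) (by fun_prop) (of_forall fun z => ?_)
    rw [Complex.norm_exp]
    simp

/-- The bilinear kernel of two spherical means. -/
theorem lintegral_pair_sph {r r' : ℝ} (hr : 0 < r) (hr' : 0 < r') {k : Space → ℝ≥0∞}
    (hk : Measurable k) :
    ofReal (r * r') * ∫⁻ ω, ∫⁻ ω', k (r' • ω' - r • ω) ∂sph ∂sph ≤
      (ofReal sphArea)⁻¹ * ∫⁻ y in {y : Space | ‖y‖ ∈ Ici |r - r'|}, ofReal ‖y‖⁻¹ * k y := by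
  have := radLaw_finite r r'
  have hm : Measurable fun z : Space × Space => k (r' • z.2 - r • z.1) := hk.comp (by fun_prop)
  have hm2 : Measurable fun z : ℝ⁴ => k (z.1 • z.2) := hk.comp (by fun_prop)
  have e1 : ∫⁻ ω, ∫⁻ ω', k (r' • ω' - r • ω) ∂sph ∂sph = ∫⁻ ρ, ∫⁻ ω, k (ρ • ω) ∂sph ∂(radLaw r r') := by
    rw [← lintegral_prod (μ := sph) (ν := sph) _ hm.aemeasurable,
      ← lintegral_prod (μ := radLaw r r') (ν := sph) _ hm2.aemeasurable,
      ← lintegral_map (f := k) hk (by fun_prop : Measurable fun z : Space × Space => r' • z.2 - r • z.1),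
      map_pair_sph hr hr', lintegral_map hk (by fun_prop)]
  rw [e1, setLIntegral_polar measurableSet_Ici (F := fun q => ofReal q.1⁻¹ * k q.2)
      (Measurable.mul (by fun_prop) (hk.comp measurable_snd)), inv_sphArea_mul, radLaw,
    lintegral_withDensity_eq_lintegral_mul _ (by fun_prop) (hm2.lintegral_prod_right'),
    ← lintegral_const_mul' _ _ ofReal_ne_top]
  have hsub : Ioc |r - r'| (r + r') ⊆ Ici |r - r'| ∩ Ioi 0 := fun ρ hρ =>
    ⟨hρ.1.le, (abs_nonneg _).trans_lt hρ.1⟩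
  refine (setLIntegral_mono' measurableSet_Ioc fun ρ hρ => ?_).trans (lintegral_mono_set hsub)
  have hρ0 : 0 < ρ := (hsub hρ).2
  simp only
  rw [lintegral_const_mul' _ _ ofReal_ne_top, Pi.mul_apply, ← mul_assoc, ← mul_assoc,
    ← ofReal_mul (by positivity), ← ofReal_mul (by positivity)]
  refine mul_le_mul' (ofReal_le_ofReal ?_) le_rfl
  rw [show r * r' * (ρ / (2 * r * r')) = ρ / 2 by field_simp, show ρ ^ 2 * ρ⁻¹ = ρ by field_simp]
  linarith

/-! ### Bilinear estimate for spherical means -/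

/-- `r` times the spherical mean of a nonnegative function. -/
def sm (r : ℝ) (φ : Space → ℝ≥0∞) (x : Space) : ℝ≥0∞ :=
  ofReal r * ∫⁻ ω, φ (x + r • ω) ∂sph

theorem lintegral_sph_neg {k : Space → ℝ≥0∞} (hk : Measurable k) :
    ∫⁻ ω, k (-ω) ∂sph = ∫⁻ ω, k ω ∂sph := by
  conv_rhs => rw [← map_sph_isometry (LinearIsometryEquiv.neg ℝ)]
  rw [lintegral_map hk (by fun_prop)]
  rfl

theorem lintegral_mul_sm {φ ψ : Space → ℝ≥0∞} (hφ : Measurable φ) (hψ : Measurable ψ) (r : ℝ) :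
    ∫⁻ x, φ x * sm r ψ x = ∫⁻ x, sm r φ x * ψ x := by
  have h1 : ∀ {φ ψ : Space → ℝ≥0∞}, Measurable φ → Measurable ψ → ∫⁻ x, φ x * sm r ψ x =
      ofReal r * ∫⁻ ω, (∫⁻ x, φ x * ψ (x + r • ω)) ∂sph := by
    intro φ ψ hφ hψ
    have hm : Measurable fun z : Space × Space => φ z.1 * ψ (z.1 + r • z.2) :=
      (hφ.comp measurable_fst).mul (hψ.comp (by fun_prop))
    rw [← lintegral_lintegral_swap hm.aemeasurable, ← lintegral_const_mul' _ _ ofReal_ne_top]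
    refine lintegral_congr fun x => ?_
    have hm' : Measurable fun ω : Space => ψ (x + r • ω) := hψ.comp (by fun_prop)
    rw [lintegral_const_mul _ hm', sm]
    ring
  rw [h1 hφ hψ]
  have h2 := h1 hψ hφ
  simp only [mul_comm (sm r φ _)]
  rw [h2]
  congr 1
  have hm : Measurable fun z : Space × Space => ψ z.1 * φ (z.1 + r • z.2) :=
    (hψ.comp measurable_fst).mul (hφ.comp (by fun_prop))
  have hm' : Measurable fun ω : Space => ∫⁻ x, ψ x * φ (x + r • ω) :=
    (hm.comp measurable_swap).lintegral_prod_right'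
  rw [← lintegral_sph_neg hm']
  refine lintegral_congr fun ω => ?_
  have := lintegral_add_right_eq_self (μ := (volume : Measure Space))
    (fun x => ψ x * φ (x + r • -ω)) (r • ω)
  rw [← this]
  refine lintegral_congr fun x => ?_
  rw [smul_neg, add_neg_cancel_right, mul_comm]

theorem lintegral_kernel_six {d : ℝ} (hd : 0 < d) :
    ∫⁻ y in {y : Space | ‖y‖ ∈ Ici d}, ofReal ‖y‖⁻¹ ^ 6 = ofReal (sphArea / 3 * d ^ (-3 : ℝ)) := by
  rw [setLIntegral_polar measurableSet_Ici (F := fun q => ofReal q.1⁻¹ ^ 6) (by fun_prop),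
    inter_eq_left.2 (show Ici d ⊆ Ioi 0 from fun r hr => lt_of_lt_of_le hd hr), Measure.restrict_congr_set Ioi_ae_eq_Ici.symm,
    setLIntegral_congr_fun (g := fun r => ofReal (r ^ (-4 : ℝ))) measurableSet_Ioi fun r hr => ?_,
    ← ofReal_integral_eq_lintegral_ofReal (integrableOn_Ioi_rpow_of_lt (by norm_num) hd)
    ((ae_restrict_mem measurableSet_Ioi).mono fun r hr =>
      Real.rpow_nonneg (hd.le.trans (le_of_lt hr)) _),
    integral_Ioi_rpow_of_lt (by norm_num) hd, ← ofReal_mul sphArea_pos.le]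
  · congr 1
    norm_num
    ring
  · have hr : 0 < r := hd.trans hr
    simp only
    rw [lintegral_const, measure_univ, mul_one, ← ofReal_pow (by positivity), ← ofReal_mul (by positivity),
      Real.rpow_neg hr.le]
    congr 1
    norm_cast
    field_simp

theorem young_three {k φ ψ : Space → ℝ≥0∞} (hk : Measurable k) (hφ : Measurable φ) (hψ : Measurable ψ)
    (S : Set Space) : ∫⁻ w in S, k w * ∫⁻ y, φ y * ψ (y + w) ≤ (∫⁻ w in S, k w ^ 6) ^ (1 / 6 : ℝ) *
      (∫⁻ y, φ y ^ (12 / 11 : ℝ)) ^ (11 / 12 : ℝ) * (∫⁻ y, ψ y ^ (12 / 11 : ℝ)) ^ (11 / 12 : ℝ) := by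
  set p : ℝ := 12 / 11
  have m1 : Measurable fun z : Space × Space => φ z.2 ^ p * ψ (z.2 + z.1) ^ p :=
    ((hφ.comp measurable_snd).pow_const _).mul ((hψ.comp (by fun_prop)).pow_const _)
  have m2 : Measurable fun z : Space × Space => φ z.2 ^ p * k z.1 ^ 6 :=
    ((hφ.comp measurable_snd).pow_const _).mul ((hk.comp measurable_fst).pow_const _)
  have m3 : Measurable fun z : Space × Space => ψ (z.2 + z.1) ^ p * k z.1 ^ 6 :=
    ((hψ.comp (by fun_prop)).pow_const _).mul ((hk.comp measurable_fst).pow_const _)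
  have m0 : Measurable fun z : Space × Space => k z.1 * (φ z.2 * ψ (z.2 + z.1)) :=
    (hk.comp measurable_fst).mul ((hφ.comp measurable_snd).mul (hψ.comp (by fun_prop)))
  have h := three_fn_holder (μ := (volume.restrict S).prod (volume : Measure Space))
    m1.aemeasurable m2.aemeasurable m3.aemeasurable (a := 10 / 12) (b := 1 / 12) (c := 1 / 12)
    (by norm_num) (by norm_num) (by norm_num) (by norm_num)
  have hψw (w) : ∫⁻ y, ψ (y + w) ^ p = ∫⁻ y, ψ y ^ p := lintegral_add_right_eq_self (fun y => ψ y ^ p) w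
  have hψy (y) : ∫⁻ w, ψ (y + w) ^ p = ∫⁻ w, ψ w ^ p := lintegral_add_left_eq_self (fun w => ψ w ^ p) y
  set Φ := ∫⁻ y, φ y ^ p
  set Ψ := ∫⁻ y, ψ y ^ p
  set K := ∫⁻ w in S, k w ^ 6
  have hψm (w) : Measurable fun y => ψ (y + w) ^ p := (hψ.comp (by fun_prop)).pow_const _
  have i2 : ∫⁻ z, φ z.2 ^ p * k z.1 ^ 6 ∂((volume.restrict S).prod volume) = Φ * K := by
    rw [lintegral_prod _ m2.aemeasurable, ← lintegral_const_mul _ (hk.pow_const _)]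
    exact lintegral_congr fun w => lintegral_mul_const (k w ^ 6) (hφ.pow_const p)
  have i3 : ∫⁻ z, ψ (z.2 + z.1) ^ p * k z.1 ^ 6 ∂((volume.restrict S).prod volume) = Ψ * K := by
    rw [lintegral_prod _ m3.aemeasurable, ← lintegral_const_mul _ (hk.pow_const _)]
    exact lintegral_congr fun w => by simp only; rw [lintegral_mul_const _ (hψm w), hψw]
  have i1 : ∫⁻ z, φ z.2 ^ p * ψ (z.2 + z.1) ^ p ∂((volume.restrict S).prod volume) ≤ Φ * Ψ := by
    rw [lintegral_prod_symm' _ m1, ← lintegral_mul_const _ (hφ.pow_const _)]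
    refine lintegral_mono fun y => (setLIntegral_le_lintegral _ _).trans_eq ?_
    have hm : Measurable fun w => ψ (y + w) ^ p := (hψ.comp (by fun_prop)).pow_const _
    simp only
    rw [lintegral_const_mul _ hm, hψy]
  rw [i2, i3] at h
  have h1 : ∀ x : ℝ≥0∞, x ^ (11 / 12 : ℝ) = x ^ (10 / 12 : ℝ) * x ^ (1 / 12 : ℝ) := fun x => by
    rw [← rpow_add_of_nonneg _ _ (by norm_num) (by norm_num)]; norm_num
  have h2 : ∀ x : ℝ≥0∞, x ^ (1 / 6 : ℝ) = x ^ (1 / 12 : ℝ) * x ^ (1 / 12 : ℝ) := fun x => by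
    rw [← rpow_add_of_nonneg _ _ (by norm_num) (by norm_num)]; norm_num
  calc ∫⁻ w in S, k w * ∫⁻ y, φ y * ψ (y + w)
      = ∫⁻ z, k z.1 * (φ z.2 * ψ (z.2 + z.1)) ∂((volume.restrict S).prod volume) := by
        rw [lintegral_prod _ m0.aemeasurable]
        exact lintegral_congr fun w => (lintegral_const_mul _ (hφ.mul (hψ.comp (by fun_prop)))).symm
    _ = ∫⁻ z, (φ z.2 ^ p * ψ (z.2 + z.1) ^ p) ^ (10 / 12 : ℝ) * (φ z.2 ^ p * k z.1 ^ 6) ^ (1 / 12 : ℝ) *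
        (ψ (z.2 + z.1) ^ p * k z.1 ^ 6) ^ (1 / 12 : ℝ) ∂((volume.restrict S).prod volume) := by
        refine lintegral_congr fun z => ?_
        have hp : ∀ x : ℝ≥0∞, x = (x ^ p) ^ (10 / 12 : ℝ) * (x ^ p) ^ (1 / 12 : ℝ) := fun x => by
          rw [← h1, ← rpow_mul]
          norm_num [p]
        have hkp : ∀ x : ℝ≥0∞, x = (x ^ 6) ^ (1 / 12 : ℝ) * (x ^ 6) ^ (1 / 12 : ℝ) := fun x => by
          rw [← h2, ENNReal.pow_rpow (m := 1) (by norm_num), pow_one]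
        simp only [mul_rpow_of_nonneg _ _ (show (0:ℝ) ≤ 10 / 12 by norm_num),
          mul_rpow_of_nonneg _ _ (show (0:ℝ) ≤ 1 / 12 by norm_num)]
        conv_lhs => rw [hp (φ z.2), hp (ψ (z.2 + z.1)), hkp (k z.1)]
        ring
    _ ≤ (Φ * Ψ) ^ (10 / 12 : ℝ) * (Φ * K) ^ (1 / 12 : ℝ) * (Ψ * K) ^ (1 / 12 : ℝ) := h.trans (by gcongr)
    _ = _ := by
        simp only [mul_rpow_of_nonneg _ _ (show (0:ℝ) ≤ 10 / 12 by norm_num),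
          mul_rpow_of_nonneg _ _ (show (0:ℝ) ≤ 1 / 12 by norm_num), h1, h2]
        ring

/-- The `L^{12/11}` norm. -/
def dualNorm (φ : Space → ℝ≥0∞) : ℝ≥0∞ := (∫⁻ y, φ y ^ (12 / 11 : ℝ)) ^ (11 / 12 : ℝ)

/-- The constant of the bilinear estimate. -/
def bilConst : ℝ≥0∞ := (ofReal sphArea)⁻¹ * ofReal (sphArea / 3) ^ (1 / 6 : ℝ)

theorem bilConst_ne_top : bilConst ≠ ⊤ :=
  ENNReal.mul_ne_top (by simpa using sphArea_pos)
    (rpow_ne_top_of_nonneg (by norm_num) ofReal_ne_top)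

theorem lintegral_sm_mul_sm_le {φ ψ : Space → ℝ≥0∞} (hφ : Measurable φ) (hψ : Measurable ψ) {r r' : ℝ}
    (hrr : r ≠ r') : ∫⁻ x, sm r φ x * sm r' ψ x ≤
      bilConst * ofReal (|r - r'| ^ (-(1 / 2) : ℝ)) * dualNorm φ * dualNorm ψ := by
  rcases le_or_gt r 0 with hr | hr
  · simp [sm, ENNReal.ofReal_of_nonpos hr]
  rcases le_or_gt r' 0 with hr' | hr'
  · simp [sm, ENNReal.ofReal_of_nonpos hr']
  have hd : 0 < |r - r'| := abs_pos.2 (sub_ne_zero.2 hrr)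
  have hKm : Measurable fun w => ∫⁻ y, φ y * ψ (y + w) := by
    have : Measurable fun z : Space × Space => φ z.2 * ψ (z.2 + z.1) :=
      (hφ.comp measurable_snd).mul (hψ.comp (by fun_prop))
    exact this.lintegral_prod_right'
  have e1 : ∫⁻ x, sm r φ x * sm r' ψ x =
      ofReal (r * r') * ∫⁻ ω, ∫⁻ ω', (∫⁻ y, φ y * ψ (y + (r' • ω' - r • ω))) ∂sph ∂sph := by
    have e2 : ∀ x, sm r φ x * sm r' ψ x = ofReal (r * r') *
        ∫⁻ ω, ∫⁻ ω', φ (x + r • ω) * ψ (x + r' • ω') ∂sph ∂sph := fun x => by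
      have ma : Measurable fun ω : Space => φ (x + r • ω) := hφ.comp (by fun_prop)
      have mb : Measurable fun ω : Space => ψ (x + r' • ω) := hψ.comp (by fun_prop)
      rw [ofReal_mul hr.le, sm, sm]
      have : ∀ ω, ∫⁻ ω', φ (x + r • ω) * ψ (x + r' • ω') ∂sph =
          φ (x + r • ω) * ∫⁻ ω', ψ (x + r' • ω') ∂sph := fun ω =>
        lintegral_const_mul _ mb
      simp only [this]
      rw [lintegral_mul_const _ ma]
      ring
    simp only [e2]
    have m3 : Measurable fun z : (Space × Space) × Space => φ (z.1.1 + r • z.1.2) * ψ (z.1.1 + r' • z.2) :=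
      (hφ.comp (by fun_prop)).mul (hψ.comp (by fun_prop))
    rw [lintegral_const_mul' _ _ ofReal_ne_top]
    congr 1
    rw [lintegral_lintegral_swap (f := fun x ω => ∫⁻ ω', φ (x + r • ω) * ψ (x + r' • ω') ∂sph)
      (m3.lintegral_prod_right').aemeasurable]
    refine lintegral_congr fun ω => ?_
    have m4 : Measurable fun z : Space × Space => φ (z.1 + r • ω) * ψ (z.1 + r' • z.2) :=
      (hφ.comp (by fun_prop)).mul (hψ.comp (by fun_prop))
    rw [lintegral_lintegral_swap m4.aemeasurable]
    refine lintegral_congr fun ω' => ?_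
    rw [← lintegral_add_right_eq_self (fun y => φ y * ψ (y + (r' • ω' - r • ω))) (r • ω)]
    refine lintegral_congr fun x => ?_
    congr 2
    abel
  rw [e1]
  refine (lintegral_pair_sph hr hr' hKm).trans ?_
  refine (mul_le_mul' le_rfl (young_three (by fun_prop) hφ hψ _)).trans (le_of_eq ?_)
  rw [lintegral_kernel_six hd, ofReal_mul (by have := sphArea_pos; positivity),
    mul_rpow_of_nonneg _ _ (by norm_num),
    ofReal_rpow_of_nonneg (x := |r - r'| ^ (-3 : ℝ)) (by positivity) (by norm_num),
    ← Real.rpow_mul hd.le, bilConst, dualNorm, dualNorm]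
  norm_num
  ring

/-! ### Fractional integration of order one half on the line -/

theorem lintegral_comp_abs_eq {k : ℝ → ℝ≥0∞} :
    ∫⁻ s, k |s| = 2 * ∫⁻ s in Ioi (0:ℝ), k s := by
  have h1 : ∫⁻ s in Ioi (0:ℝ), k |s| = ∫⁻ s in Ioi (0:ℝ), k s :=
    setLIntegral_congr_fun measurableSet_Ioi fun s hs => by rw [abs_of_pos hs]
  have h2 : ∫⁻ s in Iic (0:ℝ), k |s| = ∫⁻ s in Ioi (0:ℝ), k s := by
    rw [← Measure.restrict_congr_set Iio_ae_eq_Iic, ← h1]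
    have := (Measure.measurePreserving_neg (volume : Measure ℝ)).setLIntegral_comp_preimage_emb
      (MeasurableEquiv.neg ℝ).measurableEmbedding (fun s => k |s|) (Ioi 0)
    rw [← this]
    simp
  rw [← lintegral_add_compl _ (measurableSet_Ioi (a := (0:ℝ))), compl_Ioi, h1, h2, two_mul]

theorem lintegral_abs_near {ρ : ℝ} (hρ : 0 < ρ) :
    ∫⁻ s : ℝ, (Iic ρ).indicator (fun s => ofReal (s ^ (-(1 / 2) : ℝ))) |s| =
      ofReal (4 * ρ ^ (1 / 2 : ℝ)) := by
  rw [lintegral_comp_abs_eq (k := (Iic ρ).indicator fun s => ofReal (s ^ (-(1 / 2) : ℝ))),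
    lintegral_indicator measurableSet_Iic, Measure.restrict_restrict measurableSet_Iic]
  have hs : Iic ρ ∩ Ioi 0 = Ioc 0 ρ := by ext; simp [and_comm]
  have hi := (intervalIntegral.intervalIntegrable_rpow' (a := 0) (b := ρ) (r := -(1 / 2))
    (by norm_num)).1
  rw [hs, ← ofReal_integral_eq_lintegral_ofReal hi ((ae_restrict_mem measurableSet_Ioc).mono
    fun s hs => Real.rpow_nonneg hs.1.le _), ← integral_of_le hρ.le,
    integral_rpow (Or.inl (by norm_num)), show (2 : ℝ≥0∞) = ofReal 2 by simp,
    ← ofReal_mul (by norm_num)]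
  congr 1
  norm_num
  ring

theorem lintegral_abs_far {ρ : ℝ} (hρ : 0 < ρ) :
    ∫⁻ s : ℝ, (Ioi ρ).indicator (fun s => ofReal (s ^ (-(1 / 2) : ℝ)) ^ (4 : ℝ)) |s| =
      ofReal (2 / ρ) := by
  rw [lintegral_comp_abs_eq (k := (Ioi ρ).indicator
    fun s => ofReal (s ^ (-(1 / 2) : ℝ)) ^ (4 : ℝ)),
    lintegral_indicator measurableSet_Ioi, Measure.restrict_restrict measurableSet_Ioi]
  have hs : Ioi ρ ∩ Ioi 0 = Ioi ρ := inter_eq_left.2 fun s hs => hρ.trans hs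
  have e : ∀ s ∈ Ioi ρ, ofReal (s ^ (-(1 / 2) : ℝ)) ^ (4 : ℝ) =
      ofReal (s ^ (-2 : ℝ)) := fun s hs => by
    have hs' : 0 < s := hρ.trans hs
    rw [ofReal_rpow_of_nonneg (by positivity) (by norm_num), ← Real.rpow_mul hs'.le]
    norm_num
  rw [hs, setLIntegral_congr_fun measurableSet_Ioi e, ← ofReal_integral_eq_lintegral_ofReal
    (integrableOn_Ioi_rpow_of_lt (by norm_num) hρ)
    ((ae_restrict_mem measurableSet_Ioi).mono fun r hr =>
      Real.rpow_nonneg (hρ.le.trans (le_of_lt hr)) _),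
    integral_Ioi_rpow_of_lt (by norm_num) hρ, show (2 : ℝ≥0∞) = ofReal 2 by simp,
    ← ofReal_mul (by norm_num)]
  congr 1
  norm_num [Real.rpow_neg_one]
  ring

theorem half_integral_trunc_le {μ : Measure ℝ} (hμ : μ ≤ volume) {a : ℝ → ℝ≥0∞} (ha : Measurable a)
    (b : ℝ≥0∞) (t : ℝ) {ρ : ℝ} (hρ : 0 < ρ) :
    ∫⁻ s, ({s | a s ≤ b}.indicator a s) * ofReal (|s - t| ^ (-(1 / 2) : ℝ)) ∂μ ≤
      b * ofReal (4 * ρ ^ (1 / 2 : ℝ)) +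
        (∫⁻ s, a s ^ (4 / 3 : ℝ) ∂μ) ^ (3 / 4 : ℝ) * ofReal (2 / ρ) ^ (1 / 4 : ℝ) := by
  set k : ℝ → ℝ≥0∞ := fun s => ofReal (s ^ (-(1 / 2) : ℝ)) with hk
  have mk : Measurable k := by fun_prop
  set n : ℝ → ℝ≥0∞ := fun s => (Iic ρ).indicator k |s - t|
  set l : ℝ → ℝ≥0∞ := fun s => (Ioi ρ).indicator k |s - t|
  have mn : Measurable n := (mk.indicator measurableSet_Iic).comp (by fun_prop)
  have ml : Measurable l := (mk.indicator measurableSet_Ioi).comp (by fun_prop)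
  have hp : ∀ s, ({s | a s ≤ b}.indicator a s) * ofReal (|s - t| ^ (-(1 / 2) : ℝ)) ≤
      b * n s + a s * l s := fun s => by
    by_cases h : a s ≤ b
    · rw [indicator_of_mem (show s ∈ {s | a s ≤ b} from h)]
      by_cases h' : |s - t| ≤ ρ
      · simp only [n, indicator_of_mem (show |s - t| ∈ Iic ρ from h')]
        exact (mul_le_mul' h le_rfl).trans le_self_add
      · simp only [l, indicator_of_mem (show |s - t| ∈ Ioi ρ from not_le.1 h')]
        exact le_add_self
    · rw [indicator_of_notMem (show s ∉ {s | a s ≤ b} from h)]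
      simp
  have en : ∫⁻ s, n s ∂μ ≤ ofReal (4 * ρ ^ (1 / 2 : ℝ)) := by
    refine (lintegral_mono' hμ le_rfl).trans (le_of_eq ?_)
    rw [← lintegral_abs_near hρ]
    exact lintegral_sub_right_eq_self (fun s => (Iic ρ).indicator k |s|) t
  have el : ∫⁻ s, l s ^ (4 : ℝ) ∂μ ≤ ofReal (2 / ρ) := by
    refine (lintegral_mono' hμ le_rfl).trans (le_of_eq ?_)
    rw [← lintegral_abs_far hρ, ← lintegral_sub_right_eq_self (fun s => (Ioi ρ).indicator
      (fun s => ofReal (s ^ (-(1 / 2) : ℝ)) ^ (4 : ℝ)) |s|) t]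
    refine lintegral_congr fun s => ?_
    by_cases h' : |s - t| ∈ Ioi ρ
    · simp only [l, indicator_of_mem h', hk]
    · simp only [l, indicator_of_notMem h']
      simp
  refine (lintegral_mono hp).trans ?_
  have mbn : Measurable fun s => b * n s := measurable_const.mul mn
  rw [lintegral_add_left mbn, lintegral_const_mul _ mn]
  refine add_le_add (mul_le_mul' le_rfl en) ?_
  have hH := ENNReal.lintegral_mul_le_Lp_mul_Lq μ (p := 4 / 3) (q := 4)
    (by constructor <;> norm_num) ha.aemeasurable ml.aemeasurable
  refine hH.trans ?_
  rw [show (1 / (4 / 3) : ℝ) = 3 / 4 by norm_num]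
  exact mul_le_mul' le_rfl (rpow_le_rpow el (by norm_num))

theorem half_integral_le {μ : Measure ℝ} (hμ : μ ≤ volume) {a : ℝ → ℝ≥0∞} (ha : Measurable a)
    (hA : ∫⁻ s, a s ^ (4 / 3 : ℝ) ∂μ ≠ ⊤) (hA0 : ∫⁻ s, a s ^ (4 / 3 : ℝ) ∂μ ≠ 0) {t : ℝ}
    (ht : a t ≠ ⊤) :
    ∫⁻ s, ({s | a s ≤ a t}.indicator a s) * ofReal (|s - t| ^ (-(1 / 2) : ℝ)) ∂μ ≤
      6 * (∫⁻ s, a s ^ (4 / 3 : ℝ) ∂μ) ^ (1 / 2 : ℝ) * a t ^ (1 / 3 : ℝ) := by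
  rcases eq_or_ne (a t) 0 with h0 | h0
  · refine le_trans (le_of_eq ?_) bot_le
    rw [bot_eq_zero']
    refine lintegral_eq_zero_of_ae_eq_zero (of_forall fun s => ?_)
    change {s | a s ≤ a t}.indicator a s * ofReal (|s - t| ^ (-(1 / 2) : ℝ)) = 0
    by_cases h : a s ≤ a t
    · rw [indicator_of_mem (show s ∈ {s | a s ≤ a t} from h), le_antisymm (h.trans h0.le) bot_le]
      simp
    · rw [indicator_of_notMem (show s ∉ {s | a s ≤ a t} from h)]
      simp
  obtain ⟨A, hAe⟩ : ∃ A : ℝ, ∫⁻ s, a s ^ (4 / 3 : ℝ) ∂μ = ofReal A :=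
    ⟨_, (ofReal_toReal hA).symm⟩
  obtain ⟨b, hb⟩ : ∃ b : ℝ, a t = ofReal b := ⟨_, (ofReal_toReal ht).symm⟩
  have hAp : 0 < A := by rw [hAe] at hA0; simpa using hA0
  have hbp : 0 < b := by rw [hb] at h0; simpa using h0
  have hρ : 0 < A * b ^ (-(4 / 3) : ℝ) := by positivity
  refine (half_integral_trunc_le hμ ha (a t) t hρ).trans ?_
  rw [hAe, hb, ofReal_rpow_of_nonneg hAp.le (by norm_num),
    ofReal_rpow_of_nonneg hAp.le (by norm_num),
    ofReal_rpow_of_nonneg hbp.le (by norm_num),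
    ofReal_rpow_of_nonneg (by positivity) (by norm_num), ← ofReal_mul hbp.le,
    ← ofReal_mul (by positivity), ← ofReal_add (by positivity) (by positivity),
    show (6 : ℝ≥0∞) = ofReal 6 by simp, ← ofReal_mul (by norm_num),
    ← ofReal_mul (by positivity)]
  refine ofReal_le_ofReal ?_
  have e1 : b * (4 * (A * b ^ (-(4 / 3) : ℝ)) ^ (1 / 2 : ℝ)) = 4 * (A ^ (1 / 2 : ℝ) * b ^ (1 / 3 : ℝ)) := by
    rw [Real.mul_rpow hAp.le (by positivity), ← Real.rpow_mul hbp.le]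
    have : b * b ^ (-(4 / 3) * (1 / 2) : ℝ) = b ^ (1 / 3 : ℝ) := by
      nth_rewrite 1 [← Real.rpow_one b]
      rw [← Real.rpow_add hbp]; norm_num
    rw [← this]; ring
  have e2 : A ^ (3 / 4 : ℝ) * (2 / (A * b ^ (-(4 / 3) : ℝ))) ^ (1 / 4 : ℝ) =
      2 ^ (1 / 4 : ℝ) * (A ^ (1 / 2 : ℝ) * b ^ (1 / 3 : ℝ)) := by
    rw [Real.div_rpow (by norm_num) hρ.le, Real.mul_rpow hAp.le (by positivity), ← Real.rpow_mul hbp.le,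
      div_eq_mul_inv (2 ^ (1 / 4 : ℝ) : ℝ), mul_inv, ← Real.rpow_neg hAp.le, ← Real.rpow_neg hbp.le]
    have : A ^ (3 / 4 : ℝ) * A ^ (-(1 / 4) : ℝ) = A ^ (1 / 2 : ℝ) := by
      rw [← Real.rpow_add hAp]; norm_num
    rw [← this]; norm_num; ring
  rw [e1, e2]
  have e3 : (2 : ℝ) ^ (1 / 4 : ℝ) ≤ 2 := by
    calc (2 : ℝ) ^ (1 / 4 : ℝ) ≤ 2 ^ (1 : ℝ) := Real.rpow_le_rpow_of_exponent_le (by norm_num) (by norm_num)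
      _ = 2 := by norm_num
  have : 0 ≤ A ^ (1 / 2 : ℝ) * b ^ (1 / 3 : ℝ) := by positivity
  nlinarith

theorem hardy_littlewood_sobolev_half {μ : Measure ℝ} [SFinite μ] (hμ : μ ≤ volume) {a : ℝ → ℝ≥0∞}
    (ha : Measurable a) :
    ∫⁻ t, ∫⁻ s, a s * a t * ofReal (|s - t| ^ (-(1 / 2) : ℝ)) ∂μ ∂μ ≤
      12 * (∫⁻ s, a s ^ (4 / 3 : ℝ) ∂μ) ^ (3 / 2 : ℝ) := by
  set A := ∫⁻ s, a s ^ (4 / 3 : ℝ) ∂μ with hAdef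
  rcases eq_or_ne A ⊤ with hA | hA
  · rw [hA, ENNReal.top_rpow_of_pos (by norm_num)]; simp
  rcases eq_or_ne A 0 with hA0 | hA0
  · have h0 : ∀ᵐ s ∂μ, a s = 0 := by
      have := (lintegral_eq_zero_iff (ha.pow_const _)).1 hA0
      filter_upwards [this] with s hs
      simpa [show ¬ (4 / 3 : ℝ) < 0 by norm_num] using hs
    refine le_trans (le_of_eq ?_) bot_le
    refine lintegral_eq_zero_of_ae_eq_zero ?_
    filter_upwards [h0] with t ht
    simp [ht]
  have hfin : ∀ᵐ t ∂μ, a t ≠ ⊤ := by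
    filter_upwards [ae_lt_top (ha.pow_const _) hA] with t ht h
    rw [h] at ht
    simp at ht
  set k : ℝ → ℝ → ℝ≥0∞ := fun s t => ofReal (|s - t| ^ (-(1 / 2) : ℝ)) with hk
  have ksymm : ∀ s t, k s t = k t s := fun s t => by simp only [hk, abs_sub_comm]
  set Θ : ℝ → ℝ → ℝ≥0∞ := fun s t => {s | a s ≤ a t}.indicator a s * k s t * a t with hΘ
  have hset : MeasurableSet {z : ℝ × ℝ | a z.2 ≤ a z.1} :=
    measurableSet_le (ha.comp measurable_snd) (ha.comp measurable_fst)
  have mΘ : Measurable fun z : ℝ × ℝ => Θ z.2 z.1 := by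
    have : (fun z : ℝ × ℝ => Θ z.2 z.1) = fun z : ℝ × ℝ =>
      {z : ℝ × ℝ | a z.2 ≤ a z.1}.indicator (fun z => a z.2) z * k z.2 z.1 * a z.1 := by
      funext z
      simp only [hΘ]
      congr 2
    rw [this]
    exact ((((ha.comp measurable_snd).indicator hset).mul (by fun_prop)).mul (ha.comp measurable_fst))
  have mΘ' : Measurable fun z : ℝ × ℝ => Θ z.1 z.2 := mΘ.comp measurable_swap
  have hp : ∀ s t, a s * a t * k s t ≤ Θ s t + Θ t s := fun s t => by
    rcases le_total (a s) (a t) with h | h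
    · refine le_trans (le_of_eq ?_) le_self_add
      simp only [hΘ, indicator_of_mem (show s ∈ {s | a s ≤ a t} from h)]
      ring
    · refine le_trans (le_of_eq ?_) le_add_self
      simp only [hΘ, indicator_of_mem (show t ∈ {t | a t ≤ a s} from h), ksymm t s]
      ring
  have hmain : ∫⁻ t, ∫⁻ s, Θ s t ∂μ ∂μ ≤ 6 * A ^ (3 / 2 : ℝ) := by
    calc ∫⁻ t, ∫⁻ s, Θ s t ∂μ ∂μ ≤ ∫⁻ t, 6 * A ^ (1 / 2 : ℝ) * a t ^ (4 / 3 : ℝ) ∂μ := by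
          refine lintegral_mono_ae ?_
          filter_upwards [hfin] with t ht
          simp only [hΘ]
          rw [lintegral_mul_const' _ _ ht]
          refine (mul_le_mul' (half_integral_le hμ ha hA hA0 ht) le_rfl).trans (le_of_eq ?_)
          have : a t ^ (4 / 3 : ℝ) = a t ^ (1 / 3 : ℝ) * a t := by
            rw [show (4 / 3 : ℝ) = 1 / 3 + 1 by norm_num,
              rpow_add_of_nonneg _ _ (by norm_num) (by norm_num), ENNReal.rpow_one]
          rw [this, mul_assoc, mul_assoc]
      _ = _ := by
          rw [lintegral_const_mul _ (ha.pow_const _), ← hAdef, mul_assoc,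
            show (3 / 2 : ℝ) = 1 / 2 + 1 by norm_num,
            rpow_add_of_nonneg _ _ (by norm_num) (by norm_num), ENNReal.rpow_one]
  calc _ ≤ ∫⁻ t, ∫⁻ s, (Θ s t + Θ t s) ∂μ ∂μ := lintegral_mono fun t => lintegral_mono fun s => hp s t
    _ = ∫⁻ t, ∫⁻ s, Θ s t ∂μ ∂μ + ∫⁻ t, ∫⁻ s, Θ t s ∂μ ∂μ := by
        rw [← lintegral_add_left mΘ.lintegral_prod_right']
        refine lintegral_congr fun t => ?_
        rw [lintegral_add_left]
        exact mΘ.comp (measurable_prodMk_left (x := t))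
    _ = ∫⁻ t, ∫⁻ s, Θ s t ∂μ ∂μ + ∫⁻ t, ∫⁻ s, Θ s t ∂μ ∂μ := by
        congr 1
        rw [lintegral_lintegral_swap mΘ'.aemeasurable]
    _ ≤ 6 * A ^ (3 / 2 : ℝ) + 6 * A ^ (3 / 2 : ℝ) := add_le_add hmain hmain
    _ = _ := by rw [← add_mul]; norm_num

/-! ### Strichartz estimate in `L⁴L¹²` -/

theorem measurable_sm_param {α : Type*} [MeasurableSpace α] {r : α → ℝ} (hr : Measurable r)
    {ψ : α × Space → ℝ≥0∞} (hψ : Measurable ψ) :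
    Measurable fun z : α × Space => sm (r z.1) (fun y => ψ (z.1, y)) z.2 := by
  have : Measurable fun q : (α × Space) × Space => ψ (q.1.1, q.1.2 + r q.1.1 • q.2) :=
    hψ.comp ((measurable_fst.comp measurable_fst).prodMk ((measurable_snd.comp measurable_fst).add
      ((hr.comp (measurable_fst.comp measurable_fst)).smul measurable_snd)))
  exact ((hr.comp measurable_fst).ennreal_ofReal).mul this.lintegral_prod_right'

theorem measurable_slice {α : Type*} [MeasurableSpace α] {ψ : α × Space → ℝ≥0∞} (hψ : Measurable ψ)
    (t : α) : Measurable fun y => ψ (t, y) := hψ.comp measurable_prodMk_left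

theorem lintegral_sum_sm_sq_le {μ : Measure ℝ} [SFinite μ] (hμ : μ ≤ volume) {ψ : ℝ⁴ → ℝ≥0∞}
    (hψ : Measurable ψ) (s : ℝ) :
    ∫⁻ x, (∫⁻ t, sm (t - s) (fun y => ψ (t, y)) x ∂μ) ^ 2 ≤
      12 * bilConst * (∫⁻ t, dualNorm (fun y => ψ (t, y)) ^ (4 / 3 : ℝ) ∂μ) ^ (3 / 2 : ℝ) := by
  set P : ℝ → Space → ℝ≥0∞ := fun t x => sm (t - s) (fun y => ψ (t, y)) x with hP
  set d : ℝ → ℝ≥0∞ := fun t => dualNorm (fun y => ψ (t, y)) with hd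
  have mP : Measurable fun z : ℝ⁴ => P z.1 z.2 :=
    measurable_sm_param (r := fun t => t - s) (by fun_prop) hψ
  have md : Measurable d := by
    have : Measurable fun t => ∫⁻ y, ψ (t, y) ^ (12 / 11 : ℝ) := (hψ.pow_const _).lintegral_prod_right'
    exact this.pow_const _
  have mPt : ∀ t, Measurable (P t) := fun t => mP.comp measurable_prodMk_left
  have mPx : ∀ x, Measurable fun t => P t x := fun x => mP.comp measurable_prodMk_right
  have e1 : ∀ x, (∫⁻ t, P t x ∂μ) ^ 2 = ∫⁻ t, ∫⁻ t', P t' x * P t x ∂μ ∂μ := fun x => by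
    rw [sq, ← lintegral_const_mul _ (mPx x)]
    refine lintegral_congr fun t => ?_
    rw [lintegral_mul_const _ (mPx x)]
  have m3 : Measurable fun q : (Space × ℝ) × ℝ => P q.2 q.1.1 * P q.1.2 q.1.1 :=
    (mP.comp (measurable_snd.prodMk (measurable_fst.comp measurable_fst))).mul
      (mP.comp ((measurable_snd.comp measurable_fst).prodMk (measurable_fst.comp measurable_fst)))
  have hne : ∀ t : ℝ, ∀ᵐ t' ∂μ, t' ≠ t := fun t =>
    (Measure.absolutelyContinuous_of_le hμ).ae_le (Measure.ae_ne volume t)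
  calc ∫⁻ x, (∫⁻ t, P t x ∂μ) ^ 2 = ∫⁻ x, ∫⁻ t, ∫⁻ t', P t' x * P t x ∂μ ∂μ := lintegral_congr e1
    _ = ∫⁻ t, (∫⁻ x, ∫⁻ t', P t' x * P t x ∂μ) ∂μ := by
        rw [lintegral_lintegral_swap (f := fun x t => ∫⁻ t', P t' x * P t x ∂μ)
          m3.lintegral_prod_right'.aemeasurable]
    _ = ∫⁻ t, ∫⁻ t', (∫⁻ x, P t' x * P t x) ∂μ ∂μ := by
        refine lintegral_congr fun t => ?_
        have m2 : Measurable fun q : Space × ℝ => P q.2 q.1 * P t q.1 :=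
          (mP.comp (measurable_snd.prodMk measurable_fst)).mul ((mPt t).comp measurable_fst)
        rw [lintegral_lintegral_swap m2.aemeasurable]
    _ ≤ ∫⁻ t, ∫⁻ t', bilConst * (d t' * d t * ofReal (|t' - t| ^ (-(1 / 2) : ℝ))) ∂μ ∂μ := by
        refine lintegral_mono fun t => lintegral_mono_ae ?_
        filter_upwards [hne t] with t' ht'
        refine (lintegral_sm_mul_sm_le (measurable_slice hψ t') (measurable_slice hψ t)
          (show t' - s ≠ t - s by simpa using ht')).trans (le_of_eq ?_)
        rw [sub_sub_sub_cancel_right]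
        simp only [hd]
        ring
    _ = bilConst * ∫⁻ t, ∫⁻ t', d t' * d t * ofReal (|t' - t| ^ (-(1 / 2) : ℝ)) ∂μ ∂μ := by
        rw [← lintegral_const_mul' _ _ bilConst_ne_top]
        refine lintegral_congr fun t => ?_
        rw [lintegral_const_mul' _ _ bilConst_ne_top]
    _ ≤ bilConst * (12 * (∫⁻ t, d t ^ (4 / 3 : ℝ) ∂μ) ^ (3 / 2 : ℝ)) :=
        mul_le_mul' le_rfl (hardy_littlewood_sobolev_half hμ md)
    _ = _ := by ring

theorem rpow_third_le_dual_pairing {n : ℝ≥0∞} {w : Space → ℝ≥0∞} (hw : Measurable w)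
    (hn : n = ∫⁻ x, w x ^ 12) (hn' : n ≠ ⊤) :
    n ^ (1 / 3 : ℝ) ≤ ∫⁻ x, w x * (w x ^ 11 * n ^ (-(2 / 3) : ℝ)) := by
  rcases eq_or_ne n 0 with h0 | h0
  · rw [h0, ENNReal.zero_rpow_of_pos (by norm_num)]; exact bot_le
  have : ∀ x, w x * (w x ^ 11 * n ^ (-(2 / 3) : ℝ)) = w x ^ 12 * n ^ (-(2 / 3) : ℝ) := fun x => by ring
  simp only [this]
  rw [lintegral_mul_const _ (hw.pow_const _), ← hn]
  nth_rewrite 2 [← ENNReal.rpow_one n]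
  rw [← ENNReal.rpow_add _ _ h0 hn']
  norm_num

theorem dualNorm_dual_le {n : ℝ≥0∞} {w : Space → ℝ≥0∞} (hw : Measurable w)
    (hn : n = ∫⁻ x, w x ^ 12) :
    dualNorm (fun x => w x ^ 11 * n ^ (-(2 / 3) : ℝ)) ≤ n ^ (1 / 4 : ℝ) := by
  rcases eq_or_ne n ⊤ with ht | ht
  · have : n ^ (1 / 4 : ℝ) = ⊤ := by rw [ht, ENNReal.top_rpow_of_pos (by norm_num)]
    rw [this]; exact le_top
  have hp : ∀ x, (w x ^ 11 * n ^ (-(2 / 3) : ℝ)) ^ (12 / 11 : ℝ) = w x ^ 12 * n ^ (-(8 / 11) : ℝ) := by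
    intro x
    rw [mul_rpow_of_nonneg _ _ (by norm_num), ← rpow_mul, ← rpow_natCast,
      ← rpow_mul, ← rpow_natCast (w x) 12]
    norm_num
  rw [dualNorm]
  simp only [hp]
  rcases eq_or_ne n 0 with h0 | h0
  · have : ∀ᵐ x, w x ^ 12 = 0 := (lintegral_eq_zero_iff (hw.pow_const _)).1 (hn ▸ h0)
    rw [lintegral_eq_zero_of_ae_eq_zero (by filter_upwards [this] with x hx; simp [hx]),
      ENNReal.zero_rpow_of_pos (by norm_num)]
    exact bot_le
  rw [lintegral_mul_const _ (hw.pow_const _), ← hn]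
  refine le_of_eq ?_
  nth_rewrite 1 [← ENNReal.rpow_one n]
  rw [← ENNReal.rpow_add _ _ h0 ht, ← rpow_mul]
  norm_num

/-- A measurable function dominated by a superposition of spherical means of `F` satisfies the
`L⁴L¹²` Strichartz bound. -/
theorem strichartz {ν μ : Measure ℝ} [SFinite ν] [SFinite μ] (hμ : μ ≤ volume)
    {F w : ℝ⁴ → ℝ≥0∞} (hF : Measurable F) (hw : Measurable w)
    (hle : ∀ᵐ t ∂μ, ∀ x, w (t, x) ≤ ∫⁻ s, sm (t - s) (fun y => F (s, y)) x ∂ν)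
    (hY : ∫⁻ t, (∫⁻ x, w (t, x) ^ 12) ^ (1 / 3 : ℝ) ∂μ ≠ ⊤) :
    ∫⁻ t, (∫⁻ x, w (t, x) ^ 12) ^ (1 / 3 : ℝ) ∂μ ≤
      (12 * bilConst) ^ 2 * (∫⁻ s, (∫⁻ x, F (s, x) ^ 2) ^ (1 / 2 : ℝ) ∂ν) ^ 4 := by
  set n : ℝ → ℝ≥0∞ := fun t => ∫⁻ x, w (t, x) ^ 12 with hn
  set Y := ∫⁻ t, n t ^ (1 / 3 : ℝ) ∂μ with hYdef
  set S := ∫⁻ s, (∫⁻ x, F (s, x) ^ 2) ^ (1 / 2 : ℝ) ∂ν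
  have mn : Measurable n := (hw.pow_const _).lintegral_prod_right'
  set ψ : ℝ⁴ → ℝ≥0∞ := fun z => w z ^ 11 * n z.1 ^ (-(2 / 3) : ℝ) with hψdef
  have mψ : Measurable ψ := (hw.pow_const _).mul ((mn.comp measurable_fst).pow_const _)
  have hnt : ∀ᵐ t ∂μ, n t ≠ ⊤ := by
    filter_upwards [ae_lt_top (mn.pow_const _) hY] with t ht h
    rw [h] at ht
    simp at ht
  have mF3 : Measurable fun q : ℝ⁴ × ℝ => sm (q.1.1 - q.2) (fun y => F (q.2, y)) q.1.2 := by
    have h := measurable_sm_param (α := ℝ × ℝ) (r := fun z => z.1 - z.2) (by fun_prop)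
      (ψ := fun q => F (q.1.2, q.2)) (hF.comp (by fun_prop))
    exact h.comp (g := fun z : (ℝ × ℝ) × Space => sm (z.1.1 - z.1.2) (fun y => F (z.1.2, y)) z.2)
      (f := fun q : ℝ⁴ × ℝ => ((q.1.1, q.2), q.1.2)) (by fun_prop)
  have mψ3 : Measurable fun q : ℝ⁴ × ℝ => sm (q.2 - q.1.1) (fun y => ψ (q.2, y)) q.1.2 := by
    have h := measurable_sm_param (α := ℝ × ℝ) (r := fun z => z.1 - z.2) (by fun_prop)
      (ψ := fun q => ψ (q.1.1, q.2)) (mψ.comp (by fun_prop))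
    exact h.comp (g := fun z : (ℝ × ℝ) × Space => sm (z.1.1 - z.1.2) (fun y => ψ (z.1.1, y)) z.2)
      (f := fun q : ℝ⁴ × ℝ => ((q.2, q.1.1), q.1.2)) (by fun_prop)
  have h1 : Y ≤ ∫⁻ s, (∫⁻ x, F (s, x) * ∫⁻ t, sm (t - s) (fun y => ψ (t, y)) x ∂μ) ∂ν := by
    calc Y ≤ ∫⁻ t, (∫⁻ x, (∫⁻ s, sm (t - s) (fun y => F (s, y)) x ∂ν) * ψ (t, x)) ∂μ := by
          refine lintegral_mono_ae ?_
          filter_upwards [hnt, hle] with t ht hl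
          refine (rpow_third_le_dual_pairing (measurable_slice hw t) rfl ht).trans ?_
          exact lintegral_mono fun x => mul_le_mul' (hl x) le_rfl
      _ = ∫⁻ t, (∫⁻ s, (∫⁻ x, sm (t - s) (fun y => F (s, y)) x * ψ (t, x)) ∂ν) ∂μ := by
          refine lintegral_congr fun t => ?_
          have m2 : Measurable fun q : Space × ℝ => sm (t - q.2) (fun y => F (q.2, y)) q.1 * ψ (t, q.1) :=
            (mF3.comp (f := fun q : Space × ℝ => ((t, q.1), q.2)) (by fun_prop)).mul
              ((measurable_slice mψ t).comp measurable_fst)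
          rw [← lintegral_lintegral_swap m2.aemeasurable]
          refine lintegral_congr fun x => ?_
          have m1 : Measurable fun s => sm (t - s) (fun y => F (s, y)) x :=
            mF3.comp (f := fun s : ℝ => ((t, x), s)) (by fun_prop)
          rw [lintegral_mul_const _ m1]
      _ = ∫⁻ t, (∫⁻ s, (∫⁻ x, F (s, x) * sm (t - s) (fun y => ψ (t, y)) x) ∂ν) ∂μ := by
          refine lintegral_congr fun t => lintegral_congr fun s => ?_
          rw [lintegral_mul_sm (measurable_slice hF s) (measurable_slice mψ t)]
      _ = ∫⁻ s, (∫⁻ t, (∫⁻ x, F (s, x) * sm (t - s) (fun y => ψ (t, y)) x) ∂μ) ∂ν := by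
          have m3 : Measurable fun q : (ℝ × ℝ) × Space =>
              F (q.1.2, q.2) * sm (q.1.1 - q.1.2) (fun y => ψ (q.1.1, y)) q.2 :=
            (hF.comp (by fun_prop)).mul
              (mψ3.comp (f := fun q : (ℝ × ℝ) × Space => ((q.1.2, q.2), q.1.1)) (by fun_prop))
          exact lintegral_lintegral_swap m3.lintegral_prod_right'.aemeasurable
      _ = _ := by
          refine lintegral_congr fun s => ?_
          have m2 : Measurable fun q : ℝ⁴ => F (s, q.2) * sm (q.1 - s) (fun y => ψ (q.1, y)) q.2 :=
            ((measurable_slice hF s).comp measurable_snd).mul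
              (mψ3.comp (f := fun q : ℝ⁴ => ((s, q.2), q.1)) (by fun_prop))
          rw [lintegral_lintegral_swap m2.aemeasurable]
          refine lintegral_congr fun x => ?_
          have m1 : Measurable fun t => sm (t - s) (fun y => ψ (t, y)) x :=
            mψ3.comp (f := fun t : ℝ => ((s, x), t)) (by fun_prop)
          rw [lintegral_const_mul _ m1]
  have hd : (∫⁻ t, dualNorm (fun y => ψ (t, y)) ^ (4 / 3 : ℝ) ∂μ) ≤ Y := by
    refine lintegral_mono fun t => ?_
    refine (rpow_le_rpow (dualNorm_dual_le (measurable_slice hw t) rfl) (by norm_num)).trans ?_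
    rw [← rpow_mul]
    norm_num [hn]
  have h2 : Y ≤ S * ((12 * bilConst) ^ (1 / 2 : ℝ) * Y ^ (3 / 4 : ℝ)) := by
    refine h1.trans ?_
    have hc : (12 * bilConst) ^ (1 / 2 : ℝ) * Y ^ (3 / 4 : ℝ) ≠ ⊤ :=
      ENNReal.mul_ne_top (rpow_ne_top_of_nonneg (by norm_num)
        (ENNReal.mul_ne_top (by norm_num) bilConst_ne_top)) (rpow_ne_top_of_nonneg (by norm_num) hY)
    rw [← lintegral_mul_const' _ _ hc]
    refine lintegral_mono fun s => ?_
    have mP : Measurable fun x => ∫⁻ t, sm (t - s) (fun y => ψ (t, y)) x ∂μ := by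
      have : Measurable fun q : Space × ℝ => sm (q.2 - s) (fun y => ψ (q.2, y)) q.1 :=
        mψ3.comp (f := fun q : Space × ℝ => ((s, q.1), q.2)) (by fun_prop)
      exact this.lintegral_prod_right'
    have hH := ENNReal.lintegral_mul_le_Lp_mul_Lq (volume : Measure Space) (p := 2) (q := 2)
      (by constructor <;> norm_num) (measurable_slice hF s).aemeasurable mP.aemeasurable
    refine hH.trans ?_
    simp only [ENNReal.rpow_two]
    refine mul_le_mul' le_rfl ?_
    refine (rpow_le_rpow ((lintegral_sum_sm_sq_le hμ mψ s).trans
      (mul_le_mul' le_rfl (rpow_le_rpow hd (by norm_num)))) (by norm_num)).trans (le_of_eq ?_)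
    rw [mul_rpow_of_nonneg _ _ (by norm_num), ← rpow_mul]
    norm_num
  rcases eq_or_ne Y 0 with h0 | h0
  · rw [h0]; exact bot_le
  have h3 : Y ^ (1 / 4 : ℝ) ≤ S * (12 * bilConst) ^ (1 / 2 : ℝ) := by
    have hz : Y ^ (3 / 4 : ℝ) ≠ 0 := by simp [h0, hY]
    have hz' : Y ^ (3 / 4 : ℝ) ≠ ⊤ := rpow_ne_top_of_nonneg (by norm_num) hY
    rw [← ENNReal.mul_le_mul_iff_left hz hz', ← ENNReal.rpow_add _ _ h0 hY]
    norm_num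
    rw [mul_assoc]
    convert h2 using 3
  calc Y = (Y ^ (1 / 4 : ℝ)) ^ 4 := by
        rw [← rpow_natCast, ← rpow_mul]; norm_num
    _ ≤ (S * (12 * bilConst) ^ (1 / 2 : ℝ)) ^ 4 := pow_le_pow_left' h3 4
    _ = _ := by
        rw [mul_pow, ← rpow_natCast ((12 * bilConst) ^ (1 / 2 : ℝ)), ← rpow_mul, mul_comm,
          ← rpow_natCast (12 * bilConst) 2]
        norm_num

/-! ### Time translations and reflections -/

/-- Precomposition with the affine map `t ↦ σ t + b` of the time axis. -/
def timeMap (σ b : ℝ) (U : ℝ⁴ → ℝ) (p : ℝ⁴) : ℝ := U (σ * p.1 + b, p.2)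

theorem contDiff_timeMap (σ b : ℝ) {U : ℝ⁴ → ℝ} (hU : Smooth U) :
    Smooth (timeMap σ b U) :=
  hU.comp (by fun_prop : Smooth fun p : ℝ⁴ => (σ * p.1 + b, p.2))

theorem dd_timeMap (σ b : ℝ) {U : ℝ⁴ → ℝ} (hU : Differentiable ℝ U) (v p : ℝ⁴) :
    dd v (timeMap σ b U) p = dd (σ * v.1, v.2) U (σ * p.1 + b, p.2) := by
  have h1 : HasFDerivAt (fun p : ℝ⁴ => (σ * p.1 + b, p.2))
      ((σ • ContinuousLinearMap.fst ℝ ℝ Space).prod (ContinuousLinearMap.snd ℝ ℝ Space)) p :=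
    ((hasFDerivAt_fst.const_mul σ).add_const b).prodMk hasFDerivAt_snd
  have h2 : HasFDerivAt (timeMap σ b U) _ p := HasFDerivAt.comp (f := fun p : ℝ⁴ => (σ * p.1 + b, p.2)) p
    (hU _).hasFDerivAt h1
  rw [dd, h2.fderiv]
  simp [dd]

theorem dd_vt_timeMap (σ b : ℝ) {U : ℝ⁴ → ℝ} (hU : Differentiable ℝ U) :
    dd vt (timeMap σ b U) = fun p => σ * timeMap σ b (dd vt U) p := by
  funext p
  rw [dd_timeMap σ b hU]
  have : ((σ * vt.1, vt.2) : ℝ⁴) = σ • vt := by simp [vt]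
  rw [this]
  simp [dd, timeMap]

theorem dd_vx_timeMap (σ b : ℝ) {U : ℝ⁴ → ℝ} (hU : Differentiable ℝ U) (i : Fin 3) :
    dd (vx i) (timeMap σ b U) = timeMap σ b (dd (vx i) U) := by
  funext p
  rw [dd_timeMap σ b hU]
  have : ((σ * (vx i).1, (vx i).2) : ℝ⁴) = vx i := by simp [vx]
  rw [this]
  rfl

theorem box_timeMap {σ : ℝ} (hσ : σ ^ 2 = 1) (b : ℝ) {U : ℝ⁴ → ℝ} (hU : Smooth U)
    (p : ℝ⁴) : box (timeMap σ b U) p = box U (σ * p.1 + b, p.2) := by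
  have h1 : dd vt (dd vt (timeMap σ b U)) p = dd vt (dd vt U) (σ * p.1 + b, p.2) := by
    rw [dd_vt_timeMap σ b hU.dble, dd_mul (differentiable_const σ)
      (contDiff_timeMap σ b (hU.dd_top vt)).dble, dd_vt_timeMap σ b (hU.dd_top vt).dble]
    simp only [dd_const_fun, timeMap]
    linear_combination dd vt (dd vt U) (σ * p.1 + b, p.2) * hσ
  rw [box, h1, box]
  congr 1
  refine sum_congr rfl fun i _ => ?_
  rw [dd_vx_timeMap σ b hU.dble, dd_vx_timeMap σ b (hU.dd_top _).dble]
  rfl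

theorem edens_timeMap {σ : ℝ} (hσ : σ ^ 2 = 1) (b : ℝ) (H : ℝ → ℝ) {U : ℝ⁴ → ℝ}
    (hU : Differentiable ℝ U) (p : ℝ⁴) :
    edens H (timeMap σ b U) p = edens H U (σ * p.1 + b, p.2) := by
  simp only [edens, dd_vt_timeMap σ b hU, dd_vx_timeMap σ b hU, mul_pow, hσ, one_mul, timeMap]

theorem SpaceCpt.timeMap {U : ℝ⁴ → ℝ} (hU : SpaceCpt U) (σ b : ℝ) : SpaceCpt (timeMap σ b U) := by
  obtain ⟨R, L, hR⟩ := hU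
  refine ⟨R + |L| * |b|, |L| * |σ|, fun p hp => hR _ (lt_of_le_of_lt ?_ hp)⟩
  have h1 : L * |σ * p.1 + b| ≤ |L| * (|σ| * |p.1| + |b|) :=
    mul_le_mul (le_abs_self L) ((abs_add_le _ _).trans (by rw [abs_mul])) (abs_nonneg _) (abs_nonneg _)
  simp only
  linarith

/-! ### Free waves -/

theorem ofReal_nFour {U : ℝ⁴ → ℝ} (hU : Continuous U) (hUc : SpaceCpt U) (t : ℝ) :
    (∫⁻ x, ‖U (t, x)‖ₑ ^ 12) ^ (1 / 3 : ℝ) = ofReal (nFour U t) := by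
  rw [nFour, ← ofReal_rpow_of_nonneg (integral_nonneg fun x => Even.pow_nonneg (by decide) _) (by norm_num),
    lintegral_enorm_even_pow (by decide) ((hUc.slice t).integrable_pow (hU.comp (by fun_prop)) (by norm_num))]

theorem lintegral_ofReal_nFour {U : ℝ⁴ → ℝ} (hU : Smooth U) (hUc : SpaceCpt U)
    {a b : ℝ} (hab : a ≤ b) :
    ∫⁻ t in Icc a b, (∫⁻ x, ‖U (t, x)‖ₑ ^ 12) ^ (1 / 3 : ℝ) =
      ofReal (∫ t in a..b, nFour U t) := by
  simp only [ofReal_nFour hU.continuous hUc]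
  rw [integral_of_le hab, ← integral_Icc_eq_integral_Ioc,
    ofReal_integral_eq_lintegral_ofReal
    ((continuous_nFour hU hUc).integrableOn_Icc) (of_forall fun t => nFour_nonneg U t)]

theorem exists_freeWave_decay {u₀ u₁ : Space → ℝ} (h₀ : Smooth u₀)
    (h₁ : Continuous u₁) (hc₀ : HasCompactSupport u₀) (hc₁ : HasCompactSupport u₁) :
    ∃ C : ℝ, 0 ≤ C ∧ ∀ p : ℝ⁴, 1 ≤ |p.1| → |freeWave u₀ u₁ p| ≤ C / |p.1| := by
  let K : Space → ℝ := fun y => |u₀ y| + (‖fderiv ℝ u₀ y‖ + |u₁ y|)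
  have hK : Continuous K := h₀.continuous.abs.add
    ((h₀.continuous_fderiv (by simp)).norm.add h₁.abs)
  have hKc : HasCompactSupport K :=
    (hc₀.comp_left (g := fun z : ℝ => |z|) (by simp)).add
      (((hc₀.fderiv (𝕜 := ℝ)).norm).add (hc₁.comp_left (g := fun z : ℝ => |z|) (by simp)))
  obtain ⟨M, hM⟩ := hKc.exists_bound_of_continuous hK
  obtain ⟨R, hR⟩ := hKc.isBounded.exists_norm_le
  have hM0 : 0 ≤ M := (norm_nonneg _).trans (hM 0)
  set R' := max R 0
  refine ⟨8 * M * R' ^ 2, by positivity, fun p hp => ?_⟩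
  have hp0 : 0 < |p.1| := by linarith
  have hKn : ∀ y, 0 ≤ K y := fun y => by positivity
  have hle : ∀ y, K y ≤ {y : Space | ‖y‖ ≤ R'}.indicator (fun _ => M) y := fun y => by
    by_cases hy : ‖y‖ ≤ R'
    · rw [indicator_of_mem (show y ∈ {y : Space | ‖y‖ ≤ R'} from hy)]
      exact (le_abs_self _).trans (hM y)
    · have : y ∉ tsupport K := fun h => hy ((hR y h).trans (le_max_left _ _))
      rw [image_eq_zero_of_notMem_tsupport this]
      exact indicator_nonneg (fun _ _ => hM0) _
  have hset : MeasurableSet {ω : Space | ‖p.2 + p.1 • ω‖ ≤ R'} :=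
    measurableSet_le (by fun_prop) (by fun_prop)
  have hcap : (sph {ω : Space | ‖p.2 + p.1 • ω‖ ≤ R'}).toReal ≤ 4 * R' ^ 2 / |p.1| ^ 2 := by
    refine ENNReal.toReal_le_of_le_ofReal (by positivity) ?_
    rcases le_or_gt 0 p.1 with h | h
    · rw [abs_of_nonneg h] at hp0 ⊢
      exact cap_le _ hp0 (le_max_right _ _)
    · refine le_trans (le_of_eq ?_) (cap_le (-p.2) hp0 (le_max_right R 0))
      congr 1
      ext ω
      change ‖p.2 + p.1 • ω‖ ≤ R' ↔ ‖-p.2 + |p.1| • ω‖ ≤ R'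
      rw [abs_of_neg h, neg_smul, ← neg_add, norm_neg]
  rw [freeWave_eq h₀ h₁]
  calc _ ≤ ∫ ω, {ω : Space | ‖p.2 + p.1 • ω‖ ≤ R'}.indicator (fun _ => 2 * |p.1| * M) ω ∂sph := by
        rw [← norm_eq_abs]
        refine norm_integral_le_of_norm_le ((integrable_const _).indicator hset) ?_
        filter_upwards [ae_sph_norm] with ω hω
        set y := p.2 + p.1 • ω
        have h2 : |dd ω u₀ y| ≤ ‖fderiv ℝ u₀ y‖ := by
          have := (fderiv ℝ u₀ y).le_opNorm ω
          rwa [hω, mul_one] at this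
        have h3 : ‖u₀ y + p.1 * (dd ω u₀ y + u₁ y)‖ ≤ 2 * |p.1| * K y := by
          rw [norm_eq_abs]
          refine (abs_add_le _ _).trans ?_
          rw [abs_mul]
          have h4 := abs_add_le (dd ω u₀ y) (u₁ y)
          have h5 : |p.1| * |dd ω u₀ y + u₁ y| ≤ |p.1| * (‖fderiv ℝ u₀ y‖ + |u₁ y|) :=
            mul_le_mul_of_nonneg_left (by linarith) hp0.le
          have h6 : 1 * |u₀ y| ≤ |p.1| * |u₀ y| := mul_le_mul_of_nonneg_right hp (abs_nonneg _)
          have h7 : 0 ≤ |p.1| * K y := mul_nonneg hp0.le (hKn y)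
          have h8 : |p.1| * K y = |p.1| * |u₀ y| + |p.1| * (‖fderiv ℝ u₀ y‖ + |u₁ y|) := by
            simp only [K]; ring
          linarith
        refine h3.trans ((mul_le_mul_of_nonneg_left (hle y) (by positivity)).trans (le_of_eq ?_))
        by_cases hy : ‖y‖ ≤ R'
        · rw [indicator_of_mem (show y ∈ {y : Space | ‖y‖ ≤ R'} from hy),
            indicator_of_mem (show ω ∈ {ω : Space | ‖p.2 + p.1 • ω‖ ≤ R'} from hy)]
        · rw [indicator_of_notMem (show y ∉ {y : Space | ‖y‖ ≤ R'} from hy),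
            indicator_of_notMem (show ω ∉ {ω : Space | ‖p.2 + p.1 • ω‖ ≤ R'} from hy), mul_zero]
    _ = (sph {ω : Space | ‖p.2 + p.1 • ω‖ ≤ R'}).toReal * (2 * |p.1| * M) := by
        rw [integral_indicator_const _ hset]
        rfl
    _ ≤ (4 * R' ^ 2 / |p.1| ^ 2) * (2 * |p.1| * M) := mul_le_mul_of_nonneg_right hcap (by positivity)
    _ = _ := by field_simp; ring

theorem SpaceCpt.freeWave {u₀ u₁ : Space → ℝ} (h₀ : Smooth u₀)
    (h₁ : Continuous u₁) (hc₀ : HasCompactSupport u₀) (hc₁ : HasCompactSupport u₁) :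
    SpaceCpt (freeWave u₀ u₁) := by
  obtain ⟨R₀, hR₀⟩ := hc₀.isBounded.exists_norm_le
  obtain ⟨R₁, hR₁⟩ := hc₁.isBounded.exists_norm_le
  refine ⟨max R₀ R₁ + 1, 1, fun p hp => freeWave_eq_zero h₀ h₁ (R := max R₀ R₁ + 1) (fun x hx => ?_)
    (fun x hx => ?_) (by simpa using hp)⟩
  · refine image_eq_zero_of_notMem_tsupport fun h => ?_
    have := hR₀ x h
    have := le_max_left R₀ R₁
    linarith
  · refine image_eq_zero_of_notMem_tsupport fun h => ?_
    have := hR₁ x h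
    have := le_max_right R₀ R₁
    linarith

theorem abs_dd_add_dd_le {W : ℝ⁴ → ℝ} (hW : Differentiable ℝ W) (a : ℝ) (y : Space) {ω : Space}
    (hω : ‖ω‖ = 1) : |dd ω (fun y => W (a, y)) y + dd vt W (a, y)| ≤
      2 * √(edens₀ W (a, y)) := by
  have h2 : |dd ω (fun y => W (a, y)) y| ≤ ‖fderiv ℝ (fun y => W (a, y)) y‖ := by
    have := (fderiv ℝ (fun y => W (a, y)) y).le_opNorm ω
    rwa [hω, mul_one] at this
  have h3 := norm_fderiv_sq (fun y => W (a, y)) y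
  simp only [dd_slice hW] at h3
  change _ = ∑ i, dd (vx i) W (a, y) ^ 2 at h3
  set A := ‖fderiv ℝ (fun y => W (a, y)) y‖
  set D := dd vt W (a, y)
  have h4 : edens₀ W (a, y) = 1 / 2 * (D ^ 2 + A ^ 2) := by rw [edens, h3, add_zero]
  refine (abs_add_le _ _).trans ?_
  have h5 : (A + |D|) / 2 ≤ √(edens₀ W (a, y)) := by
    refine Real.le_sqrt_of_sq_le ?_
    rw [h4, ← sq_abs D]
    nlinarith [sq_nonneg (A - |D|)]
  linarith

theorem integral_edens_free {W : ℝ⁴ → ℝ} (hW : Smooth W) (hWc : SpaceCpt W)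
    (hbox : ∀ p, box W p = 0) (a b : ℝ) :
    ∫ x, edens₀ W (a, x) = ∫ x, edens₀ W (b, x) := by
  wlog hab : a ≤ b generalizing a b
  · exact (this b a (le_of_not_ge hab)).symm
  have h := integral_edens_eq (H := fun _ => 0) (h := fun _ => 0) contDiff_const
    (fun s => hasDerivAt_const s 0) rfl (contDiff_timeMap 1 a hW) (hWc.timeMap 1 a) (T := b - a)
    (fun p _ _ => by rw [box_timeMap (by norm_num) a hW, hbox, neg_zero]) (sub_nonneg.2 hab) le_rfl
  simp only [edens_timeMap (show (1:ℝ) ^ 2 = 1 by norm_num) a _ hW.dble] at h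
  simp only [one_mul, sub_add_cancel, zero_add] at h
  exact h.symm

theorem enorm_free_le {W : ℝ⁴ → ℝ} (hW : Smooth W) (hbox : ∀ p, box W p = 0)
    {a t : ℝ} (hat : a ≤ t) {ε : ℝ} (hε : ∀ y, |W (a, y)| ≤ ε) (x : Space) :
    ‖W (t, x)‖ₑ ≤ ofReal ε +
      sm (t - a) (fun y => ofReal (2 * √(edens₀ W (a, y)))) x := by
  have hr : 0 ≤ t - a := sub_nonneg.2 hat
  have hWt : Continuous fun y => dd vt W (a, y) := (contDiff_slice (hW.dd_top vt) a).continuous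
  have hk := kirchhoff hW a t x
  simp only [hbox] at hk
  have hz : ∀ s, smean (fun _ => (0:ℝ)) (t - s, x) = 0 := fun s => by simp [smean]
  simp only [hz, intervalIntegral.integral_zero, add_zero] at hk
  rw [hk, freeWave_eq (contDiff_slice hW a) hWt]
  refine (enorm_integral_le_lintegral_enorm _).trans ?_
  simp only
  have hm : Measurable fun ω : Space =>
      ofReal (2 * √(edens₀ W (a, x + (t - a) • ω))) := by
    have := (contDiff_edens (H := fun _ => 0) contDiff_const hW).continuous
    have h2 : Continuous fun ω : Space => edens₀ W (a, x + (t - a) • ω) :=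
      this.comp (by fun_prop)
    exact (continuous_const.mul h2.sqrt).measurable.ennreal_ofReal
  calc _ ≤ ∫⁻ ω, (ofReal ε + ofReal (t - a) *
        ofReal (2 * √(edens₀ W (a, x + (t - a) • ω)))) ∂sph := by
        refine lintegral_mono_ae ?_
        filter_upwards [ae_sph_norm] with ω hω
        rw [← ofReal_mul hr, ← ofReal_add ((abs_nonneg _).trans (hε 0)) (by positivity),
          enorm_eq_ofReal_abs]
        refine ofReal_le_ofReal ((abs_add_le _ _).trans (add_le_add (hε _) ?_))
        rw [abs_mul, abs_of_nonneg hr]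
        exact mul_le_mul_of_nonneg_left (abs_dd_add_dd_le hW.dble a _ hω) hr
    _ = _ := by
        rw [lintegral_add_left measurable_const, lintegral_const_mul _ hm, lintegral_const, measure_univ,
          mul_one, sm]

/-- The constant of the Strichartz estimate for free waves. -/
def strConst : ℝ := ((12 * bilConst) ^ 2).toReal

theorem strConst_nonneg : 0 ≤ strConst := toReal_nonneg

theorem ofReal_strConst : ofReal strConst = (12 * bilConst) ^ 2 :=
  ofReal_toReal (pow_ne_top (ENNReal.mul_ne_top (by norm_num) bilConst_ne_top))

theorem lintegral_sub_le_of_decay {W : ℝ⁴ → ℝ} (hW : Smooth W) (hWc : SpaceCpt W)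
    (hbox : ∀ p, box W p = 0) {L a : ℝ} (hL : 0 ≤ L) (ha : a ≤ 0) {ε : ℝ} (hε : ∀ y, |W (a, y)| ≤ ε) :
    ∫⁻ t in Icc 0 L, (∫⁻ x, (‖W (t, x)‖ₑ - ofReal ε) ^ 12) ^ (1 / 3 : ℝ) ≤
      ofReal (16 * strConst * (∫ x, edens₀ W (0, x)) ^ 2) := by
  have hed := (contDiff_edens (H := fun _ => 0) contDiff_const hW)
  set F : ℝ⁴ → ℝ≥0∞ := fun p => ofReal (2 * √(edens₀ W p)) with hFd
  have hF : Measurable F := (continuous_const.mul hed.continuous.sqrt).measurable.ennreal_ofReal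
  have hw : Measurable fun p => ‖W p‖ₑ - ofReal ε :=
    hW.continuous.measurable.enorm.sub measurable_const
  have hei : Integrable fun x => edens₀ W (a, x) :=
    SpaceCpt.integrable (K := edens₀ W) (hWc.of_local fun p hp => by
      simp [edens, (eventually_zero_dd hp _).self_of_nhds]) hed.continuous a
  have hS : ∫⁻ x, F (a, x) ^ 2 = ofReal (4 * ∫ x, edens₀ W (0, x)) := by
    rw [integral_edens_free hW hWc hbox 0 a, ← integral_const_mul,
      ofReal_integral_eq_lintegral_ofReal (hei.const_mul 4)
        (of_forall fun x => mul_nonneg (by norm_num) (edens_zero_nonneg W _))]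
    refine lintegral_congr fun x => ?_
    rw [hFd, ← ofReal_pow (by positivity), mul_pow, sq_sqrt (edens_zero_nonneg W _)]
    norm_num
  have hfin : ∫⁻ t in Icc 0 L, (∫⁻ x, (‖W (t, x)‖ₑ - ofReal ε) ^ 12) ^ (1 / 3 : ℝ) ≠ ⊤ := by
    refine ne_top_of_le_ne_top ?_ (lintegral_mono fun t => rpow_le_rpow
      (lintegral_mono fun x => pow_le_pow_left' tsub_le_self 12) (by norm_num))
    rw [lintegral_ofReal_nFour hW hWc hL]
    exact ofReal_ne_top
  refine (strichartz (ν := Measure.dirac a) (μ := volume.restrict (Icc 0 L)) Measure.restrict_le_self hF hw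
    ?_ hfin).trans ?_
  · filter_upwards [ae_restrict_mem measurableSet_Icc] with t ht x
    rw [lintegral_dirac]
    exact tsub_le_iff_left.2 (enorm_free_le hW hbox (ha.trans ht.1) hε x)
  · rw [lintegral_dirac, hS, ← ofReal_strConst, ← rpow_natCast _ 4, ← rpow_mul]
    have hE : 0 ≤ ∫ x, edens₀ W (0, x) := integral_nonneg fun x => edens_zero_nonneg W _
    rw [show (1 / 2 * ((4:ℕ):ℝ)) = ((2:ℕ):ℝ) by norm_num, rpow_natCast,
      ← ofReal_pow (by positivity), ← ofReal_mul strConst_nonneg]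
    exact ofReal_le_ofReal (le_of_eq (by ring))

/-- Strichartz estimate for free waves with compactly supported data. -/
theorem integral_nFour_freeWave_le {u₀ u₁ : Space → ℝ} (h₀ : Smooth u₀)
    (h₁ : Smooth u₁) (hc₀ : HasCompactSupport u₀) (hc₁ : HasCompactSupport u₁) {L : ℝ}
    (hL : 0 ≤ L) : ∫ t in (0:ℝ)..L, nFour (freeWave u₀ u₁) t ≤
      16 * strConst * (∫ x, edens₀ (freeWave u₀ u₁) (0, x)) ^ 2 := by
  set W := freeWave u₀ u₁
  have hW : Smooth W := contDiff_freeWave h₀ h₁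
  have hWc : SpaceCpt W := SpaceCpt.freeWave h₀ h₁.continuous hc₀ hc₁
  have hbox : ∀ p, box W p = 0 := box_freeWave h₀ h₁
  obtain ⟨C, hC, hdec⟩ := exists_freeWave_decay h₀ h₁.continuous hc₀ hc₁
  set D := 16 * strConst * (∫ x, edens₀ W (0, x)) ^ 2 with hD
  have hD0 : 0 ≤ D := mul_nonneg (mul_nonneg (by norm_num) strConst_nonneg) (sq_nonneg _)
  set ε : ℕ → ℝ≥0∞ := fun k => ofReal (C / (k + 1)) with hεd
  have hεanti : Antitone ε := fun k l hkl => ofReal_le_ofReal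
    (div_le_div_of_nonneg_left hC (by positivity) (by have : (k:ℝ) ≤ l := by exact_mod_cast hkl
                                                      linarith))
  have hε0 : Filter.Tendsto ε Filter.atTop (nhds 0) := by
    have : Filter.Tendsto (fun k : ℕ => C / ((k:ℝ) + 1)) Filter.atTop (nhds 0) := by
      have := tendsto_one_div_add_atTop_nhds_zero_nat (𝕜 := ℝ) |>.const_mul C
      simpa [div_eq_mul_inv] using this
    simpa using ENNReal.tendsto_ofReal this
  have hk : ∀ k : ℕ, ∫⁻ t in Icc 0 L, (∫⁻ x, (‖W (t, x)‖ₑ - ε k) ^ 12) ^ (1 / 3 : ℝ) ≤ ofReal D := by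
    intro k
    have hk1 : (0:ℝ) < (k:ℝ) + 1 := by positivity
    refine lintegral_sub_le_of_decay hW hWc hbox hL (a := -((k:ℝ) + 1)) (by linarith) fun y => ?_
    have ha : |-((k:ℝ) + 1)| = (k:ℝ) + 1 := by rw [abs_neg, abs_of_pos hk1]
    have := hdec (-((k:ℝ) + 1), y) (by simp only [ha]; linarith [show (0:ℝ) ≤ k by positivity])
    simpa only [ha] using this
  have hmeas : ∀ k, Measurable fun p => (‖W p‖ₑ - ε k) ^ 12 := fun k =>
    (hW.continuous.measurable.enorm.sub measurable_const).pow_const _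
  have hin : ∀ t, Filter.Tendsto (fun k => (∫⁻ x, (‖W (t, x)‖ₑ - ε k) ^ 12) ^ (1 / 3 : ℝ)) Filter.atTop
      (nhds ((∫⁻ x, ‖W (t, x)‖ₑ ^ 12) ^ (1 / 3 : ℝ))) := fun t => by
    refine (ENNReal.continuous_rpow_const.tendsto _).comp ?_
    refine lintegral_tendsto_of_tendsto_of_monotone
      (fun k => (measurable_slice (hmeas k) t).aemeasurable)
      (of_forall fun x k l hkl => pow_le_pow_left' (tsub_le_tsub_left (hεanti hkl) _) 12)
      (of_forall fun x => ?_)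
    have := ENNReal.Tendsto.sub (tendsto_const_nhds (x := ‖W (t, x)‖ₑ)) hε0 (Or.inl enorm_ne_top)
    rw [tsub_zero] at this
    exact ENNReal.Tendsto.pow this
  have hout := lintegral_tendsto_of_tendsto_of_monotone (μ := volume.restrict (Icc 0 L))
    (fun k => ((hmeas k).lintegral_prod_right'.pow_const (1 / 3 : ℝ)).aemeasurable)
    (of_forall fun t k l hkl => rpow_le_rpow (lintegral_mono fun x =>
      pow_le_pow_left' (tsub_le_tsub_left (hεanti hkl) _) 12) (by norm_num))
    (of_forall hin)
  have := le_of_tendsto hout (of_forall hk)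
  rw [lintegral_ofReal_nFour hW hWc hL] at this
  exact (ofReal_le_ofReal_iff hD0).1 this

theorem SpaceCpt.sub {U V : ℝ⁴ → ℝ} (hU : SpaceCpt U) (hV : SpaceCpt V) :
    SpaceCpt fun p => U p - V p := by
  obtain ⟨R, L, hR⟩ := hU
  obtain ⟨R', L', hR'⟩ := hV
  refine ⟨max R R', max L L', fun p hp => ?_⟩
  have h1 := mul_le_mul_of_nonneg_right (le_max_left L L') (abs_nonneg p.1)
  have h2 := mul_le_mul_of_nonneg_right (le_max_right L L') (abs_nonneg p.1)
  simp only
  rw [hR p (by linarith [le_max_left R R']), hR' p (by linarith [le_max_right R R']), sub_zero]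

/-! ### Solutions on a time slab -/

/-- `U` is smooth, spatially compactly supported, and solves `□U = -h(U)` for times in `[0, T]`, where
`h = H'` is defocusing with at most quintic growth on the range of `U`, and `U` has energy at most `E`. -/
structure SlabSol (h H : ℝ → ℝ) (T G E : ℝ) (U : ℝ⁴ → ℝ) : Prop where
  smooth : Smooth U
  cpt : SpaceCpt U
  eqn : ∀ p : ℝ⁴, 0 ≤ p.1 → p.1 ≤ T → box U p = -h (U p)
  smoothH : Smooth H
  deriv : ∀ s, HasDerivAt H (h s) s
  zero : H 0 = 0
  lower : ∀ s, s ^ 6 ≤ 8 * H s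
  virial : ∀ s, 1 / 8 * s ^ 6 ≤ 1 / 2 * (s * h s) - H s
  growth : ∀ p : ℝ⁴, 0 ≤ p.1 → p.1 ≤ T → |h (U p)| ≤ G * |U p| ^ 5
  one_le : 1 ≤ G
  energy : ∫ x, edens H U (0, x) ≤ E
  time_nonneg : 0 ≤ T

namespace SlabSol

variable {h H : ℝ → ℝ} {T G E : ℝ} {U : ℝ⁴ → ℝ}

theorem H_nonneg (hS : SlabSol h H T G E U) (s : ℝ) : 0 ≤ H s := by
  have := hS.lower s
  have h6 : 0 ≤ s ^ 6 := Even.pow_nonneg (by decide) _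
  linarith

theorem integrable_edens (hS : SlabSol h H T G E U) (t : ℝ) : Integrable fun x => edens H U (t, x) :=
  SpaceCpt.integrable (K := edens H U) (hS.cpt.of_local fun p hp => by
    simp [edens, (eventually_zero_dd hp _).self_of_nhds, hp.self_of_nhds, hS.zero])
    (contDiff_edens hS.smoothH hS.smooth).continuous t

theorem integral_edens_le (hS : SlabSol h H T G E U) {t : ℝ} (h0 : 0 ≤ t) (hT : t ≤ T) :
    ∫ x, edens H U (t, x) ≤ E :=
  (integral_edens_eq hS.smoothH hS.deriv hS.zero hS.smooth hS.cpt hS.eqn h0 hT).le.trans hS.energy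

theorem integral_edens_zero_le (hS : SlabSol h H T G E U) {t : ℝ} (h0 : 0 ≤ t) (hT : t ≤ T) :
    ∫ x, edens₀ U (t, x) ≤ E := by
  refine (integral_mono_of_nonneg (of_forall fun x => edens_zero_nonneg U _)
    (hS.integrable_edens t) (of_forall fun x => ?_)).trans (hS.integral_edens_le h0 hT)
  simp only [edens]
  linarith [hS.H_nonneg (U (t, x))]

theorem energy_nonneg (hS : SlabSol h H T G E U) : 0 ≤ E :=
  (integral_nonneg fun _ => edens_zero_nonneg U _).trans (hS.integral_edens_zero_le le_rfl hS.time_nonneg)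

theorem lintegral_six_graph_le (hS : SlabSol h H T G E U) {φ : Space → ℝ} (hφ : LipschitzWith 1 φ)
    (h0 : ∀ x, 0 ≤ φ x) (hT : ∀ x, φ x ≤ T) :
    ∫⁻ x, ‖U (φ x, x)‖ₑ ^ 6 ≤ ofReal (8 * E) := by
  have hle := (integral_graph_potential_le hS.smoothH hS.deriv hS.zero hS.smooth hS.cpt hS.eqn hφ h0
    hT).trans hS.energy
  have hcont : Continuous fun x => (φ x, x) := hφ.continuous.prodMk continuous_id
  have hi : Integrable fun x => H (U (φ x, x)) := by
    refine ((hS.smoothH.continuous.comp hS.smooth.continuous).comp hcont).integrable_of_hasCompactSupport ?_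
    obtain ⟨R, L, hR⟩ := hS.cpt
    refine HasCompactSupport.intro (isCompact_closedBall (0 : Space) (R + |L| * T)) fun x hx => ?_
    have : U (φ x, x) = 0 := hR _ (by
      have h1 : L * |φ x| ≤ |L| * T := mul_le_mul (le_abs_self L) (by rw [abs_of_nonneg (h0 x)]; exact hT x)
        (abs_nonneg _) (abs_nonneg _)
      have h2 : R + |L| * T < ‖x‖ := by simpa using hx
      simp only
      linarith)
    simp [this, hS.zero]
  calc ∫⁻ x, ‖U (φ x, x)‖ₑ ^ 6 ≤ ∫⁻ x, ofReal (8 * H (U (φ x, x))) := by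
        refine lintegral_mono fun x => ?_
        rw [enorm_eq_ofReal_abs, ← ofReal_pow (abs_nonneg _), Even.pow_abs (by decide)]
        exact ofReal_le_ofReal (hS.lower _)
    _ = ofReal (8 * ∫ x, H (U (φ x, x))) := by
        rw [← integral_const_mul, ofReal_integral_eq_lintegral_ofReal (hi.const_mul 8)
          (of_forall fun x => mul_nonneg (by norm_num) (hS.H_nonneg _))]
    _ ≤ _ := ofReal_le_ofReal (by linarith)

theorem lintegral_six_le (hS : SlabSol h H T G E U) {t : ℝ} (h0 : 0 ≤ t) (hT : t ≤ T) :
    ∫⁻ x, ‖U (t, x)‖ₑ ^ 6 ≤ ofReal (8 * E) :=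
  hS.lintegral_six_graph_le (φ := fun _ => t) (LipschitzWith.const' t) (fun _ => h0) fun _ => hT

theorem reflect (hS : SlabSol h H T G E U) : SlabSol h H T G E (timeMap (-1) T U) where
  smooth := contDiff_timeMap _ _ hS.smooth
  cpt := hS.cpt.timeMap _ _
  eqn p h0 hT := by
    rw [box_timeMap (by norm_num) T hS.smooth, hS.eqn _ (by simp only; linarith) (by simp only; linarith)]
    rfl
  smoothH := hS.smoothH
  deriv := hS.deriv
  zero := hS.zero
  lower := hS.lower
  virial := hS.virial
  growth p h0 hT := hS.growth (-1 * p.1 + T, p.2) (by simp only; linarith) (by simp only; linarith)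
  one_le := hS.one_le
  energy := by
    simp only [edens_timeMap (show (-1:ℝ) ^ 2 = 1 by norm_num) T _ hS.smooth.dble]
    exact hS.integral_edens_le (by linarith [hS.time_nonneg]) (by linarith)
  time_nonneg := hS.time_nonneg

/-! #### The free evolution from time `a` -/

/-- The free wave with the Cauchy data of `U` at time `a`. -/
def _root_.freeFrom (U : ℝ⁴ → ℝ) (a : ℝ) : ℝ⁴ → ℝ :=
  timeMap 1 (-a) (freeWave (fun y => U (a, y)) fun y => dd vt U (a, y))

theorem _root_.contDiff_freeFrom (hU : Smooth U) (a : ℝ) : Smooth (freeFrom U a) :=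
  contDiff_timeMap _ _ (contDiff_freeWave (contDiff_slice hU a) (contDiff_slice (hU.dd_top vt) a))

theorem _root_.SpaceCpt.freeFrom (hU : Smooth U) (hUc : SpaceCpt U) (a : ℝ) :
    SpaceCpt (freeFrom U a) :=
  (SpaceCpt.freeWave (contDiff_slice hU a) (contDiff_slice (hU.dd_top vt) a).continuous (hUc.slice a)
    ((hUc.dd vt).slice a)).timeMap _ _

theorem _root_.box_freeFrom (hU : Smooth U) (a : ℝ) (p : ℝ⁴) : box (freeFrom U a) p = 0 := by
  rw [freeFrom, box_timeMap (by norm_num) _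
    (contDiff_freeWave (contDiff_slice hU a) (contDiff_slice (hU.dd_top vt) a)),
    box_freeWave (contDiff_slice hU a) (contDiff_slice (hU.dd_top vt) a)]

theorem _root_.integral_edens_freeFrom (hU : Smooth U) (hUc : SpaceCpt U) (a t : ℝ) :
    ∫ x, edens₀ (freeFrom U a) (t, x) = ∫ x, edens₀ U (a, x) := by
  rw [integral_edens_free (contDiff_freeFrom hU a) (SpaceCpt.freeFrom hU hUc a) (box_freeFrom hU a) t a]
  refine integral_congr_ae (of_forall fun x => ?_)
  have h0 := contDiff_slice hU a
  have h1 := contDiff_slice (hU.dd_top vt) a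
  have hW := contDiff_freeWave h0 h1
  simp only [freeFrom]
  rw [edens_timeMap (by norm_num) _ _ hW.dble]
  simp only [one_mul, add_neg_cancel, edens, dd_freeWave_zero h0 h1]
  have hx : ∀ i, dd (vx i) (freeWave (fun y => U (a, y)) fun y => dd vt U (a, y)) (0, x) =
      dd (vx i) U (a, x) := fun i => by
    have e1 := dd_slice hW.dble (ex i) 0 x
    have e2 := dd_slice hU.dble (ex i) a x
    have e3 : (fun y => freeWave (fun y => U (a, y)) (fun y => dd vt U (a, y)) ((0:ℝ), y)) =
        fun y => U (a, y) := funext fun y => freeWave_zero h0 h1.continuous y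
    rw [e3] at e1
    change dd ((0:ℝ), ex i) _ _ = dd ((0:ℝ), ex i) _ _
    rw [← e1, e2]
  simp only [hx]

theorem _root_.enorm_smean_le (ψ : Space → ℝ) {r : ℝ} (hr : 0 ≤ r) (x : Space) :
    ‖smean ψ (r, x)‖ₑ ≤ sm r (fun y => ‖ψ y‖ₑ) x := by
  refine (enorm_integral_le_lintegral_enorm _).trans (le_of_eq ?_)
  simp only [enorm_mul]
  rw [lintegral_const_mul' _ _ enorm_ne_top, sm, Real.enorm_eq_ofReal hr]

/-- Contribution of the source on `[a, b]`. -/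
theorem enorm_duhamel_le (hS : SlabSol h H T G E U) {a b t : ℝ} (ha : 0 ≤ a) (hab : a ≤ b) (hbt : b ≤ t)
    (hb : b ≤ T) (x : Space) :
    ‖∫ s in a..b, smean (fun y => box U (s, y)) (t - s, x)‖ₑ ≤
      ∫⁻ s in Icc a b, sm (t - s) (fun y => ofReal G * ‖U (s, y)‖ₑ ^ 5) x := by
  rw [integral_of_le hab, ← integral_Icc_eq_integral_Ioc]
  refine (enorm_integral_le_lintegral_enorm _).trans ?_
  refine setLIntegral_mono_ae' measurableSet_Icc (of_forall fun s hs => ?_)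
  refine (enorm_smean_le _ (by linarith [hs.2]) x).trans ?_
  refine mul_le_mul' le_rfl (lintegral_mono fun ω => ?_)
  have h0 : 0 ≤ s := ha.trans hs.1
  have h1 : s ≤ T := hs.2.trans hb
  simp only
  rw [hS.eqn _ h0 h1, enorm_neg, enorm_eq_ofReal_abs, enorm_eq_ofReal_abs,
    ← ofReal_pow (abs_nonneg _), ← ofReal_mul (by linarith [hS.one_le])]
  exact ofReal_le_ofReal (hS.growth _ h0 h1)

theorem _root_.sub_freeFrom_eq (hU : Smooth U) (a t : ℝ) (x : Space) :
    U (t, x) - freeFrom U a (t, x) = ∫ s in a..t, smean (fun y => box U (s, y)) (t - s, x) := by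
  have := kirchhoff hU a t x
  rw [freeFrom, timeMap]
  simp only [one_mul, ← sub_eq_add_neg]
  linarith

theorem lintegral_ten_le (hS : SlabSol h H T G E U) {t : ℝ} (h0 : 0 ≤ t) (hT : t ≤ T) :
    (∫⁻ x, (ofReal G * ‖U (t, x)‖ₑ ^ 5) ^ 2) ^ (1 / 2 : ℝ) ≤
      ofReal (G * (8 * E) ^ (1 / 6 : ℝ) * nFour U t) := by
  have hm : Measurable fun x => ‖U (t, x)‖ₑ :=
    (contDiff_slice hS.smooth t).continuous.measurable.enorm
  have hG : 0 ≤ G := by linarith [hS.one_le]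
  have hE := hS.energy_nonneg
  have h1 : ∫⁻ x, (ofReal G * ‖U (t, x)‖ₑ ^ 5) ^ 2 ≤
      ofReal G ^ 2 * ((∫⁻ x, ‖U (t, x)‖ₑ ^ 12) ^ (2 / 3 : ℝ) *
        (ofReal (8 * E)) ^ (1 / 3 : ℝ)) := by
    have e : ∀ x, (ofReal G * ‖U (t, x)‖ₑ ^ 5) ^ 2 = ofReal G ^ 2 *
        ((‖U (t, x)‖ₑ ^ 12) ^ (2 / 3 : ℝ) * (‖U (t, x)‖ₑ ^ 6) ^ (1 / 3 : ℝ) *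
          (fun _ => (1:ℝ≥0∞)) x ^ (0 : ℝ)) := fun x => by
      rw [ENNReal.pow_rpow (m := 8) (by norm_num), ENNReal.pow_rpow (m := 2) (by norm_num), ENNReal.rpow_zero]
      ring
    simp only [e]
    rw [lintegral_const_mul' _ _ (pow_ne_top ofReal_ne_top)]
    refine mul_le_mul' le_rfl ?_
    refine (three_fn_holder (hm.pow_const 12).aemeasurable (hm.pow_const 6).aemeasurable
      aemeasurable_const (by norm_num) (by norm_num) le_rfl (by norm_num)).trans ?_
    rw [ENNReal.rpow_zero, mul_one]
    exact mul_le_mul' le_rfl (rpow_le_rpow (hS.lintegral_six_le h0 hT) (by norm_num))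
  refine (rpow_le_rpow h1 (by norm_num)).trans (le_of_eq ?_)
  rw [mul_rpow_of_nonneg _ _ (by norm_num), mul_rpow_of_nonneg _ _ (by norm_num),
    ← rpow_mul, ← rpow_mul, ← rpow_natCast, ← rpow_mul,
    ofReal_mul (p := G * (8 * E) ^ (1 / 6 : ℝ)) (by positivity), ofReal_mul hG,
    ← ofReal_nFour hS.smooth.continuous hS.cpt,
    ← ofReal_rpow_of_nonneg (x := 8 * E) (by positivity) (by norm_num)]
  norm_num
  ring

/-- The Duhamel part on a short interval is controlled by the Strichartz norm. -/
theorem integral_nFour_sub_freeFrom_le (hS : SlabSol h H T G E U) {a d : ℝ} (ha : 0 ≤ a) (had : a ≤ d)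
    (hd : d ≤ T) : ∫ t in a..d, nFour (fun p => U p - freeFrom U a p) t ≤
      strConst * (G * (8 * E) ^ (1 / 6 : ℝ) * ∫ t in a..d, nFour U t) ^ 4 := by
  have hG : 0 ≤ G := by linarith [hS.one_le]
  have hE := hS.energy_nonneg
  have hfr := contDiff_freeFrom hS.smooth a
  have hV : Smooth fun p => U p - freeFrom U a p := hS.smooth.sub hfr
  have hVc : SpaceCpt fun p => U p - freeFrom U a p :=
    hS.cpt.sub (SpaceCpt.freeFrom hS.smooth hS.cpt a)
  have hN : 0 ≤ ∫ t in a..d, nFour U t :=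
    intervalIntegral.integral_nonneg had fun t _ => nFour_nonneg U t
  have hrhs : 0 ≤ strConst * (G * (8 * E) ^ (1 / 6 : ℝ) * ∫ t in a..d, nFour U t) ^ 4 :=
    mul_nonneg strConst_nonneg (by positivity)
  rw [← ofReal_le_ofReal_iff hrhs, ← lintegral_ofReal_nFour hV hVc had]
  have hF : Measurable fun p : ℝ⁴ => ofReal G * ‖U p‖ₑ ^ 5 :=
    measurable_const.mul (hS.smooth.continuous.measurable.enorm.pow_const 5)
  refine (strichartz (ν := volume.restrict (Icc a d)) (μ := volume.restrict (Icc a d))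
    Measure.restrict_le_self hF hV.continuous.measurable.enorm ?_ ?_).trans ?_
  · filter_upwards [ae_restrict_mem measurableSet_Icc] with t ht x
    rw [sub_freeFrom_eq hS.smooth]
    refine (hS.enorm_duhamel_le ha ht.1 le_rfl (ht.2.trans hd) x).trans ?_
    exact lintegral_mono' (Measure.restrict_mono (Icc_subset_Icc le_rfl ht.2) le_rfl) le_rfl
  · rw [lintegral_ofReal_nFour hV hVc had]
    exact ofReal_ne_top
  · rw [← ofReal_strConst, ofReal_mul strConst_nonneg, ofReal_pow (by positivity)]
    refine mul_le_mul' le_rfl (pow_le_pow_left' ?_ 4)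
    rw [← intervalIntegral.integral_const_mul, integral_of_le had,
      ← integral_Icc_eq_integral_Ioc, ofReal_integral_eq_lintegral_ofReal
      ((continuous_nFour hS.smooth hS.cpt).integrableOn_Icc.const_mul _)
      (of_forall fun t => mul_nonneg (by positivity) (nFour_nonneg U t))]
    exact setLIntegral_mono_ae' measurableSet_Icc (of_forall fun s hs =>
      hS.lintegral_ten_le (ha.trans hs.1) (hs.2.trans hd))

end SlabSol

/-! ### Integrals over backward light cones -/

/-- A closed spherical shell around the origin. -/
def shell (r s : ℝ) : Set Space := {y | ‖y‖ ∈ Icc r s}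

theorem setLIntegral_Icc_sub_left (k : ℝ → ℝ≥0∞) (t l m : ℝ) :
    ∫⁻ r in Icc l m, k (t - r) = ∫⁻ s in Icc (t - m) (t - l), k s := by
  rw [← lintegral_indicator measurableSet_Icc, ← lintegral_indicator measurableSet_Icc,
    ← lintegral_sub_left_eq_self ((Icc (t - m) (t - l)).indicator _) t]
  refine lintegral_congr fun r => ?_
  simp only [indicator, mem_Icc, sub_le_sub_iff_left, and_comm]

theorem lintegral_cone {Φ : ℝ⁴ → ℝ≥0∞} (hΦ : Measurable Φ) {a t : ℝ} (hat : a < t) (x : Space) :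
    ∫⁻ s in Icc 0 a, sm (t - s) (fun y => Φ (s, y)) x = (ofReal sphArea)⁻¹ *
      ∫⁻ y in shell (t - a) t, ofReal ‖y‖⁻¹ * Φ (t - ‖y‖, x + y) := by
  have h := setLIntegral_Icc_sub_left (fun s => sm (t - s) (fun y => Φ (s, y)) x) t (t - a) t
  rw [sub_self, sub_sub_cancel] at h
  rw [shell, setLIntegral_polar measurableSet_Icc (F := fun q => ofReal q.1⁻¹ * Φ (t - q.1, x + q.2))
      (Measurable.mul (by fun_prop) (hΦ.comp (by fun_prop))), inv_sphArea_mul, ← h, inter_eq_left.2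
      (show Icc (t - a) t ⊆ Ioi 0 from fun r hr => lt_of_lt_of_le (sub_pos.2 hat) hr.1)]
  refine setLIntegral_congr_fun measurableSet_Icc fun r hr => ?_
  have hr : 0 < r := (sub_pos.2 hat).trans_le hr.1
  simp only [sm, sub_sub_cancel]
  rw [lintegral_const_mul' _ _ ofReal_ne_top, ← mul_assoc, ← ofReal_mul (by positivity)]
  congr 2
  field_simp

/-- The `L⁶` flux through a part of a backward light cone. -/
def coneSix (U : ℝ⁴ → ℝ) (l m t : ℝ) (x : Space) : ℝ≥0∞ :=
  ∫⁻ y in shell l m, ‖U (t - ‖y‖, x + y)‖ₑ ^ 6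

theorem cone_holder {U : ℝ⁴ → ℝ} (hU : Continuous U) {r : ℝ} (hr : 0 < r) (m G t : ℝ) (x : Space) :
    (ofReal sphArea)⁻¹ * ∫⁻ y in shell r m, ofReal ‖y‖⁻¹ * (ofReal G * ‖U (t - ‖y‖, x + y)‖ₑ ^ 5) ≤
      bilConst * ofReal (r ^ (-(1 / 2) : ℝ)) * ofReal G * coneSix U r m t x ^ (5 / 6 : ℝ) := by
  have mU : Measurable fun y => ‖U (t - ‖y‖, x + y)‖ₑ :=
    (hU.comp (by fun_prop : Continuous fun y : Space => (t - ‖y‖, x + y))).measurable.enorm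
  have hH := three_fn_holder (μ := volume.restrict (shell r m)) (f₁ := fun y => ofReal ‖y‖⁻¹ ^ 6) (by fun_prop)
    (mU.pow_const 6).aemeasurable (f₃ := fun _ => 1) aemeasurable_const (a := 1 / 6) (b := 5 / 6) (c := 0)
    (by norm_num) (by norm_num) le_rfl (by norm_num)
  simp only [ENNReal.pow_rpow (show (6:ℕ) * (1 / 6 : ℝ) = (1:ℕ) by norm_num), ENNReal.rpow_zero, mul_one,
    ENNReal.pow_rpow (show (6:ℕ) * (5 / 6 : ℝ) = (5:ℕ) by norm_num), pow_one] at hH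
  simp only [mul_left_comm _ (ofReal G)]
  rw [lintegral_const_mul' _ _ ofReal_ne_top]
  refine (mul_le_mul' le_rfl (mul_le_mul' le_rfl (hH.trans (mul_le_mul' (rpow_le_rpow
    ((lintegral_mono_set fun y hy => hy.1).trans_eq (lintegral_kernel_six hr)) (by norm_num)) le_rfl)))).trans
    (le_of_eq ?_)
  rw [ofReal_mul (by have := sphArea_pos; positivity), mul_rpow_of_nonneg _ _ (by norm_num),
    ofReal_rpow_of_nonneg (x := r ^ (-3 : ℝ)) (by positivity) (by norm_num),
    ← Real.rpow_mul hr.le, bilConst, coneSix]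
  norm_num
  ring

theorem contDiff_source {K : ℝ⁴ → ℝ} (hK : Smooth K) (t : ℝ) (x : Space) :
    Smooth fun s => smean (fun y => K (s, y)) (t - s, x) := by
  refine contDiff_integral_param (isCompact_closedBall (0 : Space) 1) ae_sph_mem
    (f := fun z : ℝ⁴ => (t - z.1) * K (z.1, x + (t - z.1) • z.2)) ?_
  exact (contDiff_const.sub contDiff_fst).mul (hK.comp (by fun_prop))

namespace SlabSol

variable {h H : ℝ → ℝ} {T G E : ℝ} {U : ℝ⁴ → ℝ}

theorem _root_.measurableSet_shell (r s : ℝ) : MeasurableSet (shell r s) := measurable_norm measurableSet_Icc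

theorem _root_.coneSix_le_graph (U : ℝ⁴ → ℝ) (l : ℝ) {m t R : ℝ} (hmt : m ≤ t) (hmR : m ≤ R) (x : Space) :
    coneSix U l m t x ≤ ∫⁻ y in closedBall x R, ‖U (max 0 (t - ‖y - x‖), y)‖ₑ ^ 6 := by
  rw [← lintegral_indicator measurableSet_closedBall, coneSix, ← lintegral_indicator (measurableSet_shell l m),
    ← lintegral_add_left_eq_self (fun y => (closedBall x R).indicator
      (fun y => ‖U (max 0 (t - ‖y - x‖), y)‖ₑ ^ 6) y) x]
  refine lintegral_mono fun y => ?_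
  by_cases h : y ∈ shell l m
  · rw [indicator_of_mem h, indicator_of_mem (show x + y ∈ closedBall x R by simpa using h.2.trans hmR),
      add_sub_cancel_left, max_eq_right (by linarith [h.2])]
  · rw [indicator_of_notMem h]; exact bot_le

theorem _root_.lipschitzWith_backward (t : ℝ) (x : Space) :
    LipschitzWith 1 fun y : Space => max 0 (t - ‖y - x‖) := by
  have h1 : LipschitzWith 1 fun y : Space => t - ‖y - x‖ := by
    refine LipschitzWith.of_dist_le_mul fun y z => ?_
    rw [NNReal.coe_one, one_mul, Real.dist_eq, dist_eq_norm]
    have := abs_norm_sub_norm_le (z - x) (y - x)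
    rw [sub_sub_sub_cancel_right, norm_sub_rev z y] at this
    rwa [sub_sub_sub_cancel_left]
  exact h1.const_max 0

theorem coneSix_le (hS : SlabSol h H T G E U) {m t : ℝ} (h0 : 0 ≤ t) (hT : t ≤ T) (hmt : m ≤ t)
    (l : ℝ) (x : Space) : coneSix U l m t x ≤ ofReal (8 * E) := by
  refine (coneSix_le_graph U l hmt hmt x).trans ((setLIntegral_le_lintegral _ _).trans ?_)
  refine hS.lintegral_six_graph_le (lipschitzWith_backward t x) (fun y => le_max_left _ _)
    fun y => max_le (h0.trans hT) ?_
  linarith [norm_nonneg (y - x)]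

/-- The part of the solution generated on `[0, a]`. -/
def _root_.oldPart (U : ℝ⁴ → ℝ) (a : ℝ) (p : ℝ⁴) : ℝ := freeFrom U a p - freeFrom U 0 p

theorem enorm_oldPart_le_cone (hS : SlabSol h H T G E U) {a t r : ℝ} (ha : 0 ≤ a) (hr : 0 < r) (hrt : r ≤ t - a)
    (hT : t ≤ T) (x : Space) : ‖oldPart U a (t, x)‖ₑ ≤ (ofReal sphArea)⁻¹ *
      ∫⁻ y in shell r t, ofReal ‖y‖⁻¹ * (ofReal G * ‖U (t - ‖y‖, x + y)‖ₑ ^ 5) := by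
  have hat : a < t := by linarith
  have e1 : oldPart U a (t, x) = ∫ s in (0:ℝ)..a, smean (fun y => box U (s, y)) (t - s, x) := by
    have hc : Continuous fun s => smean (fun y => box U (s, y)) (t - s, x) :=
      (contDiff_source (contDiff_box hS.smooth) t x).continuous
    have h1 := sub_freeFrom_eq hS.smooth a t x
    have h2 := sub_freeFrom_eq hS.smooth 0 t x
    have h3 := integral_add_adjacent_intervals (μ := volume)
      (hc.intervalIntegrable 0 a) (hc.intervalIntegrable a t)
    rw [oldPart]
    linarith
  rw [e1]
  refine (hS.enorm_duhamel_le le_rfl ha hat.le (hat.le.trans hT) x).trans ?_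
  rw [lintegral_cone (Φ := fun p => ofReal G * ‖U p‖ₑ ^ 5)
    (measurable_const.mul (hS.smooth.continuous.measurable.enorm.pow_const 5)) hat x]
  exact mul_le_mul' le_rfl (lintegral_mono_set fun y hy => ⟨hrt.trans hy.1, hy.2⟩)

theorem _root_.contDiff_oldPart (hU : Smooth U) (a : ℝ) : Smooth (oldPart U a) :=
  (contDiff_freeFrom hU a).sub (contDiff_freeFrom hU 0)

theorem _root_.SpaceCpt.oldPart (hU : Smooth U) (hUc : SpaceCpt U) (a : ℝ) :
    SpaceCpt (oldPart U a) :=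
  (SpaceCpt.freeFrom hU hUc a).sub (SpaceCpt.freeFrom hU hUc 0)

theorem integral_grad_oldPart_le (hS : SlabSol h H T G E U) {a : ℝ} (ha : 0 ≤ a) (haT : a ≤ T) (t : ℝ) :
    ∫ x, ∑ i, dd (vx i) (oldPart U a) (t, x) ^ 2 ≤ 8 * E := by
  have h1 := contDiff_freeFrom hS.smooth a
  have h2 := contDiff_freeFrom hS.smooth 0
  have i1 : ∀ b, Integrable fun x => edens₀ (freeFrom U b) (t, x) := fun b =>
    SpaceCpt.integrable (K := edens₀ (freeFrom U b))
      ((SpaceCpt.freeFrom hS.smooth hS.cpt b).of_local fun p hp => by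
        simp [edens, (eventually_zero_dd hp _).self_of_nhds])
      (contDiff_edens contDiff_const (contDiff_freeFrom hS.smooth b)).continuous t
  have hle : ∀ x, ∑ i, dd (vx i) (oldPart U a) (t, x) ^ 2 ≤
      4 * edens₀ (freeFrom U a) (t, x) + 4 * edens₀ (freeFrom U 0) (t, x) := by
    intro x
    have hd : ∀ i, dd (vx i) (oldPart U a) (t, x) =
        dd (vx i) (freeFrom U a) (t, x) - dd (vx i) (freeFrom U 0) (t, x) := fun i =>
      dd_sub h1.dble h2.dble _ _
    simp only [hd, edens, add_zero]
    have : ∑ i, (dd (vx i) (freeFrom U a) (t, x) - dd (vx i) (freeFrom U 0) (t, x)) ^ 2 ≤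
        ∑ i, (2 * dd (vx i) (freeFrom U a) (t, x) ^ 2 + 2 * dd (vx i) (freeFrom U 0) (t, x) ^ 2) :=
      sum_le_sum fun i _ => by
        nlinarith [sq_nonneg (dd (vx i) (freeFrom U a) (t, x) + dd (vx i) (freeFrom U 0) (t, x))]
    rw [Finset.sum_add_distrib, ← mul_sum, ← mul_sum] at this
    nlinarith [sq_nonneg (dd vt (freeFrom U a) (t, x)), sq_nonneg (dd vt (freeFrom U 0) (t, x))]
  refine (integral_mono_of_nonneg (of_forall fun x =>
    sum_nonneg fun i _ => sq_nonneg _) (((i1 a).const_mul 4).add ((i1 0).const_mul 4))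
    (of_forall hle)).trans ?_
  have e := integral_add ((i1 a).const_mul 4) ((i1 0).const_mul 4)
  have e' : ∫ x, ((fun x => 4 * edens₀ (freeFrom U a) (t, x)) +
      fun x => 4 * edens₀ (freeFrom U 0) (t, x)) x =
      (∫ x, 4 * edens₀ (freeFrom U a) (t, x)) +
        ∫ x, 4 * edens₀ (freeFrom U 0) (t, x) := e
  rw [e', integral_const_mul, integral_const_mul, integral_edens_freeFrom hS.smooth hS.cpt,
    integral_edens_freeFrom hS.smooth hS.cpt]
  have := hS.integral_edens_zero_le ha haT
  have := hS.integral_edens_zero_le le_rfl hS.time_nonneg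
  linarith

end SlabSol

/-! ### Averages over small balls -/

/-- The uniform probability measure on the ball of radius `ρ`. -/
def ballMeas (ρ : ℝ) : Measure Space :=
  (volume (closedBall (0:Space) ρ))⁻¹ • volume.restrict (closedBall 0 ρ)

theorem isProbabilityMeasure_ballMeas {ρ : ℝ} (hρ : 0 < ρ) : IsProbabilityMeasure (ballMeas ρ) := ⟨by
  rw [ballMeas, Measure.smul_apply, Measure.restrict_apply_univ, smul_eq_mul]
  exact ENNReal.inv_mul_cancel (Metric.measure_closedBall_pos _ _ hρ).ne' measure_closedBall_lt_top.ne⟩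

theorem ae_ballMeas (ρ : ℝ) : ∀ᵐ z ∂ballMeas ρ, ‖z‖ ≤ ρ := by
  refine Measure.ae_smul_measure ?_ _
  filter_upwards [ae_restrict_mem measurableSet_closedBall] with z hz
  simpa using hz

theorem lintegral_rpow_le_of_prob {α : Type*} [MeasurableSpace α] {β : Measure α} [IsProbabilityMeasure β]
    {k : α → ℝ≥0∞} (hk : AEMeasurable k β) {a : ℝ} (ha : 0 ≤ a) (ha1 : a ≤ 1) :
    ∫⁻ z, k z ^ a ∂β ≤ (∫⁻ z, k z ∂β) ^ a := by
  have := three_fn_holder hk (f₂ := fun _ => 1) aemeasurable_const (f₃ := fun _ => 1) aemeasurable_const ha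
    (sub_nonneg.2 ha1) le_rfl (by ring)
  simpa using this

theorem lintegral_pow_le_of_prob {α : Type*} [MeasurableSpace α] {β : Measure α} [IsProbabilityMeasure β]
    {k : α → ℝ≥0∞} (hk : AEMeasurable k β) {n : ℕ} (hn : n ≠ 0) :
    (∫⁻ z, k z ∂β) ^ n ≤ ∫⁻ z, k z ^ n ∂β := by
  have hn' : (1:ℝ) ≤ n := by exact_mod_cast Nat.one_le_iff_ne_zero.2 hn
  have h := lintegral_rpow_le_of_prob (hk.pow_const n) (a := (n:ℝ)⁻¹) (by positivity)
    (inv_le_one_of_one_le₀ hn')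
  simp only [ENNReal.pow_rpow_inv_natCast hn] at h
  exact (pow_le_pow_left' h n).trans_eq (ENNReal.rpow_inv_natCast_pow hn _)

theorem lintegral_shift_sub_sq_le {v : Space → ℝ} (hv : Smooth v) (z : Space) :
    ∫⁻ x, ‖v x - v (x + z)‖ₑ ^ 2 ≤ ‖z‖ₑ ^ 2 * ∫⁻ x, ‖fderiv ℝ v x‖ₑ ^ 2 := by
  have hc : Continuous (fderiv ℝ v) := hv.continuous_fderiv (by simp)
  have hm : Measurable fun q : Space × ℝ => ‖z‖ₑ ^ 2 * ‖fderiv ℝ v (q.1 + q.2 • z)‖ₑ ^ 2 :=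
    measurable_const.mul (((hc.comp (by fun_prop : Continuous fun q : Space × ℝ => q.1 + q.2 • z)).enorm
      |>.measurable).pow_const 2)
  have hp : IsProbabilityMeasure ((volume : Measure ℝ).restrict (Ioc 0 1)) := ⟨by simp⟩
  have h1 : ∀ x, ‖v x - v (x + z)‖ₑ ^ 2 ≤
      ∫⁻ s in Ioc (0:ℝ) 1, ‖z‖ₑ ^ 2 * ‖fderiv ℝ v (x + s • z)‖ₑ ^ 2 := fun x => by
    have hd : ∀ s : ℝ, HasDerivAt (fun s : ℝ => v (x + s • z)) (fderiv ℝ v (x + s • z) z) s := fun s => by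
      have h2 : HasDerivAt (fun s : ℝ => x + s • z) z s := by
        simpa using ((hasDerivAt_id s).smul_const z).const_add x
      exact (hv.dble (x + s • z)).hasFDerivAt.comp_hasDerivAt s h2
    have hcont : Continuous fun s : ℝ => fderiv ℝ v (x + s • z) z :=
      (hc.comp (by fun_prop)).clm_apply continuous_const
    have h3 := integral_eq_sub_of_hasDerivAt (fun s _ => hd s)
      (hcont.intervalIntegrable 0 1)
    rw [one_smul, zero_smul, add_zero, integral_of_le zero_le_one] at h3
    have hme : Measurable fun s : ℝ => ‖fderiv ℝ v (x + s • z) z‖ₑ := hcont.enorm.measurable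
    rw [← enorm_neg, neg_sub, ← h3]
    refine (pow_le_pow_left' (enorm_integral_le_lintegral_enorm _) 2).trans
      ((lintegral_pow_le_of_prob hme.aemeasurable two_ne_zero).trans (lintegral_mono fun s => ?_))
    rw [← mul_pow, mul_comm]
    exact pow_le_pow_left' ((fderiv ℝ v (x + s • z)).le_opENorm z) 2
  refine (lintegral_mono h1).trans ?_
  rw [lintegral_lintegral_swap hm.aemeasurable]
  have h2 : ∀ s : ℝ, ∫⁻ x, ‖z‖ₑ ^ 2 * ‖fderiv ℝ v (x + s • z)‖ₑ ^ 2 =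
      ‖z‖ₑ ^ 2 * ∫⁻ x, ‖fderiv ℝ v x‖ₑ ^ 2 := fun s => by
    rw [lintegral_const_mul' _ _ (pow_ne_top enorm_ne_top),
      lintegral_add_right_eq_self (fun x => ‖fderiv ℝ v x‖ₑ ^ 2) (s • z)]
  simp [h2]

theorem measurable_enorm_add {v : Space → ℝ} (hv : Continuous v) :
    Measurable fun q : Space × Space => ‖v (q.1 + q.2)‖ₑ :=
  (hv.comp (by fun_prop : Continuous fun q : Space × Space => q.1 + q.2)).measurable.enorm

/-- If the averages of `v` over balls of radius `ρ` are at most `λ`, then the `L¹²` norm of `v` is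
controlled by its gradient and its `L⁶` norm. -/
theorem lintegral_twelve_le_of_avg {v : Space → ℝ} (hv : Smooth v) {ρ S l : ℝ} (hρ : 0 < ρ)
    (hS : ∀ x, |v x| ≤ S) (hl : ∀ x, |∫ z, v (x + z) ∂ballMeas ρ| ≤ l) :
    ∫⁻ x, ‖v x‖ₑ ^ 12 ≤ 2 ^ 11 * (ofReal (2 * S) ^ 10 * (ofReal ρ ^ 2 *
      ∫⁻ x, ‖fderiv ℝ v x‖ₑ ^ 2) + ofReal l ^ 6 * ∫⁻ x, ‖v x‖ₑ ^ 6) := by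
  have := isProbabilityMeasure_ballMeas hρ
  set w : Space → ℝ := fun x => ∫ z, v (x + z) ∂ballMeas ρ with hw
  have hvc := hv.continuous
  have hSn : 0 ≤ S := (abs_nonneg _).trans (hS 0)
  have hig : ∀ x, Integrable (fun z => v (x + z)) (ballMeas ρ) := fun x =>
    Integrable.of_bound (hvc.comp (by fun_prop)).aestronglyMeasurable S
      (of_forall fun z => hS _)
  have hwS : ∀ x, |w x| ≤ S := fun x => by
    have := norm_integral_le_of_norm_le_const (μ := ballMeas ρ) (f := fun z => v (x + z))
      (of_forall fun z => hS (x + z))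
    simpa using this
  have hwm : Measurable w :=
    ((hvc.comp (by fun_prop : Continuous fun q : Space × Space => q.1 + q.2)).stronglyMeasurable
      |>.integral_prod_right').measurable
  have h2 : ∫⁻ x, ‖v x - w x‖ₑ ^ 2 ≤ ofReal ρ ^ 2 * ∫⁻ x, ‖fderiv ℝ v x‖ₑ ^ 2 := by
    have hm2 : Measurable fun q : Space × Space => ‖v q.1 - v (q.1 + q.2)‖ₑ ^ 2 :=
      ((hvc.comp continuous_fst).sub (hvc.comp (by fun_prop))).measurable.enorm.pow_const 2
    calc ∫⁻ x, ‖v x - w x‖ₑ ^ 2 ≤ ∫⁻ x, ∫⁻ z, ‖v x - v (x + z)‖ₑ ^ 2 ∂ballMeas ρ := by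
          refine lintegral_mono fun x => ?_
          have e : v x - w x = ∫ z, (v x - v (x + z)) ∂ballMeas ρ := by
            rw [integral_sub (integrable_const _) (hig x)]; simp [hw]
          rw [e]
          refine (pow_le_pow_left' (enorm_integral_le_lintegral_enorm _) 2).trans
            (lintegral_pow_le_of_prob ?_ two_ne_zero)
          exact (continuous_const.sub (hvc.comp (by fun_prop))).measurable.enorm.aemeasurable
      _ = ∫⁻ z, (∫⁻ x, ‖v x - v (x + z)‖ₑ ^ 2) ∂ballMeas ρ := lintegral_lintegral_swap hm2.aemeasurable
      _ ≤ ∫⁻ _, (ofReal ρ ^ 2 * ∫⁻ x, ‖fderiv ℝ v x‖ₑ ^ 2) ∂ballMeas ρ := by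
          refine lintegral_mono_ae ?_
          filter_upwards [ae_ballMeas ρ] with z hz
          refine (lintegral_shift_sub_sq_le hv z).trans (mul_le_mul' (pow_le_pow_left' ?_ 2) le_rfl)
          rw [← ofReal_norm]
          exact ofReal_le_ofReal hz
      _ = _ := by simp
  have h6 : ∫⁻ x, ‖w x‖ₑ ^ 6 ≤ ∫⁻ x, ‖v x‖ₑ ^ 6 := by
    have hm6 := (measurable_enorm_add hvc).pow_const 6
    calc ∫⁻ x, ‖w x‖ₑ ^ 6 ≤ ∫⁻ x, ∫⁻ z, ‖v (x + z)‖ₑ ^ 6 ∂ballMeas ρ := by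
          refine lintegral_mono fun x => ?_
          refine (pow_le_pow_left' (enorm_integral_le_lintegral_enorm _) 6).trans
            (lintegral_pow_le_of_prob ?_ (by norm_num))
          exact (hvc.comp (by fun_prop)).measurable.enorm.aemeasurable
      _ = ∫⁻ z, (∫⁻ x, ‖v (x + z)‖ₑ ^ 6) ∂ballMeas ρ := lintegral_lintegral_swap hm6.aemeasurable
      _ = _ := by simp [lintegral_add_right_eq_self (fun x => ‖v x‖ₑ ^ 6)]
  have hpt : ∀ x, ‖v x‖ₑ ^ 12 ≤ 2 ^ 11 * (ofReal (2 * S) ^ 10 * ‖v x - w x‖ₑ ^ 2 +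
      ofReal l ^ 6 * ‖w x‖ₑ ^ 6) := fun x => by
    have e1 : ‖v x‖ₑ ^ 12 ≤ 2 ^ 11 * (‖v x - w x‖ₑ ^ 12 + ‖w x‖ₑ ^ 12) := by
      simp only [enorm_eq_ofReal_abs, ← ofReal_pow (abs_nonneg _)]
      rw [← ofReal_add (by positivity) (by positivity),
        show (2:ℝ≥0∞) ^ 11 = ofReal (2 ^ 11) by norm_num, ← ofReal_mul (by norm_num)]
      refine ofReal_le_ofReal ?_
      have h3 : |v x| ≤ |v x - w x| + |w x| := by
        have := abs_add_le (v x - w x) (w x); rwa [sub_add_cancel] at this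
      exact (pow_le_pow_left₀ (abs_nonneg _) h3 12).trans
        (add_pow_le (abs_nonneg _) (abs_nonneg _) 12)
    refine e1.trans (mul_le_mul' le_rfl (add_le_add ?_ ?_))
    · rw [show 12 = 10 + 2 by norm_num, pow_add]
      refine mul_le_mul' (pow_le_pow_left' ?_ 10) le_rfl
      rw [enorm_eq_ofReal_abs]
      exact ofReal_le_ofReal ((abs_sub _ _).trans (by linarith [hS x, hwS x]))
    · rw [show 12 = 6 + 6 by norm_num, pow_add]
      refine mul_le_mul' (pow_le_pow_left' ?_ 6) le_rfl
      rw [enorm_eq_ofReal_abs]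
      exact ofReal_le_ofReal (hl x)
  refine (lintegral_mono hpt).trans ?_
  have hvw : Measurable fun x => ‖v x - w x‖ₑ ^ 2 := (hvc.measurable.sub hwm).enorm.pow_const 2
  rw [lintegral_const_mul' _ _ (by norm_num), lintegral_add_left (hvw.const_mul _),
    lintegral_const_mul _ hvw, lintegral_const_mul' _ _ (pow_ne_top ofReal_ne_top)]
  gcongr

theorem volume_closedBall_eq {ρ : ℝ} (hρ : 0 < ρ) :
    volume (closedBall (0:Space) ρ) = ofReal (sphArea * (ρ ^ 3 / 3)) := by
  rw [show closedBall (0:Space) ρ = {y | ‖y‖ ∈ Iic ρ} by ext; simp, ← setLIntegral_one,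
    setLIntegral_polar measurableSet_Iic (F := fun _ => 1) measurable_const, inter_comm, Ioi_inter_Iic]
  simp only [lintegral_const, measure_univ, mul_one]
  rw [← ofReal_integral_eq_lintegral_ofReal
      ((continuous_pow 2).integrableOn_Ioc) (of_forall fun r => sq_nonneg r),
    ← integral_of_le hρ.le, integral_pow, ← ofReal_mul sphArea_pos.le]
  norm_num

/-- Averaging the flux through backward cones gives a space-time integral. -/
theorem lintegral_coneSix_le {U : ℝ⁴ → ℝ} (hU : Continuous U) {ρ l : ℝ} (hρ : 0 < ρ) (hl : 0 < l)
    (m t : ℝ) (x : Space) :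
    ∫⁻ z, coneSix U l m t (x + z) ∂ballMeas ρ ≤ ofReal (12 / ρ) *
      ∫⁻ s in Icc (t - m) (t - l), ∫⁻ w in closedBall x (ρ + m), ‖U (s, w)‖ₑ ^ 6 := by
  set B : Set Space := closedBall 0 ρ with hBd
  have hB : MeasurableSet B := measurableSet_closedBall
  set K : ℝ⁴ → ℝ≥0∞ := fun q => ‖U q‖ₑ ^ 6 with hK
  have hKm : Measurable K := hU.measurable.enorm.pow_const 6
  set J : ℝ → ℝ≥0∞ := fun s => ∫⁻ w in closedBall x (ρ + m), K (s, w)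
  set F : ℝ⁴ → ℝ≥0∞ := fun q => ∫⁻ w, B.indicator 1 (x - w + q.2) * K (t - q.1, w)
  have hFm : Measurable F := by
    have : Measurable fun z : ℝ⁴ × Space => B.indicator (1 : Space → ℝ≥0∞) (x - z.2 + z.1.2) * K (t - z.1.1, z.2) :=
      ((measurable_one.indicator hB).comp (by fun_prop)).mul (hKm.comp (by fun_prop))
    exact this.lintegral_prod_right'
  have h1 : ∫⁻ z in B, coneSix U l m t (x + z) = ∫⁻ y in shell l m, F (‖y‖, y) := by
    have hm : Measurable fun q : Space × Space => K (t - ‖q.2‖, x + q.1 + q.2) := hKm.comp (by fun_prop)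
    simp only [coneSix]
    rw [lintegral_lintegral_swap hm.aemeasurable]
    refine lintegral_congr fun y => ?_
    simp only [F]
    rw [← lintegral_indicator hB, ← lintegral_add_right_eq_self (fun w => B.indicator 1 (x - w + y) * K (t - ‖y‖, w)) (x + y)]
    refine lintegral_congr fun z => ?_
    rw [show x - (z + (x + y)) + y = -z by abel, show z + (x + y) = x + z + y by abel]
    by_cases hz : ‖z‖ ≤ ρ <;> simp [indicator, hBd, hz, hK]
  have h2 : ∀ r ∈ Icc l m, ofReal (r ^ 2) * ∫⁻ ω, F (r, r • ω) ∂sph ≤ ofReal (4 * ρ ^ 2) * J (t - r) := fun r h => by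
    have hr : 0 < r := hl.trans_le h.1
    have hm : Measurable fun q : Space × Space => B.indicator (1 : Space → ℝ≥0∞) (x - q.2 + r • q.1) *
        K (t - r, q.2) := ((measurable_one.indicator hB).comp (by fun_prop)).mul (hKm.comp (by fun_prop))
    simp only [F, J]
    rw [lintegral_lintegral_swap hm.aemeasurable, ← lintegral_const_mul' _ _ ofReal_ne_top,
      ← lintegral_indicator measurableSet_closedBall, ← lintegral_const_mul' _ _ ofReal_ne_top]
    refine lintegral_mono fun w => ?_
    have hset : MeasurableSet {ω : Space | ‖x - w + r • ω‖ ≤ ρ} := measurableSet_le (by fun_prop) (by fun_prop)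
    have e : ∫⁻ ω, B.indicator 1 (x - w + r • ω) * K (t - r, w) ∂sph =
        sph {ω | ‖x - w + r • ω‖ ≤ ρ} * K (t - r, w) := by
      rw [lintegral_mul_const' _ _ (pow_ne_top enorm_ne_top), ← lintegral_indicator_one hset]
      simp [indicator, hBd, hK]
    rw [e, ← mul_assoc]
    by_cases hw : w ∈ closedBall x (ρ + m)
    · rw [indicator_of_mem hw]
      refine mul_le_mul' ((mul_le_mul' le_rfl (cap_le (x - w) hr hρ.le)).trans (le_of_eq ?_)) le_rfl
      rw [← ofReal_mul (by positivity)]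
      congr 1
      field_simp
    · have : sph {ω | ‖x - w + r • ω‖ ≤ ρ} = 0 := by
        rw [← compl_compl {ω | ‖x - w + r • ω‖ ≤ ρ}, ← mem_ae_iff]
        filter_upwards [ae_sph_norm_smul hr.le] with ω hω (hh : ‖x - w + r • ω‖ ≤ ρ)
        refine hw ?_
        rw [mem_closedBall_iff_norm, norm_sub_rev]
        have h3 : ‖x - w‖ ≤ ‖x - w + r • ω‖ + ‖r • ω‖ := by simpa using norm_sub_le (x - w + r • ω) (r • ω)
        linarith [h.2]
      rw [this, mul_zero, zero_mul]
      exact bot_le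
  have ha := sphArea_pos
  rw [ballMeas, lintegral_smul_measure, smul_eq_mul, h1, shell, setLIntegral_polar measurableSet_Icc hFm,
    volume_closedBall_eq hρ, inter_eq_left.2 (show Icc l m ⊆ Ioi 0 from fun r hr => lt_of_lt_of_le hl hr.1)]
  refine (mul_le_mul' le_rfl (mul_le_mul' le_rfl (setLIntegral_mono' measurableSet_Icc h2))).trans (le_of_eq ?_)
  rw [lintegral_const_mul' _ _ ofReal_ne_top, setLIntegral_Icc_sub_left J, ← mul_assoc, ← mul_assoc,
    ← ENNReal.ofReal_inv_of_pos (by positivity), ← ofReal_mul (by positivity), ← ofReal_mul (by positivity)]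
  congr 2
  field_simp
  norm_num

/-! ### Concentration bubbles -/

/-- The solution concentrates near `(t, x)` at scale `R`: it carries potential energy at least `ε` on a
spacelike graph through `(t, x)`, and space-time `L⁶` mass at least `m`. -/
def IsBubble (U : ℝ⁴ → ℝ) (T t : ℝ) (x : Space) (R ε m : ℝ) : Prop :=
  (∃ τ : Space → ℝ, LipschitzWith 1 τ ∧ (∀ y, 0 ≤ τ y ∧ τ y ≤ T) ∧ (∀ y, |τ y - t| ≤ ‖y - x‖) ∧
    ofReal ε ≤ ∫⁻ y in closedBall x R, ‖U (τ y, y)‖ₑ ^ 6) ∧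
  ofReal m ≤ ∫⁻ s in Icc 0 T ∩ Icc (t - R) (t + R),
    ∫⁻ y in closedBall x (3 * R), ‖U (s, y)‖ₑ ^ 6

theorem nFour_add_three_le {V V₁ V₂ V₃ : ℝ⁴ → ℝ} (h : Continuous V) (hc : SpaceCpt V)
    (h₁ : Continuous V₁) (hc₁ : SpaceCpt V₁) (h₂ : Continuous V₂) (hc₂ : SpaceCpt V₂)
    (h₃ : Continuous V₃) (hc₃ : SpaceCpt V₃) (he : ∀ p, V p = V₁ p + V₂ p + V₃ p) (t : ℝ) :
    nFour V t ≤ 256 * (nFour V₁ t + nFour V₂ t + nFour V₃ t) := by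
  have n₁ := nFour_nonneg V₁ t
  have n₂ := nFour_nonneg V₂ t
  have n₃ := nFour_nonneg V₃ t
  rw [← ofReal_le_ofReal_iff (by positivity), ofReal_mul (by norm_num),
    ofReal_add (by positivity) n₃, ofReal_add n₁ n₂, ← ofReal_nFour h hc,
    ← ofReal_nFour h₁ hc₁, ← ofReal_nFour h₂ hc₂, ← ofReal_nFour h₃ hc₃]
  have hm : ∀ {W : ℝ⁴ → ℝ}, Continuous W → Measurable fun x => ‖W (t, x)‖ₑ ^ 12 := fun hW =>
    (hW.comp (by fun_prop : Continuous fun x : Space => (t, x))).measurable.enorm.pow_const 12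
  have hp : ∀ x, ‖V (t, x)‖ₑ ^ 12 ≤ 2 ^ 24 * (‖V₁ (t, x)‖ₑ ^ 12 + ‖V₂ (t, x)‖ₑ ^ 12 + ‖V₃ (t, x)‖ₑ ^ 12) := by
    intro x
    simp only [enorm_eq_ofReal_abs, ← ofReal_pow (abs_nonneg _)]
    rw [← ofReal_add (by positivity) (by positivity),
      ← ofReal_add (by positivity) (by positivity),
      show (2:ℝ≥0∞) ^ 24 = ofReal (2 ^ 24) by norm_num, ← ofReal_mul (by norm_num)]
    refine ofReal_le_ofReal ?_
    rw [he]
    set a := |V₁ (t, x)|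
    set b := |V₂ (t, x)|
    set c := |V₃ (t, x)|
    have h1 := add_pow_le (show 0 ≤ a + b by positivity) (show 0 ≤ c by positivity) 12
    have h2 := add_pow_le (show 0 ≤ a by positivity) (show 0 ≤ b by positivity) 12
    have h3 := pow_le_pow_left₀ (abs_nonneg _) (abs_add_three (V₁ (t, x)) (V₂ (t, x)) (V₃ (t, x))) 12
    have : 0 ≤ a ^ 12 := by positivity
    have : 0 ≤ b ^ 12 := by positivity
    have : 0 ≤ c ^ 12 := by positivity
    norm_num at h1 h2 ⊢
    linarith
  refine (rpow_le_rpow (lintegral_mono hp) (by norm_num)).trans ?_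
  rw [lintegral_const_mul' _ _ (by norm_num), lintegral_add_right _ (hm h₃), lintegral_add_right _ (hm h₂),
    mul_rpow_of_nonneg _ _ (by norm_num)]
  refine mul_le_mul' (le_of_eq ?_) ((ENNReal.rpow_add_le_add_rpow _ _ (by norm_num) (by norm_num)).trans
    (add_le_add (ENNReal.rpow_add_le_add_rpow _ _ (by norm_num) (by norm_num)) le_rfl))
  rw [ENNReal.pow_rpow (m := 8) (by norm_num)]
  norm_num

namespace SlabSol

variable {h H : ℝ → ℝ} {T G E : ℝ} {U : ℝ⁴ → ℝ}

theorem le_integral_nFour_oldPart (hS : SlabSol h H T G E U) {a b d η : ℝ} (ha : 0 ≤ a) (hab : a ≤ b)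
    (hbd : b ≤ d) (hd : d ≤ T) (h1 : ∫ t in a..b, nFour U t = η) (h2 : ∫ t in b..d, nFour U t = η)
    (h3 : ∫ t in b..d, nFour (freeFrom U 0) t ≤ η / 1000)
    (hη : strConst * (G * (8 * E) ^ (1 / 6 : ℝ) * (2 * η)) ^ 4 ≤ η / 1000) :
    η / 1000 ≤ ∫ t in b..d, nFour (oldPart U a) t := by
  have hi : ∀ {V : ℝ⁴ → ℝ}, Smooth V → SpaceCpt V → ∀ x y,
      IntervalIntegrable (nFour V) volume x y := fun hV hVc x y =>
    (continuous_nFour hV hVc).intervalIntegrable x y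
  have hF := contDiff_freeFrom hS.smooth a
  have hFc := SpaceCpt.freeFrom hS.smooth hS.cpt a
  have hF0 := contDiff_freeFrom hS.smooth 0
  have hF0c := SpaceCpt.freeFrom hS.smooth hS.cpt 0
  have hO := contDiff_oldPart hS.smooth a
  have hOc := SpaceCpt.oldPart hS.smooth hS.cpt a
  have hD : Smooth fun p => U p - freeFrom U a p := hS.smooth.sub hF
  have hDc : SpaceCpt fun p => U p - freeFrom U a p := hS.cpt.sub hFc
  have h4 := hS.integral_nFour_sub_freeFrom_le ha (hab.trans hbd) hd
  rw [← integral_add_adjacent_intervals (hi hS.smooth hS.cpt a b) (hi hS.smooth hS.cpt b d),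
    h1, h2, ← two_mul, ← integral_add_adjacent_intervals (hi hD hDc a b) (hi hD hDc b d)] at h4
  have h5 : 0 ≤ ∫ t in a..b, nFour (fun p => U p - freeFrom U a p) t :=
    intervalIntegral.integral_nonneg hab fun t _ => nFour_nonneg _ t
  have h6 : ∫ t in b..d, nFour U t ≤ ∫ t in b..d, 256 * (nFour (freeFrom U 0) t + nFour (oldPart U a) t +
      nFour (fun p => U p - freeFrom U a p) t) :=
    integral_mono_on hbd (hi hS.smooth hS.cpt b d)
      ((((hi hF0 hF0c b d).add (hi hO hOc b d)).add (hi hD hDc b d)).const_mul 256) fun t _ =>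
      nFour_add_three_le hS.smooth.continuous hS.cpt hF0.continuous hF0c hO.continuous hOc hD.continuous hDc
        (fun p => by simp only [oldPart]; ring) t
  rw [h2, intervalIntegral.integral_const_mul, intervalIntegral.integral_add
    ((hi hF0 hF0c b d).add (hi hO hOc b d)) (hi hD hDc b d), intervalIntegral.integral_add
    (hi hF0 hF0c b d) (hi hO hOc b d)] at h6
  have h7 : 0 ≤ η := h1 ▸ intervalIntegral.integral_nonneg hab fun t _ => nFour_nonneg _ t
  linarith

/-- Size of the part of the solution generated at distance at least `r` in the past. -/
def _root_.pastConst (E : ℝ) : ℝ := bilConst.toReal * (8 * E) ^ (5 / 6 : ℝ)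

theorem cone_le_pastConst (hS : SlabSol h H T G E U) {r t : ℝ} (hr : 0 < r) (h0 : 0 ≤ t) (hT : t ≤ T) (x : Space) :
    (ofReal sphArea)⁻¹ * ∫⁻ y in shell r t, ofReal ‖y‖⁻¹ * (ofReal G * ‖U (t - ‖y‖, x + y)‖ₑ ^ 5) ≤
      ofReal (pastConst E * G * r ^ (-(1 / 2) : ℝ)) := by
  have hE := hS.energy_nonneg
  have hG := hS.one_le
  refine (cone_holder hS.smooth.continuous hr t G t x).trans
    ((mul_le_mul' le_rfl (rpow_le_rpow (hS.coneSix_le h0 hT le_rfl r x) (by norm_num))).trans (le_of_eq ?_))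
  rw [ofReal_rpow_of_nonneg (by positivity) (by norm_num), pastConst,
    ← ofReal_toReal bilConst_ne_top, ← ofReal_mul toReal_nonneg,
    ← ofReal_mul (by positivity), ← ofReal_mul (by positivity), ENNReal.toReal_ofReal
      toReal_nonneg]
  congr 1
  ring

theorem abs_oldPart_le (hS : SlabSol h H T G E U) {a t r : ℝ} (ha : 0 ≤ a) (hr : 0 < r) (hrt : r ≤ t - a)
    (hT : t ≤ T) (x : Space) : |oldPart U a (t, x)| ≤ pastConst E * G * r ^ (-(1 / 2) : ℝ) := by
  have hE := hS.energy_nonneg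
  have hG := hS.one_le
  have h1 := (hS.enorm_oldPart_le_cone ha hr hrt hT x).trans (hS.cone_le_pastConst hr (by linarith) hT x)
  rw [enorm_eq_ofReal_abs] at h1
  refine (ofReal_le_ofReal_iff ?_).1 h1
  unfold pastConst
  positivity

theorem nFour_oldPart_le_of_avg (hS : SlabSol h H T G E U) {C₆ : ℝ} (hC₆ : 0 < C₆)
    (hsob : ∀ v : Space → ℝ, Smooth v →
      HasCompactSupport v → ∫ x, v x ^ 6 ≤ C₆ * (∫ x, ∑ i, dd (ex i) v x ^ 2) ^ 3)
    {a t S ρ l : ℝ} (ha : 0 ≤ a) (haT : a ≤ T) (hρ : 0 < ρ) (hSn : ∀ x, |oldPart U a (t, x)| ≤ S)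
    (hl : ∀ x, |∫ z, oldPart U a (t, x + z) ∂ballMeas ρ| ≤ l) :
    nFour (oldPart U a) t ≤
      (2 ^ 11 * ((2 * S) ^ 10 * (ρ ^ 2 * (8 * E)) + l ^ 6 * (C₆ * (8 * E) ^ 3))) ^ (1 / 3 : ℝ) := by
  have hE := hS.energy_nonneg
  have hO := contDiff_oldPart hS.smooth a
  have hOc := SpaceCpt.oldPart hS.smooth hS.cpt a
  have hv := contDiff_slice hO t
  have hvc := hOc.slice t
  have hS0 : 0 ≤ S := (abs_nonneg _).trans (hSn 0)
  have hl0 : 0 ≤ l := (abs_nonneg _).trans (hl 0)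
  have e1 : ∀ x, ‖fderiv ℝ (fun x => oldPart U a (t, x)) x‖ ^ 2 = ∑ i, dd (vx i) (oldPart U a) (t, x) ^ 2 :=
    fun x => by simp only [norm_fderiv_sq, dd_slice hO.dble]; rfl
  have g1 : ∫⁻ x, ‖fderiv ℝ (fun x => oldPart U a (t, x)) x‖ₑ ^ 2 ≤ ofReal (8 * E) := by
    refine le_trans (le_of_eq ?_) (ofReal_le_ofReal (hS.integral_grad_oldPart_le ha haT t))
    simp only [← e1]
    refine lintegral_enorm_pow ?_
    simp only [e1]
    exact SpaceCpt.integrable (K := fun p => ∑ i, dd (vx i) (oldPart U a) p ^ 2)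
      (hOc.of_local fun p hp => by simp [(eventually_zero_dd hp _).self_of_nhds])
      (continuous_finsetSum _ fun i _ => (hO.dd_top _).continuous.pow 2) t
  have g2 : ∫⁻ x, ‖oldPart U a (t, x)‖ₑ ^ 6 ≤ ofReal (C₆ * (8 * E) ^ 3) := by
    have h6 := hsob _ hv hvc
    have h7 : ∫ x, ∑ i, dd (ex i) (fun x => oldPart U a (t, x)) x ^ 2 ≤ 8 * E := by
      simp only [dd_slice hO.dble]
      exact hS.integral_grad_oldPart_le ha haT t
    have h8 : 0 ≤ ∫ x, ∑ i, dd (ex i) (fun x => oldPart U a (t, x)) x ^ 2 :=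
      integral_nonneg fun x => sum_nonneg fun i _ => sq_nonneg _
    rw [lintegral_enorm_even_pow (by decide) (hvc.integrable_pow hv.continuous (by norm_num))]
    exact ofReal_le_ofReal (h6.trans (mul_le_mul_of_nonneg_left (pow_le_pow_left₀ h8 h7 3) hC₆.le))
  have h12 := lintegral_twelve_le_of_avg hv hρ hSn hl
  rw [← ofReal_le_ofReal_iff (by positivity), ← ofReal_nFour hO.continuous hOc,
    ← ofReal_rpow_of_nonneg (by positivity) (by norm_num)]
  refine rpow_le_rpow (h12.trans ?_) (by norm_num)
  rw [ofReal_mul (p := 2 ^ 11) (by positivity), ofReal_add (by positivity) (by positivity),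
    ofReal_mul (p := (2 * S) ^ 10) (by positivity), ofReal_mul (p := ρ ^ 2) (by positivity),
    ofReal_mul (p := l ^ 6) (by positivity), ofReal_pow (p := 2 * S) (by positivity),
    ofReal_pow hρ.le, ofReal_pow hl0, show ofReal (2 ^ 11) = 2 ^ 11 by norm_num]
  exact mul_le_mul' le_rfl (add_le_add (mul_le_mul' le_rfl (mul_le_mul' le_rfl g1)) (mul_le_mul' le_rfl g2))

/-- A large average of the old part produces a bubble. -/
theorem isBubble_of_avg (hS : SlabSol h H T G E U) {a t r ρ A l ε : ℝ} (ha : 0 ≤ a) (hr : 0 < r)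
    (hrt : r ≤ t - a) (hT : t ≤ T) (hρ : 0 < ρ) (hρr : ρ ≤ r) (hA : 1 ≤ A) (hε : 0 < ε) (x : Space)
    (hl : l ≤ |∫ z, oldPart U a (t, x + z) ∂ballMeas ρ|)
    (hfar : pastConst E * G * (A * r) ^ (-(1 / 2) : ℝ) ≤ l / 2)
    (hnear : bilConst.toReal * r ^ (-(1 / 2) : ℝ) * G * ε ^ (5 / 6 : ℝ) < l / 2) :
    ∃ x₁, IsBubble U T t x₁ (A * r) ε (ε * ρ / 12) := by
  have hG := hS.one_le
  have hβ := isProbabilityMeasure_ballMeas hρ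
  have ht0 : 0 ≤ t := by linarith
  set m := min (A * r) t
  have hl0 : 0 < l := by
    have : 0 ≤ bilConst.toReal * r ^ (-(1 / 2) : ℝ) * G * ε ^ (5 / 6 : ℝ) := by positivity
    linarith
  set I : Space → ℝ≥0∞ := fun z => coneSix U r m t (x + z)
  have hIm : Measurable I := by
    have : Measurable fun q : Space × Space => ‖U (t - ‖q.2‖, x + q.1 + q.2)‖ₑ ^ 6 :=
      (hS.smooth.continuous.comp (by fun_prop : Continuous fun q : Space × Space =>
        (t - ‖q.2‖, x + q.1 + q.2))).measurable.enorm.pow_const 6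
    exact this.lintegral_prod_right'
  have hpt : ∀ z, ‖oldPart U a (t, x + z)‖ₑ ≤
      bilConst * ofReal (r ^ (-(1 / 2) : ℝ)) * ofReal G * I z ^ (5 / 6 : ℝ) +
        ofReal (l / 2) := fun z => by
    have hsub : shell r t ⊆ shell r m ∪ shell (A * r) t := fun y hy => by
      rcases le_total ‖y‖ (A * r) with h | h
      exacts [.inl ⟨hy.1, le_min h hy.2⟩, .inr ⟨h, hy.2⟩]
    refine (hS.enorm_oldPart_le_cone ha hr hrt hT _).trans
      ((mul_le_mul' le_rfl ((lintegral_mono_set hsub).trans (lintegral_union_le _ _ _))).trans ?_)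
    rw [mul_add]
    exact add_le_add (cone_holder hS.smooth.continuous hr m G t (x + z))
      ((hS.cone_le_pastConst (by positivity) ht0 hT (x + z)).trans (ofReal_le_ofReal hfar))
  have hX : ofReal ε ≤ ∫⁻ z, I z ∂ballMeas ρ := by
    by_contra hlt
    rw [not_le] at hlt
    have h1 : ofReal l ≤ bilConst * ofReal (r ^ (-(1 / 2) : ℝ)) * ofReal G *
        ofReal ε ^ (5 / 6 : ℝ) + ofReal (l / 2) := by
      calc ofReal l ≤ ‖∫ z, oldPart U a (t, x + z) ∂ballMeas ρ‖ₑ := by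
            rw [enorm_eq_ofReal_abs]; exact ofReal_le_ofReal hl
        _ ≤ ∫⁻ z, (bilConst * ofReal (r ^ (-(1 / 2) : ℝ)) * ofReal G * I z ^ (5 / 6 : ℝ) +
            ofReal (l / 2)) ∂ballMeas ρ :=
            (enorm_integral_le_lintegral_enorm _).trans (lintegral_mono hpt)
        _ = bilConst * ofReal (r ^ (-(1 / 2) : ℝ)) * ofReal G *
            (∫⁻ z, I z ^ (5 / 6 : ℝ) ∂ballMeas ρ) + ofReal (l / 2) := by
            rw [lintegral_add_right _ measurable_const, lintegral_const_mul _ (hIm.pow_const _)]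
            simp
        _ ≤ _ := by
            refine add_le_add (mul_le_mul' le_rfl ?_) le_rfl
            exact (lintegral_rpow_le_of_prob hIm.aemeasurable (by norm_num) (by norm_num)).trans
              (rpow_le_rpow hlt.le (by norm_num))
    rw [← ofReal_toReal bilConst_ne_top, ofReal_rpow_of_nonneg hε.le (by norm_num),
      ← ofReal_mul toReal_nonneg, ← ofReal_mul (by positivity),
      ← ofReal_mul (by positivity), ← ofReal_add (by positivity) (by positivity),
      ofReal_le_ofReal_iff (by positivity)] at h1
    linarith
  obtain ⟨z, hz, hzI⟩ := exists_notMem_null_lintegral_le (μ := ballMeas ρ) (f := I)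
    (ne_top_of_le_ne_top (b := ofReal (8 * E)) ofReal_ne_top ((lintegral_mono fun z =>
      hS.coneSix_le ht0 hT (min_le_right _ _) r (x + z)).trans (by simp)))
    (show ballMeas ρ {z | ¬ ‖z‖ ≤ ρ} = 0 from ae_ballMeas ρ)
  have hz : ‖z‖ ≤ ρ := not_not.1 hz
  have hrA : r ≤ A * r := le_mul_of_one_le_left hr.le hA
  refine ⟨x + z, ⟨fun y => max 0 (t - ‖y - (x + z)‖), lipschitzWith_backward t _, fun y =>
    ⟨le_max_left _ _, max_le (ht0.trans hT) (by linarith [norm_nonneg (y - (x + z))])⟩, fun y => ?_,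
    hX.trans (hzI.trans (coneSix_le_graph U r (min_le_right _ _) (min_le_left _ _) _))⟩, ?_⟩
  · have := norm_nonneg (y - (x + z))
    simp only
    rcases le_total 0 (t - ‖y - (x + z)‖) with h1 | h1
    · rw [max_eq_right h1, abs_le]; constructor <;> linarith
    · rw [max_eq_left h1, abs_le]; constructor <;> linarith
  · have h1 := hX.trans (lintegral_coneSix_le hS.smooth.continuous hρ hr m t x)
    have h2 : ∫⁻ s in Icc (t - m) (t - r), ∫⁻ w in closedBall x (ρ + m), ‖U (s, w)‖ₑ ^ 6 ≤
        ∫⁻ s in Icc 0 T ∩ Icc (t - A * r) (t + A * r),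
          ∫⁻ y in closedBall (x + z) (3 * (A * r)), ‖U (s, y)‖ₑ ^ 6 := by
      refine lintegral_mono' (Measure.restrict_mono (fun s hs => ?_) le_rfl) fun s =>
        lintegral_mono' (Measure.restrict_mono (fun w hw => ?_) le_rfl) le_rfl
      · have := min_le_left (A * r) t
        have := min_le_right (A * r) t
        exact ⟨⟨by linarith [hs.1], by linarith [hs.2]⟩, by linarith [hs.1], by linarith [hs.2]⟩
      · rw [mem_closedBall_iff_norm] at hw ⊢
        have h3 : ‖w - (x + z)‖ ≤ ‖w - x‖ + ‖z‖ := by rw [← sub_sub]; exact norm_sub_le _ _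
        have := min_le_left (A * r) t
        linarith
    calc ofReal (ε * ρ / 12) = ofReal (ρ / 12) * ofReal ε := by
          rw [← ofReal_mul (by positivity)]; congr 1; ring
      _ ≤ ofReal (ρ / 12) * (ofReal (12 / ρ) * _) :=
          mul_le_mul' le_rfl (h1.trans (mul_le_mul' le_rfl h2))
      _ = _ := by
          rw [← mul_assoc, ← ofReal_mul (by positivity), show ρ / 12 * (12 / ρ) = 1 by field_simp]
          simp

set_option maxHeartbeats 800000 in
/-- On an interval carrying a fixed small amount of Strichartz norm, on which the free evolution is small,
the solution concentrates. -/
theorem exists_bubble {E : ℝ} (hE : 0 ≤ E) : ∃ η A ε θ : ℝ, 0 < η ∧ 1 ≤ A ∧ 0 < ε ∧ 0 < θ ∧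
    ∀ {h H : ℝ → ℝ} {T G : ℝ} {U : ℝ⁴ → ℝ}, SlabSol h H T G E U → ∀ {a b d : ℝ}, 0 ≤ a → a < b →
      b ≤ d → d ≤ T → d - b ≤ b - a → ∫ t in a..b, nFour U t = η / G ^ 2 →
      ∫ t in b..d, nFour U t = η / G ^ 2 → ∫ t in b..d, nFour (freeFrom U 0) t ≤ η / G ^ 2 / 1000 →
      ∃ t ∈ Icc b d, ∃ x, IsBubble U T t x (A * G ^ 4 * (b - a)) (ε / G ^ 3) (θ / G ^ 11 * (b - a)) := by
  obtain ⟨C₆, hC₆, hsob⟩ := exists_sobolev_six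
  set K := strConst * (2 * (8 * E) ^ (1 / 6 : ℝ)) ^ 4 with hK
  have hK0 : 0 ≤ K := mul_nonneg strConst_nonneg (by positivity)
  have small : ∀ M : ℝ, 0 ≤ M → ∀ P : ℝ, 0 < P → ∃ κ : ℝ, 0 < κ ∧ κ ≤ 1 ∧ M * κ ≤ P := fun M hM P hP => by
    refine ⟨min 1 (P / (M + 1)), by positivity, min_le_left _ _, ?_⟩
    calc M * min 1 (P / (M + 1)) ≤ (M + 1) * (P / (M + 1)) :=
          mul_le_mul (by linarith) (min_le_right _ _) (by positivity) (by positivity)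
      _ = P := by field_simp
  obtain ⟨η, hη, hη1, hηK⟩ := small K hK0 (1 / 1000) (by norm_num)
  set S := pastConst E
  have hS0 : 0 ≤ S := mul_nonneg toReal_nonneg (by positivity)
  obtain ⟨κ, hκ, hκ1, hκP⟩ := small (2 ^ 11 * ((2 * S) ^ 10 * (8 * E))) (by positivity) ((η / 2000) ^ 3 / 2)
    (by positivity)
  obtain ⟨l, hl, hl1, hlP⟩ := small (2 ^ 11 * (C₆ * (8 * E) ^ 3)) (by positivity) ((η / 2000) ^ 3 / 2)
    (by positivity)
  set A := max 1 ((2 * S / l) ^ 2) with hA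
  have hA1 : 1 ≤ A := le_max_left _ _
  set B := bilConst.toReal + 1 with hB
  have hB0 : 0 < B := by have := toReal_nonneg (a := bilConst); linarith
  set μ := l / (2 * B) with hμ
  have hμ0 : 0 < μ := by positivity
  refine ⟨η, A, μ ^ (6 / 5 : ℝ), μ ^ (6 / 5 : ℝ) * κ / 12, hη, hA1, by positivity, by positivity,
    @fun h H T G U hS a b d ha hab hbd hd hdb h1 h2 h3 => ?_⟩
  have hG := hS.one_le
  have hG0 : 0 < G := by linarith
  have hr : 0 < b - a := by linarith
  set r := b - a with hrd
  set q := r ^ (-(1 / 2) : ℝ) with hq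
  have hq0 : 0 < q := by positivity
  have hqr : q ^ 2 * r = 1 := by
    rw [hq, ← Real.rpow_natCast, ← Real.rpow_mul hr.le]
    norm_num [Real.rpow_neg_one]
    field_simp
  set ρ := κ * r / G ^ 8 with hρd
  have hρ : 0 < ρ := by positivity
  have hρr : ρ ≤ r := by
    rw [hρd, div_le_iff₀ (by positivity)]
    have : (1:ℝ) ≤ G ^ 8 := one_le_pow₀ hG
    nlinarith
  have hold := hS.le_integral_nFour_oldPart ha hab.le hbd hd h1 h2 h3 (by
    have e : strConst * (G * (8 * E) ^ (1 / 6 : ℝ) * (2 * (η / G ^ 2))) ^ 4 = K * η ^ 3 / G ^ 2 * (η / G ^ 2) := by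
      rw [hK]; field_simp
    rw [e, div_eq_mul_one_div (η / G ^ 2), mul_comm]
    refine mul_le_mul_of_nonneg_left ?_ (by positivity)
    have h4 : K * η ^ 3 ≤ K * η := mul_le_mul_of_nonneg_left
      (by nlinarith [mul_le_mul_of_nonneg_left hη1 hη.le]) hK0
    refine (div_le_self (by positivity) (one_le_pow₀ hG)).trans (h4.trans hηK))
  have hsup : ∀ t ∈ Icc b d, ∀ x, |oldPart U a (t, x)| ≤ S * G * q := fun t ht x =>
    hS.abs_oldPart_le ha hr (by linarith [ht.1]) (ht.2.trans hd) x
  obtain ⟨t, ht, x, hx⟩ : ∃ t ∈ Icc b d, ∃ x, l * q / G ≤ |∫ z, oldPart U a (t, x + z) ∂ballMeas ρ| := by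
    by_contra! hcon
    have hn : ∀ t ∈ Icc b d, nFour (oldPart U a) t ≤ η / 2000 * (q ^ 2 / G ^ 2) := fun t ht => by
      refine (hS.nFour_oldPart_le_of_avg hC₆ hsob ha (by linarith) hρ (hsup t ht)
        fun x => (hcon t ht x).le).trans ?_
      have e : 2 ^ 11 * ((2 * (S * G * q)) ^ 10 * (ρ ^ 2 * (8 * E)) + (l * q / G) ^ 6 * (C₆ * (8 * E) ^ 3)) =
          (2 ^ 11 * ((2 * S) ^ 10 * (8 * E)) * κ ^ 2 * (q ^ 2 * r) ^ 2 + 2 ^ 11 * (C₆ * (8 * E) ^ 3) * l ^ 6) *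
            (q ^ 2 / G ^ 2) ^ 3 := by
        rw [hρd]; field_simp
      have e2 : 2 ^ 11 * ((2 * S) ^ 10 * (8 * E)) * κ ^ 2 * (q ^ 2 * r) ^ 2 +
          2 ^ 11 * (C₆ * (8 * E) ^ 3) * l ^ 6 ≤ (η / 2000) ^ 3 := by
        rw [hqr, one_pow, mul_one]
        have p1 := mul_le_mul_of_nonneg_left (pow_le_of_le_one hκ.le hκ1 two_ne_zero)
          (show 0 ≤ 2 ^ 11 * ((2 * S) ^ 10 * (8 * E)) by positivity)
        have p2 := mul_le_mul_of_nonneg_left (pow_le_of_le_one hl.le hl1 (show 6 ≠ 0 by norm_num))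
          (show 0 ≤ 2 ^ 11 * (C₆ * (8 * E) ^ 3) by positivity)
        linarith
      rw [e]
      refine (Real.rpow_le_rpow (by positivity) (mul_le_mul_of_nonneg_right e2 (by positivity))
        (by norm_num)).trans (le_of_eq ?_)
      rw [← mul_pow, ← Real.rpow_natCast, ← Real.rpow_mul (by positivity)]
      norm_num
    have h4 : ∫ t in b..d, nFour (oldPart U a) t ≤ ∫ _ in b..d, η / 2000 * (q ^ 2 / G ^ 2) :=
      integral_mono_on hbd
        ((continuous_nFour (contDiff_oldPart hS.smooth a) (SpaceCpt.oldPart hS.smooth hS.cpt a)).intervalIntegrable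
          b d) intervalIntegrable_const hn
    rw [intervalIntegral.integral_const, smul_eq_mul] at h4
    have h5 : (d - b) * (η / 2000 * (q ^ 2 / G ^ 2)) ≤ r * (η / 2000 * (q ^ 2 / G ^ 2)) :=
      mul_le_mul_of_nonneg_right hdb (by positivity)
    have h6 : r * (η / 2000 * (q ^ 2 / G ^ 2)) = η / G ^ 2 / 2000 * (q ^ 2 * r) := by ring
    rw [hqr] at h6
    have : 0 < η / G ^ 2 := by positivity
    linarith
  refine ⟨t, ht, ?_⟩
  have hGp : 1 ≤ A * G ^ 4 := one_le_mul_of_one_le_of_one_le hA1 (one_le_pow₀ hG)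
  have hfar : S * G * (A * G ^ 4 * r) ^ (-(1 / 2) : ℝ) ≤ l * q / G / 2 := by
    rw [Real.mul_rpow (by positivity) hr.le, ← hq, Real.mul_rpow (by positivity) (by positivity)]
    have e1 : (G ^ 4) ^ (-(1 / 2) : ℝ) = (G ^ 2)⁻¹ := by
      rw [← Real.rpow_natCast, ← Real.rpow_mul hG0.le, ← Real.rpow_natCast, ← Real.rpow_neg hG0.le]; norm_num
    have e2 : S * A ^ (-(1 / 2) : ℝ) ≤ l / 2 := by
      rw [Real.rpow_neg (by positivity), ← sqrt_eq_rpow, ← div_eq_mul_inv,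
        div_le_iff₀ (sqrt_pos.2 (by linarith))]
      have : 2 * S / l ≤ √A := Real.le_sqrt_of_sq_le (le_max_right _ _)
      rw [div_le_iff₀ hl] at this
      linarith
    rw [e1]
    calc S * G * (A ^ (-(1 / 2) : ℝ) * (G ^ 2)⁻¹ * q) = (S * A ^ (-(1 / 2) : ℝ)) * (q / G) := by
          field_simp
      _ ≤ l / 2 * (q / G) := mul_le_mul_of_nonneg_right e2 (by positivity)
      _ = _ := by ring
  have hnear : bilConst.toReal * q * G * (μ ^ (6 / 5 : ℝ) / G ^ 3) ^ (5 / 6 : ℝ) < l * q / G / 2 := by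
    have e1 : (μ ^ (6 / 5 : ℝ) / G ^ 3) ^ (5 / 6 : ℝ) ≤ μ / G ^ 2 := by
      rw [Real.div_rpow (by positivity) (by positivity), ← Real.rpow_mul hμ0.le]
      norm_num
      refine div_le_div_of_nonneg_left hμ0.le (by positivity) ?_
      rw [← Real.rpow_natCast, ← Real.rpow_natCast, ← Real.rpow_mul hG0.le]
      exact Real.rpow_le_rpow_of_exponent_le hG (by norm_num)
    calc bilConst.toReal * q * G * (μ ^ (6 / 5 : ℝ) / G ^ 3) ^ (5 / 6 : ℝ)
        ≤ bilConst.toReal * q * G * (μ / G ^ 2) :=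
          mul_le_mul_of_nonneg_left e1 (mul_nonneg (mul_nonneg toReal_nonneg hq0.le) hG0.le)
      _ < B * q * G * (μ / G ^ 2) := by
          have : 0 < q * G * (μ / G ^ 2) := by positivity
          nlinarith
      _ = _ := by rw [hμ]; field_simp
  obtain ⟨x₁, hx₁⟩ := hS.isBubble_of_avg (r := r) (A := A * G ^ 4) (ε := μ ^ (6 / 5 : ℝ) / G ^ 3) ha hr
    (by linarith [ht.1]) (ht.2.trans hd) hρ hρr hGp (by positivity) x hx hfar hnear
  refine ⟨x₁, ?_⟩
  convert hx₁ using 1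
  rw [hρd]
  field_simp

end SlabSol

/-! ### Geometry of families of bubbles -/

/-- Two bubbles are related if they are not well separated in the causal sense. -/
def bubbleRel (t R : ℕ → ℝ) (x : ℕ → Space) (i j : ℕ) : Prop :=
  ‖x i - x j‖ ≤ |t i - t j| + 2 * (R i + R j)

namespace SlabSol

variable {h H : ℝ → ℝ} {T G E : ℝ} {U : ℝ⁴ → ℝ} {t R : ℕ → ℝ} {x : ℕ → Space} {ε : ℝ} {m : ℕ → ℝ}

theorem card_mul_le (hS : SlabSol h H T G E U) {D : Finset ℕ}
    (hb : ∀ j ∈ D, IsBubble U T (t j) (x j) (R j) ε (m j))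
    (hD : ∀ i ∈ D, ∀ j ∈ D, i ≠ j → ¬ bubbleRel t R x i j) : D.card * ε ≤ 8 * E := by
  choose! τ hτ hτT hτt hτε using fun j hj => (hb j hj).1
  set B : ℕ → Set Space := fun j => closedBall (x j) (R j) with hB
  have hdist : ∀ i ∈ D, ∀ j ∈ D, ∀ y ∈ B i, ∀ z ∈ B j, |τ i y - τ j z| ≤ ‖y - z‖ := by
    intro i hi j hj y hy z hz
    by_cases hij : i = j
    · subst hij
      have := (hτ i hi).dist_le_mul y z
      rwa [NNReal.coe_one, one_mul, Real.dist_eq, dist_eq_norm] at this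
    · have h1 := hD i hi j hj hij
      rw [bubbleRel, not_le] at h1
      have h2 := abs_le.1 (hτt i hi y)
      have h3 := abs_le.1 (hτt j hj z)
      have hy' := mem_closedBall_iff_norm.1 hy
      have hz' := mem_closedBall_iff_norm.1 hz
      have h4 : ‖x i - x j‖ ≤ ‖y - x i‖ + ‖y - z‖ + ‖z - x j‖ := by
        rw [show x i - x j = -(y - x i) + (y - z) + (z - x j) by abel, ← norm_neg (y - x i)]
        exact norm_add₃_le
      have h5 := abs_le.1 (le_refl |t i - t j|)
      have := norm_nonneg (y - x i)
      have := norm_nonneg (z - x j)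
      rw [abs_le]
      constructor <;> linarith
  have hdisj : (D : Set ℕ).PairwiseDisjoint B := by
    intro i hi j hj hij
    refine Set.disjoint_left.2 fun y hy hz => hD i hi j hj hij ?_
    have hy' := mem_closedBall_iff_norm'.1 hy
    have hz' := mem_closedBall_iff_norm.1 hz
    have h1 := norm_add_le (x i - y) (y - x j)
    rw [sub_add_sub_cancel] at h1
    have := norm_nonneg (x i - y)
    have := norm_nonneg (y - x j)
    rw [bubbleRel]
    linarith [abs_nonneg (t i - t j)]
  classical
  let k : Space → ℝ := fun y => if hy : ∃ j ∈ D, y ∈ B j then τ hy.choose y else 0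
  have hk : ∀ j ∈ D, ∀ y ∈ B j, k y = τ j y := fun j hj y hy => by
    have hex : ∃ j ∈ D, y ∈ B j := ⟨j, hj, hy⟩
    have h1 := hex.choose_spec
    have h2 := hdist _ h1.1 j hj y h1.2 y hy
    rw [sub_self, norm_zero, abs_nonpos_iff, sub_eq_zero] at h2
    simp only [k, dif_pos hex, h2]
  obtain ⟨φ, hφ, hφk⟩ := LipschitzOnWith.extend_real (f := k) (K := 1) (s := ⋃ j ∈ D, B j)
    (LipschitzOnWith.of_dist_le_mul fun y hy z hz => by
      obtain ⟨i, hi, hyi⟩ := mem_iUnion₂.1 hy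
      obtain ⟨j, hj, hzj⟩ := mem_iUnion₂.1 hz
      rw [hk i hi y hyi, hk j hj z hzj, NNReal.coe_one, one_mul, Real.dist_eq, dist_eq_norm]
      exact hdist i hi j hj y hyi z hzj)
  have hmain := hS.lintegral_six_graph_le (φ := fun y => max 0 (min T (φ y))) ((hφ.const_min T).const_max 0)
    (fun y => le_max_left _ _) fun y => max_le hS.time_nonneg (min_le_left _ _)
  have hsum : ∑ j ∈ D, ofReal ε ≤ ofReal (8 * E) := by
    refine le_trans ?_ ((setLIntegral_le_lintegral (⋃ j ∈ D, B j) _).trans hmain)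
    rw [lintegral_biUnion_finset hdisj fun j _ => isClosed_closedBall.measurableSet]
    refine sum_le_sum fun j hj => (hτε j hj).trans (le_of_eq ?_)
    refine setLIntegral_congr_fun isClosed_closedBall.measurableSet fun y hy => ?_
    have h1 := hτT j hj y
    rw [← hφk (mem_iUnion₂.2 ⟨j, hj, hy⟩), hk j hj y hy, min_eq_right h1.2, max_eq_right h1.1]
  rw [Finset.sum_const, nsmul_eq_mul, ← ofReal_natCast, ← ofReal_mul (by positivity)] at hsum
  exact (ofReal_le_ofReal_iff (by have := hS.energy_nonneg; positivity)).1 hsum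

theorem lintegral_invDist_six_le (hS : SlabSol h H T G E U) (X : Space) {δ : ℝ} (hδ : 0 < δ) :
    ∫⁻ s in Icc 0 T, ∫⁻ y, ofReal (invDist X δ y) * ‖U (s, y)‖ₑ ^ 6 ≤ ofReal (96 * E) := by
  have hm := morawetz hS.smoothH hS.deriv hS.zero hS.H_nonneg (by norm_num) hS.virial hS.smooth hS.cpt
    hS.time_nonneg hS.eqn X hδ
  have hc : Smooth fun p : ℝ⁴ => invDist X δ p.2 * U p ^ 6 :=
    ((contDiff_invDist X hδ).comp contDiff_snd).mul (hS.smooth.pow 6)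
  have hcc : SpaceCpt fun p : ℝ⁴ => invDist X δ p.2 * U p ^ 6 :=
    hS.cpt.of_local fun p hp => by simp [hp.self_of_nhds]
  have hnn : ∀ p : ℝ⁴, 0 ≤ invDist X δ p.2 * U p ^ 6 := fun p =>
    mul_nonneg (invDist_pos X hδ _).le (Even.pow_nonneg (by decide) _)
  have e : ∀ s, ∫⁻ y, ofReal (invDist X δ y) * ‖U (s, y)‖ₑ ^ 6 =
      ofReal (∫ y, invDist X δ y * U (s, y) ^ 6) := fun s => by
    rw [ofReal_integral_eq_lintegral_ofReal (hcc.integrable hc.continuous s)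
      (of_forall fun y => hnn (s, y))]
    refine lintegral_congr fun y => ?_
    rw [enorm_eq_ofReal_abs, ← ofReal_pow (abs_nonneg _), Even.pow_abs (by decide),
      ofReal_mul (invDist_pos X hδ _).le]
  simp only [e]
  rw [← ofReal_integral_eq_lintegral_ofReal ((hcc.continuous_integral hc).integrableOn_Icc)
    (of_forall fun s => integral_nonneg fun y => hnn (s, y)), integral_Icc_eq_integral_Ioc,
    ← integral_of_le hS.time_nonneg]
  exact ofReal_le_ofReal (by linarith [hS.energy])

theorem _root_.lintegral_inv_sq {a : ℝ} (ha : 0 < a) :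
    ∫⁻ D : ℝ, (Ici a).indicator (fun D => ofReal (D ^ (-2 : ℝ))) D = ofReal a⁻¹ := by
  rw [lintegral_indicator measurableSet_Ici, ← Measure.restrict_congr_set Ioi_ae_eq_Ici,
    ← ofReal_integral_eq_lintegral_ofReal (integrableOn_Ioi_rpow_of_lt (by norm_num) ha)
    ((ae_restrict_mem measurableSet_Ioi).mono fun r hr => Real.rpow_nonneg (ha.le.trans (le_of_lt hr)) _),
    integral_Ioi_rpow_of_lt (by norm_num) ha]
  norm_num [Real.rpow_neg_one]

/-- Length of the smallest interval containing the `i`-th and the `j`-th interval. -/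
def _root_.hull (s : ℕ → ℝ) (i j : ℕ) : ℝ := max (s (i + 1)) (s (j + 1)) - min (s i) (s j)

/-- Total length of the bubbles related to the `i`-th one, within distance `D`. -/
theorem sum_length_le {s : ℕ → ℝ} (hs : StrictMono s) {A θ : ℝ}
    (hA : 1 ≤ A) (hθ : 0 < θ) {F : Finset ℕ}
    (ht : ∀ j ∈ F, t j ∈ Icc (s j) (s (j + 1))) (hR : ∀ j, R j = A * (s (j + 1) - s j))
    (hb : ∀ j ∈ F, IsBubble U T (t j) (x j) (R j) ε (θ * (s (j + 1) - s j))) {i : ℕ} (hi : i ∈ F) {D : ℝ}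
    {F' : Finset ℕ} (hF' : F' ⊆ F) (hF : ∀ j ∈ F', bubbleRel t R x i j ∧ hull s i j ≤ D) :
    ∑ j ∈ F', ofReal (s (j + 1) - s j) ≤ ofReal (10 * A / θ) *
      ∫⁻ r in Icc 0 T, ∫⁻ y in closedBall (x i) (8 * A * D), ‖U (r, y)‖ₑ ^ 6 := by
  have hL : ∀ j, 0 < s (j + 1) - s j := fun j => sub_pos.2 (hs j.lt_succ_self)
  have hR0 : ∀ j, 0 ≤ R j := fun j => by rw [hR]; have := hL j; positivity
  obtain ⟨u, huF, hud, hcov⟩ := Vitali.exists_disjoint_subfamily_covering_enlargement_closedBall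
    (F' : Set ℕ) t R (∑ j ∈ F', R j) (fun j hj => Finset.single_le_sum (fun j _ => hR0 j) hj) 5 (by norm_num)
  have huf : u.Finite := F'.finite_toSet.subset huF
  set u' := huf.toFinset with hu'
  have hu'F : ∀ j ∈ u', j ∈ F' := fun j hj => huF (huf.mem_toFinset.1 hj)
  set M : ℝ → ℝ≥0∞ := fun r => ∫⁻ y in closedBall (x i) (8 * A * D), ‖U (r, y)‖ₑ ^ 6
  have h1 : ∑ j ∈ F', ofReal (s (j + 1) - s j) ≤ ∑ j ∈ u', ofReal (10 * R j) := by
    have e : ∑ j ∈ F', ofReal (s (j + 1) - s j) = volume (⋃ j ∈ F', Ico (s j) (s (j + 1))) := by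
      have hd : (F' : Set ℕ).PairwiseDisjoint fun j => Ico (s j) (s (j + 1)) :=
        fun a _ b _ hab => hs.monotone.pairwise_disjoint_on_Ico_succ hab
      rw [measure_biUnion_finset hd fun j _ => measurableSet_Ico]
      simp [Real.volume_Ico]
    rw [e]
    calc volume (⋃ j ∈ F', Ico (s j) (s (j + 1))) ≤ volume (⋃ j ∈ u', closedBall (t j) (5 * R j)) := by
          refine measure_mono (iUnion₂_subset fun j hj r hr => ?_)
          obtain ⟨b, hb, hsub⟩ := hcov j hj
          refine mem_iUnion₂.2 ⟨b, huf.mem_toFinset.2 hb, hsub ?_⟩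
          have h2 := ht j (hF' hj)
          have h3 : s (j + 1) - s j ≤ R j := by rw [hR]; exact le_mul_of_one_le_left (hL j).le hA
          rw [Real.closedBall_eq_Icc]
          exact ⟨by linarith [hr.1, h2.2], by linarith [hr.2, h2.1]⟩
      _ ≤ ∑ j ∈ u', volume (closedBall (t j) (5 * R j)) := measure_biUnion_finset_le _ _
      _ = _ := sum_congr rfl fun j _ => by rw [Real.volume_closedBall]; congr 1; ring
  refine h1.trans ?_
  have h2 : ∀ j ∈ u', ofReal (10 * R j) ≤ ofReal (10 * A / θ) *
      ∫⁻ r in Icc 0 T ∩ closedBall (t j) (R j), M r := fun j hj => by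
    have hjF := hu'F j hj
    have h3 := (hb j (hF' hjF)).2
    have e : 10 * R j = 10 * A / θ * (θ * (s (j + 1) - s j)) := by rw [hR]; field_simp
    rw [e, ofReal_mul (by positivity)]
    refine mul_le_mul' le_rfl (h3.trans ?_)
    rw [← Real.closedBall_eq_Icc]
    refine lintegral_mono fun r => lintegral_mono' (Measure.restrict_mono (fun y hy => ?_) le_rfl) le_rfl
    rw [mem_closedBall_iff_norm] at hy ⊢
    obtain ⟨h4, h5⟩ := hF j hjF
    rw [bubbleRel, norm_sub_rev] at h4
    have h6 : ‖y - x i‖ ≤ ‖y - x j‖ + ‖x j - x i‖ := by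
      have := norm_add_le (y - x j) (x j - x i); rwa [sub_add_sub_cancel] at this
    have ti := ht i hi
    have tj := ht j (hF' hjF)
    rw [hull] at h5
    have m1 := le_max_left (s (i + 1)) (s (j + 1))
    have m2 := le_max_right (s (i + 1)) (s (j + 1))
    have m3 := min_le_left (s i) (s j)
    have m4 := min_le_right (s i) (s j)
    have h7 : |t i - t j| ≤ D := abs_le.2 ⟨by linarith [ti.1, tj.2], by linarith [ti.2, tj.1]⟩
    have h8 : R i ≤ A * D := by rw [hR]; exact mul_le_mul_of_nonneg_left (by linarith) (by linarith)
    have h9 : R j ≤ A * D := by rw [hR]; exact mul_le_mul_of_nonneg_left (by linarith) (by linarith)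
    have h10 : D ≤ A * D := le_mul_of_one_le_left ((abs_nonneg _).trans h7) hA
    linarith
  refine (sum_le_sum h2).trans ?_
  rw [← mul_sum]
  refine mul_le_mul' le_rfl ?_
  rw [← lintegral_biUnion_finset]
  · exact lintegral_mono' (Measure.restrict_mono (iUnion₂_subset fun j _ => inter_subset_left) le_rfl) le_rfl
  · exact fun a ha b hb hab => (hud (huf.mem_toFinset.1 ha) (huf.mem_toFinset.1 hb) hab).mono
      inter_subset_right inter_subset_right
  · exact fun j _ => measurableSet_Icc.inter isClosed_closedBall.measurableSet

theorem sum_related_le (hS : SlabSol h H T G E U) {s : ℕ → ℝ} (hs : StrictMono s) {A θ : ℝ}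
    (hA : 1 ≤ A) (hθ : 0 < θ) {F : Finset ℕ}
    (ht : ∀ j ∈ F, t j ∈ Icc (s j) (s (j + 1))) (hR : ∀ j, R j = A * (s (j + 1) - s j))
    (hb : ∀ j ∈ F, IsBubble U T (t j) (x j) (R j) ε (θ * (s (j + 1) - s j))) {i : ℕ} (hi : i ∈ F)
    {F₀ : Finset ℕ} (hF₀ : F₀ ⊆ F) (hrel : ∀ j ∈ F₀, bubbleRel t R x i j) :
    ∑ j ∈ F₀, (s (j + 1) - s j) / hull s i j ≤ 15360 * A ^ 2 / θ * E := by
  have hL : ∀ j, 0 < s (j + 1) - s j := fun j => sub_pos.2 (hs j.lt_succ_self)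
  have hE := hS.energy_nonneg
  have hh : ∀ j, s (i + 1) - s i ≤ hull s i j := fun j => by
    rw [hull]
    linarith [le_max_left (s (i + 1)) (s (j + 1)), min_le_left (s i) (s j)]
  have hh0 : ∀ j, 0 < hull s i j := fun j => (hL i).trans_le (hh j)
  set L := s (i + 1) - s i with hLd
  set w : ℝ → ℝ≥0∞ := fun D => ofReal (D ^ (-2 : ℝ)) with hw
  have hwm : Measurable w := by fun_prop
  set μ := (volume.restrict (Icc 0 T)).prod (volume : Measure Space) with hμ
  set K := ofReal (10 * A / θ)
  have hU6 : Measurable fun q : ℝ⁴ => ‖U q‖ₑ ^ 6 := hS.smooth.continuous.measurable.enorm.pow_const 6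
  have hset : MeasurableSet {z : ℝ × ℝ⁴ | L ≤ z.1 ∧ ‖z.2.2 - x i‖ ≤ 8 * A * z.1} :=
    (measurableSet_le measurable_const measurable_fst).inter
      (measurableSet_le (f := fun z : ℝ × ℝ⁴ => ‖z.2.2 - x i‖) (by fun_prop) (by fun_prop))
  set Θ : ℝ × ℝ⁴ → ℝ≥0∞ := {z : ℝ × ℝ⁴ | L ≤ z.1 ∧ ‖z.2.2 - x i‖ ≤ 8 * A * z.1}.indicator
    fun z => w z.1 * ‖U z.2‖ₑ ^ 6 with hΘ
  have hΘm : Measurable Θ := ((hwm.comp measurable_fst).mul (hU6.comp measurable_snd)).indicator hset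
  classical
  have h1 : ∀ D, ∑ j ∈ F₀, ofReal (s (j + 1) - s j) * (Ici (hull s i j)).indicator w D ≤
      K * ∫⁻ q, Θ (D, q) ∂μ := fun D => by
    have e : ∑ j ∈ F₀, ofReal (s (j + 1) - s j) * (Ici (hull s i j)).indicator w D =
        w D * ∑ j ∈ F₀ with hull s i j ≤ D, ofReal (s (j + 1) - s j) := by
      rw [Finset.sum_filter, mul_sum]
      refine sum_congr rfl fun j _ => ?_
      by_cases hj : hull s i j ≤ D
      · rw [indicator_of_mem (show D ∈ Ici _ from hj), if_pos hj, mul_comm]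
      · rw [indicator_of_notMem (show D ∉ Ici _ from hj), if_neg hj, mul_zero, mul_zero]
    rw [e]
    by_cases hD : L ≤ D
    · have h2 := sum_length_le hs hA hθ ht hR hb hi (D := D) (F' := F₀.filter fun j => hull s i j ≤ D)
        ((Finset.filter_subset _ _).trans hF₀) fun j hj =>
          ⟨hrel j (Finset.mem_filter.1 hj).1, (Finset.mem_filter.1 hj).2⟩
      refine (mul_le_mul' le_rfl h2).trans (le_of_eq ?_)
      have hΘD : Measurable fun q => Θ (D, q) := hΘm.comp measurable_prodMk_left
      rw [hμ, lintegral_prod _ hΘD.aemeasurable, ← mul_assoc, mul_comm (w D), mul_assoc,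
        ← lintegral_const_mul' _ _ ofReal_ne_top]
      congr 1
      refine lintegral_congr fun r => ?_
      rw [← lintegral_indicator isClosed_closedBall.measurableSet,
        ← lintegral_const_mul' _ _ ofReal_ne_top]
      refine lintegral_congr fun y => ?_
      by_cases hy : ‖y - x i‖ ≤ 8 * A * D
      · rw [indicator_of_mem (mem_closedBall_iff_norm.2 hy), hΘ,
          indicator_of_mem (show (D, r, y) ∈ {z : ℝ × ℝ⁴ | L ≤ z.1 ∧ ‖z.2.2 - x i‖ ≤ 8 * A * z.1} from ⟨hD, hy⟩)]
      · rw [indicator_of_notMem fun h' => hy (mem_closedBall_iff_norm.1 h'), hΘ,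
          indicator_of_notMem fun h' => hy h'.2, mul_zero]
    · rw [Finset.filter_false_of_mem fun j _ hj => hD ((hh j).trans hj)]
      simp
  have h2 : ∀ q : ℝ⁴, ∫⁻ D, Θ (D, q) ≤
      ofReal (16 * A) * (ofReal (invDist (x i) L q.2) * ‖U q‖ₑ ^ 6) := fun q => by
    set a := max L (‖q.2 - x i‖ / (8 * A)) with ha
    have ha0 : 0 < a := (hL i).trans_le (le_max_left _ _)
    have e : ∀ D, Θ (D, q) = (Ici a).indicator w D * ‖U q‖ₑ ^ 6 := fun D => by
      by_cases hD : a ≤ D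
      · rw [indicator_of_mem (show D ∈ Ici a from hD), hΘ, indicator_of_mem]
        rw [ha, max_le_iff, div_le_iff₀ (by positivity), mul_comm D] at hD
        exact hD
      · rw [indicator_of_notMem (show D ∉ Ici a from hD), hΘ, indicator_of_notMem, zero_mul]
        rw [ha, max_le_iff, div_le_iff₀ (by positivity), mul_comm D] at hD
        exact hD
    simp only [e]
    rw [lintegral_mul_const' _ _ (pow_ne_top enorm_ne_top), lintegral_inv_sq ha0, ← mul_assoc,
      ← ofReal_mul (by positivity)]
    refine mul_le_mul' (ofReal_le_ofReal ?_) le_rfl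
    have h3 : ‖q.2 - x i‖ ≤ 8 * A * a := by
      have := le_max_right L (‖q.2 - x i‖ / (8 * A))
      rwa [← ha, div_le_iff₀ (by positivity), mul_comm] at this
    have h4 : L ≤ 8 * A * a := (le_max_left L _).trans (le_mul_of_one_le_left ha0.le (by linarith))
    have h5 : √(‖q.2 - x i‖ ^ 2 + L ^ 2) ≤ 16 * A * a := by
      rw [Real.sqrt_le_left (by positivity)]
      have := pow_le_pow_left₀ (norm_nonneg _) h3 2
      have := pow_le_pow_left₀ (hL i).le h4 2
      nlinarith [sq_nonneg (A * a)]
    rw [invDist, ← div_eq_mul_inv, inv_eq_one_div, div_le_div_iff₀ ha0 (sqrt_pos.2 (by have := hL i; positivity)), one_mul]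
    exact h5
  have hsum : ∑ j ∈ F₀, ofReal ((s (j + 1) - s j) / hull s i j) ≤
      ofReal (15360 * A ^ 2 / θ * E) := by
    calc ∑ j ∈ F₀, ofReal ((s (j + 1) - s j) / hull s i j)
        = ∑ j ∈ F₀, ∫⁻ D, ofReal (s (j + 1) - s j) * (Ici (hull s i j)).indicator w D := by
          refine sum_congr rfl fun j _ => ?_
          rw [lintegral_const_mul' _ _ ofReal_ne_top, lintegral_inv_sq (hh0 j), div_eq_mul_inv,
            ofReal_mul (hL j).le]
      _ = ∫⁻ D, ∑ j ∈ F₀, ofReal (s (j + 1) - s j) * (Ici (hull s i j)).indicator w D := by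
          rw [lintegral_finsetSum]
          exact fun j _ => (hwm.indicator measurableSet_Ici).const_mul _
      _ ≤ ∫⁻ D, K * ∫⁻ q, Θ (D, q) ∂μ := lintegral_mono h1
      _ = K * ∫⁻ q, (∫⁻ D, Θ (D, q)) ∂μ := by
          rw [lintegral_const_mul' _ _ ofReal_ne_top, lintegral_lintegral_swap (f := fun D q => Θ (D, q)) hΘm.aemeasurable]
      _ ≤ K * (ofReal (16 * A) * ofReal (96 * E)) := by
          refine mul_le_mul' le_rfl ((lintegral_mono h2).trans ?_)
          have hm : Measurable fun q : ℝ⁴ => ofReal (invDist (x i) L q.2) * ‖U q‖ₑ ^ 6 :=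
            ((contDiff_invDist (x i) (hL i)).continuous.comp continuous_snd).measurable.ennreal_ofReal.mul hU6
          rw [lintegral_const_mul' _ _ ofReal_ne_top, hμ, lintegral_prod _ hm.aemeasurable]
          exact mul_le_mul' le_rfl (hS.lintegral_invDist_six_le (x i) (hL i))
      _ = _ := by
          rw [← ofReal_mul (by positivity), ← ofReal_mul (by positivity)]
          congr 1
          ring
  rw [← ENNReal.ofReal_sum_of_nonneg fun j _ => div_nonneg (hL j).le (hh0 j).le] at hsum
  exact (ofReal_le_ofReal_iff (by positivity)).1 hsum

end SlabSol

/-! ### Many intervals contain many independent bubbles -/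

theorem hull_pos {s : ℕ → ℝ} (hs : StrictMono s) (i j : ℕ) : 0 < hull s i j := by
  rw [hull]
  linarith [le_max_left (s (i + 1)) (s (j + 1)), min_le_left (s i) (s j), hs i.lt_succ_self]

theorem log_le_sum_hull {s : ℕ → ℝ} (hs : StrictMono s) (k q : ℕ) :
    (2:ℝ) ^ k * (k / 2) ≤ ∑ i ∈ Finset.Ico q (q + 2 ^ k), ∑ j ∈ Finset.Ico q (q + 2 ^ k),
      (s (j + 1) - s j) / hull s i j := by
  have hnn : ∀ i j, 0 ≤ (s (j + 1) - s j) / hull s i j := fun i j =>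
    div_nonneg (sub_nonneg.2 (hs j.lt_succ_self).le) (hull_pos hs i j).le
  induction k generalizing q with
  | zero => simpa using hnn q q
  | succ k ih =>
    set n := 2 ^ k with hn
    have hn0 : 0 < n := by positivity
    have e : q + 2 ^ (k + 1) = q + n + n := by rw [hn]; ring
    set Λ := s (q + n + n) - s q with hΛ
    have hΛ0 : 0 < Λ := sub_pos.2 (hs (by omega))
    have hsplit : ∀ X : ℕ → ℝ, ∑ j ∈ Finset.Ico q (q + n + n), X j =
        ∑ j ∈ Finset.Ico q (q + n), X j + ∑ j ∈ Finset.Ico (q + n) (q + n + n), X j := fun X =>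
      (Finset.sum_Ico_consecutive X (by omega) (by omega)).symm
    have hcross : ∀ a b, q ≤ a → a + n ≤ q + n + n → q ≤ b → b + n ≤ q + n + n →
        n * ((s (b + n) - s b) / Λ) ≤ ∑ i ∈ Finset.Ico a (a + n), ∑ j ∈ Finset.Ico b (b + n),
          (s (j + 1) - s j) / hull s i j := fun a b ha ha' hb hb' => by
      have h1 : ∀ i ∈ Finset.Ico a (a + n), (s (b + n) - s b) / Λ ≤ ∑ j ∈ Finset.Ico b (b + n),
          (s (j + 1) - s j) / hull s i j := fun i hi => by
        rw [← Finset.sum_Ico_sub s (show b ≤ b + n by omega), Finset.sum_div]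
        refine sum_le_sum fun j hj => div_le_div_of_nonneg_left
          (sub_nonneg.2 (hs j.lt_succ_self).le) (hull_pos hs i j) ?_
        rw [Finset.mem_Ico] at hi hj
        exact sub_le_sub (max_le (hs.monotone (by omega)) (hs.monotone (by omega)))
          (le_min (hs.monotone (by omega)) (hs.monotone (by omega)))
      have h2 := Finset.card_nsmul_le_sum _ _ _ h1
      rwa [Nat.card_Ico, Nat.add_sub_cancel_left, nsmul_eq_mul] at h2
    have h1 := hcross q (q + n) le_rfl (by omega) (by omega) le_rfl
    have h2 := hcross (q + n) q (by omega) le_rfl le_rfl (by omega)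
    have h3 : n * ((s (q + n + n) - s (q + n)) / Λ) + n * ((s (q + n) - s q) / Λ) = n := by
      field_simp; rw [hΛ]; ring
    have h4 := ih q
    have h5 := ih (q + n)
    rw [e, hsplit]
    simp only [hsplit, Finset.sum_add_distrib]
    have h6 : (n : ℝ) = 2 ^ k := by rw [hn]; push_cast; rfl
    rw [h6] at h1 h2 h3
    rw [pow_succ]
    push_cast
    linarith

theorem exists_independent {s : ℕ → ℝ} (hs : StrictMono s) {rel : ℕ → ℕ → Prop} (hrefl : ∀ i, rel i i)
    (hsymm : ∀ i j, rel i j → rel j i) {F : Finset ℕ} {Q : ℝ} (hQ0 : 0 ≤ Q)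
    (hQ : ∀ i ∈ F, ∀ F₀ ⊆ F, (∀ j ∈ F₀, rel i j) → ∑ j ∈ F₀, (s (j + 1) - s j) / hull s i j ≤ Q) (k m : ℕ)
    (hm : m * Q < k / 2) (p : ℕ) (hp : Finset.Ico p (p + 2 ^ (k * m)) ⊆ F) :
    ∃ D ⊆ Finset.Ico p (p + 2 ^ (k * m)), D.card = m + 1 ∧ ∀ i ∈ D, ∀ j ∈ D, i ≠ j → ¬ rel i j := by
  classical
  induction m generalizing p with
  | zero => exact ⟨{p}, by simp, by simp, by simp⟩
  | succ m ih =>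
    set w := 2 ^ (k * m) with hw
    have hw0 : 0 < w := by positivity
    have hwn : 2 ^ (k * (m + 1)) = 2 ^ k * w := by rw [hw, ← pow_add]; congr 1; ring
    rw [hwn] at hp ⊢
    have hblock : ∀ β < 2 ^ k, p + β * w + w ≤ p + 2 ^ k * w := fun β hβ => by
      have := Nat.mul_le_mul_right w (Nat.succ_le_of_lt hβ)
      rw [Nat.succ_mul] at this
      omega
    have hsub : ∀ β < 2 ^ k, Finset.Ico (p + β * w) (p + β * w + w) ⊆ Finset.Ico p (p + 2 ^ k * w) := fun β hβ =>
      Finset.Ico_subset_Ico (by omega) (hblock β hβ)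
    have hL : ∀ j, 0 ≤ s (j + 1) - s j := fun j => sub_nonneg.2 (hs j.lt_succ_self).le
    push_cast at hm
    choose! D hD hcard hind using fun β (hβ : β < 2 ^ k) =>
      ih (by nlinarith) (p + β * w) ((hsub β hβ).trans hp)
    by_contra! hno
    have hmax : ∀ β < 2 ^ k, ∀ j ∈ Finset.Ico p (p + 2 ^ k * w), ∃ i ∈ D β, rel i j := fun β hβ j hj => by
      by_contra! hall
      have hjD : j ∉ D β := fun h => hall j h (hrefl j)
      obtain ⟨i, hi, i', hi', hne, hr⟩ := hno (insert j (D β))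
        (Finset.insert_subset hj ((hD β hβ).trans (hsub β hβ))) (by rw [Finset.card_insert_of_notMem hjD, hcard β hβ])
      rw [Finset.mem_insert] at hi hi'
      rcases hi with rfl | hi <;> rcases hi' with rfl | hi'
      · exact hne rfl
      · exact hall i' hi' (hsymm _ _ hr)
      · exact hall i hi hr
      · exact hind β hβ i hi i' hi' hne hr
    set σ : ℕ → ℝ := fun β => s (p + β * w) with hσ
    have hσm : StrictMono σ := fun a b hab => hs (by have := Nat.mul_lt_mul_of_pos_right hab hw0; omega)
    have hlog := log_le_sum_hull hσm k 0
    rw [Nat.zero_add, Nat.Ico_zero_eq_range] at hlog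
    obtain ⟨β, hβ, hβk⟩ : ∃ β ∈ Finset.range (2 ^ k),
        (k / 2 : ℝ) ≤ ∑ β' ∈ Finset.range (2 ^ k), (σ (β' + 1) - σ β') / hull σ β β' := by
      refine Finset.exists_le_of_sum_le (Finset.nonempty_range_iff.2 (by positivity)) ?_
      rw [Finset.sum_const, Finset.card_range, nsmul_eq_mul]
      exact_mod_cast hlog
    rw [Finset.mem_range] at hβ
    have hblocks : ∀ (X : ℕ → ℝ) (n : ℕ), ∑ β' ∈ Finset.range n, ∑ j ∈ Finset.Ico (p + β' * w) (p + (β' + 1) * w), X j =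
        ∑ j ∈ Finset.Ico p (p + n * w), X j := fun X n => by
      induction n with
      | zero => simp
      | succ n ihn =>
        rw [Finset.sum_range_succ, ihn]
        exact Finset.sum_Ico_consecutive X (by omega) (by nlinarith)
    have h1 : ∑ β' ∈ Finset.range (2 ^ k), (σ (β' + 1) - σ β') / hull σ β β' ≤
        ∑ j ∈ Finset.Ico p (p + 2 ^ k * w), ∑ i ∈ D β with rel i j, (s (j + 1) - s j) / hull s i j := by
      rw [← hblocks]
      refine sum_le_sum fun β' hβ' => ?_
      rw [Finset.mem_range] at hβ'
      have e : (β' + 1) * w = β' * w + w := by ring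
      have e' : (β + 1) * w = β * w + w := by ring
      simp only [hσ]
      rw [← Finset.sum_Ico_sub s (show p + β' * w ≤ p + (β' + 1) * w by omega), Finset.sum_div]
      refine sum_le_sum fun j hj => ?_
      have hb' := hblock β' hβ'
      rw [Finset.mem_Ico] at hj
      obtain ⟨i, hi, hr⟩ := hmax β hβ j (Finset.mem_Ico.2 (by omega))
      refine le_trans ?_ (Finset.single_le_sum (f := fun i => (s (j + 1) - s j) / hull s i j)
        (fun i _ => div_nonneg (hL j) (hull_pos hs i j).le) (Finset.mem_filter.2 ⟨hi, hr⟩))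
      have hi' := Finset.mem_Ico.1 (hD β hβ hi)
      refine div_le_div_of_nonneg_left (hL j) (hull_pos hs i j) ?_
      exact sub_le_sub (max_le_max (hs.monotone (by omega)) (hs.monotone (by omega)))
        (min_le_min (hs.monotone (by omega)) (hs.monotone (by omega)))
    have h2 : ∑ j ∈ Finset.Ico p (p + 2 ^ k * w), ∑ i ∈ D β with rel i j, (s (j + 1) - s j) / hull s i j ≤
        ∑ _i ∈ D β, Q := by
      simp only [Finset.sum_filter]
      rw [Finset.sum_comm]
      refine sum_le_sum fun i hi => ?_
      rw [← Finset.sum_filter]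
      exact hQ i (hp (hsub β hβ (hD β hβ hi))) _ ((Finset.filter_subset _ _).trans hp)
        fun j hj => (Finset.mem_filter.1 hj).2
    rw [Finset.sum_const, hcard β hβ, nsmul_eq_mul] at h2
    push_cast at h2
    linarith

theorem exists_block_avoiding {W : ℕ} (hW : 0 < W) (X : Finset ℕ) {N : ℕ} (hN : (X.card + 1) * W ≤ N) :
    ∃ p, p + W ≤ N ∧ ∀ j ∈ Finset.Ico p (p + W), j ∉ X := by
  obtain ⟨b, hb, hbX⟩ := Finset.exists_mem_notMem_of_card_lt_card
    (s := X.image (· / W)) (t := Finset.range (X.card + 1))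
    (by rw [Finset.card_range]; exact Nat.lt_succ_of_le Finset.card_image_le)
  rw [Finset.mem_range] at hb
  refine ⟨b * W, ?_, fun j hj hjX => hbX (Finset.mem_image.2 ⟨j, hjX, ?_⟩)⟩
  · have := Nat.mul_le_mul_right W (Nat.succ_le_of_lt hb)
    rw [Nat.succ_mul] at this
    omega
  · rw [Finset.mem_Ico] at hj
    rw [Nat.div_eq_iff hW, mul_comm]
    constructor
    · rw [mul_comm]; exact hj.1
    · rw [mul_comm]; omega

/-! ### The a priori bound on the Strichartz norm -/

namespace IsBubble

variable {U : ℝ⁴ → ℝ} {T t R ε m : ℝ} {x : Space}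

theorem mono (h : IsBubble U T t x R ε m) {R' m' : ℝ} (hR : R ≤ R') (hm : m' ≤ m) : IsBubble U T t x R' ε m' := by
  obtain ⟨⟨τ, h1, h2, h3, h4⟩, h5⟩ := h
  refine ⟨⟨τ, h1, h2, h3, h4.trans (lintegral_mono_set (Metric.closedBall_subset_closedBall hR))⟩,
    (ofReal_le_ofReal hm).trans (h5.trans ?_)⟩
  exact (lintegral_mono_set (inter_subset_inter_right _ (Icc_subset_Icc (by linarith) (by linarith)))).trans
    (lintegral_mono fun s => lintegral_mono_set (Metric.closedBall_subset_closedBall (by linarith)))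

theorem reflect (h : IsBubble (timeMap (-1) T U) T t x R ε m) : IsBubble U T (T - t) x R ε m := by
  obtain ⟨⟨τ, h1, h2, h3, h4⟩, h5⟩ := h
  have e : ∀ s : ℝ, -1 * s + T = T - s := fun s => by ring
  simp only [timeMap, e] at h4 h5
  refine ⟨⟨fun y => T - τ y, ?_, fun y => ⟨by linarith [h2 y], by linarith [h2 y]⟩, fun y => ?_, h4⟩, ?_⟩
  · simpa [Function.comp_def] using (LipschitzWith.of_dist_le_mul (K := 1) fun a b : ℝ => by
      rw [NNReal.coe_one, one_mul, dist_sub_left]).comp h1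
  · rw [sub_sub_sub_cancel_left, abs_sub_comm]; exact h3 y
  · have h6 := (Measure.measurePreserving_sub_left (volume : Measure ℝ) T).setLIntegral_comp_preimage_emb
      (MeasurableEquiv.subLeft T).measurableEmbedding
      (fun s => ∫⁻ y in closedBall x (3 * R), ‖U (s, y)‖ₑ ^ 6) (Icc 0 T ∩ Icc (T - t - R) (T - t + R))
    rw [← h6]
    convert h5 using 3
    ext s
    simp only [mem_preimage, mem_inter_iff, mem_Icc]
    constructor <;> rintro ⟨⟨_, _⟩, _, _⟩ <;> exact ⟨⟨by linarith, by linarith⟩, by linarith, by linarith⟩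

end IsBubble

theorem nFour_reflect (U : ℝ⁴ → ℝ) (T t : ℝ) : nFour (timeMap (-1) T U) t = nFour U (T - t) := by
  simp only [nFour, timeMap, show -1 * t + T = T - t by ring]

namespace SlabSol

variable {h H : ℝ → ℝ} {T G E : ℝ} {U : ℝ⁴ → ℝ}

theorem integral_nFour_freeFrom_zero_le (hS : SlabSol h H T G E U) :
    ∫ t in (0:ℝ)..T, nFour (freeFrom U 0) t ≤ 16 * strConst * E ^ 2 := by
  have h1 := integral_nFour_freeWave_le (hS.smooth.comp (contDiff_prodMk_right 0)) ((hS.smooth.dd_top vt).comp (contDiff_prodMk_right 0))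
    (hS.cpt.slice 0) ((hS.cpt.dd vt).slice 0) hS.time_nonneg
  have e : ∀ p, freeFrom U 0 p = freeWave (fun x => U (0, x)) (fun x => dd vt U (0, x)) p := fun p => by
    simp [freeFrom, timeMap]
  have h2 := integral_edens_freeFrom hS.smooth hS.cpt 0 0
  rw [funext e] at h2 ⊢
  refine h1.trans (mul_le_mul_of_nonneg_left (pow_le_pow_left₀ (integral_nonneg fun _ => edens_zero_nonneg _ _) ?_ 2)
    (by have := strConst_nonneg; positivity))
  exact h2.le.trans (hS.integral_edens_zero_le le_rfl hS.time_nonneg)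

theorem exists_partition {φ : ℝ → ℝ} (hφ : Continuous φ) (hφ0 : ∀ t, 0 ≤ φ t) (hT : 0 ≤ T) {η : ℝ} (hη : 0 < η) :
    ∃ s : ℕ → ℝ, StrictMono s ∧ (∀ j, 0 ≤ s j) ∧ ∀ j : ℕ, j * η ≤ ∫ t in (0:ℝ)..T, φ t →
      s j ≤ T ∧ ∫ t in (0:ℝ)..(s j), φ t = j * η := by
  set Ψ : ℝ → ℝ := fun t => ∫ r in (0:ℝ)..t, φ r with hΨ
  have hmono : Monotone Ψ := fun a b hab => by
    rw [← sub_nonneg, hΨ]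
    simp only
    rw [integral_interval_sub_left (hφ.intervalIntegrable _ _) (hφ.intervalIntegrable _ _)]
    exact intervalIntegral.integral_nonneg hab fun t _ => hφ0 t
  have hcont : Continuous Ψ := intervalIntegral.continuous_primitive (fun a b => hφ.intervalIntegrable a b) 0
  set Φ : ℝ → ℝ := fun t => Ψ (min t T) + max (t - T) 0 with hΦ
  have hΦm : Monotone Φ := fun a b hab =>
    add_le_add (hmono (min_le_min_right T hab)) (max_le_max_right 0 (by linarith))
  have hΦc : Continuous Φ := by fun_prop
  have hΨ0 : Ψ 0 = 0 := integral_same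
  have hΨT : 0 ≤ Ψ T := hΨ0 ▸ hmono hT
  have hex : ∀ j : ℕ, ∃ s, 0 ≤ s ∧ Φ s = j * η := fun j => by
    have h0 : Φ 0 ≤ j * η := by
      simp only [hΦ, min_eq_left hT, hΨ0, zero_add, zero_sub, max_eq_right (neg_nonpos.2 hT)]
      positivity
    have h1 : (j:ℝ) * η ≤ Φ (T + j * η) := by
      have : 0 ≤ j * η := by positivity
      simp only [hΦ, min_eq_right (le_add_of_nonneg_right this), add_sub_cancel_left, max_eq_left this]
      linarith
    obtain ⟨s, hs, hs'⟩ := intermediate_value_Icc (by positivity) hΦc.continuousOn ⟨h0, h1⟩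
    exact ⟨s, hs.1, hs'⟩
  choose s hs0 hs using hex
  refine ⟨s, fun i j hij => ?_, hs0, fun j hj => ?_⟩
  · refine hΦm.reflect_lt ?_
    rw [hs, hs]
    exact mul_lt_mul_of_pos_right (by exact_mod_cast hij) hη
  · have h1 : s j ≤ T := by
      by_contra! hlt
      have := hs j
      simp only [hΦ, min_eq_right hlt.le, max_eq_left (sub_nonneg.2 hlt.le)] at this
      linarith [show Ψ T = ∫ t in (0:ℝ)..T, φ t from rfl]
    refine ⟨h1, ?_⟩
    rw [← hs j]
    simp [hΦ, min_eq_left h1, hΨ]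
    exact h1

theorem exists_integral_nFour_le {E : ℝ} (hE : 0 ≤ E) : ∃ C : ℝ, 0 < C ∧ ∀ {h H : ℝ → ℝ} {T G : ℝ}
    {U : ℝ⁴ → ℝ}, SlabSol h H T G E U → ∫ t in (0:ℝ)..T, nFour U t ≤ exp (C * G ^ 25) := by
  obtain ⟨η, A, ε, θ, hη, hA, hε, hθ, hbub⟩ := exists_bubble hE
  set B := 32 * strConst * E ^ 2 with hB
  have hB0 : 0 ≤ B := by have := strConst_nonneg; positivity
  set M := 8 * E / ε with hM
  set Q₀ := 30720 * A ^ 2 / θ * E with hQ₀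
  refine ⟨(2000 * B + 2 * η) + (2 * (M * Q₀) + 1) * M, by positivity, fun {h H T G U} hS => ?_⟩
  have hG := hS.one_le
  have hG0 : 0 < G := by linarith
  set η₄ := η / G ^ 2 with hη₄
  have hη₄0 : 0 < η₄ := by positivity
  set I := ∫ t in (0:ℝ)..T, nFour U t with hI
  have hnc := continuous_nFour hS.smooth hS.cpt
  have hig : ∀ a b, IntervalIntegrable (nFour U) volume a b := fun a b => hnc.intervalIntegrable a b
  obtain ⟨s', hs', hs'0, hs'T⟩ := exists_partition hnc (nFour_nonneg U) hS.time_nonneg hη₄0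
  have hI0 : 0 ≤ I := intervalIntegral.integral_nonneg hS.time_nonneg fun t _ => nFour_nonneg U t
  set N := ⌊I / (2 * η₄)⌋₊ with hN
  have hNI : ∀ j < N, ∀ i ≤ 2 * j + 2, (i : ℝ) * η₄ ≤ I := fun j hj i hi => by
    have h1 : ((j + 1 : ℕ) : ℝ) ≤ I / (2 * η₄) :=
      (Nat.le_floor_iff (by positivity)).1 (Nat.succ_le_of_lt hj)
    rw [le_div_iff₀ (by positivity)] at h1
    have h2 : (i : ℝ) ≤ 2 * j + 2 := by exact_mod_cast hi
    push_cast at h1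
    nlinarith
  set s : ℕ → ℝ := fun j => s' (2 * j) with hs_def
  have hs : StrictMono s := fun a b hab => hs' (by omega)
  -- the free evolutions from both ends
  have hSr := hS.reflect
  have hV₀ := continuous_nFour (contDiff_freeFrom hS.smooth 0) (SpaceCpt.freeFrom hS.smooth hS.cpt 0)
  have hV₁ := continuous_nFour (contDiff_freeFrom hSr.smooth 0) (SpaceCpt.freeFrom hSr.smooth hSr.cpt 0)
  set X₀ : ℝ → ℝ := nFour (freeFrom U 0) with hX₀
  set X₁ : ℝ → ℝ := nFour (freeFrom (timeMap (-1) T U) 0) with hX₁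
  have hV₁T : Continuous fun t => X₁ (T - t) := by fun_prop
  have hXc : Continuous fun t => X₀ t + X₁ (T - t) := hV₀.add hV₁T
  have hX0 : ∀ t, 0 ≤ X₀ t + X₁ (T - t) := fun t => add_nonneg (nFour_nonneg _ _) (nFour_nonneg _ _)
  have hXi : ∀ a b, IntervalIntegrable (fun t => X₀ t + X₁ (T - t)) volume a b := fun a b => hXc.intervalIntegrable a b
  have hXB : ∫ t in (0:ℝ)..T, (X₀ t + X₁ (T - t)) ≤ B := by
    have h1 := hS.integral_nFour_freeFrom_zero_le
    have h2 := hSr.integral_nFour_freeFrom_zero_le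
    rw [intervalIntegral.integral_add (hV₀.intervalIntegrable _ _)
      (hV₁T.intervalIntegrable _ _),
      integral_comp_sub_left (fun t => X₁ t), sub_self, sub_zero]
    rw [hB]; linarith
  have hsub : ∀ {φ ψ : ℝ → ℝ}, Continuous φ → Continuous ψ → (∀ t, 0 ≤ φ t) → (∀ t, φ t ≤ ψ t) → ∀ {a b a' b' : ℝ},
      a ≤ a' → a' ≤ b' → b' ≤ b → ∫ t in a'..b', φ t ≤ ∫ t in a..b, ψ t :=
    fun {φ ψ} hφ hψ h0 hle {a b a' b'} h1 h2 h3 =>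
      (integral_mono_on h2 (hφ.intervalIntegrable _ _) (hψ.intervalIntegrable _ _)
        fun t _ => hle t).trans (intervalIntegral.integral_mono_interval h1 h2 h3
          (of_forall fun t => (h0 t).trans (hle t)) (hψ.intervalIntegrable _ _))
  classical
  set Ex := (Finset.range N).filter fun j => η₄ / 1000 < ∫ t in (s j)..(s (j + 1)), (X₀ t + X₁ (T - t)) with hEx
  have hsT : ∀ j < N, ∀ i ≤ 2 * j + 2, s' i ≤ T := fun j hj i hi => (hs'T i (hNI j hj i hi)).1
  have hcard : Ex.card * (η₄ / 1000) ≤ B := by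
    have h1 := Finset.card_nsmul_le_sum Ex _ (η₄ / 1000) fun j hj => (Finset.mem_filter.1 hj).2.le
    rw [nsmul_eq_mul] at h1
    refine h1.trans ((Finset.sum_le_sum_of_subset_of_nonneg (Finset.filter_subset _ _) fun j _ _ =>
      intervalIntegral.integral_nonneg (hs j.lt_succ_self).le fun t _ => hX0 t).trans ?_)
    rw [intervalIntegral.sum_integral_adjacent_intervals fun j _ => hXi _ _]
    refine (hsub hXc hXc hX0 (fun _ => le_rfl) (hs'0 _) (hs.monotone (Nat.zero_le _)) ?_).trans hXB
    rcases Nat.eq_zero_or_pos N with h0 | h0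
    · rw [h0]; exact (hs'T 0 (by simpa using hI0)).1
    · exact hsT (N - 1) (by omega) _ (by omega)
  have hgood : ∀ j < N, j ∉ Ex → ∃ t ∈ Icc (s j) (s (j + 1)), ∃ x,
      IsBubble U T t x (A * G ^ 4 * (s (j + 1) - s j)) (ε / G ^ 3) (θ / (2 * G ^ 11) * (s (j + 1) - s j)) := by
    intro j hj hjE
    have hX : ∫ t in (s j)..(s (j + 1)), (X₀ t + X₁ (T - t)) ≤ η₄ / 1000 := by
      by_contra! hlt; exact hjE (Finset.mem_filter.2 ⟨Finset.mem_range.2 hj, hlt⟩)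
    set a := s' (2 * j) with ha
    set b := s' (2 * j + 1) with hb
    set d := s' (2 * j + 2) with hd
    have hsj : s (j + 1) = d := rfl
    rw [hsj, show s j = a from rfl] at hX ⊢
    have hab : a < b := hs' (by omega)
    have hbd : b < d := hs' (by omega)
    have hdT : d ≤ T := hsT j hj _ le_rfl
    have ha0 : 0 ≤ a := hs'0 _
    have i0 := (hs'T (2 * j) (hNI j hj _ (by omega))).2
    have i1 := (hs'T (2 * j + 1) (hNI j hj _ (by omega))).2
    have i2 := (hs'T (2 * j + 2) (hNI j hj _ le_rfl)).2
    rw [← ha] at i0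
    rw [← hb] at i1
    rw [← hd] at i2
    have j1 : ∫ t in a..b, nFour U t = η₄ := by
      rw [← integral_interval_sub_left (hig 0 b) (hig 0 a), i0, i1]; push_cast; ring
    have j2 : ∫ t in b..d, nFour U t = η₄ := by
      rw [← integral_interval_sub_left (hig 0 d) (hig 0 b), i1, i2]; push_cast; ring
    have hAG : 0 < A * G ^ 4 := by positivity
    have hθG : 0 < θ / G ^ 11 := by positivity
    have eθ : θ / (2 * G ^ 11) * (d - a) = θ / G ^ 11 * ((d - a) / 2) := by field_simp
    rw [eθ]
    rcases le_total (d - b) (b - a) with hle | hle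
    · obtain ⟨t, ht, x, hbb⟩ := hbub hS ha0 hab hbd.le hdT hle j1 j2
        ((hsub hV₀ hXc (nFour_nonneg _) (fun t => le_add_of_nonneg_right (nFour_nonneg _ _)) hab.le hbd.le le_rfl).trans hX)
      exact ⟨t, ⟨hab.le.trans ht.1, ht.2⟩, x, hbb.mono (mul_le_mul_of_nonneg_left (by linarith) hAG.le)
        (mul_le_mul_of_nonneg_left (by linarith) hθG.le)⟩
    · obtain ⟨t, ht, x, hbb⟩ := hbub hSr (a := T - d) (b := T - b) (d := T - a) (by linarith) (by linarith)
        (by linarith) (by linarith) (by linarith)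
        (by simp only [nFour_reflect]; rw [integral_comp_sub_left (fun t => nFour U t)]; simpa using j2)
        (by simp only [nFour_reflect]; rw [integral_comp_sub_left (fun t => nFour U t)]; simpa using j1)
        (by
          rw [← integral_comp_sub_left (fun t => X₁ t)]
          exact (hsub hV₁T hXc (fun _ => nFour_nonneg _ _)
            (fun t => le_add_of_nonneg_left (nFour_nonneg _ _)) le_rfl hab.le hbd.le).trans hX)
      exact ⟨T - t, ⟨by linarith [ht.2], by linarith [ht.1]⟩, x,
        (hbb.mono (mul_le_mul_of_nonneg_left (by linarith) hAG.le)
          (mul_le_mul_of_nonneg_left (by linarith) hθG.le)).reflect⟩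
  set ε₁ := ε / G ^ 3 with hε₁
  have hε₁0 : 0 < ε₁ := by positivity
  set Q := 15360 * (A * G ^ 4) ^ 2 / (θ / (2 * G ^ 11)) * E with hQ
  have hQ0 : 0 ≤ Q := by positivity
  have hQe : Q = Q₀ * G ^ 19 := by rw [hQ, hQ₀]; field_simp; ring
  set m := ⌊8 * E / ε₁⌋₊ with hm
  set k := ⌊2 * (m * Q)⌋₊ + 1 with hk
  have hkm : (m * Q : ℝ) < k / 2 := by
    have := Nat.lt_floor_add_one (2 * (m * Q : ℝ)); rw [hk]; push_cast; linarith
  have hNlt : N < (Ex.card + 1) * 2 ^ (k * m) := by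
    by_contra! hle
    obtain ⟨p, hpN, hpE⟩ := exists_block_avoiding (by positivity) Ex hle
    set F := Finset.Ico p (p + 2 ^ (k * m)) with hF
    choose! t ht x hb using fun j (hj : j ∈ F) => hgood j (by have := Finset.mem_Ico.1 hj; omega) (hpE j hj)
    obtain ⟨D, hDF, hDc, hDi⟩ := exists_independent hs
      (rel := bubbleRel t (fun j => A * G ^ 4 * (s (j + 1) - s j)) x)
      (fun i => by
        have := sub_pos.2 (hs i.lt_succ_self)
        rw [bubbleRel, sub_self, norm_zero, sub_self, abs_zero]; positivity)
      (fun i j hij => by rw [bubbleRel] at hij ⊢; rw [norm_sub_rev, abs_sub_comm]; linarith) hQ0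
      (fun i hi F₀ hF₀ hrel => hS.sum_related_le hs (one_le_mul_of_one_le_of_one_le hA (one_le_pow₀ hG))
        (by positivity) ht (fun _ => rfl) hb hi hF₀ hrel) k m hkm p subset_rfl
    have h1 := hS.card_mul_le (fun j hj => hb j (hDF hj)) hDi
    rw [hDc, ← le_div_iff₀ hε₁0] at h1
    have := Nat.lt_floor_add_one (8 * E / ε₁)
    push_cast at h1
    linarith
  -- numerical conclusion
  have hG1 : ∀ n : ℕ, 1 ≤ G ^ n := fun n => one_le_pow₀ hG
  have hmM : (m : ℝ) ≤ M * G ^ 3 := (Nat.floor_le (by positivity)).trans (le_of_eq (by rw [hM, hε₁]; field_simp))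
  have hkM : (k : ℝ) ≤ (2 * (M * Q₀) + 1) * G ^ 22 := by
    have h1 : (m * Q : ℝ) ≤ M * G ^ 3 * Q := mul_le_mul_of_nonneg_right hmM hQ0
    have h2 := Nat.floor_le (show 0 ≤ 2 * (m * Q : ℝ) by positivity)
    rw [hk]; push_cast
    rw [hQe] at h1 h2 ⊢
    linear_combination h2 + 2 * h1 + hG1 22
  have hkmM : ((k * m : ℕ) : ℝ) ≤ (2 * (M * Q₀) + 1) * M * G ^ 25 := by
    push_cast
    refine (mul_le_mul hkM hmM (by positivity) (by positivity)).trans (le_of_eq (by ring))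
  have h2exp : (2:ℝ) ^ (k * m) ≤ exp ((2 * (M * Q₀) + 1) * M * G ^ 25) := by
    refine (pow_le_pow_left₀ (by norm_num) (show (2:ℝ) ≤ exp 1 by linarith [Real.add_one_le_exp 1]) _).trans ?_
    rw [← Real.exp_nat_mul, mul_one]
    exact exp_le_exp.2 hkmM
  have hIN : I ≤ 2 * η₄ * ((Ex.card + 1) * 2 ^ (k * m)) := by
    have h1 := Nat.lt_floor_add_one (I / (2 * η₄))
    rw [← hN, div_lt_iff₀ (by positivity)] at h1
    have h2 : ((N + 1 : ℕ) : ℝ) ≤ ((Ex.card + 1) * 2 ^ (k * m) : ℕ) := by exact_mod_cast hNlt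
    push_cast at h2
    nlinarith
  have hpre : 2 * η₄ * (Ex.card + 1) ≤ exp ((2000 * B + 2 * η) * G ^ 25) := by
    have h1 : η₄ ≤ η := div_le_self hη.le (hG1 2)
    have h2 : 2000 * B + 2 * η ≤ (2000 * B + 2 * η) * G ^ 25 := le_mul_of_one_le_right (by positivity) (hG1 25)
    linarith [Real.add_one_le_exp ((2000 * B + 2 * η) * G ^ 25)]
  rw [add_mul, Real.exp_add]
  calc I ≤ 2 * η₄ * (Ex.card + 1) * 2 ^ (k * m) := by linarith
    _ ≤ _ := mul_le_mul hpre h2exp (by positivity) (by positivity)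

end SlabSol

/-! ### The nonlinearity -/

section nonlinearity

variable {c : ℝ}

theorem log_ten_add_ge (u : ℝ) : 9 / 4 ≤ log (10 + u ^ 2) := by
  rw [Real.le_log_iff_exp_le (by positivity)]
  have h1 : exp (9 / 4) ^ 4 ≤ 10 ^ 4 := by
    rw [← Real.exp_nat_mul, show ((4:ℕ):ℝ) * (9 / 4) = (9:ℕ) * 1 by norm_num, Real.exp_nat_mul]
    exact (pow_le_pow_left₀ (exp_pos 1).le Real.exp_one_lt_d9.le 9).trans (by norm_num)
  linarith [le_of_pow_le_pow_left₀ (by norm_num) (by norm_num) h1, sq_nonneg u]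

theorem loglog_ge (u : ℝ) : 3 / 4 ≤ log (log (10 + u ^ 2)) := by
  have h0 := log_ten_add_ge u
  rw [Real.le_log_iff_exp_le (by linarith)]
  have h1 : exp (3 / 4) ^ 4 ≤ (9 / 4) ^ 4 := by
    rw [← Real.exp_nat_mul, show ((4:ℕ):ℝ) * (3 / 4) = (3:ℕ) * 1 by norm_num, Real.exp_nat_mul]
    exact (pow_le_pow_left₀ (exp_pos 1).le Real.exp_one_lt_d9.le 3).trans (by norm_num)
  linarith [le_of_pow_le_pow_left₀ (by norm_num) (by norm_num) h1]

theorem g_ge (hc : 0 < c) (hc1 : c < 1) (u : ℝ) : 3 / 4 ≤ g c u := by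
  refine le_trans ?_ (Real.rpow_le_rpow (by norm_num) (loglog_ge u) hc.le)
  simpa using Real.rpow_le_rpow_of_exponent_ge (x := 3 / 4) (by norm_num) (by norm_num) hc1.le

theorem g_mono (hc : 0 < c) {u v : ℝ} (h : u ^ 2 ≤ v ^ 2) : g c u ≤ g c v := by
  refine Real.rpow_le_rpow (by linarith [loglog_ge u]) (Real.log_le_log (by linarith [log_ten_add_ge u])
    (Real.log_le_log (by positivity) (by linarith))) hc.le

theorem contDiff_g : Smooth (g c) := by
  refine ContDiff.rpow_const_of_ne (ContDiff.log (ContDiff.log (by fun_prop) fun u => by positivity) fun u => ?_) fun u => ?_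
  · linarith [log_ten_add_ge u]
  · linarith [loglog_ge u]

theorem contDiff_f : Smooth (f c) := (contDiff_id.pow 5).mul contDiff_g

theorem hasDerivAt_Fpot (u : ℝ) : HasDerivAt (Fpot c) (f c u) u :=
  integral_hasDerivAt_right (contDiff_f.continuous.intervalIntegrable _ _)
    (contDiff_f.continuous.stronglyMeasurableAtFilter _ _) contDiff_f.continuous.continuousAt

theorem contDiff_Fpot : Smooth (Fpot c) := by
  refine contDiff_infty_iff_deriv.2 ⟨fun u => (hasDerivAt_Fpot u).differentiableAt, ?_⟩
  rw [funext fun u => (hasDerivAt_Fpot (c := c) u).deriv]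
  exact contDiff_f

theorem Fpot_neg (u : ℝ) : Fpot c (-u) = Fpot c u := by
  have h := intervalIntegral.integral_comp_neg (fun v => f c v) (a := 0) (b := u)
  have e : ∀ v, f c (-v) = -f c v := fun v => by simp only [f, g, neg_sq]; ring
  simp only [e, intervalIntegral.integral_neg, neg_zero] at h
  rw [Fpot, intervalIntegral.integral_symm, ← h, neg_neg, Fpot]

theorem Fpot_bounds (hc : 0 < c) (hc1 : c < 1) (u : ℝ) : u ^ 6 ≤ 8 * Fpot c u ∧ Fpot c u ≤ g c u * u ^ 6 / 6 := by
  wlog hu : 0 ≤ u generalizing u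
  · have := this (-u) (by linarith)
    simpa [Fpot_neg, g, Even.neg_pow (show Even 6 by decide)] using this
  have hi : ∀ K : ℝ, ∫ v in (0:ℝ)..u, K * v ^ 5 = K * u ^ 6 / 6 := fun K => by
    rw [intervalIntegral.integral_const_mul, integral_pow]; ring
  have hc5 : ∀ K : ℝ, IntervalIntegrable (fun v : ℝ => K * v ^ 5) volume 0 u := fun K =>
    Continuous.intervalIntegrable (by fun_prop) _ _
  have hf := (contDiff_f (c := c)).continuous.intervalIntegrable (μ := volume) 0 u
  constructor
  · have := integral_mono_on hu (hc5 (3 / 4)) hf fun v hv => by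
      rw [f, mul_comm]; exact mul_le_mul_of_nonneg_left (g_ge hc hc1 v) (pow_nonneg hv.1 5)
    rw [hi] at this
    rw [Fpot]; linarith
  · have := integral_mono_on hu hf (hc5 (g c u)) fun v hv => by
      rw [f, mul_comm]
      exact mul_le_mul_of_nonneg_right (g_mono hc (pow_le_pow_left₀ hv.1 hv.2 2)) (pow_nonneg hv.1 5)
    rwa [hi] at this

theorem virial_f (hc : 0 < c) (hc1 : c < 1) (u : ℝ) : 1 / 8 * u ^ 6 ≤ 1 / 2 * (u * f c u) - Fpot c u := by
  have h1 := (Fpot_bounds hc hc1 u).2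
  have h2 := mul_le_mul_of_nonneg_right (g_ge hc hc1 u) (Even.pow_nonneg (show Even 6 by decide) u)
  have h3 : u * f c u = g c u * u ^ 6 := by rw [f]; ring
  have h6 : 0 ≤ u ^ 6 := Even.pow_nonneg (by decide) u
  linarith

theorem abs_deriv_f_le (hc : 0 < c) (hc1 : c < 1) (u : ℝ) : |deriv (f c) u| ≤ 7 * g c u * u ^ 4 := by
  have hl := log_ten_add_ge u
  have hll := loglog_ge u
  have hg := g_ge hc hc1 u
  set L := log (10 + u ^ 2) with hL
  have h1 : HasDerivAt (fun u : ℝ => 10 + u ^ 2) (2 * u) u := by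
    simpa using (hasDerivAt_pow 2 u).const_add 10
  have h2 := ((h1.log (by positivity)).log (by rw [← hL]; linarith)).rpow_const (p := c) (Or.inl (by rw [← hL]; linarith))
  rw [← hL] at h2
  have h3 := (hasDerivAt_pow 5 u).mul h2
  have h4 : deriv (f c) u = _ := h3.deriv
  set q := log L ^ (c - 1) with hq
  have eg : g c u = q * log L := by
    rw [hq, Real.rpow_sub_one (by linarith), div_mul_cancel₀ _ (by linarith : log L ≠ 0)]; rfl
  have hq0 : 0 ≤ q := Real.rpow_nonneg (by linarith) _
  have h5 : deriv (f c) u = u ^ 4 * (5 * g c u + c * q * (2 * (u ^ 2 / (10 + u ^ 2)) / L)) := by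
    rw [h4, show log L ^ c = g c u from rfl]; push_cast; field_simp
  have h6 : u ^ 2 / (10 + u ^ 2) ≤ 1 := div_le_one_of_le₀ (by linarith) (by positivity)
  have h7 : 0 ≤ u ^ 2 / (10 + u ^ 2) := by positivity
  have h8 : 2 * (u ^ 2 / (10 + u ^ 2)) / L ≤ 1 := by rw [div_le_one (by linarith)]; linarith
  have h9 : 0 ≤ 2 * (u ^ 2 / (10 + u ^ 2)) / L := div_nonneg (by linarith) (by linarith)
  have h10 : c * q * (2 * (u ^ 2 / (10 + u ^ 2)) / L) ≤ 2 * g c u := by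
    calc _ ≤ c * q * 1 := mul_le_mul_of_nonneg_left h8 (by positivity)
      _ ≤ 2 * g c u := by rw [eg]; nlinarith
  rw [h5, abs_of_nonneg (mul_nonneg (by positivity) (by positivity)), mul_comm]
  exact mul_le_mul_of_nonneg_right (by linarith) (by positivity)

open Filter in
theorem eventually_rpow_le {a δ : ℝ} (ha : a < 1) (hδ : 0 < δ) : ∀ᶠ L : ℝ in atTop, L ^ a ≤ δ * L := by
  filter_upwards [(tendsto_rpow_atTop (sub_pos.2 ha)).eventually_ge_atTop δ⁻¹, eventually_gt_atTop 0] with L h1 h2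
  have e : L = L ^ (1 - a) * L ^ a := by rw [← Real.rpow_add h2]; simp
  calc L ^ a = δ * (δ⁻¹ * L ^ a) := by field_simp
    _ ≤ δ * (L ^ (1 - a) * L ^ a) := by gcongr
    _ = δ * L := by rw [← e]

open Filter in
/-- The growth of `g` is slow enough for the bootstrap to close. -/
theorem exists_bootstrap_level (hc : 0 < c) (hc1 : 25 * c < 1) (K₁ K₂ B C S : ℝ) (hS : 0 < S) (hB : 0 < B) (hC : 0 < C) :
    ∃ M, K₁ + K₂ * exp (B * (1 + g c (√(S * M))) * exp (C * (1 + g c (√(S * M))) ^ 25)) < M ∧ K₁ < M := by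
  have key : ∀ᶠ L : ℝ in atTop, B * (1 + L ^ c) * exp (C * (1 + L ^ c) ^ 25) ≤ 1 / 2 * exp L := by
    have e1 : ∀ᶠ L : ℝ in atTop, C * (1 + L ^ c) ^ 25 ≤ L / 2 := by
      have h := eventually_rpow_le hc1 (show 0 < 1 / (2 * C * 2 ^ 25) by positivity)
      filter_upwards [h, eventually_ge_atTop 1] with L hL hL1
      have h0 : 1 ≤ L ^ c := Real.one_le_rpow hL1 hc.le
      have h1 : (1 + L ^ c) ^ 25 ≤ 2 ^ 25 * L ^ (25 * c) := by
        rw [mul_comm 25 c, Real.rpow_mul (by linarith), show (25:ℝ) = ((25:ℕ):ℝ) by norm_num, Real.rpow_natCast, ← mul_pow]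
        exact pow_le_pow_left₀ (by linarith) (by linarith) 25
      calc C * (1 + L ^ c) ^ 25 ≤ C * (2 ^ 25 * (1 / (2 * C * 2 ^ 25) * L)) := by gcongr; exact h1.trans (by gcongr)
        _ = L / 2 := by field_simp
    have e2 : ∀ᶠ L : ℝ in atTop, B * (1 + L ^ c) ≤ 1 / 2 * exp (L / 2) := by
      have h := ((isLittleO_pow_exp_pos_mul_atTop 1 (show (0:ℝ) < 1 / 2 by norm_num))).bound (show 0 < 1 / (4 * B) by positivity)
      filter_upwards [h, eventually_ge_atTop 1] with L hL hL1
      have h0 : L ^ c ≤ L := by simpa using Real.rpow_le_rpow_of_exponent_le hL1 (show c ≤ 1 by linarith)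
      rw [norm_of_nonneg (by positivity), pow_one, norm_of_nonneg (exp_pos _).le] at hL
      calc B * (1 + L ^ c) ≤ B * (2 * (1 / (4 * B) * exp (1 / 2 * L))) := by gcongr; linarith
        _ = _ := by rw [show 1 / 2 * L = L / 2 by ring]; field_simp; norm_num
    filter_upwards [e1, e2, eventually_ge_atTop 0] with L h1 h2 h3
    have : exp L = exp (L / 2) * exp (L / 2) := by rw [← Real.exp_add]; ring_nf
    have h4 := mul_le_mul h2 (exp_le_exp.2 h1) (exp_pos _).le (by positivity)
    linarith
  have hM : Tendsto (fun y : ℝ => (y - 10) / S) atTop atTop := (tendsto_atTop_add_const_right _ _ tendsto_id).atTop_div_const hS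
  have hll := Real.tendsto_log_atTop.comp Real.tendsto_log_atTop
  have hsq : ∀ᶠ y : ℝ in atTop, K₁ + |K₂| * √y < (y - 10) / S := by
    have h := eventually_rpow_le (show (1 / 2 : ℝ) < 1 by norm_num)
      (show 0 < 1 / (2 * S * (|K₂| + 1)) by positivity)
    filter_upwards [h, eventually_gt_atTop (2 * S * |K₁| + 20), eventually_ge_atTop 0] with y h1 h2 h3
    rw [← sqrt_eq_rpow] at h1
    have h4 : |K₂| * √y ≤ (|K₂| + 1) * (1 / (2 * S * (|K₂| + 1)) * y) := by gcongr; linarith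
    have h5 : (|K₂| + 1) * (1 / (2 * S * (|K₂| + 1)) * y) = y / (2 * S) := by field_simp
    rw [h5] at h4
    have h6 : (y - 10) / S = y / (2 * S) + (y - 20) / (2 * S) := by field_simp; ring
    have h7 : K₁ < (y - 20) / (2 * S) := by
      rw [lt_div_iff₀ (by positivity)]; nlinarith [le_abs_self K₁]
    linarith
  obtain ⟨y, ⟨h1, h2, h3⟩, h4⟩ := (((hll.eventually key).and (hsq.and (hM.eventually_gt_atTop K₁))).and
    (eventually_ge_atTop 10)).exists
  refine ⟨(y - 10) / S, lt_of_le_of_lt ?_ h2, h3⟩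
  have eS : S * ((y - 10) / S) = y - 10 := by field_simp
  have eg : g c (√(S * ((y - 10) / S))) = (log ∘ log) y ^ c := by
    rw [eS, g, sq_sqrt (by linarith)]; simp
  rw [eg]
  have hy : exp ((log ∘ log) y) = log y := Real.exp_log (Real.log_pos (by linarith))
  rw [hy] at h1
  have h5 := exp_le_exp.2 h1
  have h6 : exp (1 / 2 * log y) = √y := by
    rw [sqrt_eq_rpow, Real.rpow_def_of_pos (by linarith), mul_comm]
  rw [h6] at h5
  have := mul_le_mul (le_abs_self K₂) h5 (exp_pos _).le (abs_nonneg _)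
  linarith

end nonlinearity

/-! ### The bootstrap -/

/-- The sum of the free energies of `U` and of its spatial derivatives. -/
def totEn (U : ℝ⁴ → ℝ) (t : ℝ) : ℝ := hEn U t + ∫ x, edens₀ U (t, x)

theorem spaceCpt_edens {U : ℝ⁴ → ℝ} (hU : SpaceCpt U) : SpaceCpt (edens₀ U) :=
  hU.of_local fun p hp => by simp [edens, (eventually_zero_dd hp _).self_of_nhds]

theorem continuous_totEn {U : ℝ⁴ → ℝ} (hU : Smooth U) (hUc : SpaceCpt U) :
    Continuous (totEn U) :=
  (continuous_finsetSum _ fun i _ => (spaceCpt_edens (hUc.dd (vx i))).continuous_integral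
    (contDiff_edens contDiff_const (hU.dd_top _))).add
    ((spaceCpt_edens hUc).continuous_integral (contDiff_edens contDiff_const hU))

theorem exists_totEn_sobolev : ∃ S : ℝ, 0 < S ∧ ∀ U : ℝ⁴ → ℝ, Smooth U → SpaceCpt U → ∀ t,
    ∫ x, U (t, x) ^ 6 ≤ S * totEn U t ^ 3 ∧ ∀ x, U (t, x) ^ 2 ≤ S * totEn U t := by
  obtain ⟨C, hC, hsix⟩ := exists_sobolev_six
  obtain ⟨K, hK, hsup⟩ := exists_sobolev_sup
  set S := 1 + 8 * C + K.toReal ^ 6 * (9216 * C) with hSd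
  have hK0 : 0 ≤ K.toReal := toReal_nonneg
  have hS1 : 1 ≤ S := by rw [hSd, add_assoc]; exact le_add_of_nonneg_right (by positivity)
  refine ⟨S, by linarith, fun U hU hUc t => ?_⟩
  set Z := totEn U t with hZ
  have hZ0 : 0 ≤ Z := add_nonneg (hEn_nonneg U t) (integral_nonneg fun _ => edens_zero_nonneg _ _)
  have six : ∀ W : ℝ⁴ → ℝ, Smooth W → SpaceCpt W → ∫ x, edens₀ W (t, x) ≤ Z →
      ∫ x, W (t, x) ^ 6 ≤ 8 * C * Z ^ 3 := fun W hW hWc hle => by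
    have h1 := hsix _ (contDiff_slice hW t) (hWc.slice t)
    simp only [dd_slice_fun hW] at h1
    rw [integral_edens_zero hW hWc] at hle
    have h2 : 0 ≤ ∫ x, dd vt W (t, x) ^ 2 := integral_nonneg fun x => sq_nonneg _
    have h3 : 0 ≤ ∫ x, ∑ j, dd (vx j) W (t, x) ^ 2 := integral_nonneg fun x => sum_nonneg fun _ _ => sq_nonneg _
    calc _ ≤ _ := h1
      _ ≤ C * (2 * Z) ^ 3 := mul_le_mul_of_nonneg_left (pow_le_pow_left₀ h3 (by linarith) 3) hC.le
      _ = _ := by ring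
  have h0 := six U hU hUc (le_add_of_nonneg_left (hEn_nonneg U t))
  have hi : ∀ i, ∫ x, dd (vx i) U (t, x) ^ 6 ≤ 8 * C * Z ^ 3 := fun i => six _ (hU.dd_top _) (hUc.dd _)
    ((Finset.single_le_sum (f := fun i => ∫ x, edens₀ (dd (vx i) U) (t, x))
      (fun _ _ => integral_nonneg fun _ => edens_zero_nonneg _ _) (Finset.mem_univ i)).trans
      (le_add_of_nonneg_right (integral_nonneg fun _ => edens_zero_nonneg _ _)))
  refine ⟨h0.trans (mul_le_mul_of_nonneg_right (by rw [hSd]; nlinarith [show 0 ≤ K.toReal ^ 6 * (9216 * C) by positivity])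
    (by positivity)), fun x => ?_⟩
  have int6 : ∀ W : ℝ⁴ → ℝ, Smooth W → SpaceCpt W → Integrable fun x => W (t, x) ^ 6 := fun W hW hWc =>
    SpaceCpt.integrable (K := fun p => W p ^ 6) (hWc.of_local fun p hp => by simp [hp.self_of_nhds]) (hW.pow 6).continuous t
  have hpt : ∀ y, (‖U (t, y)‖ₑ + ‖fderiv ℝ (fun z => U (t, z)) y‖ₑ) ^ (6 : ℝ) ≤
      ofReal (288 * (U (t, y) ^ 6 + ∑ i, dd (vx i) U (t, y) ^ 6)) := fun y => by
    set D := ‖fderiv ℝ (fun z => U (t, z)) y‖ with hD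
    have hD2 : D ^ 2 = ∑ i, dd (vx i) U (t, y) ^ 2 := by
      rw [hD, norm_fderiv_sq]; simp only [dd_slice_fun hU]; rfl
    rw [← ofReal_norm, ← ofReal_norm, ← ofReal_add (norm_nonneg _) (norm_nonneg _), ← hD,
      show (6:ℝ) = ((6:ℕ):ℝ) by norm_num, rpow_natCast, ← ofReal_pow (by positivity)]
    refine ofReal_le_ofReal ?_
    have h1 : (∑ i, dd (vx i) U (t, y) ^ 2) ^ 3 ≤ 9 * ∑ i, dd (vx i) U (t, y) ^ 6 := by
      have h := pow_sum_div_card_le_sum_pow (s := Finset.univ) (f := fun i : Fin 3 => dd (vx i) U (t, y) ^ 2)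
        (fun _ _ => sq_nonneg _) 2
      rw [Finset.card_fin, div_le_iff₀ (by norm_num)] at h
      simp only [← pow_mul] at h
      norm_num at h ⊢
      linarith
    have hD0 : 0 ≤ D := norm_nonneg _
    rw [norm_eq_abs]
    have ha := abs_nonneg (U (t, y))
    have h2 := add_pow_le ha hD0 6
    have e1 : D ^ 6 = (D ^ 2) ^ 3 := by ring
    rw [Even.pow_abs (by decide), e1, hD2] at h2
    norm_num at h2
    have h3 : 0 ≤ U (t, y) ^ 6 := Even.pow_nonneg (by decide) _
    linarith
  have hig : ∫⁻ y, (‖U (t, y)‖ₑ + ‖fderiv ℝ (fun z => U (t, z)) y‖ₑ) ^ (6 : ℝ) ≤ ofReal (9216 * C * Z ^ 3) := by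
    have hI : Integrable fun y => ∑ i, dd (vx i) U (t, y) ^ 6 :=
      integrable_finsetSum _ fun i _ => int6 _ (hU.dd_top _) (hUc.dd _)
    have hI' : Integrable fun y => 288 * (U (t, y) ^ 6 + ∑ i, dd (vx i) U (t, y) ^ 6) := ((int6 U hU hUc).add hI).const_mul _
    refine (lintegral_mono hpt).trans ?_
    rw [← ofReal_integral_eq_lintegral_ofReal hI' (of_forall fun y =>
      mul_nonneg (by norm_num) (add_nonneg (Even.pow_nonneg (by decide) _) (sum_nonneg fun _ _ => Even.pow_nonneg (by decide) _)))]
    refine ofReal_le_ofReal ?_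
    rw [integral_const_mul, integral_add (int6 U hU hUc) hI, integral_finsetSum _ fun i _ => int6 _ (hU.dd_top _) (hUc.dd _)]
    have := sum_le_sum fun i (_ : i ∈ Finset.univ) => hi i
    rw [Finset.sum_const, Finset.card_fin, nsmul_eq_mul] at this
    push_cast at this
    linarith
  have h1 := pow_le_pow_left₀ bot_le (hsup _ (contDiff_slice hU t) x) 6
  rw [mul_pow, ← rpow_natCast (_ ^ (1 / 6 : ℝ)), ← rpow_mul] at h1
  norm_num at h1
  have h2 := h1.trans (mul_le_mul' le_rfl (by simpa using hig))
  rw [← ofReal_norm, ← ofReal_toReal hK, ← ofReal_pow (norm_nonneg _), ← ofReal_pow hK0,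
    ← ofReal_mul (by positivity), ofReal_le_ofReal_iff (by positivity), norm_eq_abs,
    Even.pow_abs (by decide)] at h2
  refine le_of_pow_le_pow_left₀ (n := 3) (by norm_num) (by positivity) ?_
  have h3 : S ≤ S ^ 3 := le_self_pow₀ hS1 (by norm_num)
  calc (U (t, x) ^ 2) ^ 3 = U (t, x) ^ 6 := by ring
    _ ≤ S * Z ^ 3 := h2.trans (by rw [← mul_assoc]; exact mul_le_mul_of_nonneg_right (by linarith) (by positivity))
    _ ≤ S ^ 3 * Z ^ 3 := mul_le_mul_of_nonneg_right h3 (by positivity)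
    _ = _ := by ring

theorem exists_uniform_bound {c : ℝ} (hc : 0 < c) (hc1 : 25 * c < 1) {K : ℝ} (hK : 0 ≤ K) : ∃ M n : ℝ, 0 < n ∧
    ∀ h : ℝ → ℝ, (∀ s, |s| ≤ n → h s = f c s) → ∀ V : ℝ⁴ → ℝ, Smooth V → SpaceCpt V →
      (∀ p, box V p = -h (V p)) → totEn V 0 ≤ K → ∀ t, 0 ≤ t → totEn V t ≤ M ∧ ∀ x, |V (t, x)| ≤ n := by
  have hc2 : c < 1 := by linarith
  obtain ⟨S, hS, hsob⟩ := exists_totEn_sobolev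
  obtain ⟨C₂, hC₂, hgrow⟩ := exists_hEn_growth
  have hg0 : ∀ u, 0 ≤ g c u := fun u => by linarith [g_ge hc hc2 u]
  set E := K + g c (√(S * K)) * (S * K ^ 3) with hEd
  have hKE : K ≤ E := le_add_of_nonneg_right (mul_nonneg (hg0 _) (by positivity))
  obtain ⟨C₁, hC₁, hstr⟩ := SlabSol.exists_integral_nFour_le (hK.trans hKE)
  obtain ⟨M, hM, hEM⟩ := exists_bootstrap_level hc hc1 E K (7 * C₂) C₁ S hS (by positivity) hC₁
  have hM0 : 0 < M := by linarith
  set n := √(S * M) with hn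
  have hn0 : 0 < n := sqrt_pos.2 (by positivity)
  refine ⟨M, n, hn0, fun h hh V hV hVc hbox hV0 => ?_⟩
  have hsupn : ∀ t, totEn V t ≤ M → ∀ x, |V (t, x)| ≤ n := fun t ht x =>
    Real.abs_le_sqrt (((hsob V hV hVc t).2 x).trans (mul_le_mul_of_nonneg_left ht hS.le))
  have hEn0 : hEn V 0 ≤ K := (le_add_of_nonneg_right (integral_nonneg fun _ => edens_zero_nonneg _ _)).trans hV0
  have hen : ∫ x, edens (Fpot c) V (0, x) ≤ E := by
    have hi1 := (spaceCpt_edens hVc).integrable (contDiff_edens contDiff_const hV).continuous 0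
    have hi2 : Integrable fun x => g c (√(S * K)) * V (0, x) ^ 6 :=
      (SpaceCpt.integrable (K := fun p => V p ^ 6) (hVc.of_local fun p hp => by simp [hp.self_of_nhds])
        (hV.pow 6).continuous 0).const_mul _
    have h1 := integral_mono_of_nonneg (μ := volume) (f := fun x => edens (Fpot c) V (0, x)) (of_forall fun x => by
      have h1 := edens_zero_nonneg V (0, x)
      have h2 := (Fpot_bounds hc hc2 (V (0, x))).1
      have h3 : 0 ≤ V (0, x) ^ 6 := Even.pow_nonneg (by decide) _
      simp only [edens, Pi.zero_apply] at h1 ⊢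
      linarith) (hi1.add hi2) (of_forall fun x => by
      have h2 := (Fpot_bounds hc hc2 (V (0, x))).2
      have h3 : 0 ≤ V (0, x) ^ 6 := Even.pow_nonneg (by decide) _
      have h4 : g c (V (0, x)) ≤ g c (√(S * K)) := g_mono hc (by
        rw [sq_sqrt (by positivity)]
        exact ((hsob V hV hVc 0).2 x).trans (mul_le_mul_of_nonneg_left hV0 hS.le))
      have h5 := mul_le_mul_of_nonneg_right h4 h3
      have h6 := mul_nonneg (hg0 (√(S * K))) h3
      simp only [edens, Pi.add_apply]
      linarith)
    refine h1.trans ?_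
    simp only [Pi.add_apply]
    rw [integral_add hi1 hi2, integral_const_mul]
    have hZ0 : 0 ≤ totEn V 0 := add_nonneg (hEn_nonneg V 0) (integral_nonneg fun _ => edens_zero_nonneg _ _)
    exact add_le_add ((le_add_of_nonneg_left (hEn_nonneg V 0)).trans hV0) (mul_le_mul_of_nonneg_left
      ((hsob V hV hVc 0).1.trans (mul_le_mul_of_nonneg_left (pow_le_pow_left₀ hZ0 hV0 3) hS.le)) (hg0 _))
  have step : ∀ T, 0 ≤ T → (∀ t ∈ Icc 0 T, totEn V t ≤ M) → totEn V T < M := fun T hT hle => by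
    have hsn : ∀ p : ℝ⁴, 0 ≤ p.1 → p.1 ≤ T → |V p| ≤ n := fun p h0 h1 => hsupn p.1 (hle _ ⟨h0, h1⟩) p.2
    have heq : ∀ p : ℝ⁴, 0 ≤ p.1 → p.1 ≤ T → box V p = -f c (V p) := fun p h0 h1 => by
      rw [hbox, hh _ (hsn p h0 h1)]
    have hgn : ∀ p : ℝ⁴, 0 ≤ p.1 → p.1 ≤ T → g c (V p) ≤ 1 + g c n := fun p h0 h1 => by
      have := g_mono hc (sq_le_sq.2 ((hsn p h0 h1).trans (le_abs_self n)))
      linarith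
    have hSl : SlabSol (f c) (Fpot c) T (1 + g c n) E V :=
      { smooth := hV, cpt := hVc, eqn := heq, smoothH := contDiff_Fpot, deriv := hasDerivAt_Fpot
        zero := integral_same, lower := fun s => (Fpot_bounds hc hc2 s).1, virial := virial_f hc hc2
        growth := fun p h0 h1 => by
          rw [f, abs_mul, abs_pow, abs_of_nonneg (hg0 _), mul_comm]
          exact mul_le_mul_of_nonneg_right (hgn p h0 h1) (by positivity)
        one_le := le_add_of_nonneg_right (hg0 n), energy := hen, time_nonneg := hT }
    have h1 := hgrow (f c) (deriv (f c)) (fun s => (contDiff_f.dble s).hasDerivAt) V hV hVc T (7 * (1 + g c n))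
      (by have := hg0 n; positivity) heq (fun p h0 h1 => (abs_deriv_f_le hc hc2 _).trans
        (mul_le_mul_of_nonneg_right (by linarith [hgn p h0 h1]) (by positivity))) T ⟨hT, le_rfl⟩
    have h2 := hSl.integral_edens_zero_le hT le_rfl
    have h3 : hEn V 0 * exp (C₂ * (7 * (1 + g c n)) * ∫ s in (0:ℝ)..T, nFour V s) ≤
        K * exp (7 * C₂ * (1 + g c n) * exp (C₁ * (1 + g c n) ^ 25)) := by
      refine mul_le_mul hEn0 (exp_le_exp.2 ?_) (exp_pos _).le hK
      rw [show C₂ * (7 * (1 + g c n)) = 7 * C₂ * (1 + g c n) by ring]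
      exact mul_le_mul_of_nonneg_left (hstr hSl) (by have := hg0 n; positivity)
    rw [totEn]
    linarith
  have hcont := continuous_totEn hV hVc
  have hlt0 : totEn V 0 < M := by linarith
  have hall : ∀ t, 0 ≤ t → totEn V t ≤ M := fun t ht => by
    by_contra! hgt
    have ivt : ∀ t, 0 ≤ t → M < totEn V t → ∃ r ∈ Icc 0 t, totEn V r = M := fun t ht hgt =>
      intermediate_value_Icc ht hcont.continuousOn ⟨hlt0.le, hgt.le⟩
    obtain ⟨T, ⟨hT, hTM⟩, hmin⟩ := (isCompact_Icc.inter_right (isClosed_eq hcont continuous_const)).exists_isLeast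
      (show (Icc 0 t ∩ {r | totEn V r = M}).Nonempty from (ivt t ht hgt).imp fun _ h => h)
    refine (step T hT.1 fun r hr => ?_).ne hTM
    by_contra! hrM
    obtain ⟨q, hq, hqM⟩ := ivt r hr.1 hrM
    have := hmin ⟨⟨hq.1, by linarith [hq.2, hr.2, hT.2]⟩, hqM⟩
    have : r = q := le_antisymm (hr.2.trans this) hq.2
    rw [this, hqM] at hrM
    exact lt_irrefl _ hrM
  exact fun t ht => ⟨hall t ht, hsupn t (hall t ht)⟩

/-! ### Comparison of norms -/

theorem iteratedFDeriv_two_bounds {v : Space → ℝ} (hv : Smooth v) (x : Space) :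
    ‖iteratedFDeriv ℝ 2 v x‖ ^ 2 ≤ ∑ i, ∑ j, dd (ex j) (dd (ex i) v) x ^ 2 ∧
      ∑ i, ∑ j, dd (ex j) (dd (ex i) v) x ^ 2 ≤ 9 * ‖iteratedFDeriv ℝ 2 v x‖ ^ 2 := by
  have e : ∀ m : Fin 2 → Space, iteratedFDeriv ℝ 2 v x m = dd (m 0) (dd (m 1) v) x := fun m => by
    rw [iteratedFDeriv_two_apply]
    have := fderiv_clm_apply (((hv.fderiv_right (m := (⊤ : ℕ∞)) (by norm_cast)).dble) x) (differentiableAt_const (m 1))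
    unfold dd
    rw [this]
    simp
  have hle : ∀ (φ : Space → ℝ) w, dd w φ x ^ 2 ≤ ‖w‖ ^ 2 * ∑ i, dd (ex i) φ x ^ 2 := fun φ w => by
    rw [← norm_fderiv_sq, ← sq_abs, ← mul_pow, mul_comm, ← norm_eq_abs]
    exact pow_le_pow_left₀ (norm_nonneg _) ((fderiv ℝ φ x).le_opNorm w) 2
  constructor
  · rw [← Real.le_sqrt (norm_nonneg _) (sum_nonneg fun _ _ => sum_nonneg fun _ _ => sq_nonneg _)]
    refine ContinuousMultilinearMap.opNorm_le_bound (sqrt_nonneg _) fun m => ?_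
    rw [e, norm_eq_abs, Fin.prod_univ_two]
    refine abs_le_of_sq_le_sq ?_ (by positivity)
    rw [mul_pow, sq_sqrt (sum_nonneg fun _ _ => sum_nonneg fun _ _ => sq_nonneg _)]
    calc dd (m 0) (dd (m 1) v) x ^ 2 ≤ ‖m 0‖ ^ 2 * ∑ i, dd (m 1) (dd (ex i) v) x ^ 2 := by
          simp only [dd_comm hv (m 1)]; exact hle _ _
      _ ≤ ‖m 0‖ ^ 2 * ∑ i, ‖m 1‖ ^ 2 * ∑ j, dd (ex j) (dd (ex i) v) x ^ 2 := by gcongr; exact hle _ _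
      _ = _ := by rw [← mul_sum]; ring
  · have h1 : ∀ i j, dd (ex j) (dd (ex i) v) x ^ 2 ≤ ‖iteratedFDeriv ℝ 2 v x‖ ^ 2 := fun i j => by
      have := (iteratedFDeriv ℝ 2 v x).le_opNorm ![ex j, ex i]
      rw [e, Fin.prod_univ_two] at this
      simp only [Matrix.cons_val_zero, Matrix.cons_val_one, ex, PiLp.norm_single, norm_one, mul_one] at this
      rw [← sq_abs]
      exact pow_le_pow_left₀ (abs_nonneg _) this 2
    refine (sum_le_sum fun i _ => sum_le_sum fun j _ => h1 i j).trans (le_of_eq ?_)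
    simp only [Finset.sum_const, Finset.card_fin, nsmul_eq_mul]
    push_cast
    ring

section norms

variable {U : ℝ⁴ → ℝ}

theorem totEn_eq (hU : Smooth U) (hUc : SpaceCpt U) (t : ℝ) : totEn U t = 1 / 2 * ((∫ x, dd vt U (t, x) ^ 2) + (∫ x, ‖gradient (fun y => U (t, y)) x‖ ^ 2) +
    (∫ x, ‖gradient (fun y => dd vt U (t, y)) x‖ ^ 2) +
    ∫ x, ∑ i, ∑ j, dd (ex j) (dd (ex i) fun y => U (t, y)) x ^ 2) := by
  have hig : ∀ W : ℝ⁴ → ℝ, Smooth W → SpaceCpt W → Integrable fun x => W (t, x) ^ 2 := fun W hW hWc =>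
    SpaceCpt.integrable (K := fun p => W p ^ 2) (hWc.of_local fun p hp => by simp [hp.self_of_nhds]) (hW.pow 2).continuous t
  simp only [norm_gradient_eq, norm_fderiv_sq, dd_slice_fun hU, dd_slice_fun (hU.dd_top _), totEn, hEn]
  rw [integral_edens_zero hU hUc]
  simp only [fun i => integral_edens_zero (hU.dd_top (vx i)) (hUc.dd (vx i)) t]
  rw [← mul_sum, Finset.sum_add_distrib, ← integral_finsetSum _ fun i _ => hig _ ((hU.dd_top _).dd_top _) ((hUc.dd _).dd _),
    ← integral_finsetSum _ fun i _ => integrable_finsetSum _ fun j _ => hig _ ((hU.dd_top _).dd_top _) ((hUc.dd _).dd _)]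
  simp only [fun i => dd_comm hU vt (vx i)]
  simp only [vx]
  ring

theorem integral_comparable {a b : Space → ℝ} (ha : Continuous a) (hb : Continuous b) (hac : HasCompactSupport a)
    (h0 : ∀ x, 0 ≤ a x) (h1 : ∀ x, a x ≤ b x) (h2 : ∀ x, b x ≤ 9 * a x) :
    ∫ x, a x ≤ ∫ x, b x ∧ ∫ x, b x ≤ 9 * ∫ x, a x := by
  have hi := ha.integrable_of_hasCompactSupport hac (μ := volume)
  have hib : Integrable b := (hi.const_mul 9).mono' hb.aestronglyMeasurable (of_forall fun x => by
    rw [norm_of_nonneg ((h0 x).trans (h1 x))]; exact h2 x)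
  exact ⟨integral_mono hi hib h1, integral_const_mul (9:ℝ) a ▸ integral_mono hib (hi.const_mul 9) h2⟩

theorem integral_iteratedFDeriv_bounds {v : Space → ℝ} (hv : Smooth v) (hvc : HasCompactSupport v) :
    ∫ x, ‖iteratedFDeriv ℝ 2 v x‖ ^ 2 ≤ ∫ x, ∑ i, ∑ j, dd (ex j) (dd (ex i) v) x ^ 2 ∧
    ∫ x, ∑ i, ∑ j, dd (ex j) (dd (ex i) v) x ^ 2 ≤ 9 * ∫ x, ‖iteratedFDeriv ℝ 2 v x‖ ^ 2 :=
  integral_comparable ((hv.continuous_iteratedFDeriv (WithTop.coe_le_coe.2 le_top)).norm.pow 2)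
    (continuous_finsetSum _ fun i _ => continuous_finsetSum _ fun j _ => ((hv.dd_top _).dd_top _).continuous.pow 2)
    ((hvc.iteratedFDeriv (𝕜 := ℝ) 2).norm.comp_left (g := fun z : ℝ => z ^ 2) (by norm_num)) (fun _ => sq_nonneg _)
    (fun x => (iteratedFDeriv_two_bounds hv x).1) fun x => (iteratedFDeriv_two_bounds hv x).2

theorem norms_le_totEn (hU : Smooth U) (hUc : SpaceCpt U) (t : ℝ) : H2tildeNorm (fun x => U (t, x)) + H1Norm (fun x => dd vt U (t, x)) ≤ 4 * √(2 * totEn U t) := by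
  have h1 := totEn_eq hU hUc t
  have h2 := (integral_iteratedFDeriv_bounds (contDiff_slice hU t) (hUc.slice t)).1
  have p1 : 0 ≤ ∫ x, dd vt U (t, x) ^ 2 := integral_nonneg fun _ => sq_nonneg _
  have p2 : 0 ≤ ∫ x, ‖gradient (fun y => U (t, y)) x‖ ^ 2 := integral_nonneg fun _ => sq_nonneg _
  have p3 : 0 ≤ ∫ x, ‖gradient (fun y => dd vt U (t, y)) x‖ ^ 2 := integral_nonneg fun _ => sq_nonneg _
  have p4 : 0 ≤ ∫ x, ‖iteratedFDeriv ℝ 2 (fun y => U (t, y)) x‖ ^ 2 := integral_nonneg fun _ => sq_nonneg _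
  simp only [H2tildeNorm, H1Norm, ← sqrt_eq_rpow]
  have q : ∀ a, a ≤ 2 * totEn U t → √a ≤ √(2 * totEn U t) := fun a ha => Real.sqrt_le_sqrt ha
  linarith [q _ (show ∫ x, dd vt U (t, x) ^ 2 ≤ 2 * totEn U t by linarith),
    q _ (show ∫ x, ‖gradient (fun y => U (t, y)) x‖ ^ 2 ≤ 2 * totEn U t by linarith),
    q _ (show ∫ x, ‖gradient (fun y => dd vt U (t, y)) x‖ ^ 2 ≤ 2 * totEn U t by linarith),
    q _ (show ∫ x, ‖iteratedFDeriv ℝ 2 (fun y => U (t, y)) x‖ ^ 2 ≤ 2 * totEn U t by linarith)]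

theorem totEn_le_norms (hU : Smooth U) (hUc : SpaceCpt U) (t : ℝ) : totEn U t ≤ 5 * H2tildeNorm (fun x => U (t, x)) ^ 2 + H1Norm (fun x => dd vt U (t, x)) ^ 2 := by
  have h1 := totEn_eq hU hUc t
  have h2 := (integral_iteratedFDeriv_bounds (contDiff_slice hU t) (hUc.slice t)).2
  simp only [H2tildeNorm, H1Norm, ← sqrt_eq_rpow]
  have q : ∀ a b : ℝ, 0 ≤ a → 0 ≤ b → a + b ≤ (√a + √b) ^ 2 := fun a b ha hb => by
    nlinarith [sq_sqrt ha, sq_sqrt hb, sqrt_nonneg a, sqrt_nonneg b, mul_nonneg (sqrt_nonneg a) (sqrt_nonneg b)]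
  have p : ∀ W : Space → ℝ, 0 ≤ ∫ x, W x ^ 2 := fun W => integral_nonneg fun _ => sq_nonneg _
  have := q _ _ (p fun x => ‖iteratedFDeriv ℝ 2 (fun y => U (t, y)) x‖) (p fun x => ‖gradient (fun y => U (t, y)) x‖)
  have := q _ _ (p fun x => dd vt U (t, x)) (p fun x => ‖gradient (fun y => dd vt U (t, y)) x‖)
  have := p fun x => ‖iteratedFDeriv ℝ 2 (fun y => U (t, y)) x‖
  have := p fun x => ‖gradient (fun y => U (t, y)) x‖
  have := p fun x => dd vt U (t, x)
  have := p fun x => ‖gradient (fun y => dd vt U (t, y)) x‖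
  linarith

theorem dt1_eq (hU : Smooth U) (t : ℝ) (x : Space) : dt1 (fun t x => U (t, x)) t x = dd vt U (t, x) := by
  have h := dd_slice_left hU.dble (1:ℝ) t x
  rw [vt, ← h]
  rfl

theorem dt2_sub_lap (hU : Smooth U) (t : ℝ) (x : Space) :
    dt2 (fun t x => U (t, x)) t x - lap (fun x => U (t, x)) x = box U (t, x) := by
  rw [box, dt2]
  simp only [dt1_eq hU]
  congr 1
  · exact dt1_eq (hU.dd_top vt) t x
  · refine sum_congr rfl fun i _ => ?_
    change dd (ex i) (dd (ex i) fun y => U (t, y)) x = _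
    rw [dd_slice_fun hU, dd_slice (hU.dd_top _).dble]
    rfl

end norms

theorem totEn_timeMap {U : ℝ⁴ → ℝ} (hU : Smooth U) (t : ℝ) :
    totEn (timeMap (-1) 0 U) t = totEn U (-t) := by
  simp only [totEn, hEn, dd_vx_timeMap _ _ hU.dble, edens_timeMap (show (-1:ℝ) ^ 2 = 1 by norm_num) 0 _ hU.dble,
    fun i => edens_timeMap (show (-1:ℝ) ^ 2 = 1 by norm_num) 0 (fun _ => 0) (hU.dd_top (vx i)).dble, neg_one_mul, add_zero]

theorem exists_global_solution {c : ℝ} (hc : 0 < c) (hc1 : 25 * c < 1) {K : ℝ} (hK : 0 ≤ K) : ∃ M : ℝ,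
    ∀ u₀ u₁ : Space → ℝ, Smooth u₀ → Smooth u₁ → HasCompactSupport u₀ → HasCompactSupport u₁ →
      5 * H2tildeNorm u₀ ^ 2 + H1Norm u₁ ^ 2 ≤ K →
      ∃ U : ℝ⁴ → ℝ, Smooth U ∧ SpaceCpt U ∧ (∀ p, box U p = -f c (U p)) ∧ (∀ x, U (0, x) = u₀ x) ∧
        (∀ x, dd vt U (0, x) = u₁ x) ∧ ∀ t, totEn U t ≤ M := by
  obtain ⟨M, n, hn, hM⟩ := exists_uniform_bound hc hc1 hK
  refine ⟨M, fun u₀ u₁ h₀ h₁ hc₀ hc₁ hle => ?_⟩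
  let χ : ContDiffBump (0:ℝ) := ⟨n, n + 1, hn, by linarith⟩
  set h : ℝ → ℝ := fun s => χ s * f c s with hh
  have hhs : Smooth h := χ.contDiff.mul contDiff_f
  obtain ⟨L, hL⟩ := hhs.lipschitzWith_of_hasCompactSupport (χ.hasCompactSupport.mul_right) (by simp)
  obtain ⟨R₀, hR₀, hu₀⟩ := hc₀.exists_pos_le_norm
  obtain ⟨R₁, hR₁, hu₁⟩ := hc₁.exists_pos_le_norm
  obtain ⟨U, hU, hbox, hU0, hU1, hsupp⟩ := exists_solution hhs (L := L) (fun a b => by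
      simpa [Real.dist_eq] using hL.dist_le_mul a b) L.2 (by simp [hh, f]) h₀ h₁ (R := max R₀ R₁)
    (fun x hx => hu₀ x ((le_max_left _ _).trans hx)) fun x hx => hu₁ x ((le_max_right _ _).trans hx)
  have hUc : SpaceCpt U := ⟨_, _, hsupp⟩
  have hhf : ∀ s, |s| ≤ n → h s = f c s := fun s hs => by
    simp only [hh]
    rw [χ.one_of_mem_closedBall (by simpa using hs), one_mul]
  have hE0 : totEn U 0 ≤ K := by
    have := totEn_le_norms hU hUc 0
    simp only [hU0, hU1] at this
    exact this.trans hle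
  have hp := hM h hhf U hU hUc hbox hE0
  have hm := hM h hhf (timeMap (-1) 0 U) (contDiff_timeMap _ _ hU) (hUc.timeMap _ _)
    (fun p => by rw [box_timeMap (by norm_num) 0 hU, hbox]; rfl) (by rw [totEn_timeMap hU, neg_zero]; exact hE0)
  have hall : ∀ t, totEn U t ≤ M ∧ ∀ x, |U (t, x)| ≤ n := fun t => by
    rcases le_total 0 t with ht | ht
    · exact hp t ht
    · have := hm (-t) (by linarith)
      rw [totEn_timeMap hU] at this
      simpa [timeMap] using this
  exact ⟨U, hU, hUc, fun p => by rw [hbox, hhf _ ((hall p.1).2 p.2)], hU0, hU1, fun t => (hall t).1⟩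

/-- Global regularity for the loglog energy-supercritical wave equation, with a uniform
bound depending only on `‖u₀‖_{H̃²}` and `‖u₁‖_{H¹}`. -/
theorem global_regularity (c : ℝ) (hc : 0 < c) (hc' : c < 8 / 225) :
    ∃ M₀ : ℝ → ℝ → ℝ,
      ∀ u₀ u₁ : Space → ℝ,
        ContDiff ℝ (⊤ : ℕ∞) u₀ → ContDiff ℝ (⊤ : ℕ∞) u₁ →
        HasCompactSupport u₀ → HasCompactSupport u₁ →
        0 ≤ M₀ (H2tildeNorm u₀) (H1Norm u₁) ∧
        ∃ u : ℝ → Space → ℝ,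
          IsClassicalSol c Set.univ u ∧
          (∀ x, u 0 x = u₀ x) ∧ (∀ x, dt1 u 0 x = u₁ x) ∧
          ∀ t : ℝ, H2tildeNorm (u t) + H1Norm (fun x => dt1 u t x)
            ≤ M₀ (H2tildeNorm u₀) (H1Norm u₁) := by
  have key : ∀ a b : ℝ, ∃ M, _ := fun a b =>
    exists_global_solution hc (by linarith) (show 0 ≤ 5 * a ^ 2 + b ^ 2 by positivity)
  choose M hM using key
  refine ⟨fun a b => 4 * √(2 * M a b), fun u₀ u₁ h₀ h₁ hc₀ hc₁ => ⟨by positivity, ?_⟩⟩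
  obtain ⟨U, hU, hUc, hbox, hU0, hU1, hE⟩ := hM _ _ u₀ u₁ h₀ h₁ hc₀ hc₁ le_rfl
  refine ⟨fun t x => U (t, x), ⟨hU.contDiffOn, fun t _ => hUc.slice t, fun t _ x => ?_⟩, hU0, fun x => ?_, fun t => ?_⟩
  · rw [dt2_sub_lap hU, hbox]
  · rw [dt1_eq hU, hU1]
  · simp only [dt1_eq hU]
    exact (norms_le_totEn hU hUc t).trans (by gcongr; exact hE t)
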